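/- Every graph with no K7^∨-minor is 6-colorable, i.e., every finite simple graph that does not contain K7^∨ as a minor has chromatic number at most 6. -/

import Mathlib

open SimpleGraph

/-- `K7vee` is the graph obtained from `K 7` by deleting two edges with a common end. -/
def K7vee : SimpleGraph (Fin 7) :=
  (completeGraph (Fin 7)).deleteEdges {s(0, 1), s(0, 2)}

/-- `K6vee` is the graph obtained from `K 6` by deleting two edges with a common end. -/
def K6vee : SimpleGraph (Fin 6) :=
  (completeGraph (Fin 6)).deleteEdges {s(0, 1), s(0, 2)}

/-- The complete multipartite graph with four parts of size two. -/
def K2222 : SimpleGraph (Fin 4 × Fin 2) :=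
  SimpleGraph.comap Prod.fst (completeGraph (Fin 4))

/-- `H` is a minor of `G`: there is a model of `H` in `G`, i.e. a family of pairwise disjoint
nonempty connected branch sets, one for each vertex of `H`, with edges of `G` between branch
sets corresponding to adjacent vertices of `H`. -/
def IsMinor {W V : Type} (H : SimpleGraph W) (G : SimpleGraph V) : Prop :=
  ∃ bag : W → Set V,
    (∀ w, (G.induce (bag w)).Connected) ∧
    (∀ w w', w ≠ w' → Disjoint (bag w) (bag w')) ∧
    (∀ w w', H.Adj w w' → ∃ u ∈ bag w, ∃ v ∈ bag w', G.Adj u v)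

/-- A graph is `k`-connected if it has more than `k` vertices and stays connected after
removing any set of fewer than `k` vertices. -/
def IsKConnected {V : Type} [Fintype V] (k : ℕ) (G : SimpleGraph V) : Prop :=
  k < Fintype.card V ∧ ∀ S : Set V, S.ncard < k → (G.induce (Sᶜ : Set V)).Connected

/-- A separation of `G`: `A ∪ B = V(G)` and no edge joins `A - B` to `B - A`. -/
def IsSeparation {V : Type} (G : SimpleGraph V) (A B : Set V) : Prop :=
  A ∪ B = Set.univ ∧ ∀ ⦃u v : V⦄, G.Adj u v → ¬(u ∈ A \ B ∧ v ∈ B \ A)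

/-- `(G, Z)` is internally `k`-connected: every separation `(A,B)` of `G` with `Z ⊆ A`
and `B - A ≠ ∅` has order at least `k`. -/
def InternallyConnected {V : Type} (G : SimpleGraph V) (Z : Set V) (k : ℕ) : Prop :=
  ∀ A B : Set V, IsSeparation G A B → Z ⊆ A → (B \ A).Nonempty →
    k ≤ (A ∩ B).ncard

/-- A `Z`-rooted `K₄`-model in `G`. -/
def HasRootedK4Model {V : Type} (G : SimpleGraph V) (Z : Set V) : Prop :=
  ∃ B : Fin 4 → Set V,
    (∀ i, (G.induce (B i)).Connected) ∧
    (∀ i j, i ≠ j → Disjoint (B i) (B j)) ∧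
    (∀ i, ∃! z : V, z ∈ Z ∧ z ∈ B i) ∧
    (∀ z ∈ Z, ∃ i, z ∈ B i) ∧
    (∀ i j, i ≠ j → ∃ u ∈ B i, ∃ v ∈ B j, G.Adj u v)

/-- A `Z`-rooted `K*₄,₂`-model in `G`. -/
def HasRootedK42starModel {V : Type} (G : SimpleGraph V) (Z : Set V) : Prop :=
  ∃ (B : Fin 4 → Set V) (C : Fin 2 → Set V),
    (∀ i, (G.induce (B i)).Connected) ∧
    (∀ j, (G.induce (C j)).Connected) ∧
    (∀ i j, i ≠ j → Disjoint (B i) (B j)) ∧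
    (∀ i j, i ≠ j → Disjoint (C i) (C j)) ∧
    (∀ i j, Disjoint (B i) (C j)) ∧
    (∀ i, ∃! z : V, z ∈ Z ∧ z ∈ B i) ∧
    (∀ z ∈ Z, ∃ i, z ∈ B i) ∧
    (∀ i j, ∃ u ∈ B i, ∃ v ∈ C j, G.Adj u v) ∧
    (∃ u ∈ C 0, ∃ v ∈ C 1, G.Adj u v)

/-- An enemy: a `4`-connected graph with `|E(G)| ≥ 4|V(G)| - 8`, with no `K7vee`-minor,
not isomorphic to `K_{2,2,2,2}`. -/
def Enemy {V : Type} [Fintype V] (G : SimpleGraph V) : Prop :=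
  IsKConnected 4 G ∧
    4 * (Fintype.card V : ℤ) - 8 ≤ (G.edgeSet.ncard : ℤ) ∧
    ¬ IsMinor K7vee G ∧
    IsEmpty (G ≃g K2222)

/-- A minor-minimal enemy: an enemy, no minor of which, other than itself, is an enemy. -/
def MinorMinimalEnemy {V : Type} [Fintype V] (G : SimpleGraph V) : Prop :=
  Enemy G ∧ ∀ (W : Type) [Fintype W] (H : SimpleGraph W),
    IsMinor H G → Enemy H → Nonempty (H ≃g G)

/-- The simple graph obtained from `G` by contracting the edge `uv`
(`v` is merged into `u`). -/
def contractEdge {V : Type} (G : SimpleGraph V) (u v : V) :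
    SimpleGraph {x : V // x ≠ v} :=
  SimpleGraph.fromRel (fun x y => G.Adj ↑x ↑y ∨ ((x : V) = u ∧ G.Adj v ↑y))

/-- A graph is `7`-contraction-critical if its chromatic number is `7` and
every minor of it, other than itself, has chromatic number less than `7`. -/
def ContractionCritical7 {V : Type} [Fintype V] (G : SimpleGraph V) : Prop :=
  G.chromaticNumber = 7 ∧
    ∀ (W : Type) [Fintype W] (H : SimpleGraph W),
      IsMinor H G → IsEmpty (H ≃g G) → H.chromaticNumber < 7

/-! ### Connected vertex sets -/

section Connected

variable {V W : Type} {G H : SimpleGraph V} {A B S T : Set V} {u v x y : V}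

/-- The vertex set `S` induces a connected subgraph of `G`. -/
def Conn (G : SimpleGraph V) (S : Set V) : Prop := (G.induce S).Connected

/-- Some edge of `G` joins `S` to `T`. -/
def Touch (G : SimpleGraph V) (S T : Set V) : Prop := ∃ u ∈ S, ∃ v ∈ T, G.Adj u v

theorem Touch.symm (h : Touch G S T) : Touch G T S := by
  obtain ⟨u, hu, v, hv, h⟩ := h
  exact ⟨v, hv, u, hu, h.symm⟩

theorem Touch.mono (h : Touch G S T) (hS : S ⊆ A) (hT : T ⊆ B) : Touch G A B := by
  obtain ⟨u, hu, v, hv, h⟩ := h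
  exact ⟨u, hS hu, v, hT hv, h⟩

theorem Touch.mono_graph (h : Touch G S T) (hGH : G ≤ H) : Touch H S T := by
  obtain ⟨u, hu, v, hv, h⟩ := h
  exact ⟨u, hu, v, hv, hGH h⟩

theorem touch_singleton : Touch G {u} {v} ↔ G.Adj u v := by simp [Touch]

theorem conn_iff : Conn G S ↔ S.Nonempty ∧
    ∀ A ⊆ S, A.Nonempty → A ≠ S → ∃ u ∈ A, ∃ v ∈ S \ A, G.Adj u v := by
  constructor
  · intro h
    refine ⟨Set.nonempty_coe_sort.1 h.nonempty, fun A hA ⟨a, ha⟩ hne => ?_⟩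
    obtain ⟨b, hb, hbA⟩ := Set.exists_of_ssubset (hA.ssubset_of_ne hne)
    by_contra! hcon
    have key : ∀ p q : S, (G.induce S).Reachable p q → (p : V) ∈ A → (q : V) ∈ A := by
      rintro p q ⟨w⟩ hp
      induction w with
      | nil => exact hp
      | @cons p r q hpr _ ih =>
        refine ih ?_
        by_contra hr
        exact hcon p hp r ⟨r.2, hr⟩ hpr
    exact hbA (key ⟨a, hA ha⟩ ⟨b, hb⟩ (h.preconnected _ _) ha)
  · rintro ⟨⟨s, hs⟩, h⟩
    rw [Conn, SimpleGraph.connected_iff_exists_forall_reachable]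
    refine ⟨⟨s, hs⟩, fun ⟨t, ht⟩ => ?_⟩
    by_contra hst
    let A : Set V := {x | ∃ hx : x ∈ S, (G.induce S).Reachable ⟨s, hs⟩ ⟨x, hx⟩}
    obtain ⟨u, ⟨hu, hur⟩, v, ⟨hv, hvA⟩, huv⟩ := h A (fun x hx => hx.1)
      ⟨s, hs, SimpleGraph.Reachable.refl _⟩ (fun hA => hst (by
        have : t ∈ A := hA ▸ ht
        exact this.2))
    refine hvA ⟨hv, hur.trans ?_⟩
    exact SimpleGraph.Adj.reachable (by simpa using huv)

theorem Conn.nonempty (h : Conn G S) : S.Nonempty := (conn_iff.1 h).1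

theorem Conn.exists_adj (h : Conn G S) (hA : A ⊆ S) (hne : A.Nonempty) (hAS : A ≠ S) :
    ∃ u ∈ A, ∃ v ∈ S \ A, G.Adj u v := (conn_iff.1 h).2 A hA hne hAS

/-- A connected set meeting a set closed under adjacency inside it is contained in that set. -/
theorem Conn.subset_of_closed (h : Conn G S) (hne : (S ∩ A).Nonempty)
    (hcl : ∀ u ∈ S, ∀ v ∈ S, u ∈ A → G.Adj u v → v ∈ A) : S ⊆ A := by
  by_contra hS
  obtain ⟨u, hu, v, hv, huv⟩ := h.exists_adj (A := S ∩ A) Set.inter_subset_left hne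
    (fun e => hS (e ▸ Set.inter_subset_right))
  exact hv.2 ⟨hv.1, hcl u hu.1 v hv.1 hu.2 huv⟩

theorem conn_of_closed (hne : S.Nonempty)
    (h : ∀ A : Set V, (S ∩ A).Nonempty → (∀ u ∈ S, ∀ v ∈ S, u ∈ A → G.Adj u v → v ∈ A) → S ⊆ A) :
    Conn G S := by
  refine conn_iff.2 ⟨hne, fun A hA hne hAS => ?_⟩
  by_contra! hcon
  refine hAS (hA.antisymm (h A (by rwa [Set.inter_eq_right.2 hA]) fun u _ v hv hu huv => ?_))
  by_contra hvA
  exact hcon u hu v ⟨hv, hvA⟩ huv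

theorem Conn.mono_graph (h : Conn G S) (hGH : ∀ u ∈ S, ∀ v ∈ S, G.Adj u v → H.Adj u v) :
    Conn H S :=
  conn_of_closed h.nonempty fun _ hne hcl =>
    h.subset_of_closed hne fun u hu v hv huA huv => hcl u hu v hv huA (hGH u hu v hv huv)

theorem conn_singleton (v : V) : Conn G {v} :=
  conn_of_closed ⟨v, rfl⟩ fun A ⟨x, hx, hA⟩ _ => by
    rw [Set.mem_singleton_iff] at hx; subst hx; simpa using hA

theorem Conn.union (hS : Conn G S) (hT : Conn G T) (h : Touch G S T) : Conn G (S ∪ T) := by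
  obtain ⟨u, hu, v, hv, huv⟩ := h
  refine conn_of_closed (hS.nonempty.mono Set.subset_union_left) fun A ⟨x, hx, hxA⟩ hcl => ?_
  have h1 : (S ∩ A).Nonempty → S ⊆ A := fun hne => hS.subset_of_closed hne
    fun u hu v hv => hcl u (Or.inl hu) v (Or.inl hv)
  have h2 : (T ∩ A).Nonempty → T ⊆ A := fun hne => hT.subset_of_closed hne
    fun u hu v hv => hcl u (Or.inr hu) v (Or.inr hv)
  rcases hx with hx | hx
  · have hSA := h1 ⟨x, hx, hxA⟩
    exact Set.union_subset hSA (h2 ⟨v, hv, hcl u (Or.inl hu) v (Or.inr hv) (hSA hu) huv⟩)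
  · have hTA := h2 ⟨x, hx, hxA⟩
    exact Set.union_subset (h1 ⟨u, hu, hcl v (Or.inr hv) u (Or.inl hu) (hTA hv) huv.symm⟩) hTA

theorem Conn.union_of_inter (hS : Conn G S) (hT : Conn G T) (h : (S ∩ T).Nonempty) :
    Conn G (S ∪ T) := by
  obtain ⟨v, hv, hv'⟩ := h
  refine conn_of_closed (hS.nonempty.mono Set.subset_union_left) fun A ⟨x, hx, hxA⟩ hcl => ?_
  have h1 : (S ∩ A).Nonempty → S ⊆ A := fun hne => hS.subset_of_closed hne
    fun u hu v hv => hcl u (Or.inl hu) v (Or.inl hv)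
  have h2 : (T ∩ A).Nonempty → T ⊆ A := fun hne => hT.subset_of_closed hne
    fun u hu v hv => hcl u (Or.inr hu) v (Or.inr hv)
  rcases hx with hx | hx
  · have hSA := h1 ⟨x, hx, hxA⟩
    exact Set.union_subset hSA (h2 ⟨v, hv', hSA hv⟩)
  · have hTA := h2 ⟨x, hx, hxA⟩
    exact Set.union_subset (h1 ⟨v, hv, hTA hv'⟩) hTA

theorem Conn.insert_adj (hS : Conn G S) (hu : u ∈ S) (h : G.Adj u v) : Conn G (insert v S) := by
  rw [Set.insert_eq, Set.union_comm]
  exact hS.union (conn_singleton v) ⟨u, hu, v, rfl, h⟩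

theorem conn_pair (h : G.Adj u v) : Conn G {u, v} := by
  have := (conn_singleton (G := G) v).insert_adj rfl h.symm
  exact this

/-- The preimage-type union of connected sets indexed by a connected set is connected. -/
theorem Conn.biUnion {H : SimpleGraph W} {S : Set W} (hS : Conn H S) {f : W → Set V}
    (hf : ∀ w ∈ S, Conn G (f w))
    (hadj : ∀ w ∈ S, ∀ w' ∈ S, H.Adj w w' → Touch G (f w) (f w')) :
    Conn G (⋃ w ∈ S, f w) := by
  obtain ⟨s, hs⟩ := hS.nonempty
  refine conn_of_closed ((hf s hs).nonempty.mono (Set.subset_biUnion_of_mem hs))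
    fun A ⟨x, hx, hxA⟩ hcl => ?_
  have hin : ∀ w ∈ S, ∀ u ∈ f w, u ∈ ⋃ w ∈ S, f w := fun w hw u hu =>
    Set.mem_biUnion hw hu
  have h1 : ∀ w ∈ S, (f w ∩ A).Nonempty → f w ⊆ A := fun w hw hne =>
    (hf w hw).subset_of_closed hne fun u hu v hv => hcl u (hin w hw u hu) v (hin w hw v hv)
  have h2 : S ⊆ {w | f w ⊆ A} := by
    obtain ⟨w, hw, hxw⟩ := Set.mem_iUnion₂.1 hx
    refine hS.subset_of_closed ⟨w, hw, h1 w hw ⟨x, hxw, hxA⟩⟩ fun p hp q hq hpA hpq => ?_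
    obtain ⟨a, ha, b, hb, hab⟩ := hadj p hp q hq hpq
    exact h1 q hq ⟨b, hb, hcl a (hin p hp a ha) b (hin q hq b hb) (hpA ha) hab⟩
  exact Set.iUnion₂_subset h2

/-- `C` is a connected component of the subgraph induced by `S`. -/
structure IsComp (G : SimpleGraph V) (S C : Set V) : Prop where
  conn : Conn G C
  subset : C ⊆ S
  closed : ∀ u ∈ C, ∀ v ∈ S, G.Adj u v → v ∈ C

theorem exists_isComp (G : SimpleGraph V) (hx : x ∈ S) : ∃ C, x ∈ C ∧ IsComp G S C := by
  let C : Set V := ⋃₀ {D | x ∈ D ∧ D ⊆ S ∧ Conn G D}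
  have hxC : x ∈ C := ⟨{x}, ⟨rfl, by simpa using hx, conn_singleton x⟩, rfl⟩
  have hC : Conn G C := by
    refine conn_of_closed ⟨x, hxC⟩ fun A ⟨y, hy, hyA⟩ hcl => ?_
    have h1 : ∀ D, (x ∈ D ∧ D ⊆ S ∧ Conn G D) → (D ∩ A).Nonempty → D ⊆ A := fun D hD hne =>
      hD.2.2.subset_of_closed hne fun u hu v hv => hcl u ⟨D, hD, hu⟩ v ⟨D, hD, hv⟩
    obtain ⟨D, hD, hyD⟩ := hy
    have hxA : x ∈ A := h1 D hD ⟨y, hyD, hyA⟩ hD.1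
    rintro z ⟨E, hE, hzE⟩
    exact h1 E hE ⟨x, hE.1, hxA⟩ hzE
  have hCS : C ⊆ S := Set.sUnion_subset fun D hD => hD.2.1
  refine ⟨C, hxC, hC, hCS, fun u hu v hv huv => ?_⟩
  exact ⟨insert v C, ⟨Or.inr hxC, Set.insert_subset hv hCS, hC.insert_adj hu huv⟩, Or.inl rfl⟩

theorem IsComp.subset_of_conn (h : IsComp G S A) (hB : Conn G B) (hBS : B ⊆ S)
    (hne : (B ∩ A).Nonempty) : B ⊆ A :=
  hB.subset_of_closed hne fun u _ v hv huA huv => h.closed u huA v (hBS hv) huv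

/-- In a connected set with a component `C` of `S \ {x}`, the vertex `x` has a neighbour in `C`. -/
theorem Conn.adj_comp (hS : Conn G S) (hx : x ∈ S) (hC : IsComp G (S \ {x}) A) :
    ∃ u ∈ A, G.Adj u x := by
  obtain ⟨u, hu, v, hv, huv⟩ := hS.exists_adj (A := A) (hC.subset.trans Set.sdiff_subset)
    hC.conn.nonempty (fun e => (hC.subset (e ▸ hx)).2 rfl)
  by_cases hvx : v = x
  · exact ⟨u, hu, hvx ▸ huv⟩
  · exact absurd (hC.closed u hu v ⟨hv.1, hvx⟩ huv) hv.2

/-- Removing a component of `S \ B`, where `B` is connected, leaves a connected set. -/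
theorem Conn.diff_comp (hS : Conn G S) (hB : Conn G B) (hBS : B ⊆ S)
    (hC : IsComp G (S \ B) A) : Conn G (S \ A) := by
  have hBA : B ⊆ S \ A := fun b hb => ⟨hBS hb, fun h => (hC.subset h).2 hb⟩
  refine conn_of_closed (hB.nonempty.mono hBA) fun X ⟨x, hx, hxX⟩ hcl => ?_
  have hBX : B ⊆ X := by
    by_contra hBX
    have hdis : ∀ b ∈ B, b ∉ X := fun b hb hbX => hBX (hB.subset_of_closed ⟨b, hb, hbX⟩
      fun u hu v hv => hcl u (hBA hu) v (hBA hv))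
    obtain ⟨b, hb⟩ := hB.nonempty
    have : S ⊆ X ∩ (S \ A) := hS.subset_of_closed ⟨x, hx.1, hxX, hx⟩ fun u hu v hv huX huv => by
      by_cases hvA : v ∈ A
      · exact absurd (hC.closed v hvA u ⟨hu, fun h => hdis u h huX.1⟩ huv.symm) huX.2.2
      · exact ⟨hcl u huX.2 v ⟨hv, hvA⟩ huX.1 huv, hv, hvA⟩
    exact hdis b hb (this (hBS hb)).1
  have : S ⊆ X ∪ A := by
    refine hS.subset_of_closed (A := X ∪ A) ?_ ?_
    · obtain ⟨b, hb⟩ := hB.nonempty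
      exact ⟨b, hBS hb, Or.inl (hBX hb)⟩
    · intro u hu v hv huX huv
      by_contra hv'
      rw [Set.mem_union, not_or] at hv'
      by_cases hvB : v ∈ B
      · exact hv'.1 (hBX hvB)
      rcases huX with huX | huA
      · by_cases huA : u ∈ A
        · exact hv'.2 (hC.closed u huA v ⟨hv, hvB⟩ huv)
        · exact hv'.1 (hcl u ⟨hu, huA⟩ v ⟨hv, hv'.2⟩ huX huv)
      · exact hv'.2 (hC.closed u huA v ⟨hv, hvB⟩ huv)
  exact fun z hz => (this hz.1).resolve_right hz.2

theorem Conn.exists_noncut [Finite V] (hS : Conn G S) {r : V} (hr : r ∈ S) (hne : S ≠ {r}) :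
    ∃ x ∈ S, x ≠ r ∧ Conn G (S \ {x}) := by
  obtain ⟨C, hC⟩ := Set.Finite.exists_maximalFor (fun C : Set V => C.ncard)
    {C | r ∈ C ∧ C ⊂ S ∧ Conn G C} (Set.toFinite _)
    ⟨{r}, rfl, (Set.singleton_subset_iff.2 hr).ssubset_of_ne hne.symm, conn_singleton r⟩
  obtain ⟨⟨hrC, hCS, hCc⟩, hmax⟩ := hC
  obtain ⟨u, hu, v, hv, huv⟩ := hS.exists_adj hCS.subset ⟨r, hrC⟩ hCS.ne
  have hins : insert v C = S := by
    by_contra hne'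
    have hmem : insert v C ∈ {C | r ∈ C ∧ C ⊂ S ∧ Conn G C} :=
      ⟨Or.inr hrC, (Set.insert_subset hv.1 hCS.subset).ssubset_of_ne hne', hCc.insert_adj hu huv⟩
    have := hmax hmem (Set.ncard_le_ncard (Set.subset_insert v C) (Set.toFinite _))
    simp only at this
    rw [Set.ncard_insert_of_notMem hv.2 (Set.toFinite _)] at this
    omega
  refine ⟨v, hv.1, fun e => hv.2 (e ▸ hrC), ?_⟩
  rwa [← hins, Set.insert_sdiff_self_of_notMem hv.2]

end Connected

/-! ### Minor models -/

section Models

variable {U V W : Type} {G G' : SimpleGraph V} {H : SimpleGraph W}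

/-- `bag` is a model of `H` in `G`. -/
structure Model (H : SimpleGraph W) (G : SimpleGraph V) (bag : W → Set V) : Prop where
  conn : ∀ w, Conn G (bag w)
  disj : ∀ w w', w ≠ w' → Disjoint (bag w) (bag w')
  touch : ∀ w w', H.Adj w w' → Touch G (bag w) (bag w')

theorem isMinor_iff : IsMinor H G ↔ ∃ bag, Model H G bag :=
  ⟨fun ⟨b, h1, h2, h3⟩ => ⟨b, h1, h2, h3⟩, fun ⟨b, h⟩ => ⟨b, h.1, h.2, h.3⟩⟩

theorem Model.isMinor {bag : W → Set V} (h : Model H G bag) : IsMinor H G :=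
  isMinor_iff.2 ⟨bag, h⟩

theorem Model.biUnion_conn {bag : W → Set V} (h : Model H G bag) {S : Set W} (hS : Conn H S) :
    Conn G (⋃ w ∈ S, bag w) :=
  hS.biUnion (fun w _ => h.conn w) (fun w _ w' _ => h.touch w w')

theorem Model.biUnion_touch {bag : W → Set V} (h : Model H G bag) {S T : Set W}
    (hST : Touch H S T) : Touch G (⋃ w ∈ S, bag w) (⋃ w ∈ T, bag w) := by
  obtain ⟨u, hu, v, hv, huv⟩ := hST
  exact (h.touch u v huv).mono (Set.subset_biUnion_of_mem hu) (Set.subset_biUnion_of_mem hv)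

theorem Model.biUnion_disj {bag : W → Set V} (h : Model H G bag) {S T : Set W}
    (hST : Disjoint S T) : Disjoint (⋃ w ∈ S, bag w) (⋃ w ∈ T, bag w) := by
  simp only [Set.disjoint_iUnion_left, Set.disjoint_iUnion_right]
  exact fun w hw w' hw' => h.disj _ _ fun e => Set.disjoint_left.1 hST hw' (e ▸ hw)

theorem Model.trans {K : SimpleGraph U} {b₁ : U → Set W} {b₂ : W → Set V} (h₁ : Model K H b₁)
    (h₂ : Model H G b₂) : Model K G (fun u => ⋃ w ∈ b₁ u, b₂ w) :=
  ⟨fun u => h₂.biUnion_conn (h₁.conn u), fun u u' hu => h₂.biUnion_disj (h₁.disj u u' hu),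
    fun u u' hu => h₂.biUnion_touch (h₁.touch u u' hu)⟩

theorem isMinor_trans {K : SimpleGraph U} (h₁ : IsMinor K H) (h₂ : IsMinor H G) :
    IsMinor K G := by
  obtain ⟨b₁, h₁⟩ := isMinor_iff.1 h₁
  obtain ⟨b₂, h₂⟩ := isMinor_iff.1 h₂
  exact (h₁.trans h₂).isMinor

theorem Model.of_injective {f : W → V} (hf : f.Injective)
    (h : ∀ w w', H.Adj w w' → G.Adj (f w) (f w')) : Model H G (fun w => {f w}) :=
  ⟨fun _ => conn_singleton _, fun _ _ hw => Set.disjoint_singleton.2 fun e => hw (hf e),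
    fun w w' hw => touch_singleton.2 (h w w' hw)⟩

theorem Model.mono_graph {bag : W → Set V} (h : Model H G bag) (hG : G ≤ G') : Model H G' bag :=
  ⟨fun w => (h.conn w).mono_graph fun _ _ _ _ e => hG e, h.disj,
    fun w w' hw => (h.touch w w' hw).mono_graph hG⟩

theorem isMinor_mono (hG : G ≤ G') (h : IsMinor H G) : IsMinor H G' := by
  obtain ⟨b, h⟩ := isMinor_iff.1 h
  exact (h.mono_graph hG).isMinor

theorem isMinor_induce (G : SimpleGraph V) (S : Set V) : IsMinor (G.induce S) G :=
  (Model.of_injective (f := ((↑) : S → V)) Subtype.val_injective fun _ _ h => h).isMinor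

/-- The sets `f 0, …, f (n - 1)` are disjoint and connected, and `f i` touches `f j` whenever
`adj i j` holds. -/
structure Bags (G : SimpleGraph V) (n : ℕ) (adj : ℕ → ℕ → Bool) (f : ℕ → Set V) : Prop where
  conn : ∀ i < n, Conn G (f i)
  disj : ∀ i < n, ∀ j < n, i ≠ j → Disjoint (f i) (f j)
  touch : ∀ i < n, ∀ j < n, i ≠ j → adj i j = true → Touch G (f i) (f j)

/-- Move index `n` to `i`, dropping the old index `i`. -/
def dropIdx (n i k : ℕ) : ℕ := if k = i then n else k

/-- The adjacency table after merging `j` into `i`. -/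
def mergeAdj (adj : ℕ → ℕ → Bool) (i j : ℕ) (a b : ℕ) : Bool :=
  adj a b || (a == i && adj j b) || (b == i && adj a j)

variable {n : ℕ} {adj : ℕ → ℕ → Bool} {f : ℕ → Set V}

theorem Bags.drop (h : Bags G (n + 1) adj f) {i : ℕ} :
    Bags G n (fun a b => adj (dropIdx n i a) (dropIdx n i b)) (fun k => f (dropIdx n i k)) := by
  have hlt : ∀ k < n, dropIdx n i k < n + 1 := fun k hk => by unfold dropIdx; split_ifs <;> omega
  have hne : ∀ k < n, ∀ l < n, k ≠ l → dropIdx n i k ≠ dropIdx n i l := fun k hk l hl hkl => by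
    unfold dropIdx; split_ifs <;> omega
  exact ⟨fun k hk => h.conn _ (hlt k hk),
    fun k hk l hl hkl => h.disj _ (hlt k hk) _ (hlt l hl) (hne k hk l hl hkl),
    fun k hk l hl hkl => h.touch _ (hlt k hk) _ (hlt l hl) (hne k hk l hl hkl)⟩

/-- The table on `n` indices after merging `j` into `i` (or dropping `i`, if `i = j`). -/
def opAdj (n : ℕ) (adj : ℕ → ℕ → Bool) (i j : ℕ) (a b : ℕ) : Bool :=
  if i = j then adj (dropIdx n i a) (dropIdx n i b)
  else mergeAdj adj i j (dropIdx n j a) (dropIdx n j b)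

theorem Bags.op (h : Bags G (n + 1) adj f) {i j : ℕ} (hi : i ≤ n) (hj : j ≤ n)
    (hij : i = j ∨ adj i j = true ∨ adj j i = true) : ∃ f', Bags G n (opAdj n adj i j) f' := by
  by_cases he : i = j
  · subst he
    have := h.drop (i := i)
    refine ⟨_, this.conn, this.disj, fun k hk l hl hkl hadj => this.touch k hk l hl hkl ?_⟩
    simpa [opAdj] using hadj
  have hijt : Touch G (f i) (f j) := by
    rcases hij with h0 | h0 | h0
    · exact absurd h0 he
    · exact h.touch i (by omega) j (by omega) he h0
    · exact (h.touch j (by omega) i (by omega) (Ne.symm he) h0).symm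
  let g : ℕ → Set V := fun k => if k = i then f i ∪ f j else f k
  have hlt : ∀ k < n, dropIdx n j k < n + 1 := fun k hk => by unfold dropIdx; split_ifs <;> omega
  have hnj : ∀ k < n, dropIdx n j k ≠ j := fun k hk => by unfold dropIdx; split_ifs <;> omega
  have hne : ∀ k < n, ∀ l < n, k ≠ l → dropIdx n j k ≠ dropIdx n j l := fun k hk l hl hkl => by
    unfold dropIdx; split_ifs <;> omega
  have hd : ∀ a < n + 1, ∀ b < n + 1, a ≠ j → b ≠ j → a ≠ b → Disjoint (g a) (g b) := by
    intro a ha b hb haj hbj hab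
    simp only [g]
    split_ifs with h1 h2 h2
    · omega
    · exact (h.disj i (by omega) b hb (by omega)).union_left (h.disj j (by omega) b hb (by omega))
    · exact (h.disj a ha i (by omega) (by omega)).union_right (h.disj a ha j (by omega) (by omega))
    · exact h.disj a ha b hb hab
  have hsub : ∀ a, f a ⊆ g a := fun a => by
    simp only [g]; split_ifs with h1
    · subst h1; exact Set.subset_union_left
    · exact subset_rfl
  have hsubj : f j ⊆ g i := by simp only [g, if_true]; exact Set.subset_union_right
  refine ⟨fun k => g (dropIdx n j k), fun k hk => ?_, fun k hk l hl hkl => hd _ (hlt k hk) _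
    (hlt l hl) (hnj k hk) (hnj l hl) (hne k hk l hl hkl), fun k hk l hl hkl hadj => ?_⟩
  · simp only [g]
    split_ifs with h1
    · exact (h.conn i (by omega)).union (h.conn j (by omega)) hijt
    · exact h.conn _ (hlt k hk)
  · simp only [opAdj, if_neg he, mergeAdj, Bool.or_eq_true, Bool.and_eq_true, beq_iff_eq] at hadj
    have hk' := hlt k hk; have hl' := hlt l hl
    have hne' := hne k hk l hl hkl
    rcases hadj with (h1 | ⟨h1, h2⟩) | ⟨h1, h2⟩
    · exact (h.touch _ hk' _ hl' hne' h1).mono (hsub _) (hsub _)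
    · exact (h.touch j (by omega) _ hl' (hnj l hl).symm h2).mono (h1 ▸ hsubj) (hsub _)
    · exact (h.touch _ hk' j (by omega) (hnj k hk) h2).mono (hsub _) (h1 ▸ hsubj)

/-- The table misses at most the pairs `{c, a}` and `{c, b}` among the indices below `7`. -/
def veeAt (adj : ℕ → ℕ → Bool) (c a b : Fin 7) : Bool :=
  c != a && c != b && a != b && (List.finRange 7).all fun i => (List.finRange 7).all fun j =>
    decide (j ≤ i) || adj i j || adj j i || (i == c && j == a) || (i == a && j == c) ||
      (i == c && j == b) || (i == b && j == c)

/-- The pairs of indices below `7` missing from the table. -/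
def missingPairs (adj : ℕ → ℕ → Bool) : List (ℕ × ℕ) :=
  (List.range 7).flatMap fun j => ((List.range j).filter fun i => !(adj i j || adj j i)).map (·, j)

/-- The table contains `K7vee` on the indices below `7`. -/
def veeTable (adj : ℕ → ℕ → Bool) : Bool :=
  match missingPairs adj with
  | [] => true
  | [_] => true
  | [(a, b), (c, d)] => a == c || a == d || b == c || b == d
  | _ => false

theorem exists_perm_three : ∀ c a b : Fin 7, c ≠ a → c ≠ b → a ≠ b →
    ∃ e : Equiv.Perm (Fin 7), e 0 = c ∧ e 1 = a ∧ e 2 = b := by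
  intro c a b h1 h2 h3
  let s1 := Equiv.swap 0 c
  let s2 := Equiv.swap 1 (s1 a)
  let s3 := Equiv.swap 2 (s2 (s1 b))
  refine ⟨s1 * s2 * s3, ?_⟩
  revert c a b
  decide

theorem Bags.vee_of_veeAt (h : Bags G 7 adj f) {c a b : Fin 7} (hv : veeAt adj c a b = true) :
    IsMinor K7vee G := by
  simp only [veeAt, Bool.and_eq_true, bne_iff_ne, ne_eq, List.all_eq_true, List.mem_finRange,
    true_implies, Bool.or_eq_true, beq_iff_eq, decide_eq_true_eq] at hv
  obtain ⟨⟨⟨hca, hcb⟩, hab⟩, hall⟩ := hv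
  obtain ⟨e, e0, e1, e2⟩ := exists_perm_three c a b hca hcb hab
  have hne : ∀ i j : Fin 7, i ≠ j → ((e i : Fin 7) : ℕ) ≠ e j := fun i j hij hh =>
    hij (e.injective (Fin.ext hh))
  refine Model.isMinor (bag := fun i => f (e i)) ⟨fun i => h.conn _ (e i).2,
    fun i j hij => h.disj _ (e i).2 _ (e j).2 (hne i j hij), fun i j hij => ?_⟩
  have hij' : i ≠ j := hij.ne
  have h01 : ¬ (i = 0 ∧ j = 1) ∧ ¬ (i = 1 ∧ j = 0) ∧ ¬ (i = 0 ∧ j = 2) ∧ ¬ (i = 2 ∧ j = 0) := by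
    simp only [K7vee, SimpleGraph.deleteEdges_adj, Set.mem_insert_iff, Set.mem_singleton_iff,
      Sym2.eq_iff] at hij
    tauto
  have key : ∀ i j : Fin 7, (e i : Fin 7) < e j → 
      ¬ (i = 0 ∧ j = 1) ∧ ¬ (i = 1 ∧ j = 0) ∧ ¬ (i = 0 ∧ j = 2) ∧ ¬ (i = 2 ∧ j = 0) →
      Touch G (f (e i)) (f (e j)) := by
    intro i j hlt hn
    have hnn : ((e i : Fin 7) : ℕ) ≠ e j := by
      intro hh; exact hlt.ne (Fin.ext hh)
    have := hall (e i) (e j)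
    rw [← e0, ← e1, ← e2] at this
    simp only [e.injective.eq_iff, not_le.2 hlt, false_or] at this
    rcases this with ((((h1 | h1) | h1) | h1) | h1) | h1
    · exact h.touch _ (e i).2 _ (e j).2 hnn h1
    · exact (h.touch _ (e j).2 _ (e i).2 hnn.symm h1).symm
    · exact absurd h1 hn.1
    · exact absurd h1 hn.2.1
    · exact absurd h1 hn.2.2.1
    · exact absurd h1 hn.2.2.2
  rcases lt_or_gt_of_ne (fun hh => hij' (e.injective hh) : e i ≠ e j) with hlt | hlt
  · exact key i j hlt h01
  · exact (key j i hlt ⟨fun e => h01.2.1 e.symm, fun e => h01.1 e.symm,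
      fun e => h01.2.2.2 e.symm, fun e => h01.2.2.1 e.symm⟩).symm

theorem veeAt_of_missingPairs {c a b : Fin 7} (h1 : c ≠ a) (h2 : c ≠ b) (h3 : a ≠ b)
    (h : ∀ i j : Fin 7, i < j → (i.val, j.val) ∈ missingPairs adj →
      (i = c ∧ j = a) ∨ (i = a ∧ j = c) ∨ (i = c ∧ j = b) ∨ (i = b ∧ j = c)) :
    veeAt adj c a b = true := by
  simp only [veeAt, Bool.and_eq_true, bne_iff_ne, List.all_eq_true, List.mem_finRange, true_imp_iff,
    Bool.or_eq_true, decide_eq_true_eq, beq_iff_eq]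
  refine ⟨⟨⟨h1, h2⟩, h3⟩, fun i j => ?_⟩
  by_cases hij : j ≤ i
  · tauto
  have := h i j (not_le.1 hij)
  by_cases hadj : adj i j = true ∨ adj j i = true
  · tauto
  have hm : (i.val, j.val) ∈ missingPairs adj := by
    simp only [missingPairs, List.mem_flatMap, List.mem_range, List.mem_map, List.mem_filter]
    exact ⟨j, j.isLt, i, ⟨not_le.1 hij, by simpa using hadj⟩, rfl⟩
  tauto

theorem lt_of_mem_missingPairs {p : ℕ × ℕ} (h : p ∈ missingPairs adj) : p.1 < p.2 ∧ p.2 < 7 := by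
  simp only [missingPairs, List.mem_flatMap, List.mem_range, List.mem_map, List.mem_filter] at h
  obtain ⟨j, hj, i, ⟨hi, -⟩, rfl⟩ := h
  exact ⟨hi, hj⟩

theorem exists_third : ∀ a b : Fin 7, ∃ c, a ≠ c ∧ b ≠ c := by decide

theorem exists_veeAt_of_veeTable (hv : veeTable adj = true) : ∃ c a b, veeAt adj c a b = true := by
  unfold veeTable at hv
  split at hv
  · rename_i h
    exact ⟨0, 1, 2, veeAt_of_missingPairs (by decide) (by decide) (by decide) (by simp [h])⟩
  · rename_i p h
    obtain ⟨h1, h2⟩ := lt_of_mem_missingPairs (p := p) (adj := adj) (by simp [h])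
    obtain ⟨a, b⟩ := p
    obtain ⟨c, hc1, hc2⟩ := exists_third ⟨a, by omega⟩ ⟨b, h2⟩
    refine ⟨⟨a, by omega⟩, ⟨b, h2⟩, c, veeAt_of_missingPairs ?_ hc1 hc2 ?_⟩
    · simp only [ne_eq, Fin.mk.injEq]; omega
    · intro i j hij hm
      simp only [h, List.mem_singleton, Prod.mk.injEq] at hm
      exact Or.inl ⟨Fin.ext hm.1, Fin.ext hm.2⟩
  · rename_i a b c d h
    obtain ⟨h1, h2⟩ := lt_of_mem_missingPairs (p := (a, b)) (adj := adj) (by simp [h])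
    obtain ⟨h3, h4⟩ := lt_of_mem_missingPairs (p := (c, d)) (adj := adj) (by simp [h])
    simp only at h1 h2 h3 h4
    have key : ∃ z x y : Fin 7, z ≠ x ∧ z ≠ y ∧ x ≠ y ∧ ∀ i j : Fin 7, i < j →
        (i.val = a ∧ j.val = b ∨ i.val = c ∧ j.val = d) →
        (i = z ∧ j = x) ∨ (i = x ∧ j = z) ∨ (i = z ∧ j = y) ∨ (i = y ∧ j = z) := by
      by_cases he : a = c ∧ b = d
      · obtain ⟨z, hz1, hz2⟩ := exists_third ⟨a, by omega⟩ ⟨b, h2⟩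
        refine ⟨⟨a, by omega⟩, ⟨b, h2⟩, z, ?_, hz1, hz2, fun i j _ h => Or.inl ?_⟩
        · simp only [ne_eq, Fin.mk.injEq]; omega
        · simp only [Fin.ext_iff]; omega
      simp only [Bool.or_eq_true, beq_iff_eq] at hv
      rcases hv with ((hv | hv) | hv) | hv
      · refine ⟨⟨a, by omega⟩, ⟨b, h2⟩, ⟨d, h4⟩, ?_⟩
        simp only [ne_eq, Fin.ext_iff]
        exact ⟨by omega, by omega, by omega, fun i j _ h => by omega⟩
      · refine ⟨⟨a, by omega⟩, ⟨b, h2⟩, ⟨c, by omega⟩, ?_⟩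
        simp only [ne_eq, Fin.ext_iff]
        exact ⟨by omega, by omega, by omega, fun i j _ h => by omega⟩
      · refine ⟨⟨b, h2⟩, ⟨a, by omega⟩, ⟨d, h4⟩, ?_⟩
        simp only [ne_eq, Fin.ext_iff]
        exact ⟨by omega, by omega, by omega, fun i j _ h => by omega⟩
      · refine ⟨⟨b, h2⟩, ⟨a, by omega⟩, ⟨c, by omega⟩, ?_⟩
        simp only [ne_eq, Fin.ext_iff]
        exact ⟨by omega, by omega, by omega, fun i j _ h => by omega⟩
    obtain ⟨z, x, y, hzx, hzy, hxy, hk⟩ := key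
    refine ⟨z, x, y, veeAt_of_missingPairs hzx hzy hxy fun i j hij hm => hk i j hij ?_⟩
    simpa [h] using hm
  · simp at hv

theorem Bags.vee_of_veeTable (h : Bags G 7 adj f) (hv : veeTable adj = true) :
    IsMinor K7vee G := by
  obtain ⟨c, a, b, hv⟩ := exists_veeAt_of_veeTable hv
  exact h.vee_of_veeAt hv

/-- Perform the listed merges, and look for `K7vee` in the resulting table on `7` indices. -/
def veeOps : ℕ → (ℕ → ℕ → Bool) → List (ℕ × ℕ) → Bool
  | n, adj, [] => n == 7 && veeTable adj
  | 0, _, _ :: _ => false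
  | n + 1, adj, (i, j) :: l => decide (i ≤ n) && decide (j ≤ n) &&
      (i == j || adj i j || adj j i) && veeOps n (opAdj n adj i j) l

theorem Bags.vee_of_ops {l : List (ℕ × ℕ)} (h : Bags G n adj f) (hv : veeOps n adj l = true) :
    IsMinor K7vee G := by
  induction l generalizing n adj f with
  | nil =>
    simp only [veeOps, Bool.and_eq_true, beq_iff_eq] at hv
    obtain ⟨rfl, hv⟩ := hv
    exact h.vee_of_veeTable hv
  | cons p l ih =>
    obtain ⟨i, j⟩ := p
    cases n with
    | zero => simp [veeOps] at hv
    | succ n =>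
      simp only [veeOps, Bool.and_eq_true, Bool.or_eq_true, beq_iff_eq, decide_eq_true_eq] at hv
      obtain ⟨⟨⟨hi, hj⟩, hij⟩, hv⟩ := hv
      obtain ⟨_, hop⟩ := h.op hi hj (by tauto)
      exact ih hop hv

/-- Search for `K7vee` in a table on `7 + k` indices by `k` merges or deletions. -/
def veeSearch : ℕ → (ℕ → ℕ → Bool) → Bool
  | 0, adj => veeTable adj
  | k + 1, adj => (List.range (k + 8)).any fun i => (List.range (i + 1)).any fun j =>
      (i == j || adj i j || adj j i) && veeSearch k (opAdj (k + 7) adj i j)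

theorem Bags.vee_of_search {k : ℕ} (h : Bags G (7 + k) adj f) (hv : veeSearch k adj = true) :
    IsMinor K7vee G := by
  induction k generalizing adj f with
  | zero => exact h.vee_of_veeTable hv
  | succ k ih =>
    simp only [veeSearch, List.any_eq_true, List.mem_range, Bool.and_eq_true, Bool.or_eq_true,
      beq_iff_eq] at hv
    obtain ⟨i, hi, j, hj, hij, hv⟩ := hv
    have h1 : Bags G ((k + 7) + 1) adj f := by convert h using 1; omega
    obtain ⟨f', h'⟩ := h1.op (i := i) (j := j) (by omega) (by omega) (by tauto)
    exact ih (by convert h' using 1; omega) hv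

end Models

/-! ### Menger's theorem -/

section Menger

variable {V : Type} {G : SimpleGraph V} {A B S T Z : Set V}

/-- The spanning subgraph of `G` consisting of the edges inside `A`. -/
def within (G : SimpleGraph V) (A : Set V) : SimpleGraph V where
  Adj u v := G.Adj u v ∧ u ∈ A ∧ v ∈ A
  symm := ⟨fun _ _ h => ⟨h.1.symm, h.2.2, h.2.1⟩⟩
  loopless := ⟨fun _ h => G.loopless.irrefl _ h.1⟩

theorem within_le (G : SimpleGraph V) (A : Set V) : within G A ≤ G := fun _ _ h => h.1

theorem Conn.subset_of_within {P : Set V} (h : Conn (within G A) P) (hne : (P ∩ A).Nonempty) :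
    P ⊆ A :=
  h.subset_of_closed hne fun _ _ _ _ _ huv => huv.2.2

theorem Conn.of_within {P : Set V} (h : Conn (within G A) P) : Conn G P :=
  h.mono_graph fun _ _ _ _ e => e.1

/-- Disjoint connected sets meeting both `S` and `T`, indexed by `ι`. -/
structure Linkage (G : SimpleGraph V) (S T : Set V) {ι : Type} (P : ι → Set V) : Prop where
  conn : ∀ i, Conn G (P i)
  disj : ∀ i j, i ≠ j → Disjoint (P i) (P j)
  left : ∀ i, (P i ∩ S).Nonempty
  right : ∀ i, (P i ∩ T).Nonempty

theorem Linkage.mono_graph {G' : SimpleGraph V} {ι : Type} {P : ι → Set V} (h : Linkage G S T P)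
    (hG : G ≤ G') : Linkage G' S T P :=
  ⟨fun i => (h.conn i).mono_graph fun _ _ _ _ e => hG e, h.disj, h.left, h.right⟩

/-- A linkage onto a set of the right size can be indexed by that set. -/
theorem Linkage.reindex [Finite V] {k : ℕ} {P : Fin k → Set V} (h : Linkage G S T P)
    (hT : T.ncard = k) : ∃ Q : T → Set V, Linkage G S T Q ∧ ∀ t, Q t ∩ T = {(t : V)} := by
  choose g hg using h.right
  let g' : Fin k → T := fun i => ⟨g i, (hg i).2⟩
  have hinj : g'.Injective := fun i j hij => by
    by_contra hne
    have : g i = g j := congrArg Subtype.val hij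
    exact Set.disjoint_left.1 (h.disj i j hne) (hg i).1 (this ▸ (hg j).1)
  have hbij : g'.Bijective := by
    refine (Nat.bijective_iff_injective_and_card g').2 ⟨hinj, ?_⟩
    rw [Nat.card_fin, Nat.card_coe_set_eq, hT]
  let e := Equiv.ofBijective g' hbij
  have hself : ∀ t : T, (t : V) ∈ P (e.symm t) := fun t => by
    have h1 : g' (e.symm t) = t := e.apply_symm_apply t
    have h2 : g (e.symm t) = t := congrArg Subtype.val h1
    exact h2 ▸ (hg (e.symm t)).1
  refine ⟨fun t => P (e.symm t), ⟨fun t => h.conn _, fun t t' ht => h.disj _ _ fun e' =>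
    ht (e.symm.injective e'), fun t => h.left _, fun t => h.right _⟩, fun t => ?_⟩
  ext x
  simp only [Set.mem_inter_iff, Set.mem_singleton_iff]
  constructor
  · rintro ⟨hx, hxT⟩
    by_contra hne
    exact Set.disjoint_left.1 (h.disj (e.symm t) (e.symm ⟨x, hxT⟩) fun e' =>
      hne (congrArg Subtype.val (e.symm.injective e')).symm) hx (hself ⟨x, hxT⟩)
  · rintro rfl
    exact ⟨hself t, t.2⟩

theorem menger [Finite V] (k : ℕ) (G : SimpleGraph V) : ∀ S T : Set V,
    (∀ A B, IsSeparation G A B → S ⊆ A → T ⊆ B → k ≤ (A ∩ B).ncard) →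
    ∃ P : Fin k → Set V, Linkage G S T P := by
  induction G using WellFoundedLT.induction with
  | ind G ih =>
  intro S T hsep
  by_cases hbot : G = ⊥
  · subst hbot
    have h1 := hsep S (Sᶜ ∪ T) ⟨by rw [← Set.union_assoc, Set.union_compl_self, Set.univ_union],
      fun u v huv => absurd huv (by simp)⟩ subset_rfl Set.subset_union_right
    rw [Set.inter_union_distrib_left, Set.inter_compl_self, Set.empty_union] at h1
    obtain ⟨f⟩ : Nonempty (Fin k ↪ (S ∩ T : Set V)) := by
      have : Fintype (S ∩ T : Set V) := Fintype.ofFinite _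
      refine Function.Embedding.nonempty_of_card_le ?_
      rwa [Fintype.card_fin, ← Nat.card_eq_fintype_card, Nat.card_coe_set_eq]
    exact ⟨fun i => {(f i : V)}, fun i => conn_singleton _, fun i j hij =>
      Set.disjoint_singleton.2 fun e => hij (f.injective (Subtype.ext e)),
      fun i => ⟨f i, rfl, (f i).2.1⟩, fun i => ⟨f i, rfl, (f i).2.2⟩⟩
  obtain ⟨x, y, hxy⟩ : ∃ x y, G.Adj x y := by
    by_contra! hno
    exact hbot (by ext a b; simp [hno])
  let G' := G.deleteEdges {s(x, y)}
  have hadj' : ∀ a b, G.Adj a b → ¬ (a = x ∧ b = y ∨ a = y ∧ b = x) → G'.Adj a b := by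
    intro a b hab hn
    simp only [G', SimpleGraph.deleteEdges_adj, Set.mem_singleton_iff, Sym2.eq_iff]
    exact ⟨hab, hn⟩
  have hlt : G' < G := by
    refine lt_of_le_of_ne (SimpleGraph.deleteEdges_le _) fun e => ?_
    have : G'.Adj x y := e ▸ hxy
    simp [G'] at this
  by_cases hgood : ∀ A B, IsSeparation G' A B → S ⊆ A → T ⊆ B → k ≤ (A ∩ B).ncard
  · obtain ⟨P, hP⟩ := ih G' hlt S T hgood
    exact ⟨P, hP.mono_graph hlt.le⟩
  push Not at hgood
  obtain ⟨A, B, hAB, hSA, hTB, hcard⟩ := hgood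
  -- the removed edge crosses the small separation
  obtain ⟨x, y, hxy, hadj', hxA, hxB, hyB, hyA⟩ : ∃ x y, G.Adj x y ∧
      (∀ a b, G.Adj a b → ¬ (a = x ∧ b = y ∨ a = y ∧ b = x) → G'.Adj a b) ∧
      x ∈ A ∧ x ∉ B ∧ y ∈ B ∧ y ∉ A := by
    by_contra hno
    replace hno : ∀ x y, G.Adj x y →
        (∀ a b, G.Adj a b → ¬ (a = x ∧ b = y ∨ a = y ∧ b = x) → G'.Adj a b) →
        x ∈ A → x ∉ B → y ∈ B → y ∈ A := fun x y h1 h2 h3 h4 h5 =>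
      not_not.1 fun h6 => hno ⟨x, y, h1, h2, h3, h4, h5, h6⟩
    refine absurd (hsep A B ⟨hAB.1, fun u v huv hc => ?_⟩ hSA hTB) (not_le.2 hcard)
    by_cases he : u = x ∧ v = y ∨ u = y ∧ v = x
    · rcases he with ⟨rfl, rfl⟩ | ⟨rfl, rfl⟩
      · exact hc.2.2 (hno u v hxy hadj' hc.1.1 hc.1.2 hc.2.1)
      · exact hc.2.2 (hno u v huv (fun a b h1 h2 => hadj' a b h1 (by tauto)) hc.1.1 hc.1.2 hc.2.1)
    · exact hAB.2 (hadj' u v huv he) hc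
  have hcov : ∀ v, v ∈ A ∨ v ∈ B := fun v => by
    have : v ∈ A ∪ B := hAB.1 ▸ Set.mem_univ v
    exact this
  have hxn : x ∉ A ∩ B := fun h => hxB h.2
  have hyn : y ∉ A ∩ B := fun h => hyA h.1
  have hk : (A ∩ B).ncard + 1 = k := by
    have := hsep (insert y A) B ⟨Set.eq_univ_of_forall fun v =>
        (hcov v).imp (fun h => Or.inr h) id, fun u v huv hc => ?_⟩
        (hSA.trans (Set.subset_insert _ _)) hTB
    · rw [Set.insert_inter_of_mem hyB, Set.ncard_insert_of_notMem hyn] at this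
      omega
    · by_cases he : u = x ∧ v = y ∨ u = y ∧ v = x
      · rcases he with ⟨rfl, rfl⟩ | ⟨rfl, rfl⟩
        · exact hc.2.2 (Or.inl rfl)
        · exact hc.1.2 hyB
      · exact hAB.2 (hadj' u v huv he) ⟨⟨hc.1.1.resolve_left fun h => hc.1.2 (h ▸ hyB), hc.1.2⟩,
          hc.2.1, fun h => hc.2.2 (Or.inr h)⟩
  have hkx : (insert x (A ∩ B)).ncard = k := by rw [Set.ncard_insert_of_notMem hxn, hk]
  have hky : (insert y (A ∩ B)).ncard = k := by rw [Set.ncard_insert_of_notMem hyn, hk]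
  have hlink : ∀ (A B S T : Set V) (x y : V), IsSeparation G' A B → S ⊆ A → T ⊆ B →
      (∀ a b, G.Adj a b → ¬ (a = x ∧ b = y ∨ a = y ∧ b = x) → G'.Adj a b) → x ∈ A → x ∉ B →
      y ∈ B → y ∉ A → (∀ A' B', IsSeparation G A' B' → S ⊆ A' → T ⊆ B' → k ≤ (A' ∩ B').ncard) →
      (insert x (A ∩ B)).ncard = k → ∃ P : (insert x (A ∩ B) : Set V) → Set V,
        Linkage G S (insert x (A ∩ B)) P ∧ (∀ t, P t ∩ insert x (A ∩ B) = {(t : V)}) ∧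
        ∀ t, P t ⊆ A := by
    intro A B S T x y hAB hSA hTB hadj' hxA hxB hyB hyA hsep hkx
    suffices hw : ∀ A' B', IsSeparation (within G' A) A' B' → S ⊆ A' →
        insert x (A ∩ B) ⊆ B' → k ≤ (A' ∩ B').ncard by
      obtain ⟨P, hP⟩ := ih (within G' A) ((within_le _ _).trans_lt hlt) S (insert x (A ∩ B)) hw
      obtain ⟨Q, hQ, hQ'⟩ := hP.reindex hkx
      refine ⟨Q, hQ.mono_graph ((within_le _ _).trans hlt.le), hQ', fun t => ?_⟩
      refine (hQ.conn t).subset_of_within ((hQ.left t).mono ?_)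
      exact Set.inter_subset_inter_right _ hSA
    intro A' B' hAB' hSA' hZB'
    have hcov' : ∀ v, v ∈ A' ∨ v ∈ B' := fun v => by
      have : v ∈ A' ∪ B' := hAB'.1 ▸ Set.mem_univ v
      exact this
    have hcov : ∀ v, v ∈ A ∨ v ∈ B := fun v => by
      have : v ∈ A ∪ B := hAB.1 ▸ Set.mem_univ v
      exact this
    have h1 := hsep (A' ∩ A) (B' ∪ B) ⟨Set.eq_univ_of_forall fun v => ?_, fun u v huv hc => ?_⟩
      (Set.subset_inter hSA' hSA) (hTB.trans Set.subset_union_right)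
    · refine h1.trans (Set.ncard_le_ncard ?_ (Set.toFinite _))
      rintro v ⟨⟨h1, h2⟩, h3 | h3⟩
      · exact ⟨h1, h3⟩
      · exact ⟨h1, hZB' (Or.inr ⟨h2, h3⟩)⟩
    · have := hcov v; have := hcov' v
      simp only [Set.mem_union, Set.mem_inter_iff]; tauto
    · simp only [Set.mem_sdiff, Set.mem_inter_iff, Set.mem_union, not_or, not_and] at hc
      obtain ⟨⟨⟨huA', huA⟩, huB', huB⟩, hv, hv'⟩ := hc
      have hux : u ≠ x := fun h => huB' (hZB' (Or.inl h))
      have huy : u ≠ y := fun h => huB (h ▸ hyB)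
      have huv' := hadj' u v huv (by tauto)
      by_cases hvA : v ∈ A
      · have hvA' : v ∉ A' := fun h => hv' h hvA
        exact hAB'.2 (show (within G' A).Adj u v from ⟨huv', huA, hvA⟩)
          ⟨⟨huA', huB'⟩, (hcov' v).resolve_left hvA', hvA'⟩
      · exact hAB.2 huv' ⟨⟨huA, huB⟩, (hcov v).resolve_left hvA, hvA⟩
  obtain ⟨P, hP, hPZ, hPA⟩ := hlink A B S T x y hAB hSA hTB hadj' hxA hxB hyB hyA hsep hkx
  have hBA : IsSeparation G' B A := ⟨by rw [Set.union_comm, hAB.1],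
    fun u v huv hc => hAB.2 huv.symm ⟨hc.2, hc.1⟩⟩
  have hQ := hlink B A T S y x hBA hTB hSA
    (fun a b h1 h2 => hadj' a b h1 (by tauto)) hyB hyA hxA hxB
    (fun A' B' h1 h2 h3 => by
      rw [Set.inter_comm]
      exact hsep B' A' ⟨by rw [Set.union_comm, h1.1],
        fun u v huv hc => h1.2 huv.symm ⟨hc.2, hc.1⟩⟩ h3 h2) (by rwa [Set.inter_comm])
  rw [Set.inter_comm B A] at hQ
  obtain ⟨Q, hQ, hQZ, hQB⟩ := hQ
  classical
  have hm : ∀ z : (insert x (A ∩ B) : Set V), (if (z : V) = x then y else z) ∈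
      (insert y (A ∩ B) : Set V) := fun z => by
    split_ifs with h
    · exact Or.inl rfl
    · exact Or.inr (z.2.resolve_left h)
  let m : (insert x (A ∩ B) : Set V) → (insert y (A ∩ B) : Set V) := fun z => ⟨_, hm z⟩
  have hPQ : ∀ z w, ∀ q ∈ P z, q ∈ Q w → q = z ∧ q = w := by
    intro z w q hqP hqQ
    have hq : q ∈ A ∩ B := ⟨hPA z hqP, hQB w hqQ⟩
    have h1 : q ∈ P z ∩ insert x (A ∩ B) := ⟨hqP, Or.inr hq⟩
    have h2 : q ∈ Q w ∩ insert y (A ∩ B) := ⟨hqQ, Or.inr hq⟩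
    rw [hPZ] at h1
    rw [hQZ] at h2
    exact ⟨h1, h2⟩
  have hPm : ∀ z, (z : V) ∈ P z := fun z => by
    have : (z : V) ∈ P z ∩ insert x (A ∩ B) := by rw [hPZ]; rfl
    exact this.1
  have hQm : ∀ z, (z : V) ∈ Q z := fun z => by
    have : (z : V) ∈ Q z ∩ insert y (A ∩ B) := by rw [hQZ]; rfl
    exact this.1
  have hmv : ∀ z, (m z : V) = if (z : V) = x then y else z := fun z => rfl
  have hminj : ∀ z w, (m z : V) = m w → z = w := by
    intro z w h
    rw [hmv, hmv] at h
    have hzy : (z : V) ≠ y := fun e => by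
      rcases z.2 with h' | h'
      · exact hxB (h' ▸ e ▸ hyB)
      · exact hyA (e ▸ h'.1)
    have hwy : (w : V) ≠ y := fun e => by
      rcases w.2 with h' | h'
      · exact hxB (h' ▸ e ▸ hyB)
      · exact hyA (e ▸ h'.1)
    apply Subtype.ext
    split_ifs at h with h1 h2 h2
    · rw [h1, h2]
    · exact absurd h.symm hwy
    · exact absurd h hzy
    · exact h
  have hmz : ∀ z w : (insert x (A ∩ B) : Set V), (z : V) = m w → z = w := by
    intro z w h
    rw [hmv] at h
    apply Subtype.ext
    split_ifs at h with h1
    · rcases z.2 with h' | h'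
      · rw [h', h1]
      · exact absurd h'.1 (h ▸ hyA)
    · exact h
  have hL : Linkage G S T (fun z => P z ∪ Q (m z)) := by
    refine ⟨fun z => (?_ : _ ∨ _).elim ((hP.conn z).union (hQ.conn (m z)))
      ((hP.conn z).union_of_inter (hQ.conn (m z))), fun z w hzw => ?_, fun z => ?_,
      fun z => ?_⟩
    · by_cases hz : (z : V) = x
      · exact Or.inl ⟨x, hz ▸ hPm z, y, by
          have := hQm (m z)
          rwa [hmv, if_pos hz] at this, hxy⟩
      · exact Or.inr ⟨z, hPm z, by
          have := hQm (m z)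
          rwa [hmv, if_neg hz] at this⟩
    · have hd1 := hP.disj z w hzw
      have hd2 := hQ.disj (m z) (m w) fun e => hzw (hminj z w (congrArg _ e))
      have hd3 : ∀ z w, z ≠ w → Disjoint (P z) (Q (m w)) := fun z w hzw =>
        Set.disjoint_left.2 fun q h1 h2 => hzw (hmz z w
          ((hPQ z (m w) q h1 h2).1.symm.trans (hPQ z (m w) q h1 h2).2))
      exact (hd1.union_right (hd3 z w hzw)).union_left
        ((hd3 w z hzw.symm).symm.union_right hd2)
    · exact (hP.left z).mono (Set.inter_subset_inter_left _ Set.subset_union_left)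
    · exact (hQ.left (m z)).mono (Set.inter_subset_inter_left _ Set.subset_union_right)
  have e : Fin k ≃ (insert x (A ∩ B) : Set V) :=
    (Finite.equivFinOfCardEq (by rw [Nat.card_coe_set_eq, hkx])).symm
  exact ⟨_, fun i => hL.conn (e i), fun i j hij => hL.disj _ _ fun h => hij (e.injective h),
    fun i => hL.left _, fun i => hL.right _⟩

end Menger

/-! ### Quotient graphs and minimal counterexamples -/

section Quot

variable {V W : Type} {G : SimpleGraph V} {f : V → W}

/-- The simple graph on `W` obtained from `G` by identifying the vertices in each fibre of `f`. -/
def quot (G : SimpleGraph V) (f : V → W) : SimpleGraph W where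
  Adj a b := a ≠ b ∧ ∃ u v, f u = a ∧ f v = b ∧ G.Adj u v
  symm := ⟨fun _ _ h => ⟨h.1.symm, by obtain ⟨_, u, v, hu, hv, h⟩ := h; exact ⟨v, u, hv, hu, h.symm⟩⟩⟩
  loopless := ⟨fun _ h => h.1 rfl⟩

theorem quot_adj_of {u v : V} (h : G.Adj u v) (hne : f u ≠ f v) : (quot G f).Adj (f u) (f v) :=
  ⟨hne, u, v, rfl, rfl, h⟩

theorem quot_model (hf : ∀ w, Conn G (f ⁻¹' {w})) : Model (quot G f) G (fun w => f ⁻¹' {w}) := by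
  refine ⟨hf, fun w w' hw => ?_, fun w w' hw => ?_⟩
  · exact Set.disjoint_left.2 fun x hx hx' => hw (hx.symm.trans hx')
  · obtain ⟨_, u, v, hu, hv, h⟩ := hw
    exact ⟨u, hu, v, hv, h⟩

open Classical in
/-- The map contracting the set `Z` to a single point `none`. -/
noncomputable def contractMap (Z : Set V) (x : V) : Option {x : V // x ∉ Z} :=
  if h : x ∈ Z then none else some ⟨x, h⟩

theorem contractMap_of_mem {Z : Set V} {x : V} (h : x ∈ Z) : contractMap Z x = none := by
  simp [contractMap, h]

theorem contractMap_of_notMem {Z : Set V} {x : V} (h : x ∉ Z) :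
    contractMap Z x = some ⟨x, h⟩ := by
  simp [contractMap, h]

theorem conn_contractMap_fiber {Z : Set V} (hZ : Conn G Z) (w : Option {x : V // x ∉ Z}) :
    Conn G (contractMap Z ⁻¹' {w}) := by
  rcases w with _ | ⟨y, hy⟩
  · convert hZ
    ext x
    by_cases hx : x ∈ Z <;> simp [contractMap, hx]
  · convert conn_singleton (G := G) y
    ext x
    by_cases hx : x ∈ Z
    · simp only [contractMap, hx, Set.mem_preimage, Set.mem_singleton_iff]
      constructor
      · intro h; simp at h
      · rintro rfl; exact absurd hx hy
    · simp [contractMap, hx]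

theorem card_contract_lt [Finite V] {Z : Set V} (hZ : 2 ≤ Z.ncard) :
    Nat.card (Option {x : V // x ∉ Z}) < Nat.card V := by
  have h1 : Nat.card (Option {x : V // x ∉ Z}) = Nat.card {x : V // x ∉ Z} + 1 := by
    rw [Finite.card_option]
  have h2 : Nat.card {x : V // x ∉ Z} = (Zᶜ).ncard := Nat.card_coe_set_eq (Zᶜ)
  have h3 := Set.ncard_add_ncard_compl Z
  omega

end Quot

section MinCE

variable {V : Type} {G : SimpleGraph V}

theorem colorable_six_iff : G.Colorable 6 ↔ ∃ c : V → Fin 6, ∀ u v, G.Adj u v → c u ≠ c v :=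
  ⟨fun ⟨c⟩ => ⟨c, fun _ _ h => c.valid h⟩, fun ⟨c, h⟩ => ⟨SimpleGraph.Coloring.mk c fun e => h _ _ e⟩⟩

/-- The properties of a minimal counterexample used in the proof. -/
structure MinCE (G : SimpleGraph V) : Prop where
  noVee : ¬ IsMinor K7vee G
  notCol : ¬ ∃ c : V → Fin 6, ∀ u v, G.Adj u v → c u ≠ c v
  contract : ∀ Z, Conn G Z → 2 ≤ Z.ncard → ∃ c : V → Fin 6, (∀ a ∈ Z, ∀ b ∈ Z, c a = c b) ∧
    ∀ u v, G.Adj u v → ¬ (u ∈ Z ∧ v ∈ Z) → c u ≠ c v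
  delete : ∀ v, ∃ c : V → Fin 6, ∀ x y, x ≠ v → y ≠ v → G.Adj x y → c x ≠ c y

theorem minCE_of_minimal [Finite V] (hv : ¬ IsMinor K7vee G) (hc : ¬ G.Colorable 6)
    (ih : ∀ (W : Type) [Finite W] (H : SimpleGraph W), Nat.card W < Nat.card V →
      ¬ IsMinor K7vee H → H.Colorable 6) : MinCE G := by
  refine ⟨hv, fun h => hc (colorable_six_iff.2 h), fun Z hZ hZ2 => ?_, fun v => ?_⟩
  · have hm := quot_model (conn_contractMap_fiber hZ)
    obtain ⟨c, hc⟩ := colorable_six_iff.1 (ih _ (quot G (contractMap Z)) (card_contract_lt hZ2)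
      fun h => hv (isMinor_trans h hm.isMinor))
    refine ⟨fun x => c (contractMap Z x), fun a ha b hb => ?_, fun a b hab hn => ?_⟩
    · simp only [contractMap_of_mem ha, contractMap_of_mem hb]
    · refine hc _ _ (quot_adj_of hab fun he => hn ?_)
      by_cases ha : a ∈ Z
      · refine ⟨ha, ?_⟩
        by_contra hb
        simp [contractMap_of_mem ha, contractMap_of_notMem hb] at he
      · exfalso
        by_cases hb : b ∈ Z
        · simp [contractMap_of_mem hb, contractMap_of_notMem ha] at he
        · simp only [contractMap_of_notMem hb, contractMap_of_notMem ha, Option.some.injEq,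
            Subtype.mk.injEq] at he
          exact hab.ne he
  · have hlt : Nat.card ({v}ᶜ : Set V) < Nat.card V := by
      rw [Nat.card_coe_set_eq]
      have := Set.ncard_add_ncard_compl {v}
      rw [Set.ncard_singleton] at this
      omega
    obtain ⟨c, hc⟩ := colorable_six_iff.1 (ih _ (G.induce {v}ᶜ) hlt
      fun h => hv (isMinor_trans h (isMinor_induce G _)))
    classical
    refine ⟨fun x => if h : x ≠ v then c ⟨x, h⟩ else 0, fun x y hx hy hxy => ?_⟩
    simp only [hx, hy, ne_eq, not_false_eq_true, dif_pos]
    exact hc _ _ hxy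

/-- Colourings of two sides of a separation which agree on equality over the separator can be
combined. -/
theorem glue_coloring {A B : Set V} (hAB : A ∪ B = Set.univ)
    (hsep : ∀ u v, G.Adj u v → (u ∈ A ∧ v ∈ A) ∨ (u ∈ B ∧ v ∈ B)) {f g : V → Fin 6}
    (hf : ∀ u v, u ∈ A → v ∈ A → G.Adj u v → f u ≠ f v)
    (hg : ∀ u v, u ∈ B → v ∈ B → G.Adj u v → g u ≠ g v)
    (hfg : ∀ u v, u ∈ A ∩ B → v ∈ A ∩ B → (f u = f v ↔ g u = g v)) :
    ∃ c : V → Fin 6, ∀ u v, G.Adj u v → c u ≠ c v := by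
  classical
  obtain ⟨e, he⟩ : ∃ e : Equiv.Perm (Fin 6), ∀ x ∈ A ∩ B, e (g x) = f x := by
    let p : Fin 6 → Prop := fun i => ∃ x ∈ A ∩ B, g x = i
    let q : Fin 6 → Prop := fun i => ∃ x ∈ A ∩ B, f x = i
    have hp : ∀ i : {i // p i}, q (f i.2.choose) := fun i => ⟨_, i.2.choose_spec.1, rfl⟩
    have hq : ∀ i : {i // q i}, p (g i.2.choose) := fun i => ⟨_, i.2.choose_spec.1, rfl⟩
    let e0 : {i // p i} ≃ {i // q i} := by
      refine ⟨fun i => ⟨_, hp i⟩, fun i => ⟨_, hq i⟩, fun i => ?_, fun i => ?_⟩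
      · apply Subtype.ext
        have h1 := (⟨_, hp i⟩ : {i // q i}).2.choose_spec
        have h2 := i.2.choose_spec
        exact ((hfg _ _ h1.1 h2.1).1 h1.2).trans h2.2
      · apply Subtype.ext
        have h1 := (⟨_, hq i⟩ : {i // p i}).2.choose_spec
        have h2 := i.2.choose_spec
        exact ((hfg _ _ h1.1 h2.1).2 h1.2).trans h2.2
    refine ⟨e0.extendSubtype, fun x hx => ?_⟩
    have hpx : p (g x) := ⟨x, hx, rfl⟩
    rw [Equiv.extendSubtype_apply_of_mem e0 _ hpx]
    exact (hfg _ _ hpx.choose_spec.1 hx).2 hpx.choose_spec.2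
  have hcov : ∀ v, v ∉ A → v ∈ B := fun v h => by
    have : v ∈ A ∪ B := hAB ▸ Set.mem_univ v
    exact this.resolve_left h
  have hB : ∀ v ∈ B, (if v ∈ A then f v else e (g v)) = e (g v) := fun v hv => by
    split_ifs with h
    · exact (he v ⟨h, hv⟩).symm
    · rfl
  refine ⟨fun v => if v ∈ A then f v else e (g v), fun u v huv => ?_⟩
  rcases hsep u v huv with ⟨hu, hv⟩ | ⟨hu, hv⟩
  · simp only [hu, hv, if_true]
    exact hf u v hu hv huv
  · simp only [hB u hu, hB v hv]
    exact fun h => hg u v hu hv huv (e.injective h)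

end MinCE

section Basic

variable {V : Type} {G : SimpleGraph V} {C D I S : Set V}

/-- The set of vertices outside `C` with a neighbour in `C`. -/
def nb (G : SimpleGraph V) (C : Set V) : Set V := {v | v ∉ C ∧ ∃ u ∈ C, G.Adj u v}

theorem Conn.union_nb (hC : Conn G C) (hI : I ⊆ nb G C) : Conn G (C ∪ I) := by
  refine conn_of_closed (hC.nonempty.mono Set.subset_union_left) fun A ⟨x, hx, hxA⟩ hcl => ?_
  have h1 : (C ∩ A).Nonempty → C ⊆ A := fun hne => hC.subset_of_closed hne
    fun u hu v hv => hcl u (Or.inl hu) v (Or.inl hv)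
  have hCA : C ⊆ A := by
    rcases hx with hx | hx
    · exact h1 ⟨x, hx, hxA⟩
    · obtain ⟨_, u, hu, hux⟩ := hI hx
      exact h1 ⟨u, hu, hcl x (Or.inr hx) u (Or.inl hu) hxA hux.symm⟩
  rintro y (hy | hy)
  · exact hCA hy
  · obtain ⟨_, u, hu, huy⟩ := hI hy
    exact hcl u (Or.inl hu) y (Or.inr hy) (hCA hu) huy

theorem IsComp.nb_subset (h : IsComp G S C) : nb G C ⊆ Sᶜ := by
  rintro v ⟨hvC, u, hu, huv⟩ hvS
  exact hvC (h.closed u hu v hvS huv)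

theorem two_le_ncard_union [Finite V] (hC : C.Nonempty) (hI : I.Nonempty) (hd : Disjoint C I) :
    2 ≤ (C ∪ I).ncard := by
  rw [Set.ncard_union_eq hd (Set.toFinite _) (Set.toFinite _)]
  have := (Set.ncard_pos (Set.toFinite C)).2 hC
  have := (Set.ncard_pos (Set.toFinite I)).2 hI
  omega

variable [Finite V]

namespace MinCE

theorem contract_nb (hG : MinCE G) (hC : Conn G C) (hI : I ⊆ nb G C) (hne : I.Nonempty)
    (hind : ∀ a ∈ I, ∀ b ∈ I, ¬ G.Adj a b) :
    ∃ c : V → Fin 6, (∀ a ∈ I, ∀ b ∈ I, c a = c b) ∧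
      (∀ a ∈ I, ∀ b ∈ nb G C, b ∉ I → c a ≠ c b) ∧
      ∀ u v, u ∉ C → v ∉ C → G.Adj u v → c u ≠ c v := by
  obtain ⟨c, h1, h2⟩ := hG.contract (C ∪ I) (hC.union_nb hI)
    (two_le_ncard_union hC.nonempty hne (Set.disjoint_left.2 fun x hx hx' => (hI hx').1 hx))
  refine ⟨c, fun a ha b hb => h1 a (Or.inr ha) b (Or.inr hb), fun a ha b hb hbI => ?_,
    fun u v hu hv huv => h2 u v huv fun ⟨hu', hv'⟩ => ?_⟩
  · obtain ⟨hbC, u, hu, hub⟩ := hb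
    rw [h1 a (Or.inr ha) u (Or.inl hu)]
    exact h2 u b hub fun h => h.2.elim hbC hbI
  · exact hind u (hu'.resolve_left hu) v (hv'.resolve_left hv) huv

theorem no_sep (hG : MinCE G) (hC : Conn G C) (hD : Conn G D) (hDC : nb G D ⊆ nb G C)
    (hdisj : Disjoint C D) (hI : I ⊆ nb G D) (hne : I.Nonempty)
    (hind : ∀ a ∈ I, ∀ b ∈ I, ¬ G.Adj a b)
    (hcl : ∀ a ∈ nb G D, ∀ b ∈ nb G D, a ∉ I → b ∉ I → a ≠ b → G.Adj a b) : False := by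
  obtain ⟨f, f1, f2, f3⟩ := hG.contract_nb hC (hI.trans hDC) hne hind
  obtain ⟨g, g1, g2, g3⟩ := hG.contract_nb hD hI hne hind
  have hSC : ∀ x ∈ nb G D, x ∉ C := fun x hx => (hDC hx).1
  have hSD : ∀ x ∈ nb G D, x ∉ D := fun x hx => hx.1
  have hDC' : ∀ x ∈ D, x ∉ C := fun x hx hx' => Set.disjoint_left.1 hdisj hx' hx
  refine hG.notCol (glue_coloring (A := D ∪ nb G D) (B := Dᶜ) ?_ ?_
    (f := f) (g := g) (fun u v hu hv huv => f3 u v ?_ ?_ huv) (fun u v hu hv huv => g3 u v hu hv huv)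
    ?_)
  · refine Set.eq_univ_of_forall fun x => ?_
    by_cases hx : x ∈ D
    · exact Or.inl (Or.inl hx)
    · exact Or.inr hx
  · intro u v huv
    by_cases hu : u ∈ D <;> by_cases hv : v ∈ D
    · exact Or.inl ⟨Or.inl hu, Or.inl hv⟩
    · exact Or.inl ⟨Or.inl hu, Or.inr ⟨hv, u, hu, huv⟩⟩
    · exact Or.inl ⟨Or.inr ⟨hu, v, hv, huv.symm⟩, Or.inl hv⟩
    · exact Or.inr ⟨hu, hv⟩
  · exact hu.elim (hDC' u) (hSC u)
  · exact hv.elim (hDC' v) (hSC v)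
  · rintro u v ⟨hu, hu'⟩ ⟨hv, hv'⟩
    replace hu := hu.resolve_left hu'
    replace hv := hv.resolve_left hv'
    by_cases huI : u ∈ I <;> by_cases hvI : v ∈ I
    · simp only [f1 u huI v hvI, g1 u huI v hvI]
    · simp only [f2 u huI v (hDC hv) hvI, g2 u huI v hv hvI]
    · simp only [(f2 v hvI u (hDC hu) huI).symm, (g2 v hvI u hu huI).symm]
    · by_cases he : u = v
      · simp [he]
      · have hadj := hcl u hu v hv huI hvI he
        simp only [f3 u v (hSC u hu) (hSC v hv) hadj, g3 u v (hSD u hu) (hSD v hv) hadj]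

theorem no_empty_cut (hG : MinCE G) (hC : C.Nonempty) (hD : D.Nonempty) (hCD : C ∪ D = Set.univ)
    (hdisj : Disjoint C D) (hnt : ¬ Touch G C D) : False := by
  obtain ⟨a, ha⟩ := hC
  obtain ⟨b, hb⟩ := hD
  obtain ⟨f, hf⟩ := hG.delete b
  obtain ⟨g, hg⟩ := hG.delete a
  have h1 : ∀ x ∈ C, x ≠ b := fun x hx e => Set.disjoint_left.1 hdisj hx (e ▸ hb)
  have h2 : ∀ x ∈ D, x ≠ a := fun x hx e => Set.disjoint_left.1 hdisj (e ▸ ha) hx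
  refine hG.notCol (glue_coloring hCD ?_ (fun u v hu hv huv => hf u v (h1 u hu) (h1 v hv) huv)
    (fun u v hu hv huv => hg u v (h2 u hu) (h2 v hv) huv) fun u v hu => ?_)
  · intro u v huv
    have hu : u ∈ C ∪ D := hCD ▸ Set.mem_univ u
    have hv : v ∈ C ∪ D := hCD ▸ Set.mem_univ v
    rcases hu with hu | hu <;> rcases hv with hv | hv
    · exact Or.inl ⟨hu, hv⟩
    · exact absurd ⟨u, hu, v, hv, huv⟩ hnt
    · exact absurd ⟨v, hv, u, hu, huv.symm⟩ hnt
    · exact Or.inr ⟨hu, hv⟩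
  · exact absurd hu.2 (Set.disjoint_left.1 hdisj hu.1)

theorem not_clique_or_small_cut (hG : MinCE G) (hC : Conn G C) (hne : C ∪ nb G C ≠ Set.univ)
    (h : (∀ a ∈ nb G C, ∀ b ∈ nb G C, a ≠ b → G.Adj a b) ∨ (nb G C).ncard ≤ 3) : False := by
  obtain ⟨x, hx⟩ := (Set.ne_univ_iff_exists_notMem _).1 hne
  obtain ⟨D, hxD, hD⟩ := exists_isComp G (S := (C ∪ nb G C)ᶜ) hx
  have hsub : nb G D ⊆ nb G C := by
    intro y hy
    have h1 := hD.nb_subset hy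
    rw [compl_compl] at h1
    refine h1.resolve_left fun hyC => ?_
    obtain ⟨hyD, u, hu, huy⟩ := hy
    exact hD.subset hu (Or.inr ⟨fun huC => hD.subset hu (Or.inl huC), y, hyC, huy.symm⟩)
  have hdisj : Disjoint C D := Set.disjoint_left.2 fun y hy hy' => hD.subset hy' (Or.inl hy)
  by_cases hS : (nb G D).Nonempty
  · by_cases hcl : ∀ a ∈ nb G D, ∀ b ∈ nb G D, a ≠ b → G.Adj a b
    · obtain ⟨s, hs⟩ := hS
      exact hG.no_sep hC hD.conn hsub hdisj (I := {s}) (by simpa using hs) ⟨s, rfl⟩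
        (fun a ha b hb => by
          rw [Set.mem_singleton_iff] at ha hb; subst ha; subst hb; exact G.irrefl)
        fun a ha b hb _ _ => hcl a ha b hb
    · push Not at hcl
      obtain ⟨a, ha, b, hb, hab, hnadj⟩ := hcl
      have h3 : (nb G C).ncard ≤ 3 := h.resolve_left fun h =>
        hnadj (h a (hsub ha) b (hsub hb) hab)
      refine hG.no_sep hC hD.conn hsub hdisj (I := {a, b}) ?_ ⟨a, Or.inl rfl⟩ ?_ ?_
      · rintro y (rfl | rfl) <;> assumption
      · rintro y (rfl | rfl) z (rfl | rfl)
        · exact G.irrefl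
        · exact hnadj
        · exact fun h => hnadj h.symm
        · exact G.irrefl
      · intro p hp q hq hpI hqI hpq
        exfalso
        have : ({p, q, a, b} : Set V).ncard ≤ 3 := by
          refine (Set.ncard_le_ncard ?_ (Set.toFinite _)).trans h3
          rintro y (rfl | rfl | rfl | rfl) <;> apply hsub <;> assumption
        simp only [Set.mem_insert_iff, Set.mem_singleton_iff, not_or] at hpI hqI
        rw [Set.ncard_insert_of_notMem (by simp; tauto), Set.ncard_insert_of_notMem (by simp; tauto),
          Set.ncard_pair hab] at this
        omega
  · refine hG.no_empty_cut (D := Dᶜ) hD.conn.nonempty ?_ (Set.union_compl_self D)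
      disjoint_compl_right ?_
    · obtain ⟨c, hc⟩ := hC.nonempty
      exact ⟨c, Set.disjoint_left.1 hdisj hc⟩
    · rintro ⟨u, hu, v, hv, huv⟩
      exact hS ⟨v, hv, u, hu, huv⟩

theorem four_le_nb (hG : MinCE G) (hC : Conn G C) (hne : C ∪ nb G C ≠ Set.univ) :
    4 ≤ (nb G C).ncard := by
  by_contra h
  exact hG.not_clique_or_small_cut hC hne (Or.inr (by omega))

theorem nb_singleton (v : V) : nb G {v} = G.neighborSet v := by
  ext x
  simp only [nb, Set.mem_singleton_iff, exists_eq_left, Set.mem_ofPred_eq,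
    SimpleGraph.mem_neighborSet, and_iff_right_iff_imp]
  exact fun h => h.ne'

theorem extend_color (hG : MinCE G) (v : V) {c : V → Fin 6}
    (hc : ∀ x y, x ≠ v → y ≠ v → G.Adj x y → c x ≠ c y) (i : Fin 6)
    (hi : ∀ x, G.Adj v x → c x ≠ i) : False := by
  classical
  refine hG.notCol ⟨fun x => if x = v then i else c x, fun x y hxy => ?_⟩
  by_cases hx : x = v <;> by_cases hy : y = v
  · exact absurd (hx.trans hy.symm) hxy.ne
  · subst hx; simp only [if_true, hy, if_false]; exact (hi y hxy).symm
  · subst hy; simp only [if_true, hx, if_false]; exact hi x hxy.symm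
  · simp only [hx, hy, if_false]; exact hc x y hx hy hxy

theorem five_le_of_indep (hG : MinCE G) (v : V) (hI : I ⊆ G.neighborSet v)
    (hind : ∀ a ∈ I, ∀ b ∈ I, ¬ G.Adj a b) (hne : I.Nonempty) :
    5 ≤ (G.neighborSet v \ I).ncard := by
  by_contra hlt
  obtain ⟨c, h1, -, h3⟩ := hG.contract_nb (conn_singleton v) (by rwa [nb_singleton]) hne hind
  obtain ⟨a, ha⟩ := hne
  have hcard : (insert (c a) (c '' (G.neighborSet v \ I))).ncard < 6 := by
    have := Set.ncard_insert_le (c a) (c '' (G.neighborSet v \ I))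
    have := Set.ncard_image_le (f := c) (Set.toFinite (G.neighborSet v \ I))
    omega
  obtain ⟨i, hi⟩ : ∃ i, i ∉ insert (c a) (c '' (G.neighborSet v \ I)) := by
    by_contra! hall
    rw [Set.eq_univ_of_forall hall, Set.ncard_univ, Nat.card_fin] at hcard
    omega
  refine hG.extend_color v (c := c) (fun x y hx hy => h3 x y hx hy) i fun x hx e => hi ?_
  by_cases hxI : x ∈ I
  · exact Or.inl (e.symm.trans (h1 x hxI a ha))
  · exact Or.inr ⟨x, ⟨hx, hxI⟩, e⟩

end MinCE

end Basic

section FiveClique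

variable {V : Type} {G : SimpleGraph V} {X Y J U Q K : Set V} {v : V}

/-- Some vertex of `X` is adjacent to `q`. -/
def Sees (G : SimpleGraph V) (X : Set V) (q : V) : Prop := ∃ x ∈ X, G.Adj x q

theorem Sees.mono {q : V} (h : Sees G X q) (hXY : X ⊆ Y) : Sees G Y q := by
  obtain ⟨x, hx, h⟩ := h
  exact ⟨x, hXY hx, h⟩

theorem veeTable_five : ∀ a b : Fin 5, veeTable (fun i j =>
    !((i == 0 && (j == a + 2 || j == b + 2)) || (j == 0 && (i == a + 2 || i == b + 2)))) = true := by
  decide +kernel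

theorem vee_of_five_clique [Finite V] (hQ : Q.ncard = 5)
    (hcl : ∀ a ∈ Q, ∀ b ∈ Q, a ≠ b → G.Adj a b) (hX : Conn G X) (hY : Conn G Y)
    (hXY : Disjoint X Y) (ht : Touch G X Y) (hXQ : Disjoint X Q) (hYQ : Disjoint Y Q)
    (hYs : ∀ q ∈ Q, Sees G Y q) {a b : V} (ha : a ∈ Q) (hb : b ∈ Q)
    (hXs : ∀ q ∈ Q, q ≠ a → q ≠ b → Sees G X q) : IsMinor K7vee G := by
  have e : Q ≃ Fin 5 := Finite.equivFinOfCardEq (by rw [Nat.card_coe_set_eq, hQ])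
  let f : ℕ → Set V := fun k => match k with
    | 0 => X
    | 1 => Y
    | k + 2 => if h : k < 5 then {(e.symm ⟨k, h⟩ : V)} else ∅
  have hf : ∀ k (h : k < 5), f (k + 2) = {(e.symm ⟨k, h⟩ : V)} := fun k h => by simp [f, h]
  have hsee : ∀ {X : Set V} {q : V}, Sees G X q → Touch G X {q} := by
    rintro X q ⟨x, hx, h⟩
    exact ⟨x, hx, q, rfl, h⟩
  have hconn : ∀ i < 7, Conn G (f i) := by
    rintro (_ | _ | k) hk
    · exact hX
    · exact hY
    · rw [hf k (by omega)]; exact conn_singleton _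
  have hd : ∀ i < 7, ∀ j < 7, i < j → Disjoint (f i) (f j) := by
    rintro (_ | _ | k) hk (_ | _ | l) hl hkl
    · omega
    · exact hXY
    · rw [hf l (by omega)]
      exact Set.disjoint_singleton_right.2 fun h => Set.disjoint_left.1 hXQ h (Subtype.prop _)
    · omega
    · omega
    · rw [hf l (by omega)]
      exact Set.disjoint_singleton_right.2 fun h => Set.disjoint_left.1 hYQ h (Subtype.prop _)
    · omega
    · omega
    · rw [hf l (by omega), hf k (by omega)]
      refine Set.disjoint_singleton.2 fun h => ?_
      have := e.symm.injective (Subtype.ext h)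
      simp only [Fin.mk.injEq] at this
      omega
  let adj : ℕ → ℕ → Bool := fun i j => !((i == 0 && (j == e ⟨a, ha⟩ + 2 || j == e ⟨b, hb⟩ + 2)) ||
    (j == 0 && (i == e ⟨a, ha⟩ + 2 || i == e ⟨b, hb⟩ + 2)))
  have ht : ∀ i < 7, ∀ j < 7, i < j → adj i j = true → Touch G (f i) (f j) := by
    rintro (_ | _ | k) hk (_ | _ | l) hl hkl hadj
    · omega
    · exact ht
    · rw [hf l (by omega)]
      simp only [adj] at hadj
      refine hsee (hXs _ (Subtype.prop _) ?_ ?_)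
      · intro h
        have : l = e ⟨a, ha⟩ := by
          have : e.symm ⟨l, by omega⟩ = ⟨a, ha⟩ := Subtype.ext h
          rw [← this, e.apply_symm_apply]
        simp [this] at hadj
      · intro h
        have : l = e ⟨b, hb⟩ := by
          have : e.symm ⟨l, by omega⟩ = ⟨b, hb⟩ := Subtype.ext h
          rw [← this, e.apply_symm_apply]
        simp [this] at hadj
    · omega
    · omega
    · rw [hf l (by omega)]
      exact hsee (hYs _ (Subtype.prop _))
    · omega
    · omega
    · rw [hf l (by omega), hf k (by omega)]
      refine touch_singleton.2 (hcl _ (Subtype.prop _) _ (Subtype.prop _) fun h => ?_)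
      have := e.symm.injective (Subtype.ext h)
      simp only [Fin.mk.injEq] at this
      omega
  have hB : Bags G 7 adj f := by
    refine ⟨hconn, fun i hi j hj hij => ?_, fun i hi j hj hij hadj => ?_⟩
    · rcases lt_or_gt_of_ne hij with h | h
      · exact hd i hi j hj h
      · exact (hd j hj i hi h).symm
    · rcases lt_or_gt_of_ne hij with h | h
      · exact ht i hi j hj h hadj
      · refine (ht j hj i hi h ?_).symm
        simp only [adj] at hadj ⊢
        rw [Bool.or_comm]; exact hadj
  exact hB.vee_of_veeTable (veeTable_five (e ⟨a, ha⟩) (e ⟨b, hb⟩))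

/-- If deleting any vertex of `U` leaves it connected and `Y ⊂ U` is connected, then a part `J` of
`Y` attached in `Y` only at `z` contains a vertex that can be moved to `U \ Y`. -/
theorem exists_removable [Finite V] (hU : ∀ u ∈ U, Conn G (U \ {u})) (hYU : Y ⊆ U)
    (hY : Conn G Y) (hXne : (U \ Y).Nonempty) {z : V} (hz : z ∈ Y) (hJY : J ⊆ Y) (hzJ : z ∉ J)
    (hJ : J.Nonempty) (hJn : ∀ u ∈ J, ∀ w ∈ Y, G.Adj u w → w ∈ J ∨ w = z)
    (hYJ : Conn G (Y \ J)) :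
    ∃ y ∈ J, Sees G (U \ Y) y ∧ Conn G (Y \ {y}) := by
  induction hn : J.ncard using Nat.strong_induction_on generalizing J z with
  | _ n ih =>
  obtain ⟨x0, hx0⟩ := hXne
  obtain ⟨j, hj, x, ⟨⟨hxU, hxz⟩, hxJ⟩, hjx⟩ := (hU z (hYU hz)).exists_adj (A := J)
    (fun u hu => ⟨hYU (hJY hu), fun e => hzJ (e ▸ hu)⟩) hJ
    (fun e => hx0.2 (hJY (e ▸ ⟨hx0.1, fun e' => hx0.2 (e' ▸ hz)⟩)))
  have hxY : x ∉ Y := fun h => (hJn j hj x h hjx).elim hxJ hxz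
  by_cases hc : Conn G (Y \ {j})
  · exact ⟨j, hj, ⟨x, ⟨hxU, hxY⟩, hjx.symm⟩, hc⟩
  have hjY := hJY hj
  have hsub : Y \ J ⊆ Y \ {j} := fun u hu => ⟨hu.1, fun e => hu.2 (e ▸ hj)⟩
  have hzj : z ∈ Y \ {j} := ⟨hz, fun e => hzJ (e ▸ hj)⟩
  obtain ⟨C, hzC, hC⟩ := exists_isComp G hzj
  have hYC : Y \ J ⊆ C := hC.subset_of_conn hYJ hsub ⟨z, ⟨hz, hzJ⟩, hzC⟩
  have hex : ∃ q ∈ Y \ {j}, q ∉ C := by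
    by_contra! h
    exact hc (by rw [show Y \ {j} = C from Set.Subset.antisymm h hC.subset]; exact hC.conn)
  obtain ⟨q, hq, hqC⟩ := hex
  obtain ⟨D, hqD, hD⟩ := exists_isComp G hq
  have hDJ : D ⊆ J := by
    intro u hu
    by_contra huJ
    exact hqC (hC.subset_of_conn hD.conn hD.subset ⟨u, hu, hYC ⟨(hD.subset hu).1, huJ⟩⟩ hqD)
  have hlt : D.ncard < n := by
    rw [← hn]
    refine Set.ncard_lt_ncard (hDJ.ssubset_of_ne fun e => ?_) (Set.toFinite _)
    exact (hD.subset (e ▸ hj)).2 rfl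
  obtain ⟨y, hy, h1, h2⟩ := ih D.ncard hlt hjY (hDJ.trans hJY) (fun h => (hD.subset h).2 rfl)
    hD.conn.nonempty (fun u hu w hw huw => or_iff_not_imp_right.2 fun hwj =>
      hD.closed u hu w ⟨hw, hwj⟩ huw)
    (hY.diff_comp (conn_singleton j) (by simpa using hjY) hD) rfl
  exact ⟨y, hDJ hy, h1, h2⟩

theorem exists_removable_ne [Finite V] (hU : ∀ u ∈ U, Conn G (U \ {u})) (hYU : Y ⊆ U)
    (hY : Conn G Y) (hXne : (U \ Y).Nonempty) {r : V} (hr : r ∈ Y) (hYr : Y ≠ {r}) :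
    ∃ y ∈ Y, y ≠ r ∧ Sees G (U \ Y) y ∧ Conn G (Y \ {y}) := by
  have hne : (Y \ {r}).Nonempty := by
    by_contra h
    rw [Set.not_nonempty_iff_eq_empty, Set.sdiff_eq_empty] at h
    exact hYr (h.antisymm (by simpa using hr))
  obtain ⟨y, hy, h1, h2⟩ := exists_removable hU hYU hY hXne hr (J := Y \ {r}) Set.sdiff_subset
    (fun h => h.2 rfl) hne (fun u _ w hw _ => or_iff_not_imp_right.2 fun h => ⟨hw, h⟩)
    (by
      rw [Set.sdiff_sdiff_right_self, Set.inter_eq_right.2 (by simpa using hr)]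
      exact conn_singleton r)
  exact ⟨y, hy.1, hy.2, h1, h2⟩

end FiveClique

section Degree

variable {V : Type} [Finite V] {G : SimpleGraph V}

theorem vee_of_clique_nbhd {v : V} (h6 : 6 ≤ (G.neighborSet v).ncard)
    (hcl : ∀ a ∈ G.neighborSet v, ∀ b ∈ G.neighborSet v, a ≠ b → G.Adj a b) :
    IsMinor K7vee G := by
  obtain ⟨e⟩ : Nonempty (Fin 6 ↪ G.neighborSet v) := by
    have : Fintype (G.neighborSet v) := Fintype.ofFinite _
    refine Function.Embedding.nonempty_of_card_le ?_
    rwa [Fintype.card_fin, ← Nat.card_eq_fintype_card, Nat.card_coe_set_eq]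
  have hinj : Function.Injective (Fin.cons v (fun i => (e i : V)) : Fin 7 → V) := by
    refine Fin.cons_injective_iff.2 ⟨?_, Subtype.val_injective.comp e.injective⟩
    rintro ⟨i, hi⟩
    have h : G.Adj v (e i) := (e i).2
    rw [show (e i : V) = v from hi] at h
    exact G.irrefl h
  refine (Model.of_injective hinj fun i j hij => ?_).isMinor
  have hne := hij.ne
  have hne' := hinj.ne hne
  revert hne hne'
  refine Fin.cases ?_ (fun i => ?_) i <;> refine Fin.cases ?_ (fun j => ?_) j
  · intro h; exact absurd rfl h
  · intro _ _; exact (e j).2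
  · intro _ _; exact ((e i).2 : G.Adj v _).symm
  · intro _ h; exact hcl _ (e i).2 _ (e j).2 h

namespace MinCE

theorem seven_le_degree (hG : MinCE G) (v : V) : 7 ≤ (G.neighborSet v).ncard := by
  by_contra hlt
  by_cases hne : (G.neighborSet v).Nonempty
  · by_cases hcl : ∀ a ∈ G.neighborSet v, ∀ b ∈ G.neighborSet v, a ≠ b → G.Adj a b
    · obtain ⟨s, hs⟩ := hne
      have := hG.five_le_of_indep v (I := {s}) (by simpa using hs) (by simp) ⟨s, rfl⟩
      rw [Set.ncard_sdiff (by simpa using hs), Set.ncard_singleton] at this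
      exact hG.noVee (vee_of_clique_nbhd (by omega) hcl)
    · push Not at hcl
      obtain ⟨a, ha, b, hb, hab, hn⟩ := hcl
      have hsub : ({a, b} : Set V) ⊆ G.neighborSet v := by
        rintro x (rfl | rfl) <;> assumption
      have := hG.five_le_of_indep v hsub (by
        rintro y (rfl | rfl) z (rfl | rfl)
        · exact G.irrefl
        · exact hn
        · exact fun h => hn h.symm
        · exact G.irrefl) ⟨a, Or.inl rfl⟩
      rw [Set.ncard_sdiff hsub, Set.ncard_pair hab] at this
      omega
  · obtain ⟨c, hc⟩ := hG.delete v
    exact hG.extend_color v hc 0 fun x hx => absurd ⟨x, hx⟩ hne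

theorem no_indep_triple (hG : MinCE G) {v a b c : V} (h7 : (G.neighborSet v).ncard = 7)
    (ha : G.Adj v a) (hb : G.Adj v b) (hc : G.Adj v c) (hab : a ≠ b) (hac : a ≠ c) (hbc : b ≠ c)
    (nab : ¬ G.Adj a b) (nac : ¬ G.Adj a c) (nbc : ¬ G.Adj b c) : False := by
  have hsub : ({a, b, c} : Set V) ⊆ G.neighborSet v := by
    rintro x (rfl | rfl | rfl) <;> assumption
  have := hG.five_le_of_indep v hsub (by
    rintro y (rfl | rfl | rfl) z (rfl | rfl | rfl) <;>
      first | exact G.irrefl | assumption | (intro h; exact absurd h.symm (by assumption)))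
    ⟨a, Or.inl rfl⟩
  rw [Set.ncard_sdiff hsub, Set.ncard_insert_of_notMem (by simp [hab, hac]),
    Set.ncard_pair hbc] at this
  omega

end MinCE

/-- Local structure around a vertex `v` of degree `7` in a minimal counterexample, where `K` is a
clique of size `4` in the neighbourhood of `v`, `T` is the rest of the neighbourhood, and `U` is
the complement of `insert v K`. -/
structure CliqueNbhd (G : SimpleGraph V) (v : V) (K U T : Set V) : Prop where
  v_notMem : v ∉ K
  K_card : K.ncard = 4
  U_eq : U = (insert v K)ᶜ
  T_sub : T ⊆ U
  T_card : T.ncard = 3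
  adj_v : ∀ u ∈ U, G.Adj u v ↔ u ∈ T
  many : ∀ q ∈ K, ∀ a b, ∃ x ∈ U, x ≠ a ∧ x ≠ b ∧ G.Adj x q
  vee : ∀ X Y, X ⊆ U → Y ⊆ U → Conn G X → Conn G Y → Disjoint X Y → Touch G X Y →
    (∀ q ∈ insert v K, Sees G Y q) → ∀ x ∈ insert v K, ∀ y ∈ insert v K, ∀ z ∈ insert v K,
    x ≠ y → x ≠ z → y ≠ z → Sees G X x → Sees G X y → Sees G X z → False
  conn_U : Conn G U
  conn_diff : ∀ u ∈ U, Conn G (U \ {u})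
  four_nb : ∀ C, Conn G C → C ∪ nb G C ≠ Set.univ → 4 ≤ (nb G C).ncard

variable {v : V} {K U T : Set V}

theorem exists_half_coloring (hG : MinCE G) {Q D E : Set V} {u p : V}
    (hQ : Q.ncard = 5) (hcl : ∀ a ∈ Q, ∀ b ∈ Q, a ≠ b → G.Adj a b) (hE : Conn G (insert u E))
    (hEQ : Disjoint E Q) (huQ : u ∉ Q) (hDE : Disjoint D E) (hDQ : Disjoint D Q)
    (huD : u ∉ D) (hp : p ∈ Q)
    (hpE : Sees G (insert u E) p) (hpD : ¬ Sees G (insert u D) p) :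
    ∃ f : V → Fin 6, (∀ x y, x ∈ D ∪ insert u Q → y ∈ D ∪ insert u Q → G.Adj x y → f x ≠ f y) ∧
      ∀ x y, x ∈ insert u Q → y ∈ insert u Q → f x = f y → x = y := by
  classical
  have hpu : p ≠ u := fun e => huQ (e ▸ hp)
  have hpE' : p ∉ insert u E := by
    rintro (h | h)
    · exact hpu h
    · exact Set.disjoint_left.1 hEQ h hp
  obtain ⟨y, hy, hyp⟩ := hpE
  have hZ : Conn G (insert p (insert u E)) := hE.insert_adj hy hyp
  have h2 : 2 ≤ (insert p (insert u E)).ncard := by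
    rw [Set.ncard_insert_of_notMem hpE']
    have := (Set.ncard_pos (Set.toFinite _)).2 hE.nonempty
    omega
  obtain ⟨c, c1, c2⟩ := hG.contract _ hZ h2
  have hcu : c p = c u := c1 p (Or.inl rfl) u (Or.inr (Or.inl rfl))
  have hQZ : ∀ q ∈ Q, q ∈ insert p (insert u E) → q = p := by
    rintro q hq (h | h | h)
    · exact h
    · exact absurd (h ▸ hq) huQ
    · exact absurd hq (Set.disjoint_left.1 hEQ h)
  have hDZ : ∀ d ∈ D, d ∉ insert p (insert u E) := by
    rintro d hd (h | h | h)
    · exact Set.disjoint_left.1 hDQ hd (h ▸ hp)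
    · exact huD (h ▸ hd)
    · exact Set.disjoint_left.1 hDE hd h
  have hcQ : ∀ a ∈ Q, ∀ b ∈ Q, a ≠ b → c a ≠ c b := fun a ha b hb hab =>
    c2 a b (hcl a ha b hb hab) fun h => hab ((hQZ a ha h.1).trans (hQZ b hb h.2).symm)
  obtain ⟨i, hi⟩ : ∃ i, i ∉ c '' Q := by
    by_contra! hall
    have h1 := Set.ncard_image_le (f := c) (Set.toFinite Q)
    rw [Set.eq_univ_of_forall hall, Set.ncard_univ, Nat.card_fin] at h1
    omega
  have hi' : ∀ q ∈ Q, c q ≠ i := fun q hq e => hi ⟨q, hq, e⟩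
  have hiu : c u ≠ i := hcu ▸ hi' p hp
  have hcase : ∀ x, x ∈ D ∪ insert u Q → x = p ∨ (x ∈ insert u D ∨ x ∈ Q ∧ x ≠ p) := by
    rintro x (h | h | h)
    · exact Or.inr (Or.inl (Or.inr h))
    · exact Or.inr (Or.inl (Or.inl h))
    · by_cases hx : x = p
      · exact Or.inl hx
      · exact Or.inr (Or.inr ⟨h, hx⟩)
  refine ⟨fun x => if x = p then i else c x, ?_, ?_⟩
  · have key : ∀ x y, x ∈ D ∪ insert u Q → y ∈ D ∪ insert u Q → G.Adj x y → x ≠ p → y = p →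
        c x ≠ i := by
      intro x y hx hy hxy hxp hyp
      rcases (hcase x hx).resolve_left hxp with h | h
      · exact absurd ⟨x, h, hyp ▸ hxy⟩ hpD
      · exact hi' x h.1
    intro x y hx hy hxy
    by_cases hxp : x = p <;> by_cases hyp : y = p
    · exact absurd (hxp.trans hyp.symm) hxy.ne
    · simp only [hxp, hyp, if_true, if_false]
      exact (key y x hy hx hxy.symm hyp hxp).symm
    · simp only [hxp, hyp, if_true, if_false]
      exact key x y hx hy hxy hxp hyp
    · simp only [hxp, hyp, if_false]
      refine c2 x y hxy fun ⟨h1, h2⟩ => ?_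
      have h3 : ∀ x, x ∈ D ∪ insert u Q → x ∈ insert p (insert u E) → x ≠ p → x = u := by
        rintro x (h | h | h) hx hxp
        · exact absurd hx (hDZ x h)
        · exact h
        · exact absurd (hQZ x h hx) hxp
      exact hxy.ne ((h3 x hx h1 hxp).trans (h3 y hy h2 hyp).symm)
  · have h4 : ∀ q ∈ Q, q ≠ p → c q ≠ c u := fun q hq hqp => hcu ▸ hcQ q hq p hp hqp
    intro x y hx hy
    by_cases hxp : x = p <;> by_cases hyp : y = p
    · exact fun _ => hxp.trans hyp.symm
    · simp only [hxp, hyp, if_true, if_false]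
      rcases hy with rfl | hy
      · exact fun h => absurd h.symm hiu
      · exact fun h => absurd h.symm (hi' y hy)
    · simp only [hxp, hyp, if_true, if_false]
      rcases hx with rfl | hx
      · exact fun h => absurd h hiu
      · exact fun h => absurd h (hi' x hx)
    · simp only [hxp, hyp, if_false]
      rcases hx with rfl | hx <;> rcases hy with rfl | hy
      · simp
      · exact fun h => absurd h.symm (h4 y hy hyp)
      · exact fun h => absurd h (h4 x hx hxp)
      · exact fun h => by_contra fun hne => hcQ x hx y hy hne h

theorem MinCE.cliqueNbhd (hG : MinCE G) (h7 : (G.neighborSet v).ncard = 7)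
    (hK : K ⊆ G.neighborSet v) (hK4 : K.ncard = 4)
    (hcl : ∀ a ∈ K, ∀ b ∈ K, a ≠ b → G.Adj a b) :
    CliqueNbhd G v K (insert v K)ᶜ (G.neighborSet v \ K) := by
  have hvK : v ∉ K := fun h => G.irrefl (hK h : G.Adj v v)
  set Q := insert v K with hQdef
  have hQ5 : Q.ncard = 5 := by rw [hQdef, Set.ncard_insert_of_notMem hvK, hK4]
  have hQcl : ∀ a ∈ Q, ∀ b ∈ Q, a ≠ b → G.Adj a b := by
    rintro a (rfl | ha) b (rfl | hb) hab
    · exact absurd rfl hab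
    · exact hK hb
    · exact (hK ha : G.Adj _ _).symm
    · exact hcl a ha b hb hab
  have hT3 : (G.neighborSet v \ K).ncard = 3 := by rw [Set.ncard_sdiff hK]; omega
  have hTU : G.neighborSet v \ K ⊆ Qᶜ := by
    rintro x ⟨hx, hxK⟩ (rfl | h)
    · exact G.irrefl hx
    · exact hxK h
  have hmanyQ : ∀ q ∈ Q, ∀ a b, ∃ x ∈ Qᶜ, x ≠ a ∧ x ≠ b ∧ G.Adj x q := by
    intro q hq a b
    by_contra! hno
    have hsub : G.neighborSet q ⊆ (Q \ {q}) ∪ {a, b} := by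
      intro x hx
      by_contra hx'
      simp only [Set.mem_union, Set.mem_sdiff, Set.mem_singleton_iff, Set.mem_insert_iff,
        not_or, not_and, not_not] at hx'
      have hxQ : x ∉ Q := fun h => G.irrefl (hx'.1 h ▸ hx : G.Adj q q)
      exact hno x hxQ hx'.2.1 hx'.2.2 (SimpleGraph.Adj.symm hx)
    have h1 := Set.ncard_le_ncard hsub (Set.toFinite _)
    have h2 := Set.ncard_union_le (Q \ {q}) {a, b}
    have h3 : ({a, b} : Set V).ncard ≤ 2 := by
      have := Set.ncard_insert_le a {b}
      rwa [Set.ncard_singleton] at this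
    have h4 : (Q \ {q}).ncard = 4 := by
      rw [Set.ncard_sdiff (by simpa using hq), Set.ncard_singleton, hQ5]
    have := hG.seven_le_degree q
    omega
  have hvee : ∀ X Y, X ⊆ Qᶜ → Y ⊆ Qᶜ → Conn G X → Conn G Y → Disjoint X Y → Touch G X Y →
      (∀ q ∈ Q, Sees G Y q) → ∀ a ∈ Q, ∀ b ∈ Q, (∀ q ∈ Q, q ≠ a → q ≠ b → Sees G X q) → False :=
    fun X Y hX hY cX cY hXY ht hYs a ha b hb hXs => hG.noVee (vee_of_five_clique hQ5 hQcl cX cY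
      hXY ht (Set.disjoint_left.2 fun x hx => hX hx) (Set.disjoint_left.2 fun x hx => hY hx)
      hYs ha hb hXs)
  have hvee3 : ∀ X Y, X ⊆ Qᶜ → Y ⊆ Qᶜ → Conn G X → Conn G Y → Disjoint X Y → Touch G X Y →
      (∀ q ∈ Q, Sees G Y q) → 3 ≤ {q ∈ Q | Sees G X q}.ncard → False := by
    intro X Y hX hY cX cY hXY ht hYs h3
    have h1 : {q ∈ Q | ¬ Sees G X q}.ncard ≤ 2 := by
      have h2 : {q ∈ Q | ¬ Sees G X q} = Q \ {q ∈ Q | Sees G X q} := by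
        ext q; simp only [Set.mem_ofPred_eq, Set.mem_sdiff]; tauto
      rw [h2, Set.ncard_sdiff (Set.sep_subset _ _)]
      omega
    obtain ⟨a, ha, b, hb, hab⟩ : ∃ a ∈ Q, ∃ b ∈ Q, {q ∈ Q | ¬ Sees G X q} ⊆ {a, b} := by
      have hv : v ∈ Q := Or.inl rfl
      rcases Nat.lt_or_ge {q ∈ Q | ¬ Sees G X q}.ncard 2 with h | h
      · rcases (Set.ncard_le_one_iff_eq (Set.toFinite _)).1 (by omega :
          {q ∈ Q | ¬ Sees G X q}.ncard ≤ 1) with h | ⟨a, h⟩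
        · exact ⟨v, hv, v, hv, by simp [h]⟩
        · have ha : a ∈ {q ∈ Q | ¬ Sees G X q} := h ▸ rfl
          exact ⟨a, ha.1, a, ha.1, by simp [h]⟩
      · obtain ⟨a, b, hab, h⟩ := Set.ncard_eq_two.1 (le_antisymm h1 h)
        have ha : a ∈ {q ∈ Q | ¬ Sees G X q} := h ▸ Or.inl rfl
        have hb : b ∈ {q ∈ Q | ¬ Sees G X q} := h ▸ Or.inr rfl
        exact ⟨a, ha.1, b, hb.1, h.le⟩
    refine hvee X Y hX hY cX cY hXY ht hYs a ha b hb fun q hq hqa hqb => ?_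
    by_contra hs
    rcases hab (⟨hq, hs⟩ : q ∈ {q ∈ Q | ¬ Sees G X q}) with h | h
    · exact hqa h
    · exact hqb h
  have hUne : (Qᶜ).Nonempty := by
    have : (G.neighborSet v \ K).Nonempty := (Set.ncard_pos (Set.toFinite _)).1 (by omega)
    exact this.mono hTU
  have hU : Conn G Qᶜ := by
    obtain ⟨x, hx⟩ := hUne
    obtain ⟨C, hxC, hC⟩ := exists_isComp G hx
    have hCU : C = Qᶜ := by
      by_contra hne
      obtain ⟨y, hy, hyC⟩ := Set.exists_of_ssubset (hC.subset.ssubset_of_ne hne)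
      have hnb : nb G C ⊆ Q := by have := hC.nb_subset; rwa [compl_compl] at this
      refine hG.not_clique_or_small_cut hC.conn (fun h => ?_)
        (Or.inl fun a ha b hb => hQcl a (hnb ha) b (hnb hb))
      have : y ∈ C ∪ nb G C := h ▸ trivial
      exact this.elim hyC fun h => hy (hnb h)
    exact hCU ▸ hC.conn
  have hconn : ∀ u ∈ Qᶜ, Conn G (Qᶜ \ {u}) := by
    intro u hu
    by_contra hnc
    have hne : (Qᶜ \ {u}).Nonempty := by
      obtain ⟨x, hx, hxu, -, -⟩ := hmanyQ v (Or.inl rfl) u u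
      exact ⟨x, hx, hxu⟩
    obtain ⟨x, hx⟩ := hne
    obtain ⟨C, hxC, hC⟩ := exists_isComp G hx
    obtain ⟨y, hy, hyC⟩ : ∃ y ∈ Qᶜ \ {u}, y ∉ C := by
      by_contra! h
      exact hnc (by rw [show Qᶜ \ {u} = C from Set.Subset.antisymm h hC.subset]; exact hC.conn)
    -- two sides at the cut vertex `u`
    set D := (Qᶜ \ {u}) \ C with hD
    have hDu : insert u D = Qᶜ \ C := by
      ext z
      simp only [hD, Set.mem_insert_iff, Set.mem_sdiff, Set.mem_singleton_iff]
      constructor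
      · rintro (rfl | h)
        · exact ⟨hu, fun h => (hC.subset h).2 rfl⟩
        · exact ⟨h.1.1, h.2⟩
      · intro h
        by_cases hz : z = u
        · exact Or.inl hz
        · exact Or.inr ⟨⟨h.1, hz⟩, h.2⟩
    have hDc : Conn G (insert u D) := by
      rw [hDu]
      exact hU.diff_comp (conn_singleton u) (by simpa using hu) hC
    obtain ⟨c0, hc0, hc0u⟩ := hU.adj_comp hu hC
    have hCc : Conn G (insert u C) := hC.conn.insert_adj hc0 hc0u
    have hQsub : ∀ {A : Set V}, A ⊆ Qᶜ → Disjoint A Q := fun h => Set.disjoint_left.2 fun x hx => h hx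
    have hCU : C ⊆ Qᶜ := hC.subset.trans Set.sdiff_subset
    have hDU : D ⊆ Qᶜ := Set.sdiff_subset.trans Set.sdiff_subset
    have huC : u ∉ C := fun h => (hC.subset h).2 rfl
    have huD : u ∉ D := fun h => h.1.2 rfl
    -- any component at `u` sees three of the five labels
    have hlab : ∀ X, IsComp G (Qᶜ \ {u}) X → X ≠ Qᶜ \ {u} → 3 ≤ {q ∈ Q | Sees G X q}.ncard := by
      intro X hX hXne
      have hnb := hX.nb_subset
      have hne : X ∪ nb G X ≠ Set.univ := by
        obtain ⟨z, hz, hzX⟩ := Set.exists_of_ssubset (hX.subset.ssubset_of_ne hXne)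
        intro h
        have : z ∈ X ∪ nb G X := h ▸ trivial
        exact this.elim hzX fun h => hnb h hz
      have h4 := hG.four_le_nb hX.conn hne
      have hsub : nb G X ⊆ insert u {q ∈ Q | Sees G X q} := by
        intro z hz
        have := hnb hz
        by_cases hzu : z = u
        · exact Or.inl hzu
        · refine Or.inr ⟨by_contra fun h => this ⟨h, hzu⟩, ?_⟩
          obtain ⟨_, a, ha, haz⟩ := hz
          exact ⟨a, ha, haz⟩
      have h5 := Set.ncard_le_ncard hsub (Set.toFinite _)
      have h6 := Set.ncard_insert_le u {q ∈ Q | Sees G X q}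
      omega
    have hCne : C ≠ Qᶜ \ {u} := fun h => hyC (h ▸ hy)
    obtain ⟨E, hyE, hE⟩ := exists_isComp G hy
    have hED : E ⊆ D := fun z hz => ⟨hE.subset hz, fun hzC => hyC (hC.subset_of_conn hE.conn
      hE.subset ⟨z, hz, hzC⟩ hyE)⟩
    have hEne : E ≠ Qᶜ \ {u} := fun h => (hED (h ▸ hC.subset hxC)).2 hxC
    obtain ⟨e0, he0, he0u⟩ := hU.adj_comp hu hE
    have hCuU : insert u C ⊆ Qᶜ := Set.insert_subset hu hCU
    have hDuU : insert u D ⊆ Qᶜ := Set.insert_subset hu hDU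
    have hCDd : Disjoint C D := Set.disjoint_left.2 fun z hz hz' => hz'.2 hz
    have hCmiss : ∃ p ∈ Q, ¬ Sees G (insert u C) p := by
      by_contra! hall
      refine hvee3 E (insert u C) (hED.trans hDU) hCuU hE.conn hCc ?_
        ⟨e0, he0, u, Or.inl rfl, he0u⟩ hall (hlab E hE hEne)
      refine Set.disjoint_left.2 fun z hz hz' => ?_
      rcases hz' with rfl | hz'
      · exact huD (hED hz)
      · exact (hED hz).2 hz'
    have hDmiss : ∃ p ∈ Q, ¬ Sees G (insert u D) p := by
      by_contra! hall
      refine hvee3 C (insert u D) hCU hDuU hC.conn hDc ?_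
        ⟨c0, hc0, u, Or.inl rfl, hc0u⟩ hall (hlab C hC hCne)
      refine Set.disjoint_left.2 fun z hz hz' => ?_
      rcases hz' with rfl | hz'
      · exact huC hz
      · exact hz'.2 hz
    have hone : ∀ p ∈ Q, Sees G (insert u C) p ∨ Sees G (insert u D) p := by
      intro p hp
      obtain ⟨x, hx, hxu, -, hxp⟩ := hmanyQ p hp u u
      by_cases hxC : x ∈ C
      · exact Or.inl ⟨x, Or.inr hxC, hxp⟩
      · exact Or.inr ⟨x, Or.inr ⟨⟨hx, hxu⟩, hxC⟩, hxp⟩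
    obtain ⟨p, hp, hpC⟩ := hCmiss
    obtain ⟨p', hp', hpD⟩ := hDmiss
    obtain ⟨f, hf1, hf2⟩ := exists_half_coloring hG hQ5 hQcl hDc (hQsub hDU) hu hCDd (hQsub hCU) huC
      hp ((hone p hp).resolve_left hpC) hpC
    obtain ⟨g, hg1, hg2⟩ := exists_half_coloring hG hQ5 hQcl hCc (hQsub hCU) hu hCDd.symm
      (hQsub hDU) huD hp' ((hone p' hp').resolve_right hpD) hpD
    have hcov : ∀ z, z ∈ C ∨ z ∈ D ∨ z ∈ insert u Q := by
      intro z
      by_cases h1 : z ∈ insert u Q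
      · exact Or.inr (Or.inr h1)
      · by_cases h2 : z ∈ C
        · exact Or.inl h2
        · exact Or.inr (Or.inl ⟨⟨fun h => h1 (Or.inr h), fun h => h1 (Or.inl h)⟩, h2⟩)
    refine hG.notCol (glue_coloring (A := C ∪ insert u Q) (B := D ∪ insert u Q) ?_ ?_ hf1 hg1 ?_)
    · refine Set.eq_univ_of_forall fun z => ?_
      rcases hcov z with h | h | h
      · exact Or.inl (Or.inl h)
      · exact Or.inr (Or.inl h)
      · exact Or.inl (Or.inr h)
    · have hno : ∀ a ∈ C, ∀ b ∈ D, ¬ G.Adj a b := fun a ha b hb hab =>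
        hb.2 (hC.closed a ha b hb.1 hab)
      intro a b hab
      rcases hcov a with ha | ha | ha <;> rcases hcov b with hb | hb | hb
      · exact Or.inl ⟨Or.inl ha, Or.inl hb⟩
      · exact absurd hab (hno a ha b hb)
      · exact Or.inl ⟨Or.inl ha, Or.inr hb⟩
      · exact absurd hab.symm (hno b hb a ha)
      · exact Or.inr ⟨Or.inl ha, Or.inl hb⟩
      · exact Or.inr ⟨Or.inl ha, Or.inr hb⟩
      · exact Or.inl ⟨Or.inr ha, Or.inl hb⟩
      · exact Or.inr ⟨Or.inr ha, Or.inl hb⟩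
      · exact Or.inl ⟨Or.inr ha, Or.inr hb⟩
    · have h_int : ∀ z, z ∈ (C ∪ insert u Q) ∩ (D ∪ insert u Q) → z ∈ insert u Q := by
        rintro z ⟨h1 | h1, h2 | h2⟩
        · exact absurd h1 h2.2
        all_goals assumption
      intro a b ha hb
      exact ⟨fun h => by rw [hf2 a b (h_int a ha) (h_int b hb) h],
        fun h => by rw [hg2 a b (h_int a ha) (h_int b hb) h]⟩
  refine ⟨hvK, hK4, rfl, hTU, hT3, fun u hu => ⟨fun h => ⟨h.symm, fun h' => hu (Or.inr h')⟩,
    fun h => SimpleGraph.Adj.symm h.1⟩, fun q hq => hmanyQ q (Or.inr hq), ?_, hU, hconn,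
    fun C hC hne => hG.four_le_nb hC hne⟩
  intro X Y hX hY cX cY hXY ht hYs x hx y hy z hz hxy hxz hyz h1 h2 h3
  refine hvee3 X Y hX hY cX cY hXY ht hYs ?_
  have : ({x, y, z} : Set V).ncard = 3 := by
    rw [Set.ncard_insert_of_notMem (by simp [hxy, hxz]), Set.ncard_pair hyz]
  rw [← this]
  refine Set.ncard_le_ncard ?_ (Set.toFinite _)
  rintro w (rfl | rfl | rfl)
  · exact ⟨hx, h1⟩
  · exact ⟨hy, h2⟩
  · exact ⟨hz, h3⟩

end Degree

section CliqueCase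

variable {V : Type} {G : SimpleGraph V} {v p : V} {K U T X : Set V}

theorem IsSeparation.inter_nonempty {A B S : Set V} (h : IsSeparation G A B) (hS : Conn G S)
    (hA : (S ∩ A).Nonempty) (hB : (S ∩ B).Nonempty) : (S ∩ (A ∩ B)).Nonempty := by
  by_contra hno
  rw [Set.not_nonempty_iff_eq_empty] at hno
  have hno' : ∀ x ∈ S, x ∈ A → x ∉ B := fun x hx hxA hxB => by
    have : x ∈ S ∩ (A ∩ B) := ⟨hx, hxA, hxB⟩
    rw [hno] at this; exact this
  have hcov : ∀ x, x ∈ A ∨ x ∈ B := fun x => by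
    have : x ∈ A ∪ B := h.1 ▸ trivial
    exact this
  have hSA : S ⊆ A := hS.subset_of_closed hA fun u hu w hw huA huw => by
    by_contra hwA
    exact h.2 huw ⟨⟨huA, hno' u hu huA⟩, (hcov w).resolve_left hwA, hwA⟩
  obtain ⟨b, hb, hbB⟩ := hB
  exact hno' b hb (hSA hb) hbB

/-- A split of `U` into two connected parts `X` and `U \ X`, both meeting `T`. -/
structure Split (G : SimpleGraph V) (U T X : Set V) : Prop where
  sub : X ⊆ U
  conn : Conn G X
  conn' : Conn G (U \ X)
  meets : (X ∩ T).Nonempty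
  meets' : ((U \ X) ∩ T).Nonempty

/-- A split in which `X` sees exactly `p` in `K` while `U \ X` sees all of `K`. -/
structure GoodSplit (G : SimpleGraph V) (K U T X : Set V) (p : V) : Prop extends
    Split G U T X where
  mem : p ∈ K
  sees : Sees G X p
  only : ∀ q ∈ K, Sees G X q → q = p
  all : ∀ q ∈ K, Sees G (U \ X) q

namespace CliqueNbhd

theorem mem_K_ne (h : CliqueNbhd G v K U T) {q : V} (hq : q ∈ K) : v ≠ q :=
  fun e => h.v_notMem (e ▸ hq)

theorem sees_v (h : CliqueNbhd G v K U T) (hX : (X ∩ T).Nonempty) : Sees G X v := by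
  obtain ⟨t, ht, htT⟩ := hX
  exact ⟨t, ht, (h.adj_v t (h.T_sub htT)).2 htT⟩

theorem exists_T_ne (h : CliqueNbhd G v K U T) (u : V) : ∃ t ∈ T, t ≠ u := by
  by_contra! hc
  have := Set.ncard_le_ncard (show T ⊆ {u} from hc) (Set.toFinite _)
  rw [h.T_card, Set.ncard_singleton] at this
  omega

theorem no_three (h : CliqueNbhd G v K U T) {u x y z : V} (hu : u ∈ U) (hx : x ∈ insert v K)
    (hy : y ∈ insert v K) (hz : z ∈ insert v K) (hxy : x ≠ y) (hxz : x ≠ z) (hyz : y ≠ z)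
    (ux : G.Adj u x) (uy : G.Adj u y) (uz : G.Adj u z) : False := by
  have hD := h.conn_diff u hu
  have hne : U ≠ {u} := by
    intro e
    obtain ⟨a, ha, hau⟩ := hD.nonempty
    exact hau (e ▸ ha)
  obtain ⟨a, ha, b, hb, hab⟩ := h.conn_U.exists_adj (A := {u}) (by simpa using hu) ⟨u, rfl⟩ hne.symm
  refine h.vee {u} (U \ {u}) (by simpa using hu) Set.sdiff_subset (conn_singleton u) hD
    (Set.disjoint_left.2 fun x hx hx' => hx'.2 hx) ⟨a, ha, b, hb, hab⟩ ?_ x hx y hy z hz hxy hxz hyz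
    ⟨u, rfl, ux⟩ ⟨u, rfl, uy⟩ ⟨u, rfl, uz⟩
  rintro q (rfl | hq)
  · obtain ⟨t, ht, htu⟩ := h.exists_T_ne u
    exact h.sees_v ⟨t, ⟨h.T_sub ht, htu⟩, ht⟩
  · obtain ⟨w, hw, hwu, -, hwq⟩ := h.many q hq u u
    exact ⟨w, ⟨hw, hwu⟩, hwq⟩

theorem label_unique (h : CliqueNbhd G v K U T) (hX : Split G U T X)
    (hall : ∀ q ∈ K, Sees G (U \ X) q) {p q : V} (hp : p ∈ K) (hq : q ∈ K) (sp : Sees G X p)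
    (sq : Sees G X q) : q = p := by
  by_contra hne
  have hXU : X ≠ U := fun e => by
    obtain ⟨y, hy, -⟩ := hX.meets'
    exact hy.2 (e ▸ hy.1)
  obtain ⟨a, ha, b, hb, hab⟩ := h.conn_U.exists_adj hX.sub hX.conn.nonempty hXU
  refine h.vee X (U \ X) hX.sub Set.sdiff_subset hX.conn hX.conn'
    (Set.disjoint_left.2 fun x hx hx' => hx'.2 hx) ⟨a, ha, b, hb, hab⟩ ?_
    v (Or.inl rfl) p (Or.inr hp) q (Or.inr hq) (h.mem_K_ne hp) (h.mem_K_ne hq) (Ne.symm hne)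
    (h.sees_v hX.meets) sp sq
  rintro q (rfl | hq)
  · exact h.sees_v hX.meets'
  · exact hall q hq

theorem goodSplit_of (h : CliqueNbhd G v K U T) (hX : Split G U T X)
    (hall : ∀ q ∈ K, Sees G (U \ X) q) (hp : p ∈ K) (sp : Sees G X p) : GoodSplit G K U T X p :=
  ⟨hX, hp, sp, fun _ hq sq => h.label_unique hX hall hp hq sp sq, hall⟩

theorem exists_goodSplit [Finite V] (h : CliqueNbhd G v K U T) : ∃ X p, GoodSplit G K U T X p := by
  by_cases hlab : ∃ t ∈ T, ∃ p ∈ K, G.Adj t p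
  · obtain ⟨t, ht, p, hp, htp⟩ := hlab
    obtain ⟨t', ht', hne⟩ := h.exists_T_ne t
    refine ⟨{t}, p, h.goodSplit_of ⟨by simpa using h.T_sub ht, conn_singleton t,
      h.conn_diff t (h.T_sub ht), ⟨t, rfl, ht⟩, ⟨t', ⟨h.T_sub ht', hne⟩, ht'⟩⟩ ?_ hp ⟨t, rfl, htp⟩⟩
    intro q hq
    obtain ⟨x, hx, hxt, -, hxq⟩ := h.many q hq t t
    exact ⟨x, ⟨hx, hxt⟩, hxq⟩
  push Not at hlab
  have hK : K.Nonempty := (Set.ncard_pos (Set.toFinite _)).1 (by rw [h.K_card]; omega)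
  obtain ⟨q0, hq0⟩ := hK
  obtain ⟨t, ht, -⟩ := h.exists_T_ne v
  obtain ⟨t', ht', hne⟩ := h.exists_T_ne t
  have htU := h.T_sub ht
  have hUt : U \ (U \ {t}) = {t} := by
    rw [Set.sdiff_sdiff_right_self, Set.inter_eq_right.2 (by simpa using htU)]
  obtain ⟨X, hX⟩ := Set.Finite.exists_minimalFor (fun X : Set V => X.ncard)
    {X | Split G U T X ∧ ∃ q ∈ K, ¬ Sees G (U \ X) q} (Set.toFinite _)
    ⟨U \ {t}, ⟨Set.sdiff_subset, h.conn_diff t htU, by rw [hUt]; exact conn_singleton t,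
      ⟨t', ⟨h.T_sub ht', hne⟩, ht'⟩, by rw [hUt]; exact ⟨t, rfl, ht⟩⟩, q0, hq0, by
        rw [hUt]; rintro ⟨_, rfl, h'⟩; exact hlab _ ht q0 hq0 h'⟩
  obtain ⟨⟨hS, p, hp, hpY⟩, hmin⟩ := hX
  obtain ⟨r, hrX, hrT⟩ := hS.meets
  have hXr : X ≠ {r} := by
    rintro rfl
    obtain ⟨x, hx, hxr, -, hxp⟩ := h.many p hp r r
    exact hpY ⟨x, ⟨hx, hxr⟩, hxp⟩
  obtain ⟨x, hx, hxr, ⟨y, hy, hyx⟩, hxc⟩ := exists_removable_ne h.conn_diff hS.sub hS.conn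
    hS.conn'.nonempty hrX hXr
  have hcompl : U \ (X \ {x}) = insert x (U \ X) := by
    ext z
    have := hS.sub hx
    simp only [Set.mem_sdiff, Set.mem_singleton_iff, Set.mem_insert_iff, not_and, not_not]
    constructor
    · rintro ⟨h1, h2⟩
      by_cases hz : z = x
      · exact Or.inl hz
      · exact Or.inr ⟨h1, fun h => hz (h2 h)⟩
    · rintro (rfl | h1)
      · exact ⟨this, fun _ => rfl⟩
      · exact ⟨h1.1, fun h => absurd h h1.2⟩
  have hS' : Split G U T (X \ {x}) := by
    refine ⟨Set.sdiff_subset.trans hS.sub, hxc, ?_, ⟨r, ⟨hrX, hxr.symm⟩, hrT⟩, ?_⟩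
    · rw [hcompl]; exact hS.conn'.insert_adj hy hyx
    · rw [hcompl]; exact hS.meets'.mono (Set.inter_subset_inter_left _ (Set.subset_insert _ _))
  refine ⟨X \ {x}, p, h.goodSplit_of hS' ?_ hp ?_⟩
  · by_contra! hno
    have h1 := Set.ncard_sdiff_singleton_lt_of_mem hx (Set.toFinite _)
    have h2 := hmin (j := X \ {x}) ⟨hS', hno⟩ h1.le
    simp only at h2
    omega
  · obtain ⟨z, hz, hzx, -, hzp⟩ := h.many p hp x x
    exact ⟨z, ⟨by_contra fun hzX => hpY ⟨z, ⟨hz, hzX⟩, hzp⟩, hzx⟩, hzp⟩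

/-- In a maximal good split, `U \ X` has a unique neighbour `y` of `p`, meets `T` in one vertex
`t`, stays connected without `t`, and `y` belongs to each part hanging off a single vertex. -/
theorem exists_max_goodSplit [Finite V] (h : CliqueNbhd G v K U T)
    (htri : ∀ a ∈ T, ∀ b ∈ T, a ≠ b → G.Adj a b) :
    ∃ X p y t, GoodSplit G K U T X p ∧ y ∈ U \ X ∧ G.Adj y p ∧
      (∀ z ∈ U \ X, G.Adj z p → z = y) ∧ y ≠ t ∧ t ∈ U \ X ∧ (∀ z ∈ T, z ∈ U \ X ↔ z = t) ∧
      Conn G ((U \ X) \ {t}) ∧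
      ∀ J ⊆ U \ X, ∀ z ∈ U \ X, z ∉ J → t ∉ J → J.Nonempty →
        (∀ u ∈ J, ∀ w ∈ U \ X, G.Adj u w → w ∈ J ∨ w = z) → Conn G ((U \ X) \ J) → y ∈ J := by
  obtain ⟨X0, p0, h0⟩ := h.exists_goodSplit
  obtain ⟨X, hX⟩ := Set.Finite.exists_maximalFor (fun X : Set V => X.ncard)
    {X | ∃ p, GoodSplit G K U T X p} (Set.toFinite _) ⟨X0, p0, h0⟩
  obtain ⟨⟨p, hS⟩, hmax⟩ := hX
  have hYU : U \ X ⊆ U := Set.sdiff_subset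
  have hUY : U \ (U \ X) = X := by
    rw [Set.sdiff_sdiff_right_self, Set.inter_eq_right.2 hS.sub]
  have M1 : ∀ y ∈ U \ X, Sees G X y → Conn G ((U \ X) \ {y}) → (((U \ X) \ {y}) ∩ T).Nonempty →
      ∀ z ∈ U \ X, G.Adj z p → z = y := by
    rintro y hy ⟨x, hx, hxy⟩ hc hT
    have hcompl : U \ insert y X = (U \ X) \ {y} := by
      ext z
      simp only [Set.mem_sdiff, Set.mem_insert_iff, Set.mem_singleton_iff, not_or]
      tauto
    have hS' : Split G U T (insert y X) := by
      refine ⟨Set.insert_subset hy.1 hS.sub, hS.conn.insert_adj hx hxy, by rwa [hcompl],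
        hS.meets.mono (Set.inter_subset_inter_left _ (Set.subset_insert _ _)), by rwa [hcompl]⟩
    have hno : ∃ q ∈ K, ¬ Sees G ((U \ X) \ {y}) q := by
      by_contra! hall
      have hG' := h.goodSplit_of hS' (by rwa [hcompl]) hS.mem (hS.sees.mono (Set.subset_insert _ _))
      have h1 := hmax (j := insert y X) ⟨p, hG'⟩
      simp only [Set.ncard_insert_of_notMem hy.2] at h1
      have := h1 (by omega)
      omega
    obtain ⟨q, hq, hqs⟩ := hno
    obtain ⟨z, hz, hzy, -, hzq⟩ := h.many q hq y y
    have hzX : z ∈ X := by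
      by_contra hzX
      exact hqs ⟨z, ⟨⟨hz, hzX⟩, hzy⟩, hzq⟩
    obtain rfl := hS.only q hq ⟨z, hzX, hzq⟩
    intro w hw hwq
    by_contra hwy
    exact hqs ⟨w, ⟨hw, hwy⟩, hwq⟩
  obtain ⟨r, hrY, hrT⟩ := hS.meets'
  obtain ⟨y, hy, hyp⟩ := hS.all p hS.mem
  -- anything removable, other than the last vertex of `T`, is the neighbour of `p`
  have M2 : ∀ r ∈ (U \ X) ∩ T, ∀ J ⊆ U \ X, ∀ z ∈ U \ X, z ∉ J → r ∉ J → J.Nonempty →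
      (∀ u ∈ J, ∀ w ∈ U \ X, G.Adj u w → w ∈ J ∨ w = z) → Conn G ((U \ X) \ J) →
      y ∈ J ∧ ∀ z ∈ U \ X, G.Adj z p → z = y := by
    intro r hr J hJ z hz hzJ hrJ hne hcl hc
    obtain ⟨y', hy', hs, hc'⟩ := exists_removable h.conn_diff hYU hS.conn'
      (by rw [hUY]; exact hS.conn.nonempty) hz hJ hzJ hne hcl hc
    rw [hUY] at hs
    have h1 := M1 y' (hJ hy') hs hc' ⟨r, ⟨hr.1, fun e => hrJ (e ▸ hy')⟩, hr.2⟩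
    obtain rfl := h1 y hy hyp
    exact ⟨hy', h1⟩
  have hYne : ∀ r, U \ X ≠ {r} := by
    intro r e
    have hr : r ∈ U := hYU (e ▸ rfl)
    obtain ⟨a, b, c, ha, hb, hc, hab, hac, hbc⟩ := (Set.two_lt_ncard_iff (Set.toFinite K)).1
      (by rw [h.K_card]; omega)
    have hs : ∀ q ∈ K, G.Adj r q := by
      intro q hq
      obtain ⟨x, hx, hxq⟩ := hS.all q hq
      rw [e] at hx
      exact hx ▸ hxq
    exact h.no_three hr (Or.inr ha) (Or.inr hb) (Or.inr hc) hab hac hbc (hs a ha) (hs b hb) (hs c hc)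
  have M3 : ∀ r ∈ (U \ X) ∩ T, y ≠ r ∧ Conn G ((U \ X) \ {r}) ∧
      ∀ z ∈ U \ X, G.Adj z p → z = y := by
    intro r hr
    have hrs : ({r} : Set V) ⊆ U \ X := by simpa using hr.1
    have hJ : ∀ J, IsComp G ((U \ X) \ {r}) J → y ∈ J ∧ ∀ z ∈ U \ X, G.Adj z p → z = y :=
      fun J hJ => M2 r hr J (hJ.subset.trans Set.sdiff_subset) r hr.1 (fun h => (hJ.subset h).2 rfl)
        (fun h => (hJ.subset h).2 rfl) hJ.conn.nonempty
        (fun u hu w hw huw => or_iff_not_imp_right.2 fun hwr => hJ.closed u hu w ⟨hw, hwr⟩ huw)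
        (hS.conn'.diff_comp (conn_singleton r) hrs hJ)
    have hne : ((U \ X) \ {r}).Nonempty := by
      by_contra hno
      rw [Set.not_nonempty_iff_eq_empty, Set.sdiff_eq_empty] at hno
      exact hYne r (hno.antisymm hrs)
    obtain ⟨x, hx⟩ := hne
    obtain ⟨J, hxJ, hJc⟩ := exists_isComp G hx
    obtain ⟨hyJ, huniq⟩ := hJ J hJc
    refine ⟨(hJc.subset hyJ).2, ?_, huniq⟩
    have : (U \ X) \ {r} = J := by
      refine Set.Subset.antisymm (fun z hz => ?_) hJc.subset
      obtain ⟨J', hzJ', hJ'⟩ := exists_isComp G hz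
      exact hJc.subset_of_conn hJ'.conn hJ'.subset ⟨y, (hJ J' hJ').1, hyJ⟩ hzJ'
    exact this ▸ hJc.conn
  obtain ⟨hyr, hcr, huniq⟩ := M3 r ⟨hrY, hrT⟩
  refine ⟨X, p, y, r, hS, hy, hyp, huniq, hyr, hrY, fun z hz => ⟨fun hzY => ?_, ?_⟩, hcr,
    fun J hJ z hz hzJ hrJ hne hcl hc => (M2 r ⟨hrY, hrT⟩ J hJ z hz hzJ hrJ hne hcl hc).1⟩
  · by_contra hzr
    obtain ⟨t, htX, htT⟩ := hS.meets
    have := M1 r hrY ⟨t, htX, htri t htT r hrT fun e => hrY.2 (e ▸ htX)⟩ hcr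
      ⟨z, ⟨hzY, hzr⟩, hz⟩ y hy hyp
    exact hyr this
  · rintro rfl
    exact hrY

end CliqueNbhd

end CliqueCase

section CliqueCase

variable {V : Type} {G : SimpleGraph V} {v p : V} {K U T X : Set V}

/-- The graph induced on `R`, with the set `Z` attached as the single vertex `y`. -/
def attach (G : SimpleGraph V) (R : Set V) (y : V) (Z : Set V) : SimpleGraph V :=
  SimpleGraph.fromRel fun a b => (G.Adj a b ∧ a ∈ R ∧ b ∈ R) ∨ (b = y ∧ a ∈ R ∧ Sees G Z a)

theorem attach_adj {R Z : Set V} {y : V} (hy : y ∉ R) {a b : V} : (attach G R y Z).Adj a b ↔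
    (G.Adj a b ∧ a ∈ R ∧ b ∈ R) ∨ (b = y ∧ a ∈ R ∧ Sees G Z a) ∨ (a = y ∧ b ∈ R ∧ Sees G Z b) := by
  simp only [attach, SimpleGraph.fromRel_adj]
  constructor
  · rintro ⟨-, (⟨h1, h2, h3⟩ | h) | (⟨h1, h2, h3⟩ | h)⟩
    · exact Or.inl ⟨h1, h2, h3⟩
    · exact Or.inr (Or.inl h)
    · exact Or.inl ⟨h1.symm, h3, h2⟩
    · exact Or.inr (Or.inr h)
  · rintro (h | h | h)
    · exact ⟨h.1.ne, Or.inl (Or.inl h)⟩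
    · exact ⟨fun e => hy (h.1 ▸ e ▸ h.2.1), Or.inl (Or.inr h)⟩
    · exact ⟨fun e => hy (h.1 ▸ e ▸ h.2.1), Or.inr (Or.inr h)⟩

namespace CliqueNbhd

/-- The final configuration: `R ⊇ T` and `Z` partition `U`. -/
theorem exists_split_right [Finite V] (h : CliqueNbhd G v K U T)
    (htri : ∀ a ∈ T, ∀ b ∈ T, a ≠ b → G.Adj a b) :
    ∃ X p y t P w a, GoodSplit G K U T X p ∧ y ∈ U \ X ∧ (∀ z ∈ T, z ∈ U \ X ↔ z = t) ∧
      P ⊆ U \ X ∧ w ∈ U \ X ∧ w ∉ P ∧ y ∉ insert w P ∧ t ∈ insert w P ∧ Conn G (insert w P) ∧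
      Conn G ((U \ X) \ insert w P) ∧ (∀ q ∈ K, ¬ Sees G P q) ∧ a ∈ K ∧ a ≠ p ∧ G.Adj w a ∧
      ∀ q ∈ K, Sees G ((U \ X) \ insert w P) q := by
  obtain ⟨X, p, y, t, hS, hy, hyp, huniq, hyt, htY, hTY, hct, hrem⟩ := h.exists_max_goodSplit htri
  have htT : t ∈ T := by
    obtain ⟨r, hr, hrT⟩ := hS.meets'
    exact (hTY r hrT).1 hr ▸ hrT
  -- it suffices to find `P` and `w`
  suffices ∃ P w, P ⊆ U \ X ∧ w ∈ U \ X ∧ w ∉ P ∧ w ≠ y ∧ t ∈ insert w P ∧ Conn G (insert w P) ∧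
      Conn G ((U \ X) \ insert w P) ∧ (∀ q ∈ K, ¬ Sees G P q) ∧ ∃ a ∈ K, G.Adj w a by
    obtain ⟨P, w, hP, hw, hwP, hwy, ht, hc, hc', hno, a, ha, hwa⟩ := this
    have hyP : y ∉ insert w P := by
      rintro (e | h')
      · exact hwy e.symm
      · exact hno p hS.mem ⟨y, h', hyp⟩
    refine ⟨X, p, y, t, P, w, a, hS, hy, hTY, hP, hw, hwP, hyP, ht, hc, hc', hno, ha, ?_, hwa, ?_⟩
    · rintro rfl
      exact hwy (huniq w hw hwa)
    · intro q hq
      by_cases hqp : q = p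
      · exact hqp ▸ ⟨y, ⟨hy, hyP⟩, hyp⟩
      · obtain ⟨z, hz, hzw, -, hzq⟩ := h.many q hq w w
        refine ⟨z, ⟨⟨hz, fun hzX => hqp (hS.only q hq ⟨z, hzX, hzq⟩)⟩, ?_⟩, hzq⟩
        rintro (e | h')
        · exact hzw e
        · exact hno q hq ⟨z, h', hzq⟩
  by_cases hta : ∃ a ∈ K, G.Adj t a
  · refine ⟨∅, t, Set.empty_subset _, htY, Set.notMem_empty _, hyt.symm, Or.inl rfl, ?_, ?_, ?_, hta⟩
    · simpa using conn_singleton t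
    · simpa using hct
    · rintro q - ⟨x, hx, -⟩
      exact hx
  push Not at hta
  obtain ⟨P, hP⟩ := Set.Finite.exists_maximalFor (fun P : Set V => P.ncard)
    {P | P ⊆ U \ X ∧ t ∈ P ∧ Conn G P ∧ Conn G ((U \ X) \ P) ∧ ∀ q ∈ K, ¬ Sees G P q}
    (Set.toFinite _) ⟨{t}, by simpa using htY, rfl, conn_singleton t, hct, by
      rintro q hq ⟨_, rfl, h'⟩; exact hta q hq h'⟩
  obtain ⟨⟨hPY, htP, hPc, hHc, hno⟩, hmax⟩ := hP
  have hyP : y ∉ P := fun h' => hno p hS.mem ⟨y, h', hyp⟩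
  obtain ⟨w0, hw0, hw0y, hw0P⟩ : ∃ w ∈ (U \ X) \ P, w ≠ y ∧ Sees G P w := by
    by_contra! hcon
    have hPne : P ≠ U \ X := fun e => by
      obtain ⟨z, hz⟩ := hHc.nonempty
      exact hz.2 (e ▸ hz.1)
    obtain ⟨a, ha, b, hb, hab⟩ := hS.conn'.exists_adj hPY hPc.nonempty hPne
    have hby : b = y := by_contra fun hby => hcon b hb hby ⟨a, ha, hab⟩
    subst hby
    have hJne : (((U \ X) \ P) \ {b}).Nonempty := by
      by_contra hno'
      rw [Set.not_nonempty_iff_eq_empty, Set.sdiff_eq_empty] at hno'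
      obtain ⟨q1, q2, q3, h1, h2, h3, h12, h13, h23⟩ := (Set.two_lt_ncard_iff (Set.toFinite K)).1
        (by rw [h.K_card]; omega)
      have hs : ∀ q ∈ K, G.Adj b q := by
        intro q hq
        obtain ⟨x, hx, hxq⟩ := hS.all q hq
        have hxP : x ∉ P := fun hxP => hno q hq ⟨x, hxP, hxq⟩
        have : x = b := hno' ⟨hx, hxP⟩
        exact this ▸ hxq
      exact h.no_three hy.1 (Or.inr h1) (Or.inr h2) (Or.inr h3) h12 h13 h23 (hs _ h1) (hs _ h2)
        (hs _ h3)
    have := hrem (((U \ X) \ P) \ {b}) (Set.sdiff_subset.trans Set.sdiff_subset) b hy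
      (fun h' => h'.2 rfl) (fun h' => h'.1.2 htP) hJne (fun u hu w hw huw => by
        by_cases hwb : w = b
        · exact Or.inr hwb
        · refine Or.inl ⟨⟨hw, fun hwP => ?_⟩, hwb⟩
          exact hcon u hu.1 hu.2 ⟨w, hwP, huw.symm⟩) (by
        have e : (U \ X) \ (((U \ X) \ P) \ {b}) = insert b P := by
          ext z
          have hPz := @hPY z
          simp only [Set.mem_sdiff, Set.mem_singleton_iff, Set.mem_insert_iff] at hy hPz ⊢
          by_cases hz : z = b
          · subst hz; simp [hy]
          · simp only [hz, not_false_eq_true, and_true, false_or]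
            tauto
        rw [e]
        exact hPc.insert_adj ha hab)
    exact this.2 rfl
  obtain ⟨C0, hyC0, hC0⟩ := exists_isComp G (S := ((U \ X) \ P) \ {w0}) (x := y)
    ⟨⟨hy, hyP⟩, hw0y.symm⟩
  obtain ⟨⟨w, C⟩, hwC⟩ := Set.Finite.exists_maximalFor (fun x : V × Set V => x.2.ncard)
    {x | x.1 ∈ (U \ X) \ P ∧ x.1 ≠ y ∧ Sees G P x.1 ∧ IsComp G (((U \ X) \ P) \ {x.1}) x.2 ∧
      y ∈ x.2} (Set.toFinite _) ⟨(w0, C0), hw0, hw0y, hw0P, hC0, hyC0⟩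
  obtain ⟨⟨hw, hwy, ⟨x, hx, hxw⟩, hC, hyC⟩, hmaxC⟩ := hwC
  simp only at hw hwy hxw hC hyC
  have hHw : ((U \ X) \ P) \ {w} = C := by
    by_contra hne
    obtain ⟨j, hj, hjC⟩ := Set.exists_of_ssubset (hC.subset.ssubset_of_ne (Ne.symm hne))
    obtain ⟨J, hjJ, hJ⟩ := exists_isComp G hj
    have hJC : ∀ z ∈ J, z ∉ C := fun z hz hzC => hjC (hC.subset_of_conn hJ.conn hJ.subset
      ⟨z, hz, hzC⟩ hjJ)
    by_cases hJP : ∃ w' ∈ J, Sees G P w'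
    · obtain ⟨w', hw'J, hw'P⟩ := hJP
      have hw'H := hJ.subset hw'J
      have hw'y : w' ≠ y := fun e => hJC w' hw'J (e ▸ hyC)
      obtain ⟨C', hyC', hC'⟩ := exists_isComp G (S := ((U \ X) \ P) \ {w'}) (x := y)
        ⟨⟨hy, hyP⟩, hw'y.symm⟩
      obtain ⟨c, hc, hcw⟩ := hHc.adj_comp hw hC
      have hsub : insert w C ⊆ C' := hC'.subset_of_conn (hC.conn.insert_adj hc hcw) (by
        rintro z (rfl | hz)
        · exact ⟨hw, fun e => hw'H.2 e.symm⟩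
        · exact ⟨(hC.subset hz).1, fun e => hJC w' hw'J (e ▸ hz)⟩) ⟨y, Or.inr hyC, hyC'⟩
      have h1 := Set.ncard_le_ncard hsub (Set.toFinite _)
      rw [Set.ncard_insert_of_notMem fun hwC => (hC.subset hwC).2 rfl] at h1
      have h2 := hmaxC (j := (w', C')) ⟨hw'H.1, hw'y, hw'P, hC', hyC'⟩
      simp only at h2
      have := h2 (by omega)
      omega
    · push Not at hJP
      have hJY : J ⊆ U \ X := hJ.subset.trans (Set.sdiff_subset.trans Set.sdiff_subset)
      refine hJC y (hrem J hJY w hw.1 (fun h' => (hJ.subset h').2 rfl)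
        (fun h' => (hJ.subset h').1.2 htP) hJ.conn.nonempty (fun u hu z hz huz => ?_) ?_) hyC
      · refine or_iff_not_imp_right.2 fun hzw => hJ.closed u hu z ⟨⟨hz, fun hzP => ?_⟩, hzw⟩ huz
        exact hJP u hu ⟨z, hzP, huz.symm⟩
      · have hd := hHc.diff_comp (conn_singleton w) (by simpa using hw) hJ
        have hwd : w ∈ ((U \ X) \ P) \ J := ⟨hw, fun h' => (hJ.subset h').2 rfl⟩
        have := hPc.union hd ⟨x, hx, w, hwd, hxw⟩
        rwa [show P ∪ ((U \ X) \ P) \ J = (U \ X) \ J from ?_] at this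
        ext z
        simp only [Set.mem_union, Set.mem_sdiff]
        constructor
        · rintro (hz | hz)
          · exact ⟨hPY hz, fun hzJ => (hJ.subset hzJ).1.2 hz⟩
          · exact ⟨hz.1.1, hz.2⟩
        · rintro ⟨h1, h2⟩
          by_cases hz : z ∈ P
          · exact Or.inl hz
          · exact Or.inr ⟨⟨h1, hz⟩, h2⟩
  have hZ : (U \ X) \ insert w P = C := by
    rw [← hHw]
    ext z
    simp only [Set.mem_sdiff, Set.mem_insert_iff, Set.mem_singleton_iff]
    tauto
  have hcw := hPc.insert_adj hx hxw
  refine ⟨P, w, hPY, hw.1, hw.2, hwy, Or.inr htP, hcw, hZ ▸ hC.conn, hno, ?_⟩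
  by_contra! hwa
  have h1 := hmax (j := insert w P) ⟨Set.insert_subset hw.1 hPY, Or.inr htP, hcw, hZ ▸ hC.conn, by
    rintro q hq ⟨z, rfl | hz, hzq⟩
    · exact hwa q hq hzq
    · exact hno q hq ⟨z, hz, hzq⟩⟩
  simp only [Set.ncard_insert_of_notMem hw.2] at h1
  have := h1 (by omega)
  omega

theorem false_of_triangle [Finite V] (h : CliqueNbhd G v K U T)
    (htri : ∀ a ∈ T, ∀ b ∈ T, a ≠ b → G.Adj a b) : False := by
  obtain ⟨X, p, y, t, P, w, a, hS, hy, hTY, hPY, hw, hwP, hyP, ht, hRc, hZc, hno, ha, hap, hwa,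
    hZs⟩ := h.exists_split_right htri
  set Z := (U \ X) \ insert w P with hZdef
  have hyZ : y ∈ Z := ⟨hy, hyP⟩
  have hyw : y ≠ w := fun e => hyP (Or.inl e)
  set R := X ∪ insert w P with hR
  have hRU : R ⊆ U := Set.union_subset hS.sub
    (Set.insert_subset hw.1 (hPY.trans Set.sdiff_subset))
  have hUK : ∀ {z}, z ∈ U → z ∉ K := fun hz hzK => by
    rw [h.U_eq] at hz; exact hz (Or.inr hzK)
  have hpU : p ∉ U := fun h' => hUK h' hS.mem
  have hpR : p ∉ R := fun h' => hpU (hRU h')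
  have hyR : y ∉ R := fun h' => h'.elim (fun h' => hy.2 h') hyP
  have hyp : y ≠ p := fun e => hpU (e ▸ hy.1)
  have hwp : w ≠ p := fun e => hpU (e ▸ hw.1)
  have hyR' : y ∉ insert p R := fun h' => h'.elim hyp hyR
  have hTR : T ⊆ R := by
    intro z hz
    by_cases hzX : z ∈ X
    · exact Or.inl hzX
    · exact Or.inr ((hTY z hz).1 ⟨h.T_sub hz, hzX⟩ ▸ ht)
  have hRZ : ∀ z ∈ R, z ∉ Z := by
    rintro z (hz | hz) hzZ
    · exact hzZ.1.2 hz
    · exact hzZ.2 hz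
  have htri' : ∀ b ∈ T, ∀ c ∈ T, b ≠ c → G.Adj b c := htri
  set A' := attach G (insert p R) y Z with hA'
  have hadj : ∀ {b c}, A'.Adj b c ↔ _ := attach_adj hyR'
  have hsupp : ∀ M, Conn A' M → (M ∩ R).Nonempty → p ∉ M → y ∉ M → M ⊆ R := by
    intro M hM hne hpM hyM
    refine hM.subset_of_closed hne fun b hb c hc _ hbc => ?_
    rcases hadj.1 hbc with h1 | h1 | h1
    · exact h1.2.2.resolve_left fun e => hpM (e ▸ hc)
    · exact absurd (h1.1 ▸ hc) hyM
    · exact absurd (h1.1 ▸ hb) hyM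
  have hGconn : ∀ M, Conn A' M → y ∉ M → Conn G M := by
    intro M hM hyM
    refine hM.mono_graph fun b hb c hc hbc => ?_
    rcases hadj.1 hbc with h1 | h1 | h1
    · exact h1.1
    · exact absurd (h1.1 ▸ hc) hyM
    · exact absurd (h1.1 ▸ hb) hyM
  have hAconn : ∀ M, Conn G M → M ⊆ insert p R → Conn A' M := fun M hM hMR =>
    hM.mono_graph fun b hb c hc hbc => hadj.2 (Or.inl ⟨hbc, hMR hb, hMR hc⟩)
  have hW3 : ({w, p, y} : Set V).ncard = 3 := by
    rw [Set.ncard_insert_of_notMem (by simp [hwp, hyw.symm]), Set.ncard_pair hyp.symm]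
  obtain ⟨M0, hM0⟩ : ∃ P : Fin 3 → Set V, Linkage A' T {w, p, y} P := by
    refine menger 3 A' T {w, p, y} fun A B hsep hTA hWB => ?_
    by_contra hlt
    have hcov : ∀ x, x ∈ A ∨ x ∈ B := fun x => by
      have : x ∈ A ∪ B := hsep.1 ▸ trivial
      exact this
    have hwB : w ∈ B := hWB (Or.inl rfl)
    have hpB : p ∈ B := hWB (Or.inr (Or.inl rfl))
    have hyB : y ∈ B := hWB (Or.inr (Or.inr rfl))
    by_cases hyA : y ∈ A
    · obtain ⟨b, hb, hbAB⟩ := hsep.inter_nonempty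
        (hAconn _ hRc (Set.subset_union_right.trans (Set.subset_insert _ _)))
        ⟨t, ht, hTA ((hTY t (by
          obtain ⟨r, hr, hrT⟩ := hS.meets'
          exact (hTY r hrT).1 hr ▸ hrT)).2 rfl |> fun _ => by
            obtain ⟨r, hr, hrT⟩ := hS.meets'
            exact (hTY r hrT).1 hr ▸ hrT)⟩ ⟨w, Or.inl rfl, hwB⟩
      obtain ⟨x, hx, hxp⟩ := hS.sees
      obtain ⟨r, hrX, hrT⟩ := hS.meets
      obtain ⟨c, hc, hcAB⟩ := hsep.inter_nonempty
        (hAconn _ (hS.conn.insert_adj hx hxp) (Set.insert_subset_insert Set.subset_union_left))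
        ⟨r, Or.inr hrX, hTA hrT⟩ ⟨p, Or.inl rfl, hpB⟩
      have hbR : b ∈ R := Or.inr hb
      have hbc : b ≠ c := by
        rintro rfl
        rcases hc with e | hc
        · exact hpR (e ▸ hbR)
        · rcases hb with e | hb
          · exact hw.2 (e ▸ hc)
          · exact (hPY hb).2 hc
      have hby : b ≠ y := fun e => hyR (e ▸ hbR)
      have hcy : c ≠ y := by
        rintro rfl
        exact hc.elim hyp fun h' => hy.2 h'
      have h3 : ({b, c, y} : Set V).ncard = 3 := by
        rw [Set.ncard_insert_of_notMem (by simp [hbc, hby]), Set.ncard_pair hcy]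
      have := Set.ncard_le_ncard (show ({b, c, y} : Set V) ⊆ A ∩ B by
        rintro z (rfl | rfl | rfl)
        · exact hbAB
        · exact hcAB
        · exact ⟨hyA, hyB⟩) (Set.toFinite _)
      omega
    · obtain ⟨s, hsT, hsB⟩ : ∃ s ∈ T, s ∉ B := by
        by_contra! hTB
        have := Set.ncard_le_ncard (show T ⊆ A ∩ B from fun z hz => ⟨hTA hz, hTB z hz⟩)
          (Set.toFinite _)
        rw [h.T_card] at this
        omega
      obtain ⟨O, hsO, hO⟩ := exists_isComp A' (S := A \ B) (x := s) ⟨hTA hsT, hsB⟩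
      have hOB : ∀ z ∈ O, z ∉ B := fun z hz => (hO.subset hz).2
      have hOR : O ⊆ R := hsupp O hO.conn ⟨s, hsO, hTR hsT⟩ (fun h' => hOB p h' hpB)
        (fun h' => hOB y h' hyB)
      have hOA : ∀ b ∈ O, ∀ c, c ∉ O → A'.Adj b c → c ∈ A ∩ B := by
        intro b hb c hc hbc
        have hcA : c ∈ A := by
          by_contra hcA
          exact hsep.2 hbc ⟨hO.subset hb, (hcov c).resolve_left hcA, hcA⟩
        exact ⟨hcA, by_contra fun hcB => hc (hO.closed b hb c ⟨hcA, hcB⟩ hbc)⟩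
      have hnb : nb G O ⊆ insert v (A ∩ B) := by
        rintro z ⟨hzO, b, hb, hbz⟩
        have hbR := hOR hb
        by_cases hzR : z ∈ insert p R
        · exact Or.inr (hOA b hb z hzO (hadj.2 (Or.inl ⟨hbz, Or.inr hbR, hzR⟩)))
        by_cases hzv : z = v
        · exact Or.inl hzv
        exfalso
        by_cases hzK : z ∈ K
        · have hzp : z ≠ p := fun e => hzR (Or.inl e)
          rcases hbR with hbX | rfl | hbP
          · exact hzp (hS.only z hzK ⟨b, hbX, hbz⟩)
          · exact hOB _ hb hwB
          · exact hno z hzK ⟨b, hbP, hbz⟩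
        · have hzU : z ∈ U := by
            rw [h.U_eq]
            rintro (e | e)
            · exact hzv e
            · exact hzK e
          have hzZ : z ∈ Z := ⟨⟨hzU, fun h' => hzR (Or.inr (Or.inl h'))⟩,
            fun h' => hzR (Or.inr (Or.inr h'))⟩
          exact hyA (hOA b hb y (fun h' => hOB y h' hyB)
            (hadj.2 (Or.inr (Or.inl ⟨rfl, Or.inr hbR, z, hzZ, hbz.symm⟩)))).1
      have h4 := h.four_nb O (hGconn O hO.conn fun h' => hOB y h' hyB) fun e => by
        have : y ∈ O ∪ nb G O := e ▸ trivial
        rcases this with h' | h'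
        · exact hOB y h' hyB
        · rcases hnb h' with e | h'
          · have := hy.1
            rw [h.U_eq] at this
            exact this (Or.inl e)
          · exact hyA h'.1
      have h5 := Set.ncard_le_ncard hnb (Set.toFinite _)
      have h6 := Set.ncard_insert_le v (A ∩ B)
      omega
  obtain ⟨M, hM, hMT⟩ := hM0.reindex hW3
  have hself : ∀ s : ({w, p, y} : Set V), ∀ z ∈ ({w, p, y} : Set V), z ∈ M s ↔ z = s := by
    intro s z hz
    constructor
    · intro hzs
      have : z ∈ M s ∩ {w, p, y} := ⟨hzs, hz⟩
      rwa [hMT] at this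
    · rintro rfl
      have : (s : V) ∈ M s ∩ {w, p, y} := by rw [hMT]; rfl
      exact this.1
  have mw : w ∈ ({w, p, y} : Set V) := Or.inl rfl
  have mp : p ∈ ({w, p, y} : Set V) := Or.inr (Or.inl rfl)
  have my : y ∈ ({w, p, y} : Set V) := Or.inr (Or.inr rfl)
  have hdis : ∀ (s s' : ({w, p, y} : Set V)), (s : V) ≠ s' → ∀ z ∈ M s, z ∉ M s' :=
    fun s s' hne z hz hz' => Set.disjoint_left.1 (hM.disj s s' fun e => hne (e ▸ rfl)) hz hz'
  obtain ⟨tw, htw, htwT⟩ := hM.left ⟨w, mw⟩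
  obtain ⟨tp, htp, htpT⟩ := hM.left ⟨p, mp⟩
  obtain ⟨ty, hty, htyT⟩ := hM.left ⟨y, my⟩
  have hMwR : M ⟨w, mw⟩ ⊆ R := hsupp _ (hM.conn _) ⟨tw, htw, hTR htwT⟩
    (fun h' => hwp ((hself ⟨w, mw⟩ p mp).1 h').symm) (fun h' => hyw ((hself ⟨w, mw⟩ y my).1 h'))
  have hMwc : Conn G (M ⟨w, mw⟩) := hGconn _ (hM.conn _) fun h' => hyR (hMwR h')
  have hpMp : p ∈ M ⟨p, mp⟩ := (hself ⟨p, mp⟩ p mp).2 rfl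
  have hyMy : y ∈ M ⟨y, my⟩ := (hself ⟨y, my⟩ y my).2 rfl
  obtain ⟨N1, htpN, hN1⟩ := exists_isComp A' (S := M ⟨p, mp⟩ \ {p}) (x := tp)
    ⟨htp, fun e => hpR (e ▸ hTR htpT)⟩
  have hN1M : N1 ⊆ M ⟨p, mp⟩ := hN1.subset.trans Set.sdiff_subset
  have hyN1 : y ∉ N1 := fun h' => hyp ((hself ⟨p, mp⟩ y my).1 (hN1M h'))
  have hN1R : N1 ⊆ R := hsupp _ hN1.conn ⟨tp, htpN, hTR htpT⟩ (fun h' => (hN1.subset h').2 rfl) hyN1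
  obtain ⟨u1, hu1, hu1p⟩ := (hM.conn _).adj_comp hpMp hN1
  have hu1p' : G.Adj u1 p := by
    rcases hadj.1 hu1p with h1 | h1 | h1
    · exact h1.1
    · exact absurd h1.1.symm hyp
    · exact absurd (h1.1 ▸ hu1) hyN1
  obtain ⟨N2, htyN, hN2⟩ := exists_isComp A' (S := M ⟨y, my⟩ \ {y}) (x := ty)
    ⟨hty, fun e => hyR (e ▸ hTR htyT)⟩
  have hN2M : N2 ⊆ M ⟨y, my⟩ := hN2.subset.trans Set.sdiff_subset
  have hyN2 : y ∉ N2 := fun h' => (hN2.subset h').2 rfl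
  have hN2R : N2 ⊆ R := hsupp _ hN2.conn ⟨ty, htyN, hTR htyT⟩
    (fun h' => hyp ((hself ⟨y, my⟩ p mp).1 (hN2M h')).symm) hyN2
  obtain ⟨u2, hu2, hu2y⟩ := (hM.conn _).adj_comp hyMy hN2
  have hu2Z : Sees G Z u2 := by
    rcases hadj.1 hu2y with h1 | h1 | h1
    · exact absurd h1.2.2 hyR'
    · exact h1.2.2
    · exact absurd (h1.1 ▸ hu2) hyN2
  have hne_wp : tw ≠ tp := fun e => hdis ⟨w, mw⟩ ⟨p, mp⟩ hwp _ htw (e ▸ htp)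
  have hne_wy : tw ≠ ty := fun e => hdis ⟨w, mw⟩ ⟨y, my⟩ hyw.symm _ htw (e ▸ hty)
  obtain ⟨z2, hz2, hz2u⟩ := hu2Z
  have hX1 : Conn G (M ⟨w, mw⟩ ∪ N1) := hMwc.union (hGconn _ hN1.conn hyN1)
    ⟨tw, htw, tp, htpN, htri tw htwT tp htpT hne_wp⟩
  have hY1 : Conn G (N2 ∪ Z) := (hGconn _ hN2.conn hyN2).union hZc ⟨u2, hu2, z2, hz2, hz2u.symm⟩
  refine h.vee (M ⟨w, mw⟩ ∪ N1) (N2 ∪ Z) (Set.union_subset (hMwR.trans hRU) (hN1R.trans hRU))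
    (Set.union_subset (hN2R.trans hRU) (Set.sdiff_subset.trans Set.sdiff_subset)) hX1 hY1 ?_
    ⟨tw, Or.inl htw, ty, Or.inl htyN, htri tw htwT ty htyT hne_wy⟩ ?_ v (Or.inl rfl)
    a (Or.inr ha) p (Or.inr hS.mem) (h.mem_K_ne ha) (h.mem_K_ne hS.mem) hap
    (h.sees_v ⟨tw, Or.inl htw, htwT⟩)
    ⟨w, Or.inl ((hself ⟨w, mw⟩ w mw).2 rfl), hwa⟩ ⟨u1, Or.inr hu1, hu1p'⟩
  · rw [Set.disjoint_left]
    rintro z (hz | hz) (hz' | hz')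
    · exact hdis ⟨w, mw⟩ ⟨y, my⟩ hyw.symm _ hz (hN2M hz')
    · exact hRZ z (hMwR hz) hz'
    · exact hdis ⟨p, mp⟩ ⟨y, my⟩ hyp.symm _ (hN1M hz) (hN2M hz')
    · exact hRZ z (hN1R hz) hz'
  · rintro q (rfl | hq)
    · exact h.sees_v ⟨ty, Or.inl htyN, htyT⟩
    · exact (hZs q hq).mono Set.subset_union_right

end CliqueNbhd

/-- In a minimal counterexample, the neighbourhood of a vertex of degree `7` has no `4`-clique. -/
theorem MinCE.no_four_clique [Finite V] (hG : MinCE G) (h7 : (G.neighborSet v).ncard = 7)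
    (hK : K ⊆ G.neighborSet v) (hK4 : K.ncard = 4)
    (hcl : ∀ a ∈ K, ∀ b ∈ K, a ≠ b → G.Adj a b) : False := by
  have h := hG.cliqueNbhd h7 hK hK4 hcl
  refine h.false_of_triangle fun a ha b hb hab => ?_
  by_contra hnab
  obtain ⟨c, hc, hca, hcb⟩ : ∃ c ∈ K, ¬ G.Adj a c ∧ ¬ G.Adj b c := by
    by_contra! hcon
    have hone : ∀ t ∈ G.neighborSet v \ K, {q ∈ K | G.Adj t q}.ncard ≤ 1 := by
      intro t ht
      by_contra hlt
      obtain ⟨x, y, hx, hy, hxy⟩ := (Set.one_lt_ncard_iff (Set.toFinite _)).1 (not_le.1 hlt)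
      exact h.no_three (h.T_sub ht) (Or.inl rfl) (Or.inr hx.1) (Or.inr hy.1) (h.mem_K_ne hx.1)
        (h.mem_K_ne hy.1) hxy (SimpleGraph.Adj.symm ht.1) hx.2 hy.2
    have h1 := Set.ncard_le_ncard (show K ⊆ {q ∈ K | G.Adj a q} ∪ {q ∈ K | G.Adj b q} from
      fun q hq => by
        by_cases haq : G.Adj a q
        · exact Or.inl ⟨hq, haq⟩
        · exact Or.inr ⟨hq, hcon q hq haq⟩) (Set.toFinite _)
    have h2 := Set.ncard_union_le {q ∈ K | G.Adj a q} {q ∈ K | G.Adj b q}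
    have := hone a ha
    have := hone b hb
    omega
  exact hG.no_indep_triple h7 ha.1 hb.1 (hK hc) hab (fun e => ha.2 (e ▸ hc))
    (fun e => hb.2 (e ▸ hc)) hnab hca hcb

end CliqueCase

section SevenVertices

def pairBits (i j : ℕ) : ℕ := 2 ^ (7 * i + j) ||| 2 ^ (7 * j + i)

def bitAt (c i j : ℕ) : Bool := c.testBit (7 * i + j)

/-- The bit table `c` has four pairwise joined indices including `i` and `j`. -/
def hasClique (c i j : ℕ) : Bool :=
  (List.range 7).any fun a => bitAt c i a && bitAt c j a &&
    (List.range 7).any fun b => bitAt c i b && bitAt c j b && bitAt c a b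

def hasTriangle (d i j : ℕ) : Bool :=
  (List.range 7).any fun a => bitAt d i a && bitAt d j a

/-- Index `j` has a smaller neighbourhood code (among the indices `0, 1, 2`) than index `i`. -/
def codeDrop (c d i j : ℕ) : Bool :=
  (bitAt c 2 i && bitAt d 2 j) || ((bitAt c 2 i || bitAt d 2 j) &&
  ((bitAt c 1 i && bitAt d 1 j) || ((bitAt c 1 i || bitAt d 1 j) &&
    (bitAt c 0 i && bitAt d 0 j))))

/-- Search for a suitable pattern in a table `c` of edges and `d` of non-edges. -/
def hasPattern (c d : ℕ) : Bool :=
  (List.range 7).any fun x0 => (List.range 7).any fun x4 => bitAt d x0 x4 &&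
  (List.range 7).any fun x6 => bitAt c x0 x6 && bitAt c x4 x6 &&
  (List.range 7).any fun x5 => bitAt c x4 x5 && bitAt c x6 x5 &&
  (List.range 7).any fun x3 => bitAt c x4 x3 && bitAt c x5 x3 &&
  (List.range 7).any fun x1 => bitAt c x3 x1 && (bitAt c x0 x1 || bitAt c x6 x1) &&
  (List.range 7).any fun x2 => bitAt c x3 x2 && bitAt c x1 x2 &&
    (bitAt c x0 x2 || bitAt c x6 x2) && decide [x0, x1, x2, x3, x4, x5, x6].Nodup

def patternSearch : List (ℕ × ℕ) → ℕ → ℕ → Bool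
  | [], c, d => hasPattern c d
  | (i, j) :: l, c, d =>
    (hasClique (c ||| pairBits i j) i j || patternSearch l (c ||| pairBits i j) d) &&
    (hasTriangle (d ||| pairBits i j) i j || (decide (4 ≤ j) && decide (j < 7) &&
      codeDrop c (d ||| pairBits i j) (j - 1) j) || patternSearch l c (d ||| pairBits i j))

theorem patternSearch_eq : patternSearch [(2, 3), (1, 3), (0, 3), (2, 4), (1, 4), (0, 4), (3, 4),
    (2, 5), (1, 5), (0, 5), (3, 5), (4, 5), (2, 6), (1, 6), (0, 6), (3, 6), (4, 6), (5, 6)]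
    (pairBits 0 1 ||| pairBits 0 2 ||| pairBits 1 2) 0 = true := by
  decide +kernel

variable {R : ℕ → ℕ → Prop} {c d : ℕ}

theorem bitAt_or_pairBits {i j a b : ℕ} (hi : i < 7) (hj : j < 7) (_ : a < 7) (hb : b < 7)
    (h : bitAt (c ||| pairBits i j) a b = true) :
    bitAt c a b = true ∨ (a = i ∧ b = j) ∨ (a = j ∧ b = i) := by
  simp only [bitAt, pairBits, Nat.testBit_or, Nat.testBit_two_pow, Bool.or_eq_true,
    decide_eq_true_eq] at h ⊢
  rcases h with h | h | h
  · exact Or.inl h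
  · right; left; omega
  · right; right; omega

open Classical in
/-- The neighbourhood of `v` among `0, 1, 2`, as a binary number. -/
noncomputable def nbCode (R : ℕ → ℕ → Prop) (v : ℕ) : ℕ :=
  (if R 2 v then 4 else 0) + (if R 1 v then 2 else 0) + (if R 0 v then 1 else 0)

theorem nbCode_lt_of_codeDrop {i j : ℕ} (hc : ∀ k < 7, bitAt c k i = true → R k i)
    (hd : ∀ k < 7, bitAt d k j = true → ¬ R k j) (h : codeDrop c d i j = true) :
    nbCode R j < nbCode R i := by
  have h0 := hc 0 (by omega); have h1 := hc 1 (by omega); have h2 := hc 2 (by omega)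
  have g0 := hd 0 (by omega); have g1 := hd 1 (by omega); have g2 := hd 2 (by omega)
  simp only [codeDrop, Bool.or_eq_true, Bool.and_eq_true] at h
  replace h : (R 2 i ∧ ¬ R 2 j) ∨ ((R 2 i ∨ ¬ R 2 j) ∧
      ((R 1 i ∧ ¬ R 1 j) ∨ ((R 1 i ∨ ¬ R 1 j) ∧ (R 0 i ∧ ¬ R 0 j)))) := by tauto
  clear h0 h1 h2 g0 g1 g2 hc hd
  unfold nbCode
  split_ifs <;> first | omega | (exfalso; tauto)

/-- The pattern found by the search. -/
def Pattern (R : ℕ → ℕ → Prop) (x0 x1 x2 x3 x4 x5 x6 : ℕ) : Prop :=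
  ¬ R x0 x4 ∧ R x0 x6 ∧ R x4 x6 ∧ R x4 x5 ∧ R x6 x5 ∧ R x4 x3 ∧ R x5 x3 ∧ R x3 x1 ∧
    (R x0 x1 ∨ R x6 x1) ∧ R x3 x2 ∧ R x1 x2 ∧ (R x0 x2 ∨ R x6 x2) ∧
    [x0, x1, x2, x3, x4, x5, x6].Nodup ∧ ∀ x ∈ [x0, x1, x2, x3, x4, x5, x6], x < 7

theorem exists_pattern_of_search (hR : ∀ a b, R a b → R b a)
    (hK : ∀ a < 7, ∀ b < 7, ∀ x < 7, ∀ y < 7,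
      ¬ (R a b ∧ R a x ∧ R a y ∧ R b x ∧ R b y ∧ R x y))
    (hT : ∀ a < 7, ∀ b < 7, ∀ x < 7, a ≠ b → a ≠ x → b ≠ x → R a b ∨ R a x ∨ R b x)
    (hS : ∀ j, 4 ≤ j → j < 7 → nbCode R (j - 1) ≤ nbCode R j) (l : List (ℕ × ℕ))
    (hl : ∀ p ∈ l, p.1 < 7 ∧ p.2 < 7 ∧ p.1 ≠ p.2)
    (hc : ∀ a < 7, ∀ b < 7, bitAt c a b = true → R a b)
    (hd : ∀ a < 7, ∀ b < 7, bitAt d a b = true → a ≠ b ∧ ¬ R a b)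
    (h : patternSearch l c d = true) : ∃ x0 x1 x2 x3 x4 x5 x6, Pattern R x0 x1 x2 x3 x4 x5 x6 := by
  induction l generalizing c d with
  | nil =>
    simp only [patternSearch, hasPattern, List.any_eq_true, List.mem_range, Bool.and_eq_true,
      Bool.or_eq_true, decide_eq_true_eq] at h
    obtain ⟨x0, h0, x4, h4, a1, x6, h6, ⟨a2, a3⟩, x5, h5, ⟨a4, a5⟩, x3, h3, ⟨a6, a7⟩, x1, h1,
      ⟨a8, a9⟩, x2, h2, ⟨⟨a10, a11⟩, a12⟩, hn⟩ := h
    refine ⟨x0, x1, x2, x3, x4, x5, x6, (hd _ h0 _ h4 a1).2, hc _ h0 _ h6 a2, hc _ h4 _ h6 a3,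
      hc _ h4 _ h5 a4, hc _ h6 _ h5 a5, hc _ h4 _ h3 a6, hc _ h5 _ h3 a7, hc _ h3 _ h1 a8,
      a9.imp (hc _ h0 _ h1) (hc _ h6 _ h1), hc _ h3 _ h2 a10, hc _ h1 _ h2 a11,
      a12.imp (hc _ h0 _ h2) (hc _ h6 _ h2), hn, ?_⟩
    simp only [List.mem_cons, List.not_mem_nil, or_false]
    rintro x (rfl | rfl | rfl | rfl | rfl | rfl | rfl) <;> assumption
  | cons p l ih =>
    obtain ⟨i, j⟩ := p
    obtain ⟨hi, hj, hij⟩ := hl _ (List.mem_cons_self ..)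
    have hl' : ∀ p ∈ l, p.1 < 7 ∧ p.2 < 7 ∧ p.1 ≠ p.2 := fun p hp =>
      hl p (List.mem_cons_of_mem _ hp)
    simp only at hi hj hij
    simp only [patternSearch, Bool.and_eq_true, Bool.or_eq_true, decide_eq_true_eq] at h
    obtain ⟨h1, h2⟩ := h
    by_cases hr : R i j
    · have hc' : ∀ a < 7, ∀ b < 7, bitAt (c ||| pairBits i j) a b = true → R a b := by
        intro a ha b hb hab
        rcases bitAt_or_pairBits hi hj ha hb hab with h | ⟨rfl, rfl⟩ | ⟨rfl, rfl⟩
        · exact hc a ha b hb h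
        · exact hr
        · exact hR _ _ hr
      rcases h1 with h1 | h1
      · simp only [hasClique, List.any_eq_true, List.mem_range, Bool.and_eq_true] at h1
        obtain ⟨a, ha, ⟨b1, b2⟩, b, hb, ⟨b3, b4⟩, b5⟩ := h1
        exact absurd ⟨hr, hc' _ hi _ ha b1, hc' _ hi _ hb b3, hc' _ hj _ ha b2, hc' _ hj _ hb b4,
          hc' _ ha _ hb b5⟩ (hK i hi j hj a ha b hb)
      · exact ih hl' hc' hd h1
    · have hd' : ∀ a < 7, ∀ b < 7, bitAt (d ||| pairBits i j) a b = true → a ≠ b ∧ ¬ R a b := by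
        intro a ha b hb hab
        rcases bitAt_or_pairBits hi hj ha hb hab with h | ⟨rfl, rfl⟩ | ⟨rfl, rfl⟩
        · exact hd a ha b hb h
        · exact ⟨hij, hr⟩
        · exact ⟨hij.symm, fun h => hr (hR _ _ h)⟩
      rcases h2 with (h2 | ⟨⟨h4, h7⟩, h2⟩) | h2
      · simp only [hasTriangle, List.any_eq_true, List.mem_range, Bool.and_eq_true] at h2
        obtain ⟨a, ha, b1, b2⟩ := h2
        have e1 := hd' _ hi _ ha b1
        have e2 := hd' _ hj _ ha b2
        have := hT i hi j hj a ha hij e1.1 e2.1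
        tauto
      · have := nbCode_lt_of_codeDrop (R := R) (fun k hk => hc k hk (j - 1) (by omega))
          (fun k hk hb => (hd' k hk j hj hb).2) h2
        have := hS j h4 hj
        omega
      · exact ih hl' hc hd' h2

end SevenVertices

section Kempe

variable {V : Type} [Finite V] {G : SimpleGraph V} {v : V} {c : V → Fin 6}

/-- A Kempe chain joins any two neighbours of `v` whose colours occur only once around `v`. -/
theorem MinCE.exists_kempe (hG : MinCE G)
    (hc : ∀ x y, x ≠ v → y ≠ v → G.Adj x y → c x ≠ c y) {y z : V} (hy : G.Adj v y)
    (hyu : ∀ x, G.Adj v x → c x = c y → x = y) (hzu : ∀ x, G.Adj v x → c x = c z → x = z) :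
    ∃ K, Conn G K ∧ y ∈ K ∧ z ∈ K ∧ v ∉ K ∧ ∀ x ∈ K, c x = c y ∨ c x = c z := by
  classical
  obtain ⟨K, hyK, hK⟩ := exists_isComp G (S := {x | x ≠ v ∧ (c x = c y ∨ c x = c z)}) (x := y)
    ⟨hy.ne', Or.inl rfl⟩
  by_cases hzK : z ∈ K
  · exact ⟨K, hK.conn, hyK, hzK, fun h => (hK.subset h).1 rfl, fun x hx => (hK.subset hx).2⟩
  exfalso
  let s := Equiv.swap (c y) (c z)
  refine hG.extend_color v (c := fun x => if x ∈ K then s (c x) else c x) ?_ (c y) ?_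
  · intro a b ha hb hab
    have hout : ∀ a b, a ≠ v → b ≠ v → G.Adj a b → a ∈ K → b ∉ K → s (c a) ≠ c b := by
      intro a b ha hb hab haK hbK e
      refine hbK (hK.closed a haK b ⟨hb, ?_⟩ hab)
      rcases (hK.subset haK).2 with h | h
      · rw [h] at e; simp only [s, Equiv.swap_apply_left] at e; exact Or.inr e.symm
      · rw [h] at e; simp only [s, Equiv.swap_apply_right] at e; exact Or.inl e.symm
    by_cases haK : a ∈ K <;> by_cases hbK : b ∈ K <;> simp only [haK, hbK, if_true, if_false]
    · exact fun e => hc a b ha hb hab (s.injective e)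
    · exact hout a b ha hb hab haK hbK
    · exact (hout b a hb ha hab.symm hbK haK).symm
    · exact hc a b ha hb hab
  · intro x hx
    by_cases hxK : x ∈ K <;> simp only [hxK, if_true, if_false]
    · intro e
      have : c x = c z := by rw [← s.injective.eq_iff, e]; simp [s]
      exact hzK (hzu x hx this ▸ hxK)
    · exact fun e => hxK (hyu x hx e ▸ hyK)

/-- Part of a Kempe chain from `y` to `z`, namely a connected set containing `y` and touching
`z`. -/
theorem MinCE.exists_kempe_part (hG : MinCE G)
    (hc : ∀ x y, x ≠ v → y ≠ v → G.Adj x y → c x ≠ c y) {y z : V} (hy : G.Adj v y)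
    (hyz : y ≠ z) (hyu : ∀ x, G.Adj v x → c x = c y → x = y)
    (hzu : ∀ x, G.Adj v x → c x = c z → x = z) :
    ∃ K, Conn G K ∧ y ∈ K ∧ z ∉ K ∧ v ∉ K ∧ (∀ x ∈ K, c x = c y ∨ c x = c z) ∧
      Touch G K {z} := by
  obtain ⟨K, hK, hyK, hzK, hvK, hcK⟩ := hG.exists_kempe hc hy hyu hzu
  obtain ⟨D, hyD, hD⟩ := exists_isComp G (S := K \ {z}) (x := y) ⟨hyK, hyz⟩
  obtain ⟨u, hu, huz⟩ := hK.adj_comp hzK hD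
  exact ⟨D, hD.conn, hyD, fun h => (hD.subset h).2 rfl, fun h => hvK (hD.subset h).1,
    fun x hx => hcK x (hD.subset hx).1, u, hu, z, rfl, huz⟩

theorem veeTable_two_missing : veeTable (fun a b => !((a == 5 && (b == 2 || b == 3)) ||
    (b == 5 && (a == 2 || a == 3)))) = true := by decide +kernel

theorem MinCE.false_of_pattern (hG : MinCE G) {y : Fin 7 → V} (hinj : y.Injective)
    (hN : ∀ u, G.Adj v u ↔ ∃ i, y i = u) (h04 : ¬ G.Adj (y 0) (y 4)) (h06 : G.Adj (y 0) (y 6))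
    (h46 : G.Adj (y 4) (y 6)) (h45 : G.Adj (y 4) (y 5)) (h65 : G.Adj (y 6) (y 5))
    (h43 : G.Adj (y 4) (y 3)) (h53 : G.Adj (y 5) (y 3)) (h31 : G.Adj (y 3) (y 1))
    (h01 : G.Adj (y 0) (y 1) ∨ G.Adj (y 6) (y 1)) (h32 : G.Adj (y 3) (y 2))
    (h12 : G.Adj (y 1) (y 2)) (h02 : G.Adj (y 0) (y 2) ∨ G.Adj (y 6) (y 2)) : False := by
  have hv : ∀ i, G.Adj v (y i) := fun i => (hN _).2 ⟨i, rfl⟩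
  have hyne : ∀ i, y i ≠ v := fun i => (hv i).ne'
  obtain ⟨c, hc1, hc2⟩ := hG.contract ({v, y 0, y 4} : Set V) (by
      have := ((conn_singleton (G := G) v).insert_adj (u := v) rfl (hv 4)).insert_adj (u := v)
        (by simp) (hv 0)
      convert this using 1
      ext x; simp; tauto)
    (by
      have := Set.ncard_le_ncard (show ({v, y 0} : Set V) ⊆ {v, y 0, y 4} by
        rintro x (rfl | rfl) <;> simp) (Set.toFinite _)
      rwa [Set.ncard_pair (hyne 0).symm] at this)
  have hc : ∀ a b, a ≠ v → b ≠ v → G.Adj a b → c a ≠ c b := by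
    intro a b ha hb hab
    refine hc2 a b hab ?_
    rintro ⟨h1, h2⟩
    rcases h1 with rfl | rfl | rfl <;> rcases h2 with rfl | rfl | rfl <;>
      first
        | exact ha rfl
        | exact hb rfl
        | exact G.irrefl hab
        | exact h04 hab
        | exact h04 hab.symm
  have hc04 : c (y 4) = c (y 0) := hc1 _ (by simp) _ (by simp)
  let e : Fin 6 → Fin 7 := ![0, 1, 2, 3, 5, 6]
  have hsurj : Function.Surjective (fun i => c (y (e i))) := by
    intro k
    by_contra hk
    push Not at hk
    refine hG.extend_color v hc k fun x hx => ?_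
    obtain ⟨i, rfl⟩ := (hN x).1 hx
    have he : ∀ i : Fin 7, i = 4 ∨ ∃ j, e j = i := by decide
    rcases he i with rfl | ⟨j, rfl⟩
    · rw [hc04]; exact hk 0
    · exact hk j
  have hinjc := Finite.injective_iff_surjective.2 hsurj
  have hcne : ∀ i j : Fin 7, i ≠ j → i ≠ 4 → j ≠ 4 → c (y i) ≠ c (y j) := by
    intro i j hij hi hj heq
    have he : ∀ i : Fin 7, i ≠ 4 → ∃ j, e j = i := by decide
    obtain ⟨i, rfl⟩ := he i hi
    obtain ⟨j, rfl⟩ := he j hj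
    exact hij (congrArg e (hinjc heq))
  have huniq : ∀ i : Fin 7, i ≠ 0 → i ≠ 4 → ∀ x, G.Adj v x → c x = c (y i) → x = y i := by
    intro i h0 h4 x hx hxi
    obtain ⟨j, rfl⟩ := (hN x).1 hx
    by_contra hne
    have hji : j ≠ i := fun e => hne (e ▸ rfl)
    by_cases hj : j = 4
    · subst hj; rw [hc04] at hxi
      exact hcne 0 i h0.symm (by decide) h4 hxi
    · exact hcne j i hji hj h4 hxi
  obtain ⟨K1, hK1, h5K1, h1K1, hvK1, hcK1, ht1⟩ := hG.exists_kempe_part hc (hv 5)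
    (hinj.ne (by decide)) (huniq 5 (by decide) (by decide)) (huniq 1 (by decide) (by decide))
  obtain ⟨K2, hK2, h5K2, h2K2, hvK2, hcK2, ht2⟩ := hG.exists_kempe_part hc (hv 5)
    (hinj.ne (by decide)) (huniq 5 (by decide) (by decide)) (huniq 2 (by decide) (by decide))
  obtain ⟨K3, hK3, h3K3, h6K3, hvK3, hcK3, ht3⟩ := hG.exists_kempe_part hc (hv 3)
    (hinj.ne (by decide)) (huniq 3 (by decide) (by decide)) (huniq 6 (by decide) (by decide))
  have hmem : ∀ {K : Set V} {p q : Fin 7}, (∀ x ∈ K, c x = c (y p) ∨ c x = c (y q)) →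
      ∀ i, c (y i) ≠ c (y p) → c (y i) ≠ c (y q) → y i ∉ K := fun h i h1 h2 hi =>
    (h _ hi).elim h1 h2
  have hK12 : Conn G (K1 ∪ K2) := hK1.union_of_inter hK2 ⟨y 5, h5K1, h5K2⟩
  have hn4 : ∀ i : Fin 7, i ≠ 0 → i ≠ 4 → c (y 4) ≠ c (y i) := fun i h0 h4 => by
    rw [hc04]; exact hcne 0 i h0.symm (by decide) h4
  have hdK : Disjoint (K1 ∪ K2) K3 := by
    rw [Set.disjoint_left]
    rintro x (hx | hx) hx'
    · rcases hcK1 x hx with h | h <;> rcases hcK3 x hx' with h' | h' <;>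
        exact hcne _ _ (by decide) (by decide) (by decide) (h.symm.trans h')
    · rcases hcK2 x hx with h | h <;> rcases hcK3 x hx' with h' | h' <;>
        exact hcne _ _ (by decide) (by decide) (by decide) (h.symm.trans h')
  have hK12n : ∀ i : Fin 7, i ≠ 5 → i ≠ 3 → y i ∉ K1 ∪ K2 := by
    rintro i h5 h3 (hi | hi)
    · fin_cases i <;> first
        | exact h1K1 hi
        | exact absurd rfl h5
        | exact absurd rfl h3
        | exact hmem hcK1 _ (hn4 _ (by decide) (by decide)) (hn4 _ (by decide) (by decide)) hi
        | exact hmem hcK1 _ (hcne _ _ (by decide) (by decide) (by decide))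
            (hcne _ _ (by decide) (by decide) (by decide)) hi
    · fin_cases i <;> first
        | exact h2K2 hi
        | exact absurd rfl h5
        | exact absurd rfl h3
        | exact hmem hcK2 _ (hn4 _ (by decide) (by decide)) (hn4 _ (by decide) (by decide)) hi
        | exact hmem hcK2 _ (hcne _ _ (by decide) (by decide) (by decide))
            (hcne _ _ (by decide) (by decide) (by decide)) hi
  have hK3n : ∀ i : Fin 7, i ≠ 5 → i ≠ 3 → y i ∉ K3 := by
    rintro i h5 h3 hi
    fin_cases i <;> first
        | exact h6K3 hi
        | exact absurd rfl h5
        | exact absurd rfl h3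
        | exact hmem hcK3 _ (hn4 _ (by decide) (by decide)) (hn4 _ (by decide) (by decide)) hi
        | exact hmem hcK3 _ (hcne _ _ (by decide) (by decide) (by decide))
            (hcne _ _ (by decide) (by decide) (by decide)) hi
  have hvK : v ∉ K1 ∪ K2 := fun h => h.elim hvK1 hvK2
  let f : ℕ → Set V := fun k => match k with
    | 0 => {v}
    | 1 => {y 0, y 6}
    | 2 => {y 1}
    | 3 => {y 2}
    | 4 => K3
    | 5 => {y 4}
    | _ => K1 ∪ K2
  have hne : ∀ i j : Fin 7, i ≠ j → y i ≠ y j := fun i j h => hinj.ne h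
  have h16 : Touch G ({y 0, y 6} : Set V) {y 1} := h01.elim
    (fun h => ⟨y 0, by simp, y 1, rfl, h⟩) fun h => ⟨y 6, by simp, y 1, rfl, h⟩
  have h26 : Touch G ({y 0, y 6} : Set V) {y 2} := h02.elim
    (fun h => ⟨y 0, by simp, y 2, rfl, h⟩) fun h => ⟨y 6, by simp, y 2, rfl, h⟩
  have hd : ∀ i < 7, ∀ j < 7, i < j → Disjoint (f i) (f j) := by
    intro i hi j hj hij
    interval_cases j <;> interval_cases i <;>
      simp only [f, Set.disjoint_singleton_left, Set.disjoint_singleton_right,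
        Set.mem_insert_iff, Set.mem_singleton_iff, not_or, Set.disjoint_insert_left]
    all_goals first
      | exact (hyne _).symm
      | exact hyne _
      | exact hvK
      | exact hvK3
      | exact hK3n _ (by decide) (by decide)
      | exact hK12n _ (by decide) (by decide)
      | exact hdK.symm
      | exact hne _ _ (by decide)
      | exact ⟨(hyne _).symm, (hyne _).symm⟩
      | exact ⟨hne _ _ (by decide), hne _ _ (by decide)⟩
      | exact ⟨hK3n _ (by decide) (by decide), hK3n _ (by decide) (by decide)⟩
      | exact ⟨hK12n _ (by decide) (by decide), hK12n _ (by decide) (by decide)⟩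
  have h5K : y 5 ∈ K1 ∪ K2 := Or.inl h5K1
  have ht : ∀ i < 7, ∀ j < 7, i < j → (!((i == 5 && (j == 2 || j == 3)) ||
    (j == 5 && (i == 2 || i == 3)))) = true → Touch G (f i) (f j) := by
    intro i hi j hj hij hadj
    interval_cases j <;> interval_cases i <;> simp only [f]
    · exact ⟨v, rfl, y 0, by simp, hv 0⟩
    · exact ⟨v, rfl, y 1, rfl, hv 1⟩
    · exact h16
    · exact ⟨v, rfl, y 2, rfl, hv 2⟩
    · exact h26
    · exact ⟨_, rfl, _, rfl, h12⟩
    · exact ⟨v, rfl, y 3, h3K3, hv 3⟩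
    · exact (ht3.mono subset_rfl (by simp)).symm
    · exact ⟨_, rfl, y 3, h3K3, h31.symm⟩
    · exact ⟨_, rfl, y 3, h3K3, h32.symm⟩
    · exact ⟨v, rfl, y 4, rfl, hv 4⟩
    · exact ⟨y 6, by simp, y 4, rfl, h46.symm⟩
    · simp at hadj
    · simp at hadj
    · exact ⟨y 3, h3K3, y 4, rfl, h43.symm⟩
    · exact ⟨v, rfl, y 5, h5K, hv 5⟩
    · exact ⟨y 6, by simp, y 5, h5K, h65⟩
    · exact (ht1.mono Set.subset_union_left subset_rfl).symm
    · exact (ht2.mono Set.subset_union_right subset_rfl).symm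
    · exact ⟨y 3, h3K3, y 5, h5K, h53.symm⟩
    · exact ⟨y 4, rfl, y 5, h5K, h45⟩
  have hB : Bags G 7 (fun a b => !((a == 5 && (b == 2 || b == 3)) ||
      (b == 5 && (a == 2 || a == 3)))) f := by
    refine ⟨fun i hi => ?_, fun i hi j hj hij => ?_, fun i hi j hj hij hadj => ?_⟩
    · interval_cases i <;> simp only [f] <;> first
        | exact conn_singleton _
        | exact conn_pair h06
        | exact hK3
        | exact hK12
    · rcases lt_or_gt_of_ne hij with h | h
      · exact hd i hi j hj h
      · exact (hd j hj i hi h).symm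
    · rcases lt_or_gt_of_ne hij with h | h
      · exact ht i hi j hj h hadj
      · exact (ht j hj i hi h (by rw [Bool.or_comm]; exact hadj)).symm
  exact hG.noVee (hB.vee_of_veeTable veeTable_two_missing)

/-- Enumerate a set of four vertices in increasing order of a weight function. -/
theorem exists_sorted_four {S : Set V} (hS : S.ncard = 4) (w : V → ℕ) :
    ∃ g : Fin 4 → V, g.Injective ∧ (∀ i, g i ∈ S) ∧ Monotone (w ∘ g) := by
  have e : S ≃ Fin 4 := Finite.equivFinOfCardEq (by rw [Nat.card_coe_set_eq, hS])
  let g : Fin 4 → V := fun i => e.symm i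
  have hg : g.Injective := fun i j h => e.symm.injective (Subtype.ext h)
  exact ⟨g ∘ Tuple.sort (w ∘ g), hg.comp (Equiv.injective _), fun i => (e.symm _).2,
    Tuple.monotone_sort (w ∘ g)⟩

theorem exists_triangle {S : Set V} (hS : 6 ≤ S.ncard)
    (hT : ∀ a ∈ S, ∀ b ∈ S, ∀ c ∈ S, a ≠ b → a ≠ c → b ≠ c → G.Adj a b ∨ G.Adj a c ∨ G.Adj b c) :
    ∃ a ∈ S, ∃ b ∈ S, ∃ c ∈ S, G.Adj a b ∧ G.Adj a c ∧ G.Adj b c := by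
  obtain ⟨x, hx⟩ : S.Nonempty := by
    rw [← Set.ncard_pos]; omega
  have h1 : (S \ {x}).ncard + 1 = S.ncard := Set.ncard_sdiff_singleton_add_one hx
  have h2 : S \ {x} = (S \ {x}) ∩ {y | G.Adj x y} ∪ (S \ {x}) \ {y | G.Adj x y} :=
    (Set.inter_union_sdiff _ _).symm
  have h3 := Set.ncard_union_le ((S \ {x}) ∩ {y | G.Adj x y}) ((S \ {x}) \ {y | G.Adj x y})
  rw [← h2] at h3
  rcases le_or_gt 3 ((S \ {x}) ∩ {y | G.Adj x y}).ncard with h | h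
  · obtain ⟨a, b, c, ha, hb, hc, hab, hac, hbc⟩ := (Set.two_lt_ncard_iff).1 h
    rcases hT a ha.1.1 b hb.1.1 c hc.1.1 hab hac hbc with h | h | h
    · exact ⟨x, hx, a, ha.1.1, b, hb.1.1, ha.2, hb.2, h⟩
    · exact ⟨x, hx, a, ha.1.1, c, hc.1.1, ha.2, hc.2, h⟩
    · exact ⟨x, hx, b, hb.1.1, c, hc.1.1, hb.2, hc.2, h⟩
  · obtain ⟨a, b, c, ha, hb, hc, hab, hac, hbc⟩ := (Set.two_lt_ncard_iff).1
      (show 2 < ((S \ {x}) \ {y | G.Adj x y}).ncard by omega)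
    have key : ∀ a ∈ (S \ {x}) \ {y | G.Adj x y}, ∀ b ∈ (S \ {x}) \ {y | G.Adj x y}, a ≠ b →
        G.Adj a b := fun a ha b hb hab =>
      ((hT x hx a ha.1.1 b hb.1.1 (fun e => ha.1.2 e.symm) (fun e => hb.1.2 e.symm)
        hab).resolve_left ha.2).resolve_left hb.2
    exact ⟨a, ha.1.1, b, hb.1.1, c, hc.1.1, key a ha b hb hab, key a ha c hc hac, key b hb c hc hbc⟩

/-- A minimal counterexample has no vertex of degree `7`. -/
theorem MinCE.degree_ne_seven (hG : MinCE G) (v : V) : (G.neighborSet v).ncard ≠ 7 := by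
  intro h7
  have hT : ∀ a ∈ G.neighborSet v, ∀ b ∈ G.neighborSet v, ∀ c ∈ G.neighborSet v,
      a ≠ b → a ≠ c → b ≠ c → G.Adj a b ∨ G.Adj a c ∨ G.Adj b c := by
    intro a ha b hb c hc hab hac hbc
    by_contra! h
    exact hG.no_indep_triple h7 ha hb hc hab hac hbc h.1 h.2.1 h.2.2
  obtain ⟨a, ha, b, hb, c, hc, hab, hac, hbc⟩ := exists_triangle (by omega) hT
  have hcard : (G.neighborSet v \ {a, b, c}).ncard = 4 := by
    rw [Set.ncard_sdiff (by rintro x (rfl | rfl | rfl) <;> assumption), h7,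
      Set.ncard_insert_of_notMem (by simp [hab.ne, hac.ne]), Set.ncard_pair hbc.ne]
  classical
  obtain ⟨g, hg, hgS, hmono⟩ := exists_sorted_four hcard fun x =>
    (if G.Adj c x then 4 else 0) + (if G.Adj b x then 2 else 0) + (if G.Adj a x then 1 else 0)
  let f : ℕ → V := fun n => match n with
    | 0 => a
    | 1 => b
    | 2 => c
    | 3 => g 0
    | 4 => g 1
    | 5 => g 2
    | _ => g 3
  have hfS : ∀ i, f i ∈ G.neighborSet v := by
    intro i
    simp only [f]
    split <;> first | assumption | exact (hgS _).1
  have hgn : ∀ i, a ≠ g i ∧ b ≠ g i ∧ c ≠ g i := fun i => by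
    have := (hgS i).2
    simp only [Set.mem_insert_iff, Set.mem_singleton_iff, not_or] at this
    exact ⟨Ne.symm this.1, Ne.symm this.2.1, Ne.symm this.2.2⟩
  have hlt : ∀ j < 7, ∀ i < j, f i ≠ f j := by
    intro j hj i hij
    interval_cases j <;> interval_cases i <;> simp only [f] <;> first
      | exact hab.ne
      | exact hac.ne
      | exact hbc.ne
      | exact (hgn _).1
      | exact (hgn _).2.1
      | exact (hgn _).2.2
      | exact hg.ne (by decide)
  have hne : ∀ i < 7, ∀ j < 7, i ≠ j → f i ≠ f j := fun i hi j hj hij =>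
    (lt_or_gt_of_ne hij).elim (hlt j hj i) fun h => (hlt i hi j h).symm
  let R : ℕ → ℕ → Prop := fun i j => G.Adj (f i) (f j)
  have hbits : ∀ x < 7, ∀ y < 7, bitAt (pairBits 0 1 ||| pairBits 0 2 ||| pairBits 1 2) x y = true →
      R x y := by
    intro x hx y hy hxy
    rcases bitAt_or_pairBits (by omega) (by omega) hx hy hxy with h | ⟨rfl, rfl⟩ | ⟨rfl, rfl⟩
    · rcases bitAt_or_pairBits (by omega) (by omega) hx hy h with h | ⟨rfl, rfl⟩ | ⟨rfl, rfl⟩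
      · rw [← Nat.zero_or (pairBits 0 1)] at h
        rcases bitAt_or_pairBits (by omega) (by omega) hx hy h with h | ⟨rfl, rfl⟩ | ⟨rfl, rfl⟩
        · simp [bitAt] at h
        · exact hab
        · exact hab.symm
      · exact hac
      · exact hac.symm
    · exact hbc
    · exact hbc.symm
  obtain ⟨x0, x1, x2, x3, x4, x5, x6, h04, h06, h46, h45, h65, h43, h53, h31, h01, h32, h12, h02,
      hnd, hx7⟩ := exists_pattern_of_search (R := R) (fun _ _ h => SimpleGraph.Adj.symm h)
    (fun a ha b hb x hx y hy h => hG.no_four_clique (K := {f a, f b, f x, f y}) h7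
      (by rintro z (rfl | rfl | rfl | rfl) <;> exact hfS _)
      (by
        rw [Set.ncard_insert_of_notMem (by simp [h.1.ne, h.2.1.ne, h.2.2.1.ne]),
          Set.ncard_insert_of_notMem (by simp [h.2.2.2.1.ne, h.2.2.2.2.1.ne]),
          Set.ncard_pair h.2.2.2.2.2.ne])
      (by
        obtain ⟨h1, h2, h3, h4, h5, h6⟩ := h
        rintro z (rfl | rfl | rfl | rfl) w (rfl | rfl | rfl | rfl) hzw <;> first
          | exact absurd rfl hzw
          | assumption
          | exact SimpleGraph.Adj.symm (by assumption)))
    (fun a ha b hb x hx hab hax hbx => hT _ (hfS a) _ (hfS b) _ (hfS x) (hne a ha b hb hab)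
      (hne a ha x hx hax) (hne b hb x hx hbx))
    (fun j h4 hj => by
      have h01 := hmono (show (0 : Fin 4) ≤ 1 by decide)
      have h12 := hmono (show (1 : Fin 4) ≤ 2 by decide)
      have h23 := hmono (show (2 : Fin 4) ≤ 3 by decide)
      interval_cases j
      · exact h01
      · exact h12
      · exact h23)
    _ (by decide) hbits (fun a _ b _ h => by simp [bitAt] at h) patternSearch_eq
  let x : Fin 7 → ℕ := ![x0, x1, x2, x3, x4, x5, x6]
  have hxl : ∀ i, x i < 7 := fun i => hx7 _ (by fin_cases i <;> simp [x])
  have hxi : x.Injective := by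
    have : List.ofFn x = [x0, x1, x2, x3, x4, x5, x6] := by simp [x, List.ofFn_succ]
    rw [← List.nodup_ofFn, this]
    exact hnd
  have hyi : Function.Injective (fun i => f (x i)) := fun i j h => by
    by_contra hij
    exact hne _ (hxl i) _ (hxl j) (hxi.ne hij) h
  have hrange : Set.range (fun i => f (x i)) = G.neighborSet v := by
    refine Set.eq_of_subset_of_ncard_le ?_ ?_
    · rintro _ ⟨i, rfl⟩
      exact hfS _
    · rw [h7, Set.ncard_range_of_injective hyi, Nat.card_fin]
  exact hG.false_of_pattern (v := v) hyi (fun u => by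
    rw [← SimpleGraph.mem_neighborSet, ← hrange]; rfl) h04 h06 h46 h45 h65 h43 h53 h31 h01 h32 h12
    h02

end Kempe

section Octahedral

variable {U V W W' : Type} {G H H0 : SimpleGraph W} {H0' : SimpleGraph W'} {S T A B : Set W}

/-- The graph whose edges are all pairs of distinct elements of `S`. -/
def cl (S : Set W) : SimpleGraph W where
  Adj u v := u ≠ v ∧ u ∈ S ∧ v ∈ S
  symm := ⟨fun _ _ h => ⟨h.1.symm, h.2.2, h.2.1⟩⟩
  loopless := ⟨fun _ h => h.1 rfl⟩

/-- The complete multipartite graph `K_{2,2,2,2}`; the parts are `{2k, 2k+1}`. -/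
def octa : SimpleGraph (Fin 8) where
  Adj i j := i.val / 2 ≠ j.val / 2
  symm := ⟨fun _ _ h => Ne.symm h⟩
  loopless := ⟨fun _ h => h rfl⟩

instance : DecidableRel octa.Adj := fun i j => inferInstanceAs (Decidable (i.val / 2 ≠ j.val / 2))

/-- The vertex of `octa` not adjacent to `i`. -/
def anti (i : Fin 8) : Fin 8 := i ^^^ 1

theorem octa_adj_iff : ∀ i j, octa.Adj i j ↔ j ≠ i ∧ j ≠ anti i := by decide

theorem anti_ne : ∀ i, anti i ≠ i := by decide

theorem anti_anti : ∀ i, anti (anti i) = i := by decide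

theorem anti_eq_iff : ∀ i j, anti i = j ↔ i = anti j := by decide

/-- `octa` has an automorphism sending `0, 2` to a prescribed edge. -/
theorem exists_octa_aut : ∀ a b, octa.Adj a b → ∃ σ : Fin 8 → Fin 8, σ.Injective ∧
    (∀ i j, octa.Adj i j → octa.Adj (σ i) (σ j)) ∧ (∀ i, σ (anti i) = anti (σ i)) ∧
    σ 0 = a ∧ σ 2 = b := by
  have : ∀ a b : Fin 8, octa.Adj a b → ∀ σ : Fin 8 → Fin 8,
      σ = (fun i => a ^^^ (i &&& 1) ^^^ (if i &&& 2 = 0 then 0 else a ^^^ b) ^^^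
        (if i &&& 4 = 0 then 0 else if (a ^^^ b) &&& 4 = 0 then 4 else 2)) →
      σ.Injective ∧
    (∀ i j, octa.Adj i j → octa.Adj (σ i) (σ j)) ∧ (∀ i, σ (anti i) = anti (σ i)) ∧
    σ 0 = a ∧ σ 2 = b := by
    rintro a b h _ rfl
    revert a b
    unfold Function.Injective
    decide +kernel
  exact fun a b h => ⟨_, this a b h _ rfl⟩

/-- Two roots `r`-prescribed in a rooted minor. -/
def RMinor (K : SimpleGraph U) (r : Fin 4 → U) (H0 : SimpleGraph W) (s : Fin 4 → W) : Prop :=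
  ∃ bag : U → Set W, Model K H0 bag ∧ ∀ i, s i ∈ bag (r i)

/-- Four root vertices `(i, 0)`, and a clique `(i, 1)` with all edges `(i, 0) (j, 1)`, `i ≠ j`. -/
def fan : SimpleGraph (Fin 4 × Fin 2) where
  Adj p q := p.1 ≠ q.1 ∧ (p.2 = 1 ∨ q.2 = 1)
  symm := ⟨fun _ _ h => ⟨h.1.symm, h.2.symm⟩⟩
  loopless := ⟨fun _ h => h.1 rfl⟩

/-- The conclusion of the structure theorem for rooted graphs containing `octa`. -/
structure Good (H0 : SimpleGraph W) (s : Fin 4 → W) : Prop where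
  k4 : RMinor (⊤ : SimpleGraph (Fin 4)) id H0 s
  dich : IsMinor K7vee (H0 ⊔ cl (Set.range s)) ∨ RMinor fan (fun i => (i, 0)) H0 s

/-- No separation of order at most three separates a bag of `μ` from `S`. -/
def Tied (H : SimpleGraph W) (S : Set W) (μ : Fin 8 → Set W) : Prop :=
  ∀ A B, IsSeparation H A B → S ⊆ B → (∃ p, μ p ⊆ A \ B) → 4 ≤ (A ∩ B).ncard

theorem RMinor.of_model {K : SimpleGraph U} {r : Fin 4 → U} {s : Fin 4 → W} {s' : Fin 4 → W'}
    {bag : W' → Set W} (hb : Model H0' H0 bag) (hs : ∀ i, s i ∈ bag (s' i))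
    (h : RMinor K r H0' s') : RMinor K r H0 s := by
  obtain ⟨b, h1, h2⟩ := h
  exact ⟨_, h1.trans hb, fun i => Set.mem_biUnion (h2 i) (hs i)⟩

theorem Good.of_model {s : Fin 4 → W} {s' : Fin 4 → W'} {bag : W' → Set W}
    (hinj : s.Injective) (hb : Model H0' H0 bag) (hs : ∀ i, s i ∈ bag (s' i)) (h : Good H0' s') :
    Good H0 s := by
  refine ⟨h.k4.of_model hb hs, h.dich.imp (fun hv => ?_) fun hr => hr.of_model hb hs⟩
  refine isMinor_trans hv (Model.isMinor (bag := bag) ⟨?_, hb.disj, fun w w' hw => ?_⟩)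
  · exact (hb.mono_graph le_sup_left).conn
  · rcases hw with hw | ⟨hne, ⟨i, rfl⟩, ⟨j, rfl⟩⟩
    · exact (hb.touch w w' hw).mono_graph le_sup_left
    · exact ⟨s i, hs i, s j, hs j, Or.inr ⟨fun e => hne (by rw [hinj e]), ⟨i, rfl⟩, ⟨j, rfl⟩⟩⟩

theorem Model.comp_injective {K : SimpleGraph U} {L : SimpleGraph V} {μ : V → Set W}
    (h : Model L H μ) {σ : U → V} (hσ : σ.Injective) (hadj : ∀ i j, K.Adj i j → L.Adj (σ i) (σ j)) :
    Model K H (μ ∘ σ) :=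
  ⟨fun _ => h.conn _, fun _ _ hij => h.disj _ _ fun e => hij (hσ e),
    fun i j hij => h.touch _ _ (hadj i j hij)⟩

/-- The index below eight of a natural number. -/
def fin8 (k : ℕ) : Fin 8 := Fin.ofNat 8 k

theorem bags_of_fin8 {f : Fin 8 → Set W} {adj : Fin 8 → Fin 8 → Bool} (hc : ∀ i, Conn H (f i))
    (hd : ∀ i j, i ≠ j → Disjoint (f i) (f j))
    (ht : ∀ i j, i ≠ j → adj i j = true → Touch H (f i) (f j)) :
    Bags H (7 + 1) (fun i j => adj (fin8 i) (fin8 j)) (fun i => f (fin8 i)) := by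
  have key : ∀ i < 8, ∀ j < 8, i ≠ j → fin8 i ≠ fin8 j := by decide
  exact ⟨fun i _ => hc _, fun i hi j hj hij => hd _ _ (key i hi j hj hij),
    fun i hi j hj hij h => ht _ _ (key i hi j hj hij) h⟩

theorem vee_of_antipodal {μ : Fin 8 → Set W} (hμ : Model octa H μ) {p : Fin 8}
    (h : Touch H (μ p) (μ (anti p))) : IsMinor K7vee H := by
  obtain ⟨b, hb⟩ := (show ∀ p : Fin 8, ∃ b, octa.Adj p b by decide) p
  obtain ⟨σ, hσ, hadj, hanti, h0, -⟩ := exists_octa_aut p b hb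
  have hm := hμ.comp_injective hσ hadj
  have h01 : Touch H (μ (σ 0)) (μ (σ 1)) := by
    rwa [show (1 : Fin 8) = anti 0 by decide, hanti, h0]
  refine (bags_of_fin8 (adj := fun i j => decide (octa.Adj i j ∨ i.val + j.val = 1)) hm.conn hm.disj
    fun i j hij hh => ?_).vee_of_search (by decide +kernel)
  rcases of_decide_eq_true hh with hh | hh
  · exact hm.touch i j hh
  · have : i = 0 ∧ j = 1 ∨ i = 1 ∧ j = 0 := by omega
    rcases this with ⟨rfl, rfl⟩ | ⟨rfl, rfl⟩
    · exact h01
    · exact h01.symm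

/-- The table of `octa` plus the edge `2 3`, where `0` sees only `d` and `e` among `4, …, 7`. -/
def weakAdj (d e i j : Fin 8) : Bool :=
  decide (i.val + j.val = 5 ∧ (i = 2 ∨ j = 2) ∨
    octa.Adj i j ∧ (i = 0 → j.val < 4 ∨ j = d ∨ j = e) ∧ (j = 0 → i.val < 4 ∨ i = d ∨ i = e))

theorem vee_of_weak {f : Fin 8 → Set W} (hc : ∀ i, Conn H (f i))
    (hd : ∀ i j, i ≠ j → Disjoint (f i) (f j))
    (ht : ∀ i j, i ≠ 0 → j ≠ 0 → octa.Adj i j → Touch H (f i) (f j))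
    (h23 : Touch H (f 2) (f 3)) (h02 : Touch H (f 0) (f 2)) (h03 : Touch H (f 0) (f 3))
    {d e : Fin 8} (hde : d ≠ e) (hd4 : 4 ≤ d.val) (he4 : 4 ≤ e.val)
    (h0d : Touch H (f 0) (f d)) (h0e : Touch H (f 0) (f e)) : IsMinor K7vee H := by
  have key : ∀ d e : Fin 8, d ≠ e → 4 ≤ d.val → 4 ≤ e.val →
      ∃ p ∈ [(7, 4), (6, 4)],
        veeOps 8 (fun i j => weakAdj d e (fin8 i) (fin8 j)) [p] = true := by decide +kernel
  have h0 : ∀ j, (j.val < 4 ∨ j = d ∨ j = e) → octa.Adj 0 j → Touch H (f 0) (f j) := by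
    intro j hj ha
    rcases hj with hj | rfl | rfl
    · have : j = 0 ∨ j = 1 ∨ j = 2 ∨ j = 3 := by omega
      rcases this with rfl | rfl | rfl | rfl
      · exact absurd ha (by decide)
      · exact absurd ha (by decide)
      · exact h02
      · exact h03
    · exact h0d
    · exact h0e
  obtain ⟨p, -, hp⟩ := key d e hde hd4 he4
  refine (bags_of_fin8 (adj := weakAdj d e) hc hd fun i j hij hh => ?_).vee_of_ops hp
  rcases of_decide_eq_true hh with ⟨hh, hh'⟩ | ⟨ha, hi, hj⟩
  · have : i = 2 ∧ j = 3 ∨ i = 3 ∧ j = 2 := by omega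
    rcases this with ⟨rfl, rfl⟩ | ⟨rfl, rfl⟩
    · exact h23
    · exact h23.symm
  · by_cases hi0 : i = 0
    · subst hi0; exact h0 j (hi rfl) ha
    · by_cases hj0 : j = 0
      · subst hj0; exact (h0 i (hj rfl) ha.symm).symm
      · exact ht i j hi0 hj0 ha

end Octahedral

section Restrict

variable {V W : Type} {G H H0 : SimpleGraph W} {S T A B P Q : Set W}

theorem IsSeparation.symm' (h : IsSeparation G A B) : IsSeparation G B A :=
  ⟨by rw [Set.union_comm]; exact h.1, fun _ _ huv hn => h.2 huv.symm ⟨hn.2, hn.1⟩⟩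

theorem IsSeparation.mem_or (h : IsSeparation G A B) (x : W) : x ∈ A ∨ x ∈ B :=
  (h.1 ▸ Set.mem_univ x : x ∈ A ∪ B)

theorem IsSeparation.mem_left (h : IsSeparation G A B) {u v : W} (huv : G.Adj u v) (hu : u ∉ B) :
    v ∈ A := by
  by_contra hv
  exact h.2 huv ⟨⟨(h.mem_or u).resolve_right hu, hu⟩, (h.mem_or v).resolve_left hv, hv⟩

theorem IsSeparation.mem_right (h : IsSeparation G A B) {u v : W} (huv : G.Adj u v) (hu : u ∉ A) :
    v ∈ B := h.symm'.mem_left huv hu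

theorem isSeparation_of (h1 : ∀ x, x ∈ A ∨ x ∈ B) (h2 : ∀ u v, G.Adj u v → u ∉ B → v ∈ A) :
    IsSeparation G A B :=
  ⟨Set.eq_univ_of_forall h1, fun u v huv hn => hn.2.2 (h2 u v huv hn.1.2)⟩

/-- A connected set meeting both sides of a separation meets the middle. -/
theorem IsSeparation.conn_inter (h : IsSeparation G A B) (hP : Conn G P) (hA : (P ∩ A).Nonempty)
    (hB : (P ∩ B).Nonempty) : (P ∩ (A ∩ B)).Nonempty := by
  by_contra hn
  rw [Set.not_nonempty_iff_eq_empty] at hn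
  have hPA : P ⊆ A := hP.subset_of_closed hA fun u hu v hv huA huv =>
    h.mem_left huv fun huB => (hn ▸ (⟨hu, huA, huB⟩ : u ∈ P ∩ (A ∩ B)) : u ∈ (∅ : Set W))
  obtain ⟨x, hx, hxB⟩ := hB
  exact (hn ▸ (⟨hx, hPA hx, hxB⟩ : x ∈ P ∩ (A ∩ B)) : x ∈ (∅ : Set W))

theorem card_le_of_disjoint_hit [Finite W] {ι : Type} [Fintype ι] {P : ι → Set W}
    (hd : ∀ i j, i ≠ j → Disjoint (P i) (P j)) (hT : ∀ i, (P i ∩ T).Nonempty) :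
    Fintype.card ι ≤ T.ncard := by
  choose g hg using hT
  have hinj : g.Injective := fun i j hij => by
    by_contra hne
    exact Set.disjoint_left.1 (hd i j hne) (hg i).1 (hij ▸ (hg j).1)
  rw [← Nat.card_eq_fintype_card, ← Set.ncard_univ, ← Set.ncard_image_of_injective _ hinj]
  exact Set.ncard_le_ncard (by rintro _ ⟨i, -, rfl⟩; exact (hg i).2) (Set.toFinite _)

theorem IsSeparation.conn_restrict (h : IsSeparation G A B) (hP : Conn G P)
    (hA : (P ∩ A).Nonempty) :
    Conn (G.induce A ⊔ cl {x : A | (x : W) ∈ B}) {x : A | (x : W) ∈ P} := by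
  obtain ⟨a, haP, haA⟩ := hA
  refine conn_of_closed ⟨⟨a, haA⟩, haP⟩ fun X ⟨x, hxP, hxX⟩ hcl => ?_
  let Y : Set W := {y | (∃ hy : y ∈ A, (⟨y, hy⟩ : A) ∈ X) ∨
    (y ∉ A ∧ ∃ z : A, z ∈ X ∧ (z : W) ∈ B ∧ (z : W) ∈ P)}
  have hPY : P ⊆ Y := by
    refine hP.subset_of_closed ⟨x, hxP, Or.inl ⟨x.2, hxX⟩⟩ fun u hu v hv huY huv => ?_
    rcases huY with ⟨huA, huX⟩ | ⟨huA, z, hzX, hzB, hzP⟩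
    · by_cases hvA : v ∈ A
      · exact Or.inl ⟨hvA, hcl ⟨u, huA⟩ hu ⟨v, hvA⟩ hv huX (Or.inl huv)⟩
      · exact Or.inr ⟨hvA, ⟨u, huA⟩, huX, h.mem_right huv.symm hvA, hu⟩
    · by_cases hvA : v ∈ A
      · refine Or.inl ⟨hvA, ?_⟩
        by_cases hzv : z = ⟨v, hvA⟩
        · exact hzv ▸ hzX
        · exact hcl z hzP ⟨v, hvA⟩ hv hzX (Or.inr ⟨hzv, hzB, h.mem_right huv huA⟩)
      · exact Or.inr ⟨hvA, z, hzX, hzB, hzP⟩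
  intro y hy
  rcases hPY hy with ⟨_, h1⟩ | ⟨h1, _⟩
  · exact h1
  · exact absurd y.2 h1

theorem IsSeparation.touch_restrict (h : IsSeparation G A B) (hP : Conn G P) (hQ : Conn G Q)
    (hPA : (P ∩ A).Nonempty) (hQA : (Q ∩ A).Nonempty) (hPQ : Disjoint P Q) (ht : Touch G P Q) :
    Touch (G.induce A ⊔ cl {x : A | (x : W) ∈ B}) {x : A | (x : W) ∈ P}
      {x : A | (x : W) ∈ Q} := by
  obtain ⟨u, hu, v, hv, huv⟩ := ht
  by_cases hA : u ∈ A ∧ v ∈ A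
  · exact ⟨⟨u, hA.1⟩, hu, ⟨v, hA.2⟩, hv, Or.inl huv⟩
  have huB : u ∈ B := by
    by_contra huB
    exact hA ⟨(h.mem_or u).resolve_right huB, h.mem_left huv huB⟩
  have hvB : v ∈ B := by
    by_contra hvB
    exact hA ⟨h.mem_left huv.symm hvB, (h.mem_or v).resolve_right hvB⟩
  obtain ⟨x, hx, hxA, hxB⟩ := h.conn_inter hP hPA ⟨u, hu, huB⟩
  obtain ⟨y, hy, hyA, hyB⟩ := h.conn_inter hQ hQA ⟨v, hv, hvB⟩
  refine ⟨⟨x, hxA⟩, hx, ⟨y, hyA⟩, hy, Or.inr ⟨fun e => ?_, hxB, hyB⟩⟩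
  have : x = y := congrArg Subtype.val e
  exact Set.disjoint_left.1 hPQ hx (this ▸ hy)

theorem IsSeparation.bag_meets [Finite W] (h : IsSeparation G A B) {μ : Fin 8 → Set W}
    (hμ : Model octa G μ) {p : Fin 8} (hp : μ p ⊆ A \ B) (hle : (A ∩ B).ncard ≤ 5) (q : Fin 8) :
    (μ q ∩ A).Nonempty := by
  have h1 : ∀ q, octa.Adj p q → (μ q ∩ A).Nonempty := fun q hq => by
    obtain ⟨u, hu, v, hv, huv⟩ := hμ.touch p q hq
    exact ⟨v, hv, h.mem_left huv (hp hu).2⟩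
  by_cases hq : octa.Adj p q
  · exact h1 q hq
  by_contra hn
  have hqA : ∀ x ∈ μ q, x ∉ A := fun x hx hxA => hn ⟨x, hx, hxA⟩
  have hpq : q ≠ p := by
    rintro rfl
    obtain ⟨x, hx⟩ := (hμ.conn q).nonempty
    exact hqA x hx (hp hx).1
  have h2 : ∀ r, octa.Adj p r → octa.Adj q r := (show ∀ p q, ¬ octa.Adj p q → q ≠ p →
    ∀ r, octa.Adj p r → octa.Adj q r by decide) p q hq hpq
  have hc : Fintype.card {r // octa.Adj p r} = 6 := by
    have : ∀ p, Fintype.card {r // octa.Adj p r} = 6 := by decide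
    exact this p
  have := card_le_of_disjoint_hit (T := A ∩ B) (P := fun r : {r // octa.Adj p r} => μ r)
    (fun i j hij => hμ.disj _ _ fun e => hij (Subtype.ext e)) fun r => by
      refine h.conn_inter (hμ.conn _) (h1 r r.2) ?_
      obtain ⟨u, hu, v, hv, huv⟩ := hμ.touch q r (h2 r r.2)
      exact ⟨v, hv, h.mem_right huv (hqA u hu)⟩
  omega

theorem IsSeparation.octa_restrict [Finite W] (h : IsSeparation G A B) {μ : Fin 8 → Set W}
    (hμ : Model octa G μ) {p : Fin 8} (hp : μ p ⊆ A \ B) (hle : (A ∩ B).ncard ≤ 5) :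
    Model octa (G.induce A ⊔ cl {x : A | (x : W) ∈ B}) fun q => {x : A | (x : W) ∈ μ q} := by
  have hm := h.bag_meets hμ hp hle
  refine ⟨fun q => h.conn_restrict (hμ.conn q) (hm q), fun q r hqr => ?_, fun q r hqr =>
    h.touch_restrict (hμ.conn q) (hμ.conn r) (hm q) (hm r) (hμ.disj q r hqr.ne) (hμ.touch q r hqr)⟩
  exact Set.disjoint_left.2 fun x hx hr => Set.disjoint_left.1 (hμ.disj q r hqr) hx hr

/-- Reduction of a tied rooted model at a separation of order four. -/
theorem Tied.restrict [Finite W] {s : Fin 4 → W} (hs : s.Injective) {μ : Fin 8 → Set W}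
    (hμ : Model octa (H0 ⊔ cl (Set.range s)) μ) (ht : Tied (H0 ⊔ cl (Set.range s)) (Set.range s) μ)
    (h : IsSeparation (H0 ⊔ cl (Set.range s)) A B) (hSB : Set.range s ⊆ B) {p : Fin 8}
    (hp : μ p ⊆ A \ B) (h4 : (A ∩ B).ncard = 4) :
    ∃ (s' : Fin 4 → A) (μ' : Fin 8 → Set A) (bag : A → Set W), s'.Injective ∧
      Model octa (H0.induce A ⊔ cl (Set.range s')) μ' ∧
      Tied (H0.induce A ⊔ cl (Set.range s')) (Set.range s') μ' ∧
      Model (H0.induce A) H0 bag ∧ ∀ i, s i ∈ bag (s' i) := by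
  obtain ⟨P, hP⟩ := menger 4 (within H0 B) (Set.range s) (A ∩ B) fun X Y hXY hSX hTY => by
    have h1 : IsSeparation (H0 ⊔ cl (Set.range s)) (A ∪ (Y ∩ B)) (X ∩ B) := by
      refine isSeparation_of (fun x => ?_) fun u v huv hu => ?_
      · by_cases hxA : x ∈ A
        · exact Or.inl (Or.inl hxA)
        · have hxB := (h.mem_or x).resolve_left hxA
          exact (hXY.mem_or x).elim (fun hx => Or.inr ⟨hx, hxB⟩) fun hx => Or.inl (Or.inr ⟨hx, hxB⟩)
      · by_cases huB : u ∈ B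
        · have huX : u ∉ X := fun hx => hu ⟨hx, huB⟩
          by_cases hvA : v ∈ A
          · exact Or.inl hvA
          have hvB := (h.mem_or v).resolve_left hvA
          rcases huv with huv | ⟨_, huS, _⟩
          · exact Or.inr ⟨hXY.mem_right (u := u) (v := v) ⟨huv, huB, hvB⟩ huX, hvB⟩
          · exact absurd (hSX huS) huX
        · exact Or.inl (h.mem_left huv huB)
    refine (ht _ _ h1 (Set.subset_inter hSX hSB) ⟨p, fun x hx => ⟨Or.inl (hp hx).1, fun hn =>
      (hp hx).2 hn.2⟩⟩).trans (Set.ncard_le_ncard (fun x hx => ?_) (Set.toFinite _))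
    rcases hx.1 with hxA | hxY
    · exact ⟨hx.2.1, hTY ⟨hxA, hx.2.2⟩⟩
    · exact ⟨hx.2.1, hxY.1⟩
  obtain ⟨Q, hQ, hQT⟩ := hP.reindex h4
  choose g hgQ k hk using hQ.left
  have hkinj : k.Injective := fun t t' e => by
    by_contra hne
    have : g t = g t' := by rw [← hk t, ← hk t', e]
    exact Set.disjoint_left.1 (hQ.disj t t' hne) (hgQ t) (this ▸ hgQ t')
  have hkbij : k.Bijective := by
    refine (Nat.bijective_iff_injective_and_card k).2 ⟨hkinj, ?_⟩
    rw [Nat.card_fin, Nat.card_coe_set_eq, h4]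
  let e := Equiv.ofBijective k hkbij
  have hek : ∀ i, k (e.symm i) = i := fun i => e.apply_symm_apply i
  have hQB : ∀ t, Q t ⊆ B := fun t => (hQ.conn t).subset_of_within (by
    obtain ⟨y, hy, hyT⟩ := hQ.right t
    exact ⟨y, hy, hyT.2⟩)
  have hQself : ∀ t : ↑(A ∩ B), (t : W) ∈ Q t := fun t =>
    ((hQT t).symm ▸ rfl : (t : W) ∈ Q t ∩ (A ∩ B)).1
  have hQA : ∀ t : ↑(A ∩ B), ∀ x ∈ Q t, x ∈ A → x = t := fun t x hx hxA => by
    have : x ∈ Q t ∩ (A ∩ B) := ⟨hx, hxA, hQB t hx⟩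
    rwa [hQT t] at this
  let s' : Fin 4 → A := fun i => ⟨(e.symm i : W), (e.symm i).2.1⟩
  have hs'range : Set.range s' = {x : A | (x : W) ∈ B} := by
    ext x
    constructor
    · rintro ⟨i, rfl⟩; exact (e.symm i).2.2
    · intro hx
      exact ⟨e ⟨x, x.2, hx⟩, by simp [s']⟩
  classical
  let bag : A → Set W := fun x => if hx : (x : W) ∈ B then Q ⟨x, x.2, hx⟩ else {(x : W)}
  have hbagB : ∀ x : A, ∀ hx : (x : W) ∈ B, bag x = Q ⟨x, x.2, hx⟩ := fun x hx => dif_pos hx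
  have hbagN : ∀ x : A, (x : W) ∉ B → bag x = {(x : W)} := fun x hx => dif_neg hx
  have hself : ∀ x : A, (x : W) ∈ bag x := fun x => by
    by_cases hx : (x : W) ∈ B
    · rw [hbagB x hx]; exact hQself ⟨x, x.2, hx⟩
    · rw [hbagN x hx]; rfl
  have hle : (H0 ⊔ cl (Set.range s)).induce A ⊔ cl {x : A | (x : W) ∈ B} ≤
      H0.induce A ⊔ cl (Set.range s') := by
    rw [hs'range]
    rintro x y ((hxy | ⟨hne, hx, hy⟩) | hxy)
    · exact Or.inl hxy
    · exact Or.inr ⟨fun e => hne (congrArg Subtype.val e), hSB hx, hSB hy⟩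
    · exact Or.inr hxy
  refine ⟨s', _, bag, fun i j hij => e.symm.injective (Subtype.ext (Subtype.mk.inj hij)),
    (h.octa_restrict hμ hp (by omega)).mono_graph hle, ?_, ⟨fun x => ?_, fun x y hxy => ?_,
    fun x y hxy => ⟨x, hself x, y, hself y, hxy⟩⟩, fun i => ?_⟩
  · rintro X Y hXY hSY ⟨q, hq⟩
    rw [hs'range] at hSY
    have hqB : ∀ x ∈ μ q, x ∈ A \ B := by
      have h0 : μ q ∩ (A ∩ B) = ∅ := Set.eq_empty_of_forall_notMem fun x hx =>
        (hq (show (⟨x, hx.2.1⟩ : A) ∈ _ from hx.1)).2 (hSY hx.2.2)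
      have hqA := h.bag_meets hμ hp (by omega) q
      have hnB : ¬ (μ q ∩ B).Nonempty := fun hn => by
        have := h.conn_inter (hμ.conn q) hqA hn
        rw [h0] at this
        exact Set.not_nonempty_empty this
      intro x hx
      have hxB : x ∉ B := fun hxB => hnB ⟨x, hx, hxB⟩
      exact ⟨(h.mem_or x).resolve_right hxB, hxB⟩
    have h1 : IsSeparation (H0 ⊔ cl (Set.range s)) (Subtype.val '' X) (Subtype.val '' Y ∪ B) := by
      refine isSeparation_of (fun x => ?_) fun u v huv hu => ?_
      · by_cases hxB : x ∈ B
        · exact Or.inr (Or.inr hxB)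
        · have hxA := (h.mem_or x).resolve_right hxB
          exact (hXY.mem_or ⟨x, hxA⟩).imp (fun hx => ⟨_, hx, rfl⟩) fun hx => Or.inl ⟨_, hx, rfl⟩
      · have huB : u ∉ B := fun hn => hu (Or.inr hn)
        have huA := (h.mem_or u).resolve_right huB
        have hvA := h.mem_left huv huB
        have huv' : (H0.induce A ⊔ cl (Set.range s')).Adj ⟨u, huA⟩ ⟨v, hvA⟩ := hle (Or.inl huv)
        exact ⟨⟨v, hvA⟩, hXY.mem_left huv' fun hn => hu (Or.inl ⟨_, hn, rfl⟩), rfl⟩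
    refine (ht _ _ h1 (hSB.trans Set.subset_union_right) ⟨q, fun x hx => ?_⟩).trans ?_
    · have hxq := hq (show (⟨x, (hqB x hx).1⟩ : A) ∈ _ from hx)
      refine ⟨⟨_, hxq.1, rfl⟩, ?_⟩
      rintro (⟨y, hy, rfl⟩ | hxB)
      · exact hxq.2 hy
      · exact (hqB x hx).2 hxB
    · rw [← Set.ncard_image_of_injective _ (Subtype.val_injective (p := fun x => x ∈ A))]
      refine Set.ncard_le_ncard ?_ (Set.toFinite _)
      rintro _ ⟨⟨x, hx, rfl⟩, ⟨y, hy, hxy⟩ | hxB⟩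
      · obtain rfl := Subtype.ext hxy
        exact ⟨y, ⟨hx, hy⟩, rfl⟩
      · exact ⟨x, ⟨hx, hSY hxB⟩, rfl⟩
  · by_cases hx : (x : W) ∈ B
    · rw [hbagB x hx]; exact (hQ.conn _).of_within
    · rw [hbagN x hx]; exact conn_singleton _
  · have hne : (x : W) ≠ y := fun e => hxy (Subtype.ext e)
    by_cases hx : (x : W) ∈ B <;> by_cases hy : (y : W) ∈ B
    · rw [hbagB x hx, hbagB y hy]
      exact hQ.disj _ _ fun e => hne (Subtype.mk.inj e)
    · rw [hbagB x hx, hbagN y hy, Set.disjoint_singleton_right]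
      exact fun hn => hy (hQB _ hn)
    · rw [hbagB y hy, hbagN x hx, Set.disjoint_singleton_left]
      exact fun hn => hx (hQB _ hn)
    · rw [hbagN x hx, hbagN y hy, Set.disjoint_singleton]
      exact hne
  · rw [hbagB (s' i) (e.symm i).2.2]
    have h1 : s i = g (e.symm i) := by rw [← hk, hek]
    rw [h1]
    exact hgQ (e.symm i)

end Restrict

section Contract

variable {U V W W' : Type} {G H H0 : SimpleGraph W} {S T A B P Q : Set W}

theorem Conn.image_quot {f : W → W'} (h : Conn G P) : Conn (quot G f) (f '' P) := by
  refine conn_of_closed (h.nonempty.image f) fun X ⟨y, ⟨x, hx, hxy⟩, hyX⟩ hcl => ?_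
  have : P ⊆ f ⁻¹' X := h.subset_of_closed ⟨x, hx, by rwa [Set.mem_preimage, hxy]⟩ fun u hu v hv huX huv => by
    by_cases he : f u = f v
    · exact (he ▸ huX : f v ∈ X)
    · exact hcl _ ⟨u, hu, rfl⟩ _ ⟨v, hv, rfl⟩ huX (quot_adj_of huv he)
  rintro _ ⟨x, hx, rfl⟩
  exact this hx

theorem Model.image_quot {K : SimpleGraph U} {μ : U → Set W} (h : Model K G μ) {f : W → W'}
    (hf : ∀ p q, ∀ x ∈ μ p, ∀ y ∈ μ q, f x = f y → p = q) :
    Model K (quot G f) fun p => f '' μ p := by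
  refine ⟨fun p => (h.conn p).image_quot, fun p q hpq => ?_, fun p q hpq => ?_⟩
  · rw [Set.disjoint_left]
    rintro _ ⟨x, hx, rfl⟩ ⟨y, hy, hxy⟩
    exact hpq (hf p q x hx y hy hxy.symm)
  · obtain ⟨x, hx, y, hy, hxy⟩ := h.touch p q hpq
    exact ⟨_, ⟨x, hx, rfl⟩, _, ⟨y, hy, rfl⟩, quot_adj_of hxy fun e => hpq.ne (hf p q x hx y hy e)⟩

open Classical in
/-- The map merging `v` into `u`. -/
noncomputable def mergeMap {u v : W} (huv : u ≠ v) (x : W) : {x : W // x ≠ v} :=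
  if hx : x = v then ⟨u, huv⟩ else ⟨x, hx⟩

theorem mergeMap_self {u v : W} (huv : u ≠ v) : mergeMap huv v = ⟨u, huv⟩ := dif_pos rfl

theorem mergeMap_of_ne {u v : W} (huv : u ≠ v) {x : W} (hx : x ≠ v) :
    mergeMap huv x = ⟨x, hx⟩ := dif_neg hx

theorem mergeMap_eq {u v : W} (huv : u ≠ v) {x y : W} (h : mergeMap huv x = mergeMap huv y) :
    x = y ∨ x = u ∧ y = v ∨ x = v ∧ y = u := by
  by_cases hx : x = v <;> by_cases hy : y = v
  · exact Or.inl (hx.trans hy.symm)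
  · subst hx
    rw [mergeMap_self, mergeMap_of_ne huv hy] at h
    exact Or.inr (Or.inr ⟨rfl, (Subtype.mk.inj h).symm⟩)
  · subst hy
    rw [mergeMap_self, mergeMap_of_ne huv hx] at h
    exact Or.inr (Or.inl ⟨Subtype.mk.inj h, rfl⟩)
  · rw [mergeMap_of_ne huv hy, mergeMap_of_ne huv hx] at h
    exact Or.inl (Subtype.mk.inj h)

theorem mergeMap_fiber {u v : W} (h : G.Adj u v) (w : {x : W // x ≠ v}) :
    Conn G (mergeMap h.ne ⁻¹' {w}) := by
  by_cases hw : (w : W) = u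
  · convert conn_pair h using 1
    ext x
    by_cases hx : x = v
    · subst hx; simp [mergeMap_self, Subtype.ext_iff, hw]
    · simp [mergeMap_of_ne h.ne hx, Subtype.ext_iff, hw, hx]
  · convert conn_singleton (G := G) (w : W) using 1
    ext x
    by_cases hx : x = v
    · subst hx; simp [mergeMap_self, Subtype.ext_iff, Ne.symm hw, Ne.symm w.2]
    · simp [mergeMap_of_ne h.ne hx, Subtype.ext_iff]

theorem card_merge_lt [Finite W] (v : W) : Nat.card {x : W // x ≠ v} < Nat.card W :=
  Finite.card_subtype_lt (x := v) (by simp)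

/-- Reduction of a tied rooted model by contracting an edge. -/
theorem Tied.contract [Finite W] {s : Fin 4 → W} (hs : s.Injective) {μ : Fin 8 → Set W}
    (hμ : Model octa (H0 ⊔ cl (Set.range s)) μ)
    (hno : ∀ A B, IsSeparation (H0 ⊔ cl (Set.range s)) A B → Set.range s ⊆ B →
      (∃ p, μ p ⊆ A \ B) → A ≠ Set.univ → 5 ≤ (A ∩ B).ncard)
    {u v : W} (huv : H0.Adj u v) (hv : v ∉ Set.range s)
    (hm : ∀ p q, u ∈ μ p → v ∈ μ q → p = q) :
    ∃ (s' : Fin 4 → {x : W // x ≠ v}) (H0' : SimpleGraph {x : W // x ≠ v})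
      (μ' : Fin 8 → Set {x : W // x ≠ v}) (bag : {x : W // x ≠ v} → Set W), s'.Injective ∧
      Model octa (H0' ⊔ cl (Set.range s')) μ' ∧
      Tied (H0' ⊔ cl (Set.range s')) (Set.range s') μ' ∧
      Model H0' H0 bag ∧ ∀ i, s i ∈ bag (s' i) := by
  have hsv : ∀ i, s i ≠ v := fun i e => hv ⟨i, e⟩
  set f := mergeMap huv.ne with hf
  let s' : Fin 4 → {x : W // x ≠ v} := fun i => ⟨s i, hsv i⟩
  have hs' : s'.Injective := fun i j hij => hs (Subtype.mk.inj hij)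
  have hfs : ∀ i, f (s i) = s' i := fun i => mergeMap_of_ne _ (hsv i)
  have hle : quot (H0 ⊔ cl (Set.range s)) f ≤ quot H0 f ⊔ cl (Set.range s') := by
    rintro a b ⟨hne, x, y, rfl, rfl, hxy | ⟨-, ⟨i, rfl⟩, ⟨j, rfl⟩⟩⟩
    · exact Or.inl (quot_adj_of hxy hne)
    · exact Or.inr ⟨hne, ⟨i, (hfs i).symm⟩, ⟨j, (hfs j).symm⟩⟩
  refine ⟨s', quot H0 f, fun p => f '' μ p, fun w => f ⁻¹' {w}, hs', (hμ.image_quot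
    fun p q x hx y hy he => ?_).mono_graph hle, ?_, quot_model (mergeMap_fiber huv), hfs⟩
  · rcases mergeMap_eq _ he with rfl | ⟨rfl, rfl⟩ | ⟨rfl, rfl⟩
    · by_contra hne
      exact Set.disjoint_left.1 (hμ.disj p q hne) hx hy
    · exact hm p q hx hy
    · exact (hm q p hy hx).symm
  · rintro X Y hXY hSY ⟨q, hq⟩
    by_cases hX : X = Set.univ
    · rw [hX, Set.univ_inter]
      have h4 : (Set.range s').ncard = 4 := by
        rw [← Set.image_univ, Set.ncard_image_of_injective _ hs', Set.ncard_univ]; simp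
      exact h4 ▸ Set.ncard_le_ncard hSY (Set.toFinite _)
    have h1 : IsSeparation (H0 ⊔ cl (Set.range s)) (f ⁻¹' X) (f ⁻¹' Y) := by
      refine isSeparation_of (fun x => hXY.mem_or (f x)) fun x y hxy hx => ?_
      by_cases he : f x = f y
      · exact (he ▸ (hXY.mem_or (f x)).resolve_right hx : f y ∈ X)
      · exact hXY.mem_left (hle (quot_adj_of hxy he)) hx
    have h2 := hno _ _ h1 (by rintro _ ⟨i, rfl⟩; exact hSY ⟨i, (hfs i).symm⟩)
      ⟨q, fun x hx => hq ⟨x, hx, rfl⟩⟩ (fun he => hX (Set.eq_univ_of_forall fun w => by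
        have : (w : W) ∈ f ⁻¹' X := he ▸ Set.mem_univ _
        rwa [Set.mem_preimage, hf, mergeMap_of_ne _ w.2] at this))
    have h3 : f ⁻¹' X ∩ f ⁻¹' Y ⊆ insert v (Subtype.val '' (X ∩ Y)) := by
      intro x hx
      by_cases hxv : x = v
      · exact Or.inl hxv
      · have hx' : f x = ⟨x, hxv⟩ := mergeMap_of_ne _ hxv
        rw [← Set.preimage_inter, Set.mem_preimage, hx'] at hx
        exact Or.inr ⟨_, hx, rfl⟩
    have h4 := (Set.ncard_le_ncard h3 (Set.toFinite _)).trans (Set.ncard_insert_le _ _)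
    rw [Set.ncard_image_of_injective _ Subtype.val_injective] at h4
    omega

end Contract

section Terminal

variable {W : Type} {H H0 : SimpleGraph W} {s : Fin 4 → W} {μ : Fin 8 → Set W} {φ : Fin 4 → Fin 8}

/-- A reindexed form of `vee_of_weak`. -/
theorem vee_of_weak_at {f : Fin 8 → Set W} (hc : ∀ i, Conn H (f i))
    (hd : ∀ i j, i ≠ j → Disjoint (f i) (f j)) {a b : Fin 8} (hab : octa.Adj a b)
    (ht : ∀ i j, i ≠ a → j ≠ a → octa.Adj i j → Touch H (f i) (f j))
    (hbb : Touch H (f b) (f (anti b))) (h1 : Touch H (f a) (f b)) (h2 : Touch H (f a) (f (anti b)))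
    {d e : Fin 8} (hde : d ≠ e) (hda : octa.Adj a d) (hdb : octa.Adj b d) (hea : octa.Adj a e)
    (heb : octa.Adj b e) (h0d : Touch H (f a) (f d)) (h0e : Touch H (f a) (f e)) :
    IsMinor K7vee H := by
  obtain ⟨σ, hσ, hadj, hanti, rfl, rfl⟩ := exists_octa_aut a b hab
  have hsurj : σ.Surjective := Finite.surjective_of_injective hσ
  obtain ⟨d, rfl⟩ := hsurj d
  obtain ⟨e, rfl⟩ := hsurj e
  have h4 : ∀ d, octa.Adj (σ 0) (σ d) → octa.Adj (σ 2) (σ d) → 4 ≤ d.val := by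
    intro d h0 h2
    rw [octa_adj_iff, ← hanti] at h0 h2
    have e0 : d ≠ 0 := fun e => h0.1 (e ▸ rfl)
    have e1 : d ≠ 1 := fun e => h0.2 (e ▸ rfl)
    have e2 : d ≠ 2 := fun e => h2.1 (e ▸ rfl)
    have e3 : d ≠ 3 := fun e => h2.2 (e ▸ rfl)
    omega
  have h3 : anti (σ 2) = σ 3 := (hanti 2).symm
  rw [h3] at hbb h2
  exact vee_of_weak (f := f ∘ σ) (fun i => hc _) (fun i j hij => hd _ _ fun e => hij (hσ e))
    (fun i j hi hj hij => ht _ _ (fun e => hi (hσ e)) (fun e => hj (hσ e)) (hadj i j hij)) hbb h1 h2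
    (fun he => hde (by rw [he])) (h4 d hda hdb) (h4 e hea heb) h0d h0e

open Classical in
/-- A model of `octa` in `H0` plus a clique on the roots, in which no further reduction is
possible: the bags containing roots consist of roots, and Hall's condition holds with surplus. -/
structure Rooted (H0 : SimpleGraph W) (s : Fin 4 → W) (μ : Fin 8 → Set W)
    (φ : Fin 4 → Fin 8) : Prop where
  inj : s.Injective
  model : Model octa (H0 ⊔ cl (Set.range s)) μ
  mem : ∀ i q, s i ∈ μ q ↔ φ i = q
  sub : ∀ i, μ (φ i) ⊆ Set.range s
  surplus : ∀ X : Finset (Fin 4), X.Nonempty →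
    (∃ q, (∀ i, φ i ≠ q) ∧ ∀ i ∈ X, ¬ Touch H0 {s i} (μ q)) →
    X.card + 1 ≤ (Finset.univ.filter fun q => (∀ i, φ i ≠ q) ∧ ∃ i ∈ X, Touch H0 {s i} (μ q)).card

theorem Rooted.notMem (h : Rooted H0 s μ φ) {q : Fin 8} (hq : ∀ i, φ i ≠ q) {x : W} (hx : x ∈ μ q) :
    x ∉ Set.range s := by
  rintro ⟨i, rfl⟩
  exact hq i ((h.mem i q).1 hx)

theorem Rooted.conn (h : Rooted H0 s μ φ) {q : Fin 8} (hq : ∀ i, φ i ≠ q) : Conn H0 (μ q) :=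
  (h.model.conn q).mono_graph fun _ hu _ _ huv =>
    huv.resolve_right fun hn => h.notMem hq hu hn.2.1

theorem Rooted.touch (h : Rooted H0 s μ φ) {p q : Fin 8} (hq : ∀ i, φ i ≠ q)
    (hpq : octa.Adj p q) : Touch H0 (μ p) (μ q) := by
  obtain ⟨u, hu, v, hv, huv⟩ := h.model.touch p q hpq
  exact ⟨u, hu, v, hv, huv.resolve_right fun hn => h.notMem hq hv hn.2.2⟩

theorem Rooted.root (h : Rooted H0 s μ φ) {i : Fin 4} {q : Fin 8} (hq : ∀ i, φ i ≠ q)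
    (hpq : octa.Adj (φ i) q) : ∃ j, φ j = φ i ∧ Touch H0 {s j} (μ q) := by
  obtain ⟨u, hu, v, hv, huv⟩ := h.touch hq hpq
  obtain ⟨j, rfl⟩ := h.sub i hu
  exact ⟨j, (h.mem _ _).1 hu, s j, rfl, v, hv, huv⟩

open Classical in
theorem Rooted.exists_matching (h : Rooted H0 s μ φ) (a : Fin 8)
    (hO : 4 ≤ (Finset.univ.filter fun q => (∀ i, φ i ≠ q) ∧ q ≠ a).card) :
    ∃ π : Fin 4 → Fin 8, π.Injective ∧ ∀ i, (∀ j, φ j ≠ π i) ∧ π i ≠ a ∧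
      Touch H0 {s i} (μ (π i)) := by
  have hall : ∀ X : Finset (Fin 4), X.card ≤ (X.biUnion fun i =>
      Finset.univ.filter fun q => (∀ j, φ j ≠ q) ∧ q ≠ a ∧ Touch H0 {s i} (μ q)).card := by
    intro X
    rcases X.eq_empty_or_nonempty with rfl | hX
    · simp
    by_cases hq : ∃ q, (∀ i, φ i ≠ q) ∧ ∀ i ∈ X, ¬ Touch H0 {s i} (μ q)
    · have h1 := h.surplus X hX hq
      have h2 := Finset.pred_card_le_card_erase (a := a)
        (s := Finset.univ.filter fun q => (∀ i, φ i ≠ q) ∧ ∃ i ∈ X, Touch H0 {s i} (μ q))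
      refine le_trans (by omega) (h2.trans (Finset.card_le_card fun q hq => ?_))
      simp only [Finset.mem_erase, Finset.mem_filter, Finset.mem_univ, true_and,
        Finset.mem_biUnion] at hq ⊢
      obtain ⟨hqa, hq, i, hi, ht⟩ := hq
      exact ⟨i, hi, hq, hqa, ht⟩
    · push Not at hq
      have h1 := X.card_le_univ
      refine le_trans (by simpa using h1) (hO.trans (Finset.card_le_card fun q hq' => ?_))
      simp only [Finset.mem_filter, Finset.mem_univ, true_and, Finset.mem_biUnion] at hq' ⊢
      obtain ⟨i, hi, ht⟩ := hq q hq'.1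
      exact ⟨i, hi, hq'.1, hq'.2, ht⟩
  obtain ⟨π, hπ, hmem⟩ := (Finset.all_card_le_biUnion_card_iff_exists_injective _).1 hall
  exact ⟨π, hπ, fun i => by simpa using hmem i⟩

theorem Rooted.disj_root (h : Rooted H0 s μ φ) {i : Fin 4} {q : Fin 8} (hq : ∀ i, φ i ≠ q) :
    Disjoint {s i} (μ q) := by
  rw [Set.disjoint_singleton_left, h.mem]
  exact hq i

open Classical in
theorem Rooted.card_compl (φ : Fin 4 → Fin 8) : (Finset.univ.filter fun q => ∀ i, φ i ≠ q).card =
    8 - (Finset.univ.image φ).card := by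
  have : (Finset.univ.filter fun q => ∀ i, φ i ≠ q) = (Finset.univ.image φ)ᶜ := by
    ext q; simp
  rw [this, Finset.card_compl, Fintype.card_fin]

/-- Rooted `K₄` when each root lies in its own bag. -/
theorem Rooted.k4_of_injective (h : Rooted H0 s μ φ) (hφ : φ.Injective) :
    RMinor (⊤ : SimpleGraph (Fin 4)) id H0 s := by
  classical
  obtain ⟨π, hπ, hm⟩ := h.exists_matching (φ 0) (by
    have h1 := Rooted.card_compl φ
    rw [Finset.card_image_of_injective _ hφ, Finset.card_univ, Fintype.card_fin] at h1
    refine h1.symm.le.trans (Finset.card_le_card fun q hq => ?_)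
    simp only [Finset.mem_filter, Finset.mem_univ, true_and] at hq ⊢
    exact ⟨hq, fun e => hq 0 e.symm⟩)
  refine ⟨fun i => {s i} ∪ μ (π i), ⟨fun i => ?_, fun i j hij => ?_, fun i j hij => ?_⟩,
    fun i => Or.inl rfl⟩
  · exact (conn_singleton _).union (h.conn (hm i).1) (hm i).2.2
  · refine Set.disjoint_union_left.2 ⟨Set.disjoint_union_right.2 ⟨?_, h.disj_root (hm j).1⟩,
      Set.disjoint_union_right.2 ⟨(h.disj_root (hm i).1).symm, h.model.disj _ _ fun e => hij (hπ e)⟩⟩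
    exact Set.disjoint_singleton.2 fun e => hij (h.inj e)
  · by_cases ha : octa.Adj (π i) (π j)
    · exact (h.touch (hm j).1 ha).mono Set.subset_union_right Set.subset_union_right
    · have ha' : π j = anti (π i) := by
        by_contra hne
        exact ha ((octa_adj_iff _ _).2 ⟨fun e => hij.symm (hπ e), hne⟩)
      obtain ⟨k, hk, ht⟩ := h.root (i := i) (hm j).1 ((octa_adj_iff _ _).2 ⟨((hm j).1 i).symm,
        fun e => (hm i).1 i (by rw [ha', anti_eq_iff, anti_anti] at e; exact e.symm)⟩)
      rw [hφ hk] at ht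
      exact ht.mono Set.subset_union_left Set.subset_union_right

/-- Enlarging two bags repairs all antipodal pairs of a matching. -/
theorem exists_repair {π : Fin 4 → Fin 8} (hπ : π.Injective) {q : Fin 8} (hq : ∀ i, π i ≠ q) :
    ∃ i₀ j₀, i₀ ≠ j₀ ∧ ∀ i j, π j = anti (π i) →
      i = i₀ ∨ j = i₀ ∨ ((i = j₀ ∨ j = j₀) ∧ ∀ k, π k ≠ anti q) := by
  by_cases h1 : ∃ i j, π j = anti (π i)
  swap
  · exact ⟨0, 1, by decide, fun i j hij => absurd ⟨i, j, hij⟩ h1⟩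
  obtain ⟨i₀, j₁, h1⟩ := h1
  have hpart : ∀ i j k l, π j = anti (π i) → π l = anti (π k) → (i = k ↔ j = l) := by
    intro i j k l h h'
    constructor
    · rintro rfl; exact hπ (h.trans h'.symm)
    · rintro rfl
      apply hπ
      rw [← anti_anti (π i), ← h, h', anti_anti]
  have hsymm : ∀ i j, π j = anti (π i) → π i = anti (π j) := fun i j h => by rw [h, anti_anti]
  have hirr : ∀ i j, π j = anti (π i) → i ≠ j := by
    rintro i _ h rfl; exact anti_ne _ h.symm
  by_cases h2 : ∃ k l, π l = anti (π k) ∧ k ≠ i₀ ∧ l ≠ i₀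
  · obtain ⟨k, l, hkl, hk, hl⟩ := h2
    have e1 := hpart i₀ j₁ k l h1 hkl
    have e2 := hpart i₀ j₁ l k h1 (hsymm _ _ hkl)
    have e3 := hirr _ _ h1
    have e4 := hirr _ _ hkl
    have hall : ∀ m, m = i₀ ∨ m = j₁ ∨ m = k ∨ m = l := by omega
    refine ⟨i₀, k, hk.symm, fun i j hij => ?_⟩
    by_cases hi : i = i₀
    · exact Or.inl hi
    by_cases hj : j = i₀
    · exact Or.inr (Or.inl hj)
    refine Or.inr (Or.inr ⟨?_, fun m hm => ?_⟩)
    · have e5 := hpart i₀ j₁ i j h1 hij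
      have e6 := hpart i₀ j₁ j i h1 (hsymm _ _ hij)
      have e7 := hirr _ _ hij
      have := hall i
      have := hall j
      omega
    · rcases hall m with rfl | rfl | rfl | rfl
      · exact hq j₁ (by rw [h1, hm, anti_anti])
      · exact hq i₀ (by rw [hsymm _ _ h1, hm, anti_anti])
      · exact hq l (by rw [hkl, hm, anti_anti])
      · exact hq k (by rw [hsymm _ _ hkl, hm, anti_anti])
  · push Not at h2
    have : ∃ j, i₀ ≠ j := ⟨j₁, hirr _ _ h1⟩
    obtain ⟨j, hj⟩ := this
    refine ⟨i₀, j, hj, fun i j hij => ?_⟩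
    by_cases hi : i = i₀
    · exact Or.inl hi
    · exact Or.inr (Or.inl (h2 i j hij hi))

end Terminal

section Terminal

variable {W : Type} {H H0 : SimpleGraph W} {s : Fin 4 → W} {μ : Fin 8 → Set W} {φ : Fin 4 → Fin 8}

/-- If two roots share a bag, some antipodal pair of bags contains no root. -/
theorem exists_free_pair (hφ : ¬ φ.Injective) : ∃ q, (∀ i, φ i ≠ q) ∧ ∀ i, φ i ≠ anti q := by
  let f : Fin 4 → Fin 4 := fun i => ⟨(φ i).val / 2, by omega⟩
  have hf : ¬ f.Surjective := fun hs => hφ fun i j hij =>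
    Finite.injective_iff_surjective.2 hs (by simp [f, hij])
  have : ∃ k, ∀ i, f i ≠ k := by simpa [Function.Surjective] using hf
  obtain ⟨k, hk⟩ := this
  have h1 : ∀ k : Fin 4, (anti ⟨2 * k.val, by omega⟩).val = 2 * k.val + 1 := by decide
  have h2 : ∀ i, (φ i).val / 2 ≠ k.val := fun i e => hk i (Fin.ext e)
  refine ⟨⟨2 * k.val, by omega⟩, fun i e => h2 i ?_, fun i e => h2 i ?_⟩
  · rw [e]; simp
  · rw [e, h1]; omega

/-- The bags used for a rooted `K₄` when some bag has several roots. -/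
theorem Rooted.k4_of_not_injective (h : Rooted H0 s μ φ) (hφ : ¬ φ.Injective) :
    RMinor (⊤ : SimpleGraph (Fin 4)) id H0 s := by
  classical
  obtain ⟨q, hq, hq'⟩ := exists_free_pair hφ
  obtain ⟨π, hπ, hm⟩ := h.exists_matching q (by
    have h1 := Rooted.card_compl φ
    have h2 : (Finset.univ.image φ).card ≠ (Finset.univ : Finset (Fin 4)).card := fun e =>
      hφ fun i j hij => Finset.card_image_iff.1 e (Finset.mem_univ i) (Finset.mem_univ j) hij
    have h3 := Finset.card_image_le (s := (Finset.univ : Finset (Fin 4))) (f := φ)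
    rw [Finset.card_univ, Fintype.card_fin] at h2 h3
    have h4 := Finset.pred_card_le_card_erase (a := q) (s := Finset.univ.filter fun q => ∀ i, φ i ≠ q)
    refine le_trans (by omega) (h4.trans (Finset.card_le_card fun x hx => ?_))
    simp only [Finset.mem_erase, Finset.mem_filter, Finset.mem_univ, true_and] at hx ⊢
    exact ⟨hx.2, hx.1⟩)
  obtain ⟨i₀, j₀, hne, hrep⟩ := exists_repair hπ (fun i => (hm i).2.1)
  have hπO := fun i => (hm i).1
  have hπq := fun i => (hm i).2.1
  let c₁ : Fin 4 → Prop := fun i => i = i₀ ∧ π i ≠ anti q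
  let c₂ : Fin 4 → Prop := fun i => i = j₀ ∧ ∀ k, π k ≠ anti q
  let B : Fin 4 → Set W := fun i => {s i} ∪ μ (π i) ∪ {x | x ∈ μ q ∧ c₁ i} ∪
    {x | x ∈ μ (anti q) ∧ c₂ i}
  have hmemB : ∀ i x, x ∈ B i → x = s i ∨ ∃ p, (∀ k, φ k ≠ p) ∧ x ∈ μ p ∧
      (p = π i ∨ p = q ∧ i = i₀ ∨ p = anti q ∧ c₂ i) := by
    rintro i x (((hx | hx) | hx) | hx)
    · exact Or.inl hx
    · exact Or.inr ⟨_, hπO i, hx, Or.inl rfl⟩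
    · exact Or.inr ⟨_, hq, hx.1, Or.inr (Or.inl ⟨rfl, hx.2.1⟩)⟩
    · exact Or.inr ⟨_, hq', hx.1, Or.inr (Or.inr ⟨rfl, hx.2⟩)⟩
  have hadd : ∀ i p (c : Prop) (S : Set W), (∀ k, φ k ≠ p) → μ (π i) ⊆ S → Conn H0 S →
      (c → octa.Adj (π i) p) → Conn H0 (S ∪ {x | x ∈ μ p ∧ c}) := by
    intro i p c S hp hS hSc hadj
    by_cases hc : c
    · simp only [hc, and_true, Set.ofPred_mem_eq]
      exact hSc.union (h.conn hp) ((h.touch hp (hadj hc)).mono hS subset_rfl)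
    · simpa [hc] using hSc
  have htouch : ∀ i j, i ≠ j → π j = anti (π i) → (i = i₀ ∨ i = j₀ ∧ ∀ k, π k ≠ anti q) →
      Touch H0 (B i) (B j) := by
    intro i j hij ha hi
    rcases hi with rfl | hi
    · have h1 : π i ≠ anti q := fun e => hπq j (by rw [ha, e, anti_anti])
      refine (h.touch (p := q) (hπO j) ((octa_adj_iff _ _).2 ⟨hπq j, fun e => hπq i ?_⟩)).mono
        (fun x hx => Or.inl (Or.inr ⟨hx, rfl, h1⟩)) fun x hx => Or.inl (Or.inl (Or.inr hx))
      rw [← anti_anti (π i), ← ha, e, anti_anti]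
    · refine (h.touch (p := anti q) (hπO j) ((octa_adj_iff _ _).2 ⟨hi.2 j, ?_⟩)).mono
        (fun x hx => Or.inr ⟨hx, hi⟩) fun x hx => Or.inl (Or.inl (Or.inr hx))
      rw [anti_anti]; exact hπq j
  refine ⟨B, ⟨fun i => ?_, fun i j hij => ?_, fun i j hij => ?_⟩,
    fun i => Or.inl (Or.inl (Or.inl rfl))⟩
  · refine hadd i (anti q) _ _ hq' (fun x hx => Or.inl (Or.inr hx)) (hadd i q _ _ hq
      Set.subset_union_right ((conn_singleton _).union (h.conn (hπO i)) (hm i).2.2) fun hc => ?_)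
      fun hc => ?_
    · refine (octa_adj_iff _ _).2 ⟨(hπq i).symm, fun e => hc.2 ?_⟩
      rw [e, anti_anti]
    · exact (octa_adj_iff _ _).2 ⟨(hc.2 i).symm, fun e => hπq i (by
        rw [← anti_anti (π i), ← e, anti_anti])⟩
  · refine Set.disjoint_left.2 fun x hx hx' => ?_
    rcases hmemB i x hx with rfl | ⟨p, hp, hxp, hpi⟩ <;>
      rcases hmemB j _ hx' with hxj | ⟨p', hp', hxp', hpj⟩
    · exact hij (h.inj hxj)
    · exact h.notMem hp' hxp' ⟨i, rfl⟩
    · subst hxj; exact h.notMem hp hxp ⟨j, rfl⟩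
    · have hpp : p = p' := by
        by_contra hne
        exact Set.disjoint_left.1 (h.model.disj p p' hne) hxp hxp'
      subst hpp
      have e1 := hπq i
      have e2 := hπq j
      have e3 := anti_ne q
      have e4 : π i = π j → i = j := fun e => hπ e
      rcases hpi with rfl | ⟨rfl, hi⟩ | ⟨rfl, hi⟩ <;> rcases hpj with e | ⟨e, hj⟩ | ⟨e, hj⟩
      · exact hij (hπ e)
      · exact e1 e
      · exact hj.2 i e
      · exact e2 e.symm
      · exact hij (hi.trans hj.symm)
      · exact e3 e.symm
      · exact hi.2 j e.symm
      · exact e3 e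
      · exact hij (hi.1.trans hj.1.symm)
  · by_cases ha : octa.Adj (π i) (π j)
    · exact (h.touch (hπO j) ha).mono (fun x hx => Or.inl (Or.inl (Or.inr hx)))
        (fun x hx => Or.inl (Or.inl (Or.inr hx)))
    · have ha' : π j = anti (π i) := by
        by_contra hn
        exact ha ((octa_adj_iff _ _).2 ⟨fun e => hij.symm (hπ e), hn⟩)
      have ha'' : π i = anti (π j) := by rw [ha', anti_anti]
      rcases hrep i j ha' with hi | hj | ⟨hi | hj, hk⟩
      · exact htouch i j hij ha' (Or.inl hi)
      · exact (htouch j i hij.symm ha'' (Or.inl hj)).symm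
      · exact htouch i j hij ha' (Or.inr ⟨hi, hk⟩)
      · exact (htouch j i hij.symm ha'' (Or.inr ⟨hj, hk⟩)).symm

/-- The fan when each root lies in its own bag. -/
theorem Rooted.fan_of_injective (h : Rooted H0 s μ φ) (hφ : φ.Injective)
    (hanti : ∀ i j, φ j ≠ anti (φ i)) : RMinor fan (fun i => (i, 0)) H0 s := by
  have hfree : ∀ i j, φ j ≠ anti (φ i) := hanti
  have hsingle : ∀ i, μ (φ i) = {s i} := fun i => by
    refine Set.eq_singleton_iff_unique_mem.2 ⟨(h.mem i _).2 rfl, fun x hx => ?_⟩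
    obtain ⟨j, rfl⟩ := h.sub i hx
    rw [hφ ((h.mem j _).1 hx)]
  let g : Fin 4 × Fin 2 → Fin 8 := fun p => if p.2 = 0 then φ p.1 else anti (φ p.1)
  have g0 : ∀ i, g (i, 0) = φ i := fun i => rfl
  have g1 : ∀ i, g (i, 1) = anti (φ i) := fun i => rfl
  have hai : ∀ i j, anti (φ i) = anti (φ j) → i = j := fun i j e => hφ (by
    rw [← anti_anti (φ i), e, anti_anti])
  have hg : g.Injective := by
    rintro ⟨i, x⟩ ⟨j, y⟩ e
    fin_cases x <;> fin_cases y <;> simp only [Fin.zero_eta, Fin.mk_one, g0, g1] at e ⊢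
    · rw [hφ e]
    · exact absurd e (hfree j i)
    · exact absurd e.symm (hfree i j)
    · rw [hai i j e]
  have h01 : ∀ i j, i ≠ j → octa.Adj (φ i) (anti (φ j)) := fun i j hij =>
    (octa_adj_iff _ _).2 ⟨(hfree j i).symm, fun e => hij (hai j i e).symm⟩
  refine ⟨fun p => μ (g p), ⟨fun p => ?_, fun p q hpq => h.model.disj _ _ fun e => hpq (hg e),
    fun p q hpq => ?_⟩, fun i => (h.mem i _).2 rfl⟩
  · obtain ⟨i, x⟩ := p
    fin_cases x
    · simp only [Fin.zero_eta, g0, hsingle]; exact conn_singleton _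
    · simp only [Fin.mk_one, g1]; exact h.conn (hfree i)
  · obtain ⟨i, x⟩ := p
    obtain ⟨j, y⟩ := q
    obtain ⟨hij, hxy⟩ := hpq
    dsimp only at hij hxy
    fin_cases x <;> fin_cases y <;> simp only [Fin.zero_eta, Fin.mk_one, g0, g1]
    · simp at hxy
    · exact h.touch (hfree j) (h01 i j hij)
    · exact (h.touch (hfree i) (h01 j i hij.symm)).symm
    · exact h.touch (hfree j) ((octa_adj_iff _ _).2 ⟨fun e => hij (hai j i e).symm, fun e =>
        hfree j i (by rw [e, anti_anti])⟩)

theorem conn_of_subset_range {S : Set W} (hS : S ⊆ Set.range s) (hne : S.Nonempty) :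
    Conn (H0 ⊔ cl (Set.range s)) S :=
  conn_of_closed hne fun A ⟨x, hx, hxA⟩ hcl y hy => by
    by_cases hxy : x = y
    · exact hxy ▸ hxA
    · exact hcl x hx y hy hxA (Or.inr ⟨hxy, hS hx, hS hy⟩)

end Terminal

section Terminal

variable {W : Type} {H H0 : SimpleGraph W} {s : Fin 4 → W} {μ : Fin 8 → Set W} {φ : Fin 4 → Fin 8}

theorem touch_root {i j : Fin 4} (h : Rooted H0 s μ φ) (hij : i ≠ j) {S T : Set W} (hS : s i ∈ S)
    (hT : s j ∈ T) : Touch (H0 ⊔ cl (Set.range s)) S T :=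
  ⟨s i, hS, s j, hT, Or.inr ⟨fun e => hij (h.inj e), ⟨i, rfl⟩, ⟨j, rfl⟩⟩⟩

/-- A shared bag `μ a` can donate the root `s j` to the bag opposite to `b`. -/
theorem Rooted.vee_of_donate (h : Rooted H0 s μ φ) {i j k : Fin 4} {d e : Fin 8}
    (hji : φ j = φ i) (hne : j ≠ i) (hki : φ k ≠ φ i) (hanti : ∀ i j, φ j ≠ anti (φ i))
    (ht : Touch H0 {s j} (μ (anti (φ k)))) (hde : d ≠ e)
    (hda : octa.Adj (φ i) d) (hdb : octa.Adj (φ k) d) (hea : octa.Adj (φ i) e)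
    (heb : octa.Adj (φ k) e)
    (hd : Touch (H0 ⊔ cl (Set.range s)) (μ (φ i) \ {s j}) (μ d))
    (he : Touch (H0 ⊔ cl (Set.range s)) (μ (φ i) \ {s j}) (μ e)) :
    IsMinor K7vee (H0 ⊔ cl (Set.range s)) := by
  classical
  have hjk : j ≠ k := fun e => hki (by rw [← e, hji])
  have hik : i ≠ k := fun e => hki (by rw [← e])
  have hb' : ∀ l, φ l ≠ anti (φ k) := fun l => hanti k l
  have hab' : anti (φ k) ≠ φ i := (hb' i).symm
  let f : Fin 8 → Set W := fun q => if q = φ i then μ (φ i) \ {s j} else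
    if q = anti (φ k) then μ (anti (φ k)) ∪ {s j} else μ q
  have fa : f (φ i) = μ (φ i) \ {s j} := if_pos rfl
  have fb' : f (anti (φ k)) = μ (anti (φ k)) ∪ {s j} := by simp [f, hab']
  have fo : ∀ q, q ≠ φ i → q ≠ anti (φ k) → f q = μ q := fun q h1 h2 => by simp [f, h1, h2]
  have fs : ∀ q, q ≠ φ i → μ q ⊆ f q := by
    intro q hq
    by_cases hq' : q = anti (φ k)
    · rw [hq', fb']; exact Set.subset_union_left
    · rw [fo q hq hq']
  have hsi : s i ∈ f (φ i) := by
    rw [fa]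
    exact ⟨(h.mem _ _).2 rfl, fun e => hne (h.inj e).symm⟩
  have hsub : ∀ q, f q ⊆ μ q \ {s j} ∪ {x | x = s j ∧ q = anti (φ k)} := by
    intro q x hx
    by_cases h1 : q = φ i
    · subst h1; rw [fa] at hx; exact Or.inl hx
    by_cases h2 : q = anti (φ k)
    · subst h2
      rw [fb'] at hx
      by_cases hxj : x = s j
      · exact Or.inr ⟨hxj, rfl⟩
      · exact Or.inl ⟨hx.resolve_right hxj, hxj⟩
    · rw [fo q h1 h2] at hx
      refine Or.inl ⟨hx, fun e => h1 ?_⟩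
      rw [Set.mem_singleton_iff.1 e, h.mem] at hx
      rw [← hx, hji]
  refine vee_of_weak_at (f := f) (a := φ i) (b := φ k) (fun q => ?_) (fun p q hpq => ?_)
    ((octa_adj_iff _ _).2 ⟨hki, hanti i k⟩) (fun p q hp hq hpq => ?_) ?_ ?_ ?_ hde hda hdb hea heb
    ?_ ?_
  · by_cases h1 : q = φ i
    · subst h1; rw [fa]
      exact conn_of_subset_range (Set.sdiff_subset.trans (h.sub i)) ⟨_, fa ▸ hsi⟩
    by_cases h2 : q = anti (φ k)
    · subst h2; rw [fb']
      exact (h.model.conn _).union (conn_singleton _) (ht.symm.mono_graph le_sup_left)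
    · rw [fo q h1 h2]; exact h.model.conn _
  · refine Set.disjoint_left.2 fun x hx hx' => ?_
    rcases hsub p hx with hx1 | ⟨rfl, h1⟩ <;> rcases hsub q hx' with hx2 | ⟨h3, h2⟩
    · exact Set.disjoint_left.1 (h.model.disj p q hpq) hx1.1 hx2.1
    · exact hx1.2 h3
    · exact hx2.2 rfl
    · exact hpq (h1.trans h2.symm)
  · exact (h.model.touch p q hpq).mono (fs p hp) (fs q hq)
  · refine touch_root h hjk.symm (fs _ hki ((h.mem _ _).2 rfl)) ?_
    rw [fb']; exact Or.inr rfl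
  · exact touch_root h hik hsi (fs _ hki ((h.mem _ _).2 rfl))
  · refine touch_root h hne.symm hsi ?_
    rw [fb']; exact Or.inr rfl
  · rw [fa]; exact hd.mono subset_rfl (fs d ((octa_adj_iff _ _).1 hda).1)
  · rw [fa]; exact he.mono subset_rfl (fs e ((octa_adj_iff _ _).1 hea).1)

theorem Rooted.vee_of_two (h : Rooted H0 s μ φ) {i₁ i₂ k : Fin 4} (h12 : i₁ ≠ i₂)
    (h2 : φ i₂ = φ i₁) (hk : φ k ≠ φ i₁) (hanti : ∀ i j, φ j ≠ anti (φ i))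
    (hnt : ∀ i, ¬ Touch H0 {s i} (μ (anti (φ i)))) : IsMinor K7vee (H0 ⊔ cl (Set.range s)) := by
  classical
  have hD : ∀ a b : Fin 8, octa.Adj a b → ∃ d1 d2 d3, d1 ≠ d2 ∧ d1 ≠ d3 ∧ d2 ≠ d3 ∧
      octa.Adj a d1 ∧ octa.Adj b d1 ∧ octa.Adj a d2 ∧ octa.Adj b d2 ∧ octa.Adj a d3 ∧
      octa.Adj b d3 := by decide +kernel
  have hab : octa.Adj (φ i₁) (φ k) := (octa_adj_iff _ _).2 ⟨hk, hanti _ _⟩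
  have hab' : octa.Adj (φ i₁) (anti (φ k)) := (octa_adj_iff _ _).2 ⟨fun e => hanti k i₁ e.symm,
    fun e => hk (by rw [← anti_anti (φ k), e, anti_anti])⟩
  obtain ⟨j, hj, hjt⟩ := h.root (hanti k) hab'
  have : ∃ i, i ≠ j ∧ φ i = φ i₁ := by
    by_cases e : i₁ = j
    · exact ⟨i₂, fun e' => h12 (e.trans e'.symm), h2⟩
    · exact ⟨i₁, e, rfl⟩
  obtain ⟨i, hij, hi⟩ := this
  rw [← hi] at hj hk hab hab'
  clear hi h2 h12
  let D : Fin 8 → Prop := fun d => octa.Adj (φ i) d ∧ octa.Adj (φ k) d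
  let seen : Fin 4 → Fin 8 → Prop := fun j d =>
    Touch (H0 ⊔ cl (Set.range s)) (μ (φ i) \ {s j}) (μ d)
  have hseen : ∀ j l d, l ≠ j → φ l = φ i → Touch H0 {s l} (μ d) → seen j d := by
    intro j l d hlj hl ht
    refine (ht.mono_graph le_sup_left).mono (Set.singleton_subset_iff.2 ⟨?_, fun e => ?_⟩) subset_rfl
    · exact (h.mem _ _).2 hl
    · exact hlj (h.inj e)
  have hunseen : ∀ d, D d → ¬ seen j d → Touch H0 {s j} (μ d) := by
    intro d hd hns
    have hfree : ∀ l, φ l ≠ d := fun l e => hns (touch_root h (i := i) (j := l) (fun e' => ?_)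
      ⟨(h.mem _ _).2 rfl, fun e => hij (h.inj e)⟩ ((h.mem _ _).2 e))
    · obtain ⟨l, hl, ht⟩ := h.root hfree hd.1
      by_cases hlj : l = j
      · exact hlj ▸ ht
      · exact absurd (hseen j l d hlj hl ht) hns
    · exact ((octa_adj_iff _ _).1 hd.1).1 (by rw [← e, e'])
  by_cases hs : ∃ d e, d ≠ e ∧ D d ∧ D e ∧ seen j d ∧ seen j e
  · obtain ⟨d, e, hde, hd, he, hsd, hse⟩ := hs
    exact h.vee_of_donate hj hij.symm hk hanti hjt hde hd.1 hd.2 he.1 he.2 hsd hse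
  have hs2 : ∃ d e, d ≠ e ∧ D d ∧ D e ∧ ¬ seen j d ∧ ¬ seen j e := by
    obtain ⟨d1, d2, d3, h12, h13, h23, a1, b1, a2, b2, a3, b3⟩ := hD _ _ hab
    by_cases e1 : seen j d1
    · exact ⟨d2, d3, h23, ⟨a2, b2⟩, ⟨a3, b3⟩, fun e => hs ⟨d1, d2, h12, ⟨a1, b1⟩, ⟨a2, b2⟩, e1, e⟩,
        fun e => hs ⟨d1, d3, h13, ⟨a1, b1⟩, ⟨a3, b3⟩, e1, e⟩⟩
    by_cases e2 : seen j d2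
    · exact ⟨d1, d3, h13, ⟨a1, b1⟩, ⟨a3, b3⟩, e1,
        fun e => hs ⟨d2, d3, h23, ⟨a2, b2⟩, ⟨a3, b3⟩, e2, e⟩⟩
    · exact ⟨d1, d2, h12, ⟨a1, b1⟩, ⟨a2, b2⟩, e1, e2⟩
  obtain ⟨d, e, hde, hd, he, hsd, hse⟩ := hs2
  let X : Finset (Fin 4) := Finset.univ.filter fun l => φ l = φ i ∧ l ≠ j
  have hmX : ∀ l, l ∈ X ↔ φ l = φ i ∧ l ≠ j := fun l => by simp [X]
  have hXne : X.Nonempty := ⟨i, (hmX i).2 ⟨rfl, hij⟩⟩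
  have hsur := h.surplus X hXne ⟨anti (φ i), fun l => hanti i l, fun l hl => by
    rw [← ((hmX l).1 hl).1]; exact hnt l⟩
  have hX1 := hXne.card_pos
  obtain ⟨p, hp, q, hq, hpq⟩ := Finset.one_lt_card.1
    (lt_of_lt_of_le (show 1 < X.card + 1 by omega) hsur)
  simp only [Finset.mem_filter, Finset.mem_univ, true_and] at hp hq
  have hcase : ∀ p, ((∀ l, φ l ≠ p) ∧ ∃ l ∈ X, Touch H0 {s l} (μ p)) →
      p = anti (φ k) ∨ D p ∧ seen j p := by
    rintro p ⟨hfree, l, hl, ht⟩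
    rw [hmX] at hl
    by_cases e : p = anti (φ k)
    · exact Or.inl e
    refine Or.inr ⟨⟨(octa_adj_iff _ _).2 ⟨(hfree i).symm, fun e => ?_⟩,
      (octa_adj_iff _ _).2 ⟨(hfree k).symm, e⟩⟩, hseen j l p hl.2 hl.1 ht⟩
    rw [e, ← hl.1] at ht
    exact hnt l ht
  have hb : ∃ l ∈ X, Touch H0 {s l} (μ (anti (φ k))) := by
    rcases hcase p hp with rfl | hp'
    · exact hp.2
    rcases hcase q hq with rfl | hq'
    · exact hq.2
    · exact absurd ⟨p, q, hpq, hp'.1, hq'.1, hp'.2, hq'.2⟩ hs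
  obtain ⟨l, hl, ht⟩ := hb
  rw [hmX] at hl
  have hjl : φ l = φ j := hl.1.trans hj.symm
  have := h.vee_of_donate (i := j) (j := l) (k := k) (d := d) (e := e) hjl hl.2 (by rwa [hj])
    hanti ht hde (by rw [hj]; exact hd.1) hd.2 (by rw [hj]; exact he.1) he.2
    (by rw [hj]; exact hseen l j d hl.2.symm hj (hunseen d hd hsd))
    (by rw [hj]; exact hseen l j e hl.2.symm hj (hunseen e he hse))
  exact this

theorem Rooted.vee_of_const (h : Rooted H0 s μ φ) {a : Fin 8} (ha : ∀ i, φ i = a) :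
    IsMinor K7vee (H0 ⊔ cl (Set.range s)) := by
  classical
  have hfree : ∀ q, q ≠ a → ∀ i, φ i ≠ q := fun q hq i e => hq (by rw [← e, ha])
  obtain ⟨π, hπ, hm⟩ := h.exists_matching (anti a) (by
    have : ∀ a : Fin 8, 4 ≤ (Finset.univ.filter fun q => q ≠ a ∧ q ≠ anti a).card := by decide
    refine (this a).trans (Finset.card_le_card fun q hq => ?_)
    simp only [Finset.mem_filter, Finset.mem_univ, true_and] at hq ⊢
    exact ⟨hfree q hq.1, hq.2⟩)
  have hπa : ∀ i, π i ≠ a := fun i e => (hm i).1 i ((ha i).trans e.symm)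
  have hpair : ∃ i j, π j = anti (π i) := by
    by_contra hno
    push Not at hno
    let g : Fin 4 → Fin 4 := fun i => ⟨(π i).val / 2, by omega⟩
    have hkey : ∀ p q : Fin 8, p.val / 2 = q.val / 2 → q = p ∨ q = anti p := by decide
    have hg : g.Injective := fun i j e => by
      rcases hkey (π i) (π j) (Fin.ext_iff.1 e) with e | e
      · exact (hπ e).symm
      · exact absurd e (hno i j)
    obtain ⟨i, hi⟩ := Finite.surjective_of_injective hg ⟨a.val / 2, by omega⟩
    rcases hkey a (π i) (Fin.ext_iff.1 hi).symm with e | e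
    · exact hπa i e
    · exact (hm i).2.1 e
  obtain ⟨i, j, hij⟩ := hpair
  have hne : i ≠ j := by rintro rfl; exact anti_ne _ hij.symm
  obtain ⟨k, l, hkl, hki, hkj, hli, hlj⟩ := (show ∀ i j : Fin 4, ∃ k l : Fin 4, k ≠ l ∧ k ≠ i ∧
    k ≠ j ∧ l ≠ i ∧ l ≠ j by decide) i j
  have hadj : ∀ i, octa.Adj a (π i) := fun i => (octa_adj_iff _ _).2 ⟨hπa i, (hm i).2.1⟩
  have hadj' : ∀ k, k ≠ i → k ≠ j → octa.Adj (π i) (π k) := fun k h1 h2 =>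
    (octa_adj_iff _ _).2 ⟨fun e => h1 (hπ e), fun e => h2 (hπ (e.trans hij.symm))⟩
  let f : Fin 8 → Set W := fun q => if q = a then {s k, s l} else
    μ q ∪ {x | q = π i ∧ x = s i} ∪ {x | q = π j ∧ x = s j}
  have fa : f a = {s k, s l} := if_pos rfl
  have fo : ∀ q, q ≠ a → f q = μ q ∪ {x | q = π i ∧ x = s i} ∪ {x | q = π j ∧ x = s j} :=
    fun q hq => if_neg hq
  have fs : ∀ q, q ≠ a → μ q ⊆ f q := fun q hq x hx => by
    rw [fo q hq]; exact Or.inl (Or.inl hx)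
  have fi : s i ∈ f (π i) := by rw [fo _ (hπa i)]; exact Or.inl (Or.inr ⟨rfl, rfl⟩)
  have fj : s j ∈ f (anti (π i)) := by
    rw [← hij, fo _ (hπa j)]; exact Or.inr ⟨rfl, rfl⟩
  have fk : s k ∈ f a := fa ▸ Or.inl rfl
  have fl : s l ∈ f a := fa ▸ Or.inr rfl
  have hms : ∀ q, q ≠ a → ∀ x ∈ f q, (x ∈ μ q ∧ x ∉ Set.range s) ∨ (x = s i ∧ q = π i) ∨
      (x = s j ∧ q = π j) := by
    intro q hq x hx
    rw [fo q hq] at hx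
    rcases hx with (hx | hx) | hx
    · exact Or.inl ⟨hx, h.notMem (hfree q hq) hx⟩
    · exact Or.inr (Or.inl ⟨hx.2, hx.1⟩)
    · exact Or.inr (Or.inr ⟨hx.2, hx.1⟩)
  have hda : ∀ q, q ≠ a → Disjoint (f a) (f q) := by
    intro q hq
    refine Set.disjoint_left.2 fun x hx hx' => ?_
    have : x = s k ∨ x = s l := by rw [fa] at hx; exact hx
    rcases hms q hq x hx' with h1 | ⟨rfl, -⟩ | ⟨rfl, -⟩
    · rcases this with rfl | rfl <;> exact h1.2 ⟨_, rfl⟩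
    · rcases this with e | e
      · exact hki (h.inj e).symm
      · exact hli (h.inj e).symm
    · rcases this with e | e
      · exact hkj (h.inj e).symm
      · exact hlj (h.inj e).symm
  refine vee_of_weak_at (f := f) (a := a) (b := π i) (d := π k) (e := π l) (fun q => ?_)
    (fun p q hpq => ?_) (hadj i) (fun p q hp hq hpq => ?_) (touch_root h hne fi fj)
    (touch_root h hki fk fi) (touch_root h hkj fk fj) (fun e => hkl (hπ e)) (hadj k)
    (hadj' k hki hkj) (hadj l) (hadj' l hli hlj) ?_ ?_
  · by_cases hq : q = a
    · subst hq
      refine conn_of_subset_range ?_ ⟨_, fk⟩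
      rw [fa]; rintro x (rfl | rfl) <;> exact ⟨_, rfl⟩
    · rw [fo q hq]
      have hadd : ∀ (S : Set W) (m : Fin 4), μ q ⊆ S → Conn (H0 ⊔ cl (Set.range s)) S →
          Conn (H0 ⊔ cl (Set.range s)) (S ∪ {x | q = π m ∧ x = s m}) := by
        intro S m hS hc
        by_cases e : q = π m
        · have : {x | q = π m ∧ x = s m} = {s m} := by ext; simp [e]
          rw [this]
          refine hc.union (conn_singleton _) ?_
          exact ((hm m).2.2.symm.mono_graph le_sup_left).mono (by rw [← e]; exact hS) subset_rfl
        · simpa [e] using hc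
      exact hadd _ _ Set.subset_union_left (hadd _ _ subset_rfl (h.model.conn q))
  · by_cases hp : p = a
    · subst hp; exact hda q hpq.symm
    by_cases hq : q = a
    · subst hq; exact (hda p hpq).symm
    refine Set.disjoint_left.2 fun x hx hx' => ?_
    rcases hms p hp x hx with h1 | ⟨rfl, e1⟩ | ⟨rfl, e1⟩ <;>
      rcases hms q hq _ hx' with h2 | ⟨e2, e3⟩ | ⟨e2, e3⟩
    · exact Set.disjoint_left.1 (h.model.disj p q hpq) h1.1 h2.1
    · exact h1.2 ⟨_, e2.symm⟩
    · exact h1.2 ⟨_, e2.symm⟩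
    · exact h2.2 ⟨_, rfl⟩
    · exact hpq (e1.trans e3.symm)
    · exact hne (h.inj e2)
    · exact h2.2 ⟨_, rfl⟩
    · exact hne (h.inj e2).symm
    · exact hpq (e1.trans e3.symm)
  · exact (h.model.touch p q hpq).mono (fs p hp) (fs q hq)
  · exact ((hm k).2.2.mono_graph le_sup_left).mono (Set.singleton_subset_iff.2 fk) (fs _ (hπa k))
  · exact ((hm l).2.2.mono_graph le_sup_left).mono (Set.singleton_subset_iff.2 fl) (fs _ (hπa l))

theorem Rooted.vee_of_opposite (h : Rooted H0 s μ φ) {i j : Fin 4} (hij : φ j = anti (φ i)) :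
    IsMinor K7vee (H0 ⊔ cl (Set.range s)) := by
  refine vee_of_antipodal h.model (p := φ i) (touch_root h (i := i) (j := j) ?_
    ((h.mem _ _).2 rfl) ((h.mem _ _).2 hij))
  rintro rfl
  exact anti_ne _ hij.symm

theorem Rooted.good (h : Rooted H0 s μ φ) : Good H0 s := by
  by_cases hφ : φ.Injective
  · refine ⟨h.k4_of_injective hφ, ?_⟩
    by_cases hanti : ∀ i j, φ j ≠ anti (φ i)
    · exact Or.inr (h.fan_of_injective hφ hanti)
    · push Not at hanti
      obtain ⟨i, j, hij⟩ := hanti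
      exact Or.inl (h.vee_of_opposite hij)
  · refine ⟨h.k4_of_not_injective hφ, Or.inl ?_⟩
    by_cases hanti : ∀ i j, φ j ≠ anti (φ i)
    swap
    · push Not at hanti
      obtain ⟨i, j, hij⟩ := hanti
      exact h.vee_of_opposite hij
    by_cases hnt : ∀ i, ¬ Touch H0 {s i} (μ (anti (φ i)))
    swap
    · push Not at hnt
      obtain ⟨i, hi⟩ := hnt
      exact vee_of_antipodal h.model (p := φ i) ((hi.mono_graph le_sup_left).mono
        (Set.singleton_subset_iff.2 ((h.mem _ _).2 rfl)) subset_rfl)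
    have : ∃ i₁ i₂, φ i₁ = φ i₂ ∧ i₁ ≠ i₂ := by
      simpa [Function.Injective] using hφ
    obtain ⟨i₁, i₂, h2, h12⟩ := this
    by_cases hk : ∃ k, φ k ≠ φ i₁
    · obtain ⟨k, hk⟩ := hk
      exact h.vee_of_two h12 h2.symm hk hanti hnt
    · push Not at hk
      exact h.vee_of_const hk

end Terminal

section Terminal

variable {W : Type} {H H0 : SimpleGraph W} {s : Fin 4 → W} {μ : Fin 8 → Set W}

theorem Model.eq_of_mem {U : Type} {K : SimpleGraph U} {bag : U → Set W} (h : Model K H bag)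
    {p q : U} {x : W} (hp : x ∈ bag p) (hq : x ∈ bag q) : p = q := by
  by_contra hne
  exact Set.disjoint_left.1 (h.disj p q hne) hp hq

theorem exists_rooted [Finite W] (hs : s.Injective) (hμ : Model octa (H0 ⊔ cl (Set.range s)) μ)
    (ht : Tied (H0 ⊔ cl (Set.range s)) (Set.range s) μ)
    (hno : ∀ A B, IsSeparation (H0 ⊔ cl (Set.range s)) A B → Set.range s ⊆ B →
      (∃ p, μ p ⊆ A \ B) → A ≠ Set.univ → 5 ≤ (A ∩ B).ncard)
    (hterm : ∀ u v, H0.Adj u v → v ∉ Set.range s → ∃ p q, p ≠ q ∧ u ∈ μ p ∧ v ∈ μ q) :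
    ∃ φ, Rooted H0 s μ φ := by
  classical
  have hadj : ∀ u v, (H0 ⊔ cl (Set.range s)).Adj u v → v ∉ Set.range s → H0.Adj u v :=
    fun u v h hv => h.resolve_right fun h' => hv h'.2.2
  have hsing : ∀ p v, v ∈ μ p → v ∉ Set.range s → μ p = {v} := by
    intro p v hv hvs
    by_contra hne
    obtain ⟨_, rfl, w, hw, hvw⟩ := (hμ.conn p).exists_adj (Set.singleton_subset_iff.2 hv) ⟨v, rfl⟩
      (Ne.symm hne)
    obtain ⟨q, r, hqr, hwq, hvr⟩ := hterm _ _ (hadj _ _ hvw.symm hvs) hvs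
    exact hqr ((hμ.eq_of_mem hwq hw.1).trans (hμ.eq_of_mem hv hvr))
  have hsub : ∀ p i, s i ∈ μ p → μ p ⊆ Set.range s := by
    intro p i hi x hx
    by_contra hxs
    have := hsing p x hx hxs
    rw [this] at hi
    exact hxs ⟨i, hi⟩
  have hall : ∀ i, ∃ q, s i ∈ μ q := by
    intro i
    by_contra hi
    push Not at hi
    have hp : ∃ p, ∀ j, s j ∉ μ p := by
      by_contra hcon
      push Not at hcon
      choose g hg using hcon
      have hginj : g.Injective := fun p q e => hμ.eq_of_mem (hg p) (by rw [e]; exact hg q)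
      have := Fintype.card_le_of_injective g hginj
      simp at this
    obtain ⟨p, hp⟩ := hp
    have hps : ∀ x ∈ μ p, x ∉ Set.range s := by
      rintro _ hx ⟨j, rfl⟩; exact hp j hx
    have h4 := ht {s i}ᶜ (Set.range s) (isSeparation_of (fun x => ?_) fun u v huv hu => ?_)
      subset_rfl ⟨p, fun x hx => ⟨fun e => hps x hx ⟨i, e.symm⟩, hps x hx⟩⟩
    · have h1 : ({s i}ᶜ ∩ Set.range s) = Set.range s \ {s i} := by
        ext; simp [and_comm]
      rw [h1] at h4
      have h2 := Set.ncard_sdiff_singleton_add_one (s := Set.range s) ⟨i, rfl⟩ (Set.toFinite _)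
      have h3 : (Set.range s).ncard = 4 := by
        rw [← Set.image_univ, Set.ncard_image_of_injective _ hs]; simp
      omega
    · by_cases e : x = s i
      · exact Or.inr ⟨i, e.symm⟩
      · exact Or.inl e
    · rintro rfl
      obtain ⟨p, q, -, hp, -⟩ := hterm _ _ (hadj _ _ huv.symm hu) hu
      exact hi p hp
  choose φ hφ using hall
  have hmem : ∀ i q, s i ∈ μ q ↔ φ i = q := fun i q =>
    ⟨fun h => hμ.eq_of_mem (hφ i) h, fun h => h ▸ hφ i⟩
  refine ⟨φ, hs, hμ, hmem, fun i => hsub _ i (hφ i), fun X ⟨i₀, hi₀⟩ ⟨q, hq, hqX⟩ => ?_⟩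
  set N := Finset.univ.filter fun q => (∀ i, φ i ≠ q) ∧ ∃ i ∈ X, Touch H0 {s i} (μ q) with hN
  have hfree : ∀ p, (∀ i, φ i ≠ p) → ∀ x ∈ μ p, x ∉ Set.range s := by
    rintro p hp _ hx ⟨j, rfl⟩
    exact hp j ((hmem _ _).1 hx)
  let M : Set W := {x | ∃ p ∈ N, x ∈ μ p}
  have hMs : ∀ x ∈ M, x ∉ Set.range s := by
    rintro x ⟨p, hp, hx⟩
    exact hfree p (Finset.mem_filter.1 hp).2.1 x hx
  have h5 := hno ((s '' X)ᶜ) (Set.range s ∪ M) (isSeparation_of (fun x => ?_) fun u v huv hu => ?_)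
    Set.subset_union_left ⟨q, fun x hx => ⟨?_, ?_⟩⟩ fun e => ?_
  · have hsubset : (s '' X)ᶜ ∩ (Set.range s ∪ M) ⊆ (s '' (Xᶜ : Finset (Fin 4))) ∪ M := by
      rintro x ⟨h1, ⟨i, rfl⟩ | h2⟩
      · exact Or.inl ⟨i, by simpa using fun h => h1 ⟨i, h, rfl⟩, rfl⟩
      · exact Or.inr h2
    have hM : M.ncard ≤ N.card := by
      choose g hg using fun p => (hμ.conn p).nonempty
      refine (Set.ncard_le_ncard (t := g '' N) ?_ (Set.toFinite _)).trans
        ((Set.ncard_image_le (Set.toFinite _)).trans (Set.ncard_coe_finset N).le)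
      rintro x ⟨p, hp, hx⟩
      have := hg p
      rw [hsing p x hx (hMs x ⟨p, hp, hx⟩)] at this
      exact ⟨p, hp, this⟩
    have h6 := (Set.ncard_le_ncard hsubset (Set.toFinite _)).trans (Set.ncard_union_le _ _)
    rw [Set.ncard_image_of_injective _ hs, Set.ncard_coe_finset, Finset.card_compl,
      Fintype.card_fin] at h6
    have := X.card_le_univ
    simp at this
    omega
  · by_cases e : x ∈ Set.range s
    · exact Or.inr (Or.inl e)
    · exact Or.inl fun ⟨i, _, h⟩ => e ⟨i, h⟩
  · rintro ⟨i, hi, rfl⟩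
    have hus : u ∉ Set.range s := fun h => hu (Or.inl h)
    have h1 := hadj _ _ huv.symm hus
    obtain ⟨-, p, -, -, hp⟩ := hterm _ _ h1 hus
    refine hu (Or.inr ⟨p, Finset.mem_filter.2 ⟨Finset.mem_univ _, fun j e => ?_, i, hi, _, rfl, u,
      hp, h1⟩, hp⟩)
    exact hus (hsub p j ((hmem _ _).2 e) hp)
  · rintro ⟨i, -, rfl⟩
    exact hfree q hq _ hx ⟨i, rfl⟩
  · rintro (h | ⟨p, hp, hxp⟩)
    · exact hfree q hq x hx h
    · obtain ⟨-, -, i, hi, hti⟩ := Finset.mem_filter.1 hp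
      rw [hμ.eq_of_mem hxp hx] at hti
      exact hqX i hi hti
  · exact (e ▸ Set.mem_univ (s i₀) : s i₀ ∈ (s '' X)ᶜ) ⟨i₀, hi₀, rfl⟩

/-- The structure theorem for rooted graphs containing `octa`. -/
theorem good_of_tied : ∀ (n : ℕ) {W : Type} [Finite W] {H0 : SimpleGraph W} {s : Fin 4 → W}
    {μ : Fin 8 → Set W}, Nat.card W = n → s.Injective → Model octa (H0 ⊔ cl (Set.range s)) μ →
    Tied (H0 ⊔ cl (Set.range s)) (Set.range s) μ → Good H0 s := by
  intro n
  induction n using Nat.strong_induction_on with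
  | _ n ih =>
    intro W _ H0 s μ hn hs hμ ht
    by_cases hno : ∀ A B, IsSeparation (H0 ⊔ cl (Set.range s)) A B → Set.range s ⊆ B →
      (∃ p, μ p ⊆ A \ B) → A ≠ Set.univ → 5 ≤ (A ∩ B).ncard
    · by_cases hterm : ∀ u v, H0.Adj u v → v ∉ Set.range s → ∃ p q, p ≠ q ∧ u ∈ μ p ∧ v ∈ μ q
      · obtain ⟨φ, h⟩ := exists_rooted hs hμ ht hno hterm
        exact h.good
      · push Not at hterm
        obtain ⟨u, v, huv, hv, hm⟩ := hterm
        obtain ⟨s', H0', μ', bag, hs', hμ', ht', hb, hsb⟩ := Tied.contract hs hμ hno huv hv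
          (fun p q hp hq => by
            by_contra hne
            exact hm p q hne hp hq)
        exact (ih _ (hn ▸ card_merge_lt v) rfl hs' hμ' ht').of_model hs hb hsb
    · push Not at hno
      obtain ⟨A, B, h, hSB, ⟨p, hp⟩, hA, hlt⟩ := hno
      have h4 : (A ∩ B).ncard = 4 := by
        have := ht A B h hSB ⟨p, hp⟩
        omega
      obtain ⟨s', μ', bag, hs', hμ', ht', hb, hsb⟩ := ht.restrict hs hμ h hSB hp h4
      have hlt : Nat.card A < n := by
        rw [← hn, Nat.card_coe_set_eq]
        exact Set.ncard_lt_card hA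
      exact (ih _ hlt rfl hs' hμ' ht').of_model hs hb hsb

end Terminal

section Distributed

variable {U W : Type} {G H : SimpleGraph W} {A B : Set W}

/-- Some separation of order at most `k` has bags of models of `octa` strictly on both sides. -/
def OctaDist (k : ℕ) (H : SimpleGraph W) : Prop :=
  ∃ (A B : Set W) (μ ν : Fin 8 → Set W) (p q : Fin 8), IsSeparation H A B ∧ (A ∩ B).ncard ≤ k ∧
    Model octa H μ ∧ Model octa H ν ∧ μ p ⊆ A \ B ∧ ν q ⊆ B \ A

theorem IsSeparation.subset_of_meets (h : IsSeparation G A B) {P : Set W} (hP : Conn G P)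
    (hA : (P ∩ A).Nonempty) (h0 : ∀ x ∈ P, x ∈ A → x ∉ B) : P ⊆ A \ B := by
  intro x hx
  have hxB : x ∉ B := fun hxB => by
    obtain ⟨y, hy, hyA, hyB⟩ := h.conn_inter hP hA ⟨x, hx, hxB⟩
    exact h0 y hy hyA hyB
  exact ⟨(h.mem_or x).resolve_right hxB, hxB⟩

theorem good_side [Finite W] (h3 : ¬ OctaDist 3 G) (h : IsSeparation G A B) (h4 : (A ∩ B).ncard = 4)
    {μ ν : Fin 8 → Set W} (hμ : Model octa G μ) (hν : Model octa G ν) {p q : Fin 8}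
    (hp : μ p ⊆ A \ B) (hq : ν q ⊆ B \ A) {s : Fin 4 → A} (hs : s.Injective)
    (hr : Set.range s = {x : A | (x : W) ∈ B}) : Good (G.induce A) s := by
  have hmod : Model octa (G.induce A ⊔ cl (Set.range s)) fun q => {x : A | (x : W) ∈ μ q} := by
    rw [hr]; exact h.octa_restrict hμ hp (by omega)
  refine good_of_tied _ rfl hs hmod ?_
  rintro X Y hXY hSY ⟨r, hr'⟩
  have hsY : ∀ x : A, (x : W) ∈ B → x ∈ Y := fun x hx => hSY (hr ▸ hx)
  have hrB : μ r ⊆ A \ B := h.subset_of_meets (hμ.conn r) (h.bag_meets hμ hp (by omega) r)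
    fun x hx hxA hxB => (hr' (show (⟨x, hxA⟩ : A) ∈ _ from hx)).2 (hsY _ hxB)
  have h1 : IsSeparation G (Subtype.val '' X) (Subtype.val '' Y ∪ B) := by
    refine isSeparation_of (fun x => ?_) fun u v huv hu => ?_
    · by_cases hxB : x ∈ B
      · exact Or.inr (Or.inr hxB)
      · have hxA := (h.mem_or x).resolve_right hxB
        exact (hXY.mem_or ⟨x, hxA⟩).imp (fun hx => ⟨_, hx, rfl⟩) fun hx => Or.inl ⟨_, hx, rfl⟩
    · have huB : u ∉ B := fun hn => hu (Or.inr hn)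
      have huA := (h.mem_or u).resolve_right huB
      have hvA := h.mem_left huv huB
      exact ⟨⟨v, hvA⟩, hXY.mem_left (u := ⟨u, huA⟩) (v := ⟨v, hvA⟩) (Or.inl huv)
        fun hn => hu (Or.inl ⟨_, hn, rfl⟩), rfl⟩
  have h2 : Subtype.val '' X ∩ (Subtype.val '' Y ∪ B) = Subtype.val '' (X ∩ Y) := by
    ext x
    constructor
    · rintro ⟨⟨x, hx, rfl⟩, ⟨y, hy, hyx⟩ | hxB⟩
      · exact ⟨x, ⟨hx, Subtype.ext hyx ▸ hy⟩, rfl⟩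
      · exact ⟨x, ⟨hx, hsY x hxB⟩, rfl⟩
    · rintro ⟨x, ⟨hx, hy⟩, rfl⟩
      exact ⟨⟨x, hx, rfl⟩, Or.inl ⟨x, hy, rfl⟩⟩
  by_contra hlt
  refine h3 ⟨_, _, μ, ν, r, q, h1, ?_, hμ, hν, fun x hx => ⟨?_, ?_⟩, fun x hx => ⟨Or.inr (hq hx).1,
    ?_⟩⟩
  · rw [h2, Set.ncard_image_of_injective _ Subtype.val_injective]; omega
  · exact ⟨⟨x, (hrB hx).1⟩, (hr' (show (⟨x, (hrB hx).1⟩ : A) ∈ _ from hx)).1, rfl⟩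
  · rintro (⟨y, hy, rfl⟩ | hxB)
    · exact (hr' (show y ∈ _ from hx)).2 hy
    · exact (hrB hx).2 hxB
  · rintro ⟨y, -, rfl⟩
    exact (hq hx).2 y.2

theorem Conn.image_val {S : Set A} (h : Conn (G.induce A) S) : Conn G (Subtype.val '' S) := by
  refine conn_of_closed (h.nonempty.image _) fun T ⟨x, ⟨x', hx', hxx⟩, hxT⟩ hcl => ?_
  have := h.subset_of_closed (A := Subtype.val ⁻¹' T) ⟨x', hx', by rw [← hxx] at hxT; exact hxT⟩
    fun u hu v hv huT huv => hcl _ ⟨u, hu, rfl⟩ _ ⟨v, hv, rfl⟩ huT huv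
  rintro _ ⟨y, hy, rfl⟩
  exact this hy

theorem Touch.image_val {S T : Set A} (h : Touch (G.induce A) S T) :
    Touch G (Subtype.val '' S) (Subtype.val '' T) := by
  obtain ⟨u, hu, v, hv, huv⟩ := h
  exact ⟨u, ⟨u, hu, rfl⟩, v, ⟨v, hv, rfl⟩, huv⟩

/-- A rooted `K₄` on one side of a separation simulates a clique on the other side. -/
theorem isMinor_of_k4 {K : SimpleGraph U} {s : Fin 4 → A} {t : Fin 4 → B}
    (hs : s.Injective) (hst : ∀ i, (s i : W) = t i) (hAB : ∀ x : A, (x : W) ∈ B → x ∈ Set.range s)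
    (h : RMinor (⊤ : SimpleGraph (Fin 4)) id (G.induce B) t)
    (hm : IsMinor K (G.induce A ⊔ cl (Set.range s))) : IsMinor K G := by
  obtain ⟨bag, hb, ht⟩ := h
  refine isMinor_trans hm (Model.isMinor (bag := fun x => {(x : W)} ∪
    {y | ∃ i, s i = x ∧ y ∈ Subtype.val '' bag i}) ⟨fun x => ?_, fun x x' hxx => ?_,
    fun x x' hxx => ?_⟩)
  · by_cases hx : ∃ i, s i = x
    · obtain ⟨i, rfl⟩ := hx
      have : ({((s i : A) : W)} ∪ {y | ∃ j, s j = s i ∧ y ∈ Subtype.val '' bag j}) =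
          Subtype.val '' bag i := by
        ext y
        constructor
        · rintro (rfl | ⟨j, hj, hy⟩)
          · exact ⟨t i, ht i, (hst i).symm⟩
          · rw [← hs hj]; exact hy
        · exact fun hy => Or.inr ⟨i, rfl, hy⟩
      rw [this]
      exact (hb.conn i).image_val
    · have : {y | ∃ i, s i = x ∧ y ∈ Subtype.val '' bag i} = ∅ := by
        ext y
        simp only [Set.mem_ofPred_eq, Set.mem_empty_iff_false, iff_false]
        rintro ⟨i, hi, -⟩
        exact hx ⟨i, hi⟩
      rw [this, Set.union_empty]
      exact conn_singleton _
  · have key : ∀ x x' : A, ∀ i, x ≠ x' → s i = x → (x' : W) ∉ Subtype.val '' bag i := by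
      rintro x x' i hxx hi ⟨y, hy, hyx⟩
      obtain ⟨j, rfl⟩ := hAB x' (hyx ▸ y.2)
      have : y = t j := Subtype.ext (by rw [hyx, hst])
      rw [this] at hy
      exact hxx (by rw [← hi, hb.eq_of_mem hy (ht j)]; rfl)
    refine Set.disjoint_left.2 ?_
    rintro y (rfl | ⟨i, hi, hy⟩) (h1 | ⟨j, hj, hy'⟩)
    · exact hxx (Subtype.ext h1)
    · exact key x' x j hxx.symm hj hy'
    · rw [Set.mem_singleton_iff.1 h1] at hy
      exact key x x' i hxx hi hy
    · obtain ⟨z, hz, rfl⟩ := hy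
      obtain ⟨z', hz', hzz⟩ := hy'
      rw [Subtype.ext hzz] at hz'
      exact hxx (by rw [← hi, ← hj, hb.eq_of_mem hz hz'])
  · rcases hxx with hxx | ⟨hne, ⟨i, rfl⟩, ⟨j, rfl⟩⟩
    · exact ⟨x, Or.inl rfl, x', Or.inl rfl, hxx⟩
    · have hij : i ≠ j := fun e => hne (by rw [e])
      exact (hb.touch i j hij).image_val.mono (fun y hy => Or.inr ⟨i, rfl, hy⟩)
        fun y hy => Or.inr ⟨j, rfl, hy⟩

/-- The adjacency table of two fans glued along their roots. -/
def twoFans (i j : ℕ) : Bool :=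
  i % 4 != j % 4 && ((decide (4 ≤ i) && decide (i < 8) && decide (4 ≤ j) && decide (j < 8)) ||
    (decide (8 ≤ i) && decide (8 ≤ j)) || (decide (i < 4) && decide (4 ≤ j)) ||
    (decide (j < 4) && decide (4 ≤ i)))

theorem vee_of_two_fans {s : Fin 4 → A} {t : Fin 4 → B} (hst : ∀ i, (s i : W) = t i)
    (hAB : ∀ x : A, (x : W) ∈ B → x ∈ Set.range s)
    (h1 : RMinor fan (fun i => (i, 0)) (G.induce A) s)
    (h2 : RMinor fan (fun i => (i, 0)) (G.induce B) t) : IsMinor K7vee G := by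
  obtain ⟨a, ha, has⟩ := h1
  obtain ⟨b, hb, hbt⟩ := h2
  let m : ℕ → Fin 4 := Fin.ofNat 4
  let f : ℕ → Set W := fun k => if k < 4 then Subtype.val '' a (m k, 0) ∪ Subtype.val '' b (m k, 0)
    else if k < 8 then Subtype.val '' a (m k, 1) else Subtype.val '' b (m k, 1)
  have f0 : ∀ k, k < 4 → f k = Subtype.val '' a (m k, 0) ∪ Subtype.val '' b (m k, 0) :=
    fun k hk => if_pos hk
  have f1 : ∀ k, 4 ≤ k → k < 8 → f k = Subtype.val '' a (m k, 1) := fun k h1 h2 => by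
    simp [f, h2, show ¬ k < 4 by omega]
  have f2 : ∀ k, 8 ≤ k → f k = Subtype.val '' b (m k, 1) := fun k h1 => by
    simp [f, show ¬ k < 8 by omega, show ¬ k < 4 by omega]
  have hab : ∀ k x l y z, z ∈ Subtype.val '' a (k, x) → z ∈ Subtype.val '' b (l, y) →
      k = l ∧ x = 0 ∧ y = 0 := by
    rintro k x l y _ ⟨z, hz, rfl⟩ ⟨z', hz', hzz⟩
    obtain ⟨i, rfl⟩ := hAB z (hzz ▸ z'.2)
    rw [show z' = t i from Subtype.ext (hzz.trans (hst i))] at hz'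
    have e1 := ha.eq_of_mem hz (has i)
    have e2 := hb.eq_of_mem hz' (hbt i)
    simp only [Prod.mk.injEq] at e1 e2
    exact ⟨e1.1.trans e2.1.symm, e1.2, e2.2⟩
  have haa : ∀ k x l y z, z ∈ Subtype.val '' a (k, x) → z ∈ Subtype.val '' a (l, y) →
      k = l ∧ x = y := by
    rintro k x l y _ ⟨z, hz, rfl⟩ ⟨z', hz', hzz⟩
    rw [Subtype.ext hzz] at hz'
    simpa using ha.eq_of_mem hz hz'
  have hbb : ∀ k x l y z, z ∈ Subtype.val '' b (k, x) → z ∈ Subtype.val '' b (l, y) →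
      k = l ∧ x = y := by
    rintro k x l y _ ⟨z, hz, rfl⟩ ⟨z', hz', hzz⟩
    rw [Subtype.ext hzz] at hz'
    simpa using hb.eq_of_mem hz hz'
  have hm : ∀ i j, m i = m j → i % 4 = j % 4 := fun i j h => Fin.ext_iff.1 h
  have hcase : ∀ k z, z ∈ f k → ∃ x, (x = 0 ↔ k < 4) ∧ (z ∈ Subtype.val '' a (m k, x) ∧ k < 8 ∨
      z ∈ Subtype.val '' b (m k, x) ∧ (k < 4 ∨ 8 ≤ k)) := by
    intro k z hz
    by_cases h4 : k < 4
    · rw [f0 k h4] at hz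
      exact ⟨0, by simp [h4], hz.imp (fun h => ⟨h, by omega⟩) fun h => ⟨h, Or.inl h4⟩⟩
    by_cases h8 : k < 8
    · rw [f1 k (by omega) h8] at hz
      exact ⟨1, by simp [h4], Or.inl ⟨hz, h8⟩⟩
    · rw [f2 k (by omega)] at hz
      exact ⟨1, by simp [h4], Or.inr ⟨hz, Or.inr (by omega)⟩⟩
  have hbags : Bags G 12 twoFans f := by
    refine ⟨fun k hk => ?_, fun i hi j hj hij => Set.disjoint_left.2 fun z hz hz' => ?_,
      fun i hi j hj hij hadj => ?_⟩
    · by_cases h4 : k < 4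
      · rw [f0 k h4]
        exact (ha.conn _).image_val.union_of_inter (hb.conn _).image_val
          ⟨s (m k), ⟨_, has _, rfl⟩, _, hbt _, (hst _).symm⟩
      by_cases h8 : k < 8
      · rw [f1 k (by omega) h8]; exact (ha.conn _).image_val
      · rw [f2 k (by omega)]; exact (hb.conn _).image_val
    · obtain ⟨x, hx, h1⟩ := hcase i z hz
      obtain ⟨y, hy, h2⟩ := hcase j z hz'
      rcases h1 with ⟨h1, hi'⟩ | ⟨h1, hi'⟩ <;> rcases h2 with ⟨h2, hj'⟩ | ⟨h2, hj'⟩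
      · obtain ⟨e1, rfl⟩ := haa _ _ _ _ _ h1 h2
        have := hm _ _ e1
        rw [hx] at hy
        omega
      · obtain ⟨e1, rfl, rfl⟩ := hab _ _ _ _ _ h1 h2
        have := hm _ _ e1
        simp only [true_iff] at hx hy
        omega
      · obtain ⟨e1, rfl, rfl⟩ := hab _ _ _ _ _ h2 h1
        have := hm _ _ e1
        simp only [true_iff] at hx hy
        omega
      · obtain ⟨e1, rfl⟩ := hbb _ _ _ _ _ h1 h2
        have := hm _ _ e1
        rw [hx] at hy
        omega
    · simp only [twoFans, Bool.and_eq_true, Bool.or_eq_true, bne_iff_ne, ne_eq,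
        decide_eq_true_eq] at hadj
      obtain ⟨hne, hadj⟩ := hadj
      have hmij : m i ≠ m j := fun e => hne (hm _ _ e)
      have key : ∀ i j, m i ≠ m j → i < 4 → 4 ≤ j → j < 12 → Touch G (f i) (f j) := by
        intro i j hmij hi hj hj'
        by_cases h8 : j < 8
        · rw [f0 i hi, f1 j hj h8]
          exact (ha.touch (m i, 0) (m j, 1) ⟨hmij, Or.inr rfl⟩).image_val.mono
            Set.subset_union_left subset_rfl
        · rw [f0 i hi, f2 j (by omega)]
          exact (hb.touch (m i, 0) (m j, 1) ⟨hmij, Or.inr rfl⟩).image_val.mono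
            Set.subset_union_right subset_rfl
      rcases hadj with ((hadj | hadj) | hadj) | hadj
      · rw [f1 i (by omega) (by omega), f1 j (by omega) (by omega)]
        exact (ha.touch (m i, 1) (m j, 1) ⟨hmij, Or.inr rfl⟩).image_val
      · rw [f2 i (by omega), f2 j (by omega)]
        exact (hb.touch (m i, 1) (m j, 1) ⟨hmij, Or.inr rfl⟩).image_val
      · exact key i j hmij hadj.1 hadj.2 hj
      · exact (key j i hmij.symm hadj.1 hadj.2 hi).symm
  exact hbags.vee_of_ops (l := [(8, 1), (5, 2), (7, 4), (2, 8), (3, 4)]) (by decide +kernel)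

theorem vee_of_dist_four [Finite W] (h3 : ¬ OctaDist 3 G) (h4 : OctaDist 4 G) : IsMinor K7vee G := by
  obtain ⟨A, B, μ, ν, p, q, h, hle, hμ, hν, hp, hq⟩ := h4
  have hcard : (A ∩ B).ncard = 4 := by
    by_contra hne
    exact h3 ⟨A, B, μ, ν, p, q, h, by omega, hμ, hν, hp, hq⟩
  obtain ⟨g⟩ : Nonempty (Fin 4 ≃ (A ∩ B : Set W)) :=
    ⟨(Finite.equivFinOfCardEq (by rw [Nat.card_coe_set_eq, hcard])).symm⟩
  let s : Fin 4 → A := fun i => ⟨g i, (g i).2.1⟩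
  let t : Fin 4 → B := fun i => ⟨g i, (g i).2.2⟩
  have hs : s.Injective := fun i j e => g.injective (Subtype.ext (Subtype.mk.inj e))
  have ht : t.Injective := fun i j e => g.injective (Subtype.ext (Subtype.mk.inj e))
  have hsr : Set.range s = {x : A | (x : W) ∈ B} := by
    ext x
    constructor
    · rintro ⟨i, rfl⟩; exact (g i).2.2
    · intro hx
      exact ⟨g.symm ⟨x, x.2, hx⟩, Subtype.ext (by simp [s])⟩
  have htr : Set.range t = {x : B | (x : W) ∈ A} := by
    ext x
    constructor
    · rintro ⟨i, rfl⟩; exact (g i).2.1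
    · intro hx
      exact ⟨g.symm ⟨x, hx, x.2⟩, Subtype.ext (by simp [t])⟩
  have gA := good_side h3 h hcard hμ hν hp hq hs hsr
  have h3' : IsSeparation G B A := h.symm'
  have gB := good_side h3 h3' (by rw [Set.inter_comm]; exact hcard) hν hμ hq hp ht htr
  have hAB : ∀ x : A, (x : W) ∈ B → x ∈ Set.range s := fun x hx => hsr ▸ hx
  have hBA : ∀ x : B, (x : W) ∈ A → x ∈ Set.range t := fun x hx => htr ▸ hx
  rcases gA.dich with hv | hfA
  · exact isMinor_of_k4 (t := t) hs (fun _ => rfl) hAB gB.k4 hv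
  rcases gB.dich with hv | hfB
  · exact isMinor_of_k4 (t := s) ht (fun _ => rfl) hBA gA.k4 hv
  exact vee_of_two_fans (s := s) (t := t) (fun _ => rfl) hAB hfA hfB

end Distributed

section MinorClosed

variable {U W W' : Type} {G G' H : SimpleGraph W} {K : SimpleGraph U} {A B S T : Set W}

/-- No `K7vee` minor, and no small separation distributing `octa`. -/
def InW (G : SimpleGraph W) : Prop := ¬ IsMinor K7vee G ∧ ¬ OctaDist 3 G

theorem InW.not_four [Finite W] (h : InW G) : ¬ OctaDist 4 G := fun h4 =>
  h.1 (vee_of_dist_four h.2 h4)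

theorem Model.image_val {bag : U → Set A} (h : Model K (G.induce A) bag) :
    Model K G fun u => Subtype.val '' bag u :=
  ⟨fun u => (h.conn u).image_val, fun u u' hu => (Set.disjoint_image_iff
    Subtype.val_injective).2 (h.disj u u' hu), fun u u' hu => (h.touch u u' hu).image_val⟩

theorem Conn.preimage_val (h : Conn G S) (hS : S ⊆ A) :
    Conn (G.induce A) (Subtype.val ⁻¹' S) := by
  obtain ⟨x, hx⟩ := h.nonempty
  refine conn_of_closed ⟨⟨x, hS hx⟩, hx⟩ fun T ⟨y, hy, hyT⟩ hcl => ?_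
  have := h.subset_of_closed (A := Subtype.val '' T) ⟨y, hy, y, hyT, rfl⟩
    (by
      rintro _ hu v hv ⟨u, huT, rfl⟩ huv
      exact ⟨⟨v, hS hv⟩, hcl u hu ⟨v, hS hv⟩ hv huT huv, rfl⟩)
  intro z hz
  obtain ⟨z', hz', he⟩ := this hz
  exact Subtype.ext he ▸ hz'

theorem Touch.preimage_val (h : Touch G S T) (hS : S ⊆ A) (hT : T ⊆ A) :
    Touch (G.induce A) (Subtype.val ⁻¹' S) (Subtype.val ⁻¹' T) := by
  obtain ⟨u, hu, v, hv, huv⟩ := h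
  exact ⟨⟨u, hS hu⟩, hu, ⟨v, hT hv⟩, hv, huv⟩

theorem Model.preimage_val {bag : U → Set W} (h : Model K G bag) (hA : ∀ u, bag u ⊆ A) :
    Model K (G.induce A) fun u => Subtype.val ⁻¹' bag u :=
  ⟨fun u => (h.conn u).preimage_val (hA u), fun u u' hu => (h.disj u u' hu).preimage _,
    fun u u' hu => (h.touch u u' hu).preimage_val (hA u) (hA u')⟩

theorem OctaDist.of_induce [Finite W] {v : W} (h : OctaDist 3 (G.induce {v}ᶜ)) :
    OctaDist 4 G := by
  obtain ⟨A, B, μ, ν, p, q, h, hle, hμ, hν, hp, hq⟩ := h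
  refine ⟨Subtype.val '' A ∪ {v}, Subtype.val '' B ∪ {v}, _, _, p, q, isSeparation_of (fun x => ?_)
    fun x y hxy hx => ?_, ?_, hμ.image_val, hν.image_val, ?_, ?_⟩
  · by_cases hx : x = v
    · exact Or.inl (Or.inr hx)
    · exact (h.mem_or ⟨x, hx⟩).imp (fun h => Or.inl ⟨_, h, rfl⟩) fun h => Or.inl ⟨_, h, rfl⟩
  · by_cases hy : y = v
    · exact Or.inr hy
    · have hxv : x ≠ v := fun e => hx (Or.inr e)
      exact Or.inl ⟨⟨y, hy⟩, h.mem_left (u := ⟨x, hxv⟩) hxy fun hn => hx (Or.inl ⟨_, hn, rfl⟩), rfl⟩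
  · have : (Subtype.val '' A ∪ {v}) ∩ (Subtype.val '' B ∪ {v}) = Subtype.val '' (A ∩ B) ∪ {v} := by
      rw [← Set.inter_union_distrib_right, Set.image_inter Subtype.val_injective]
    rw [this]
    refine (Set.ncard_union_le _ _).trans ?_
    rw [Set.ncard_image_of_injective _ Subtype.val_injective, Set.ncard_singleton]
    omega
  · rintro _ ⟨x, hx, rfl⟩
    refine ⟨Or.inl ⟨x, (hp hx).1, rfl⟩, ?_⟩
    rintro (⟨y, hy, he⟩ | he)
    · exact (hp hx).2 (Subtype.ext he ▸ hy)
    · exact x.2 he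
  · rintro _ ⟨x, hx, rfl⟩
    refine ⟨Or.inl ⟨x, (hq hx).1, rfl⟩, ?_⟩
    rintro (⟨y, hy, he⟩ | he)
    · exact (hq hx).2 (Subtype.ext he ▸ hy)
    · exact x.2 he

theorem OctaDist.of_quot [Finite W] {u v : W} (huv : G.Adj u v)
    (h : OctaDist 3 (quot G (mergeMap huv.ne))) : OctaDist 4 G := by
  obtain ⟨A, B, μ, ν, p, q, h, hle, hμ, hν, hp, hq⟩ := h
  have hm := quot_model (mergeMap_fiber huv)
  refine ⟨mergeMap huv.ne ⁻¹' A, mergeMap huv.ne ⁻¹' B, _, _, p, q, isSeparation_of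
    (fun x => h.mem_or _) fun x y hxy hx => ?_, ?_, hμ.trans hm, hν.trans hm, ?_, ?_⟩
  · by_cases he : mergeMap huv.ne x = mergeMap huv.ne y
    · exact (he ▸ (h.mem_or _).resolve_right hx : mergeMap huv.ne y ∈ A)
    · exact h.mem_left (quot_adj_of hxy he) hx
  · rw [← Set.preimage_inter]
    have hsub : mergeMap huv.ne ⁻¹' (A ∩ B) ⊆ Subtype.val '' (A ∩ B) ∪ {v} := by
      intro x hx
      by_cases he : x = v
      · exact Or.inr he
      · rw [Set.mem_preimage, mergeMap_of_ne huv.ne he] at hx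
        exact Or.inl ⟨_, hx, rfl⟩
    refine (Set.ncard_le_ncard hsub (Set.toFinite _)).trans ((Set.ncard_union_le _ _).trans ?_)
    rw [Set.ncard_image_of_injective _ Subtype.val_injective, Set.ncard_singleton]
    omega
  · intro x hx
    simp only [Set.mem_iUnion, Set.mem_preimage, Set.mem_singleton_iff, exists_prop,
      exists_eq_right'] at hx
    exact hp hx
  · intro x hx
    simp only [Set.mem_iUnion, Set.mem_preimage, Set.mem_singleton_iff, exists_prop,
      exists_eq_right'] at hx
    exact hq hx

theorem IsSeparation.exists_bag_avoiding [Finite W] (h : IsSeparation G A B) {μ : Fin 8 → Set W}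
    (hμ : Model octa G μ) {p : Fin 8} (hp : μ p ⊆ A \ B) (hle : (A ∩ B).ncard ≤ 3) (v : W) :
    ∃ q, μ q ⊆ A \ B ∧ v ∉ μ q := by
  by_contra hno
  push Not at hno
  have h8 := card_le_of_disjoint_hit (T := (A ∩ B) ∪ {v}) hμ.disj fun q => by
    by_cases hv : v ∈ μ q
    · exact ⟨v, hv, Or.inr rfl⟩
    by_contra hne
    refine hv (hno q (h.subset_of_meets (hμ.conn q) (h.bag_meets hμ hp (by omega) q) ?_))
    exact fun x hx hxA hxB => hne ⟨x, hx, Or.inl ⟨hxA, hxB⟩⟩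
  have := Set.ncard_union_le (A ∩ B) {v}
  rw [Set.ncard_singleton] at this
  rw [Fintype.card_fin] at h8
  omega

theorem OctaDist.of_deleteEdge [Finite W] {u v : W}
    (h : OctaDist 3 (G.deleteEdges {s(u, v)})) : OctaDist 4 G := by
  obtain ⟨A, B, μ, ν, p, q, h, hle, hμ, hν, hp, hq⟩ := h
  have hG := G.deleteEdges_le {s(u, v)}
  obtain ⟨w, hw⟩ : ∃ w, IsSeparation G (A ∪ {w}) B := by
    by_cases hc : u ∉ B ∧ v ∉ A
    · refine ⟨v, isSeparation_of (fun x => (h.mem_or x).imp_left Or.inl) fun x y hxy hx => ?_⟩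
      by_cases he : s(x, y) = s(u, v)
      · rcases Sym2.eq_iff.1 he with ⟨rfl, rfl⟩ | ⟨rfl, rfl⟩
        · exact Or.inr rfl
        · exact absurd ((h.mem_or x).resolve_left hc.2) hx
      · exact Or.inl (h.mem_left (deleteEdges_adj.2 ⟨hxy, he⟩) hx)
    · refine ⟨u, isSeparation_of (fun x => (h.mem_or x).imp_left Or.inl) fun x y hxy hx => ?_⟩
      by_cases he : s(x, y) = s(u, v)
      · rcases Sym2.eq_iff.1 he with ⟨rfl, rfl⟩ | ⟨rfl, rfl⟩
        · by_contra hy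
          exact hc ⟨hx, fun hn => hy (Or.inl hn)⟩
        · exact Or.inr rfl
      · exact Or.inl (h.mem_left (deleteEdges_adj.2 ⟨hxy, he⟩) hx)
  obtain ⟨q, hq, hqw⟩ := h.symm'.exists_bag_avoiding hν hq (by rwa [Set.inter_comm]) w
  refine ⟨_, _, μ, ν, p, q, hw, ?_, hμ.mono_graph hG, hν.mono_graph hG,
    hp.trans (Set.sdiff_subset_sdiff_left Set.subset_union_left), fun x hx => ⟨(hq hx).1, ?_⟩⟩
  · have h1 : (A ∪ {w}) ∩ B ⊆ (A ∩ B) ∪ {w} := by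
      rintro x ⟨h1 | h1, h2⟩
      · exact Or.inl ⟨h1, h2⟩
      · exact Or.inr h1
    refine (Set.ncard_le_ncard h1 (Set.toFinite _)).trans ((Set.ncard_union_le _ _).trans ?_)
    rw [Set.ncard_singleton]
    omega
  · rintro (h1 | rfl)
    · exact (hq hx).2 h1
    · exact hqw hx

theorem InW.mono [Finite W] (h : InW G) (hle : G' ≤ G) : InW G' := by
  have key : ∀ s : Set (Sym2 W), InW (G.deleteEdges s) := by
    intro s
    induction s, Set.toFinite s using Set.Finite.induction_on with
    | empty => rwa [deleteEdges_empty]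
    | @insert e s _ _ ih =>
      induction e with
      | _ u v =>
        rw [Set.insert_eq, Set.union_comm, ← deleteEdges_deleteEdges]
        exact ⟨fun hm => ih.1 (isMinor_mono (deleteEdges_le _) hm),
          fun hd => ih.not_four hd.of_deleteEdge⟩
  have : G' = G.deleteEdges (G.edgeSet \ G'.edgeSet) := by
    ext u v
    simp only [deleteEdges_adj, Set.mem_sdiff, mem_edgeSet, not_and, not_not]
    exact ⟨fun h => ⟨hle h, fun _ => h⟩, fun h => h.2 h.1⟩
  rw [this]
  exact key _

theorem OctaDist.map {g : U → W} (hg : g.Bijective) {k : ℕ} (h : OctaDist k K) :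
    OctaDist k (quot K g) := by
  obtain ⟨A, B, μ, ν, p, q, h, hle, hμ, hν, hp, hq⟩ := h
  have hm : ∀ {μ : Fin 8 → Set U}, Model octa K μ → Model octa (quot K g) fun p => g '' μ p :=
    fun hμ => hμ.image_quot fun p q x hx y hy he => hμ.eq_of_mem hx (hg.1 he ▸ hy)
  refine ⟨g '' A, g '' B, _, _, p, q, isSeparation_of (fun x => ?_) ?_, ?_, hm hμ, hm hν, ?_, ?_⟩
  · obtain ⟨x, rfl⟩ := hg.2 x
    exact (h.mem_or x).imp (Set.mem_image_of_mem g) (Set.mem_image_of_mem g)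
  · rintro _ _ ⟨-, x, y, rfl, rfl, hxy⟩ hx
    exact Set.mem_image_of_mem g (h.mem_left hxy fun hn => hx (Set.mem_image_of_mem g hn))
  · rw [← Set.image_inter hg.1, Set.ncard_image_of_injective _ hg.1]; exact hle
  · rw [← Set.image_sdiff hg.1]; exact Set.image_mono hp
  · rw [← Set.image_sdiff hg.1]; exact Set.image_mono hq

theorem inW_of_card : ∀ (n : ℕ) {W U : Type} [Finite W] {G : SimpleGraph W} {K : SimpleGraph U},
    Nat.card W = n → InW G → IsMinor K G → InW K := by
  intro n
  induction n using Nat.strong_induction_on with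
  | _ n ih =>
    intro W U _ G K hn hG hK
    obtain ⟨bag, hb⟩ := isMinor_iff.1 hK
    by_cases h1 : ∃ v, ∀ u, v ∉ bag u
    · obtain ⟨v, hv⟩ := h1
      refine ih (Nat.card ({v}ᶜ : Set W)) ?_ rfl ⟨fun hm => hG.1 (isMinor_trans hm
        (isMinor_induce G _)), fun hd => hG.not_four hd.of_induce⟩
        (hb.preimage_val (A := {v}ᶜ) fun u x hx e => hv u (e ▸ hx)).isMinor
      rw [← hn]
      exact card_merge_lt v
    by_cases h2 : ∃ x u v, G.Adj u v ∧ u ∈ bag x ∧ v ∈ bag x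
    · obtain ⟨x, u, v, huv, hu, hv⟩ := h2
      refine ih _ (hn ▸ card_merge_lt v) rfl (G := quot G (mergeMap huv.ne)) ⟨fun hm => hG.1
        (isMinor_trans hm (quot_model (mergeMap_fiber huv)).isMinor),
        fun hd => hG.not_four (OctaDist.of_quot huv hd)⟩ (hb.image_quot fun p q y hy z hz he => ?_).isMinor
      rcases mergeMap_eq huv.ne he with rfl | ⟨rfl, rfl⟩ | ⟨rfl, rfl⟩
      · exact hb.eq_of_mem hy hz
      · rw [← hb.eq_of_mem hu hy, hb.eq_of_mem hv hz]
      · rw [← hb.eq_of_mem hv hy, hb.eq_of_mem hu hz]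
    push Not at h1 h2
    have hs : ∀ u, ∃ x, bag u = {x} := by
      intro u
      obtain ⟨x, hx⟩ := (hb.conn u).nonempty
      refine ⟨x, by_contra fun hne => ?_⟩
      obtain ⟨_, rfl, y, hy, hxy⟩ := (hb.conn u).exists_adj (Set.singleton_subset_iff.2 hx) ⟨x, rfl⟩
        (Ne.symm hne)
      exact h2 u _ _ hxy hx hy.1
    choose g hg using hs
    have hbij : g.Bijective := by
      refine ⟨fun u v e => hb.eq_of_mem (x := g u) (by rw [hg]; rfl) (by rw [hg, e]; rfl),
        fun x => ?_⟩
      obtain ⟨u, hu⟩ := h1 x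
      rw [hg] at hu
      exact ⟨u, hu.symm⟩
    refine ⟨fun hm => hG.1 (isMinor_trans hm hK), fun hd => ?_⟩
    refine (hG.mono (G' := quot K g) ?_).2 (hd.map hbij)
    rintro _ _ ⟨-, u, v, rfl, rfl, huv⟩
    have := hb.touch u v huv
    rwa [hg, hg, touch_singleton] at this

theorem InW.of_isMinor [Finite W] (h : InW G) (hK : IsMinor K G) : InW K :=
  inW_of_card _ rfl h hK

theorem MinCE.inW [Finite W] (hG : MinCE G) : InW G := by
  refine ⟨hG.noVee, ?_⟩
  rintro ⟨A, B, μ, ν, p, q, h, hle, hμ, hν, hp, hq⟩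
  have hC := hμ.conn p
  have hsep : ∀ x ∈ A \ B, ∀ y, G.Adj x y → y ∈ A := fun x hx y hxy => h.mem_left hxy hx.2
  obtain ⟨x, hx⟩ := hC.nonempty
  obtain ⟨C, hxC, hC⟩ := exists_isComp G (S := A \ B) (hp hx)
  have hsub : nb G C ⊆ A ∩ B := by
    rintro y ⟨hyC, u, hu, huy⟩
    have hyA := hsep u (hC.subset hu) y huy
    by_contra hn
    exact hyC (hC.closed u hu y ⟨hyA, fun hB => hn ⟨hyA, hB⟩⟩ huy)
  have := hG.four_le_nb hC.conn fun he => by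
    obtain ⟨y, hy⟩ := (hν.conn q).nonempty
    have hy' := hq hy
    rcases (he ▸ Set.mem_univ y : y ∈ C ∪ nb G C) with h1 | h1
    · exact hy'.2 (hC.subset h1).1
    · exact hy'.2 (hsub h1).1
  have := Set.ncard_le_ncard hsub (Set.toFinite _)
  omega

end MinorClosed

section Count

variable {V U : Type} {G : SimpleGraph V} {X Y C D S : Set V} {a : V}

/-- Twice the number of edges. -/
noncomputable def dc (G : SimpleGraph V) : ℕ := {p : V × V | G.Adj p.1 p.2}.ncard

/-- Twice the number of edges inside a set. -/
noncomputable def dIn (G : SimpleGraph V) (X : Set V) : ℕ :=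
  {p : V × V | p.1 ∈ X ∧ p.2 ∈ X ∧ G.Adj p.1 p.2}.ncard

theorem dc_eq_sum [Fintype V] (G : SimpleGraph V) : dc G = ∑ v, (G.neighborSet v).ncard := by
  classical
  rw [dc, Set.ncard_eq_toFinset_card', ← Finset.card_map (Equiv.sigmaEquivProd V V).symm.toEmbedding]
  simp_rw [Set.ncard_eq_toFinset_card']
  rw [← Finset.card_sigma]
  congr 1
  ext ⟨u, v⟩
  simp [Equiv.sigmaEquivProd]

theorem even_dc [Finite V] (G : SimpleGraph V) : Even (dc G) := by
  classical
  have := Fintype.ofFinite V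
  refine ⟨G.edgeFinset.card, ?_⟩
  rw [dc_eq_sum, ← two_mul, ← G.sum_degrees_eq_twice_card_edges]
  refine Finset.sum_congr rfl fun v _ => ?_
  rw [Set.ncard_eq_toFinset_card', ← G.card_neighborFinset_eq_degree]
  rfl

theorem dc_induce (X : Set V) : dc (G.induce X) = dIn G X := by
  rw [dc, dIn, ← Set.ncard_image_of_injective _
    (Function.Injective.prodMap (Subtype.val_injective (p := (· ∈ X))) Subtype.val_injective)]
  congr 1
  ext ⟨u, v⟩
  simp only [Set.mem_image, Set.mem_ofPred_eq, Prod.map, Prod.mk.injEq, Prod.exists, Subtype.exists]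
  constructor
  · rintro ⟨u, hu, v, hv, h, rfl, rfl⟩
    exact ⟨hu, hv, h⟩
  · rintro ⟨hu, hv, h⟩
    exact ⟨u, hu, v, hv, h, rfl, rfl⟩

theorem dc_le_delete [Finite V] (v : V) :
    dc G ≤ dIn G {v}ᶜ + 2 * (G.neighborSet v).ncard := by
  have h : {p : V × V | G.Adj p.1 p.2} ⊆ {p : V × V | p.1 ∈ ({v}ᶜ : Set V) ∧ p.2 ∈ ({v}ᶜ : Set V) ∧
      G.Adj p.1 p.2} ∪ ((fun x => (v, x)) '' G.neighborSet v ∪ (fun x => (x, v)) '' G.neighborSet v) := by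
    rintro ⟨x, y⟩ hxy
    by_cases hx : x = v
    · subst hx; exact Or.inr (Or.inl ⟨y, hxy, rfl⟩)
    · by_cases hy : y = v
      · subst hy; exact Or.inr (Or.inr ⟨x, SimpleGraph.Adj.symm hxy, rfl⟩)
      · exact Or.inl ⟨hx, hy, hxy⟩
  have h1 := Set.ncard_le_ncard h (Set.toFinite _)
  have h2 := Set.ncard_union_le {p : V × V | p.1 ∈ ({v}ᶜ : Set V) ∧ p.2 ∈ ({v}ᶜ : Set V) ∧
      G.Adj p.1 p.2} ((fun x => (v, x)) '' G.neighborSet v ∪ (fun x => (x, v)) '' G.neighborSet v)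
  have h3 := Set.ncard_union_le ((fun x => (v, x)) '' G.neighborSet v)
    ((fun x => (x, v)) '' G.neighborSet v)
  have h4 := Set.ncard_image_le (f := fun x => (v, x)) (G.neighborSet v).toFinite
  have h5 := Set.ncard_image_le (f := fun x => (x, v)) (G.neighborSet v).toFinite
  simp only [dc, dIn]
  omega

theorem dc_add_inter_le [Finite V] (hXY : ∀ u v, G.Adj u v → u ∈ X ∧ v ∈ X ∨ u ∈ Y ∧ v ∈ Y) :
    dc G + dIn G (X ∩ Y) ≤ dIn G X + dIn G Y := by
  have h := Set.ncard_union_add_ncard_inter {p : V × V | p.1 ∈ X ∧ p.2 ∈ X ∧ G.Adj p.1 p.2}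
    {p : V × V | p.1 ∈ Y ∧ p.2 ∈ Y ∧ G.Adj p.1 p.2}
  change _ ≤ Set.ncard _ + Set.ncard _
  rw [← h]
  refine Nat.add_le_add (Set.ncard_le_ncard ?_ (Set.toFinite _)) (Set.ncard_le_ncard ?_ (Set.toFinite _))
  · rintro ⟨u, v⟩ huv
    exact (hXY u v huv).imp (fun h => ⟨h.1, h.2, huv⟩) (fun h => ⟨h.1, h.2, huv⟩)
  · rintro ⟨u, v⟩ ⟨⟨h1, h2⟩, ⟨h3, h4⟩, h5⟩
    exact ⟨⟨h1, h3, h5⟩, h2, h4, h5⟩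

/-- The vertices of `S` not adjacent to `a`. -/
def miss (G : SimpleGraph V) (S : Set V) (a : V) : Set V := {y | y ∈ S ∧ y ≠ a ∧ ¬ G.Adj a y}

/-- Adding to `G.induce X` the edges from `a` to `S`. -/
def addStar (G : SimpleGraph V) (X S : Set V) (a : V) : SimpleGraph X where
  Adj x y := x ≠ y ∧ (G.Adj x y ∨ (x : V) = a ∧ (y : V) ∈ S ∨ (y : V) = a ∧ (x : V) ∈ S)
  symm := ⟨fun _ _ h => ⟨h.1.symm, h.2.imp SimpleGraph.Adj.symm Or.symm⟩⟩
  loopless := ⟨fun _ h => h.1 rfl⟩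

theorem addStar_isMinor (hD : Conn G D) (hX : X ⊆ Dᶜ) (hS : S ⊆ nb G D) (ha : a ∈ nb G D) :
    IsMinor (addStar G X S a) G := by
  classical
  refine Model.isMinor (bag := fun x : X => if (x : V) = a then insert a D else {(x : V)})
    ⟨fun x => ?_, fun x y hxy => ?_, fun x y hxy => ?_⟩
  · split_ifs
    · obtain ⟨-, u, hu, hua⟩ := ha
      exact hD.insert_adj hu hua
    · exact conn_singleton _
  · have hne : (x : V) ≠ y := fun e => hxy (Subtype.ext e)
    split_ifs with h1 h2 h2
    · exact absurd (h1.trans h2.symm) hne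
    · rw [Set.disjoint_singleton_right]
      rintro (h | h)
      · exact h2 h
      · exact hX y.2 h
    · rw [Set.disjoint_singleton_left]
      rintro (h | h)
      · exact h1 h
      · exact hX x.2 h
    · simpa using hne
  · have hmem : ∀ z : X, (z : V) ∈ (if (z : V) = a then insert a D else {(z : V)} : Set V) := fun z => by
      split_ifs with h
      · exact Or.inl h
      · rfl
    obtain ⟨hne, h | ⟨h1, h2⟩ | ⟨h1, h2⟩⟩ := hxy
    · exact ⟨x, hmem x, y, hmem y, h⟩
    · obtain ⟨-, u, hu, huy⟩ := hS h2
      exact ⟨u, by rw [if_pos h1]; exact Or.inr hu, y, hmem y, huy⟩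
    · obtain ⟨-, u, hu, hux⟩ := hS h2
      exact ⟨x, hmem x, u, by rw [if_pos h1]; exact Or.inr hu, hux.symm⟩

theorem dc_addStar [Finite V] (hS : S ⊆ X) (ha : a ∈ X) :
    dIn G X + 2 * (miss G S a).ncard ≤ dc (addStar G X S a) := by
  have hd1 : Disjoint {p : V × V | p.1 ∈ X ∧ p.2 ∈ X ∧ G.Adj p.1 p.2}
      ((fun x => (a, x)) '' miss G S a ∪ (fun x => (x, a)) '' miss G S a) := by
    rw [Set.disjoint_left]
    rintro _ ⟨-, -, h⟩ (⟨x, ⟨-, -, hx⟩, rfl⟩ | ⟨x, ⟨-, -, hx⟩, rfl⟩)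
    · exact hx h
    · exact hx (SimpleGraph.Adj.symm h)
  have hd2 : Disjoint ((fun x => (a, x)) '' miss G S a) ((fun x => (x, a)) '' miss G S a) := by
    rw [Set.disjoint_left]
    rintro _ ⟨x, hx, rfl⟩ ⟨y, hy, he⟩
    exact hy.2.1 (Prod.mk.inj he).1
  have h3 : ((fun x => (a, x)) '' miss G S a).ncard = (miss G S a).ncard :=
    Set.ncard_image_of_injective _ fun x y h => (Prod.mk.inj h).2
  have h4 : ((fun x => (x, a)) '' miss G S a).ncard = (miss G S a).ncard :=
    Set.ncard_image_of_injective _ fun x y h => (Prod.mk.inj h).1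
  rw [dIn, two_mul]
  nth_rw 1 [← h3]
  rw [← h4, ← Set.ncard_union_eq hd2, ← Set.ncard_union_eq hd1, dc, ← Set.ncard_image_of_injective _
    (Function.Injective.prodMap (Subtype.val_injective (p := (· ∈ X))) Subtype.val_injective)]
  refine Set.ncard_le_ncard ?_ (Set.toFinite _)
  rintro ⟨x, y⟩ (⟨hx, hy, h⟩ | ⟨z, ⟨hz, hne, -⟩, he⟩ | ⟨z, ⟨hz, hne, -⟩, he⟩)
  · exact ⟨(⟨x, hx⟩, ⟨y, hy⟩), ⟨fun e => h.ne (Subtype.mk.inj e), Or.inl h⟩, rfl⟩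
  · obtain ⟨rfl, rfl⟩ := Prod.mk.inj he
    exact ⟨(⟨a, ha⟩, ⟨z, hS hz⟩), ⟨fun e => hne (Subtype.mk.inj e).symm, Or.inr (Or.inl ⟨rfl, hz⟩)⟩, rfl⟩
  · obtain ⟨rfl, rfl⟩ := Prod.mk.inj he
    exact ⟨(⟨z, hS hz⟩, ⟨a, ha⟩), ⟨fun e => hne (Subtype.mk.inj e), Or.inr (Or.inr ⟨rfl, hz⟩)⟩, rfl⟩

/-- A minimal graph with too many edges. -/
structure Tight (t : ℕ) (G : SimpleGraph V) : Prop where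
  inW : InW G
  card : 3 ≤ Nat.card V
  edges : dc G + 2 * t = 8 * Nat.card V
  proper : ∀ {U : Type} [Finite U] (K : SimpleGraph U), IsMinor K G → 3 ≤ Nat.card U →
    Nat.card U < Nat.card V → dc K + 2 * t + 2 ≤ 8 * Nat.card U
  octa_cases : t = 8 ∧ ¬ IsMinor octa G ∨ t = 7 ∧ ∀ {U : Type} [Finite U] (K : SimpleGraph U),
    IsMinor K G → 3 ≤ Nat.card U → 8 * Nat.card U ≤ dc K + 16 → IsMinor octa K

variable {t : ℕ}

theorem Tight.t_cases (hG : Tight t G) : t = 7 ∨ t = 8 := by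
  rcases hG.octa_cases with h | h <;> omega

theorem dc_le_sq [Finite V] : dc G + Nat.card V ≤ Nat.card V * Nat.card V := by
  have h := Set.ncard_le_ncard (s := {p : V × V | G.Adj p.1 p.2} ∪ (fun x => (x, x)) '' Set.univ)
    (Set.subset_univ _) (Set.toFinite _)
  rw [Set.ncard_univ, Nat.card_prod, Set.ncard_union_eq, Set.ncard_image_of_injective _
    fun x y h => (Prod.mk.inj h).1, Set.ncard_univ] at h
  · exact h
  · rw [Set.disjoint_left]
    rintro _ h ⟨x, -, rfl⟩
    exact G.loopless.irrefl _ h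

theorem Tight.card_ge [Finite V] (hG : Tight t G) : 6 ≤ Nat.card V := by
  by_contra hlt
  have h1 := dc_le_sq (G := G)
  have h2 := hG.edges
  have h3 := hG.t_cases
  have h4 := hG.card
  generalize Nat.card V = n at *
  obtain rfl | rfl | rfl : n = 3 ∨ n = 4 ∨ n = 5 := by omega
  all_goals omega

theorem card_compl_singleton [Finite V] (v : V) : Nat.card ({v}ᶜ : Set V) + 1 = Nat.card V := by
  rw [Nat.card_coe_set_eq, ← Set.ncard_univ V, ← Set.ncard_sdiff_singleton_add_one (Set.mem_univ v)]
  congr 2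
  ext; simp

theorem Tight.five_le_degree [Finite V] (hG : Tight t G) (v : V) : 5 ≤ (G.neighborSet v).ncard := by
  have h0 := hG.card_ge
  have h1 := card_compl_singleton v
  have h2 := hG.proper (G.induce {v}ᶜ) (isMinor_induce _ _) (by omega) (by omega)
  have h3 := dc_le_delete (G := G) v
  have h4 := hG.edges
  rw [dc_induce] at h2
  omega

theorem Tight.four_le_common [Finite V] (hG : Tight t G) {u v : V} (h : G.Adj v u) :
    4 ≤ {w | G.Adj v w ∧ G.Adj u w}.ncard := by
  have h0 := hG.card_ge
  have h1 := card_compl_singleton v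
  have hu : u ∈ nb G {v} := by rw [MinCE.nb_singleton]; exact h
  have hX : nb G {v} ⊆ ({v}ᶜ : Set V) := fun x hx => hx.1
  have h2 := hG.proper (addStar G {v}ᶜ (nb G {v}) u)
    (addStar_isMinor (conn_singleton v) subset_rfl subset_rfl hu) (by omega) (by omega)
  have h3 := dc_le_delete (G := G) v
  have h4 := hG.edges
  have h5 := dc_addStar (G := G) hX (hX hu)
  rw [MinCE.nb_singleton] at h5 h2
  have h6 : G.neighborSet v ⊆ miss G (G.neighborSet v) u ∪ ({w | G.Adj v w ∧ G.Adj u w} ∪ {u}) := by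
    intro w hw
    by_cases h7 : w = u
    · exact Or.inr (Or.inr h7)
    · by_cases h8 : G.Adj u w
      · exact Or.inr (Or.inl ⟨hw, h8⟩)
      · exact Or.inl ⟨hw, h7, h8⟩
  have h7 := Set.ncard_le_ncard h6 (Set.toFinite _)
  have h8 := Set.ncard_union_le (miss G (G.neighborSet v) u) ({w | G.Adj v w ∧ G.Adj u w} ∪ {u})
  have h9 := Set.ncard_union_le {w | G.Adj v w ∧ G.Adj u w} {u}
  rw [Set.ncard_singleton] at h9
  omega

theorem Tight.exists_degree_le [Finite V] (hG : Tight t G) : ∃ v, (G.neighborSet v).ncard ≤ 7 := by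
  have := Fintype.ofFinite V
  by_contra hno
  push Not at hno
  have h := Finset.card_nsmul_le_sum Finset.univ (fun v => (G.neighborSet v).ncard) 8 fun v _ => hno v
  rw [← dc_eq_sum, Finset.card_univ, ← Nat.card_eq_fintype_card, smul_eq_mul] at h
  have := hG.edges
  have := hG.t_cases
  omega

end Count

section Cut

variable {V : Type} {G : SimpleGraph V} {X Y C D S : Set V} {t : ℕ}

theorem six_le_dIn_add_miss [Finite V] {a b c : V} (hS : ({a, b, c} : Set V).ncard = 3) :
    6 ≤ dIn G {a, b, c} + ((miss G {a, b, c} a).ncard + (miss G {a, b, c} b).ncard +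
      (miss G {a, b, c} c).ncard) := by
  set S : Set V := {a, b, c} with hSd
  have h : S ×ˢ S ⊆ ({p : V × V | p.1 ∈ S ∧ p.2 ∈ S ∧ G.Adj p.1 p.2} ∪ (fun x => (x, x)) '' S) ∪
      ((fun x => (a, x)) '' miss G S a ∪ (fun x => (b, x)) '' miss G S b ∪
        (fun x => (c, x)) '' miss G S c) := by
    rintro ⟨x, y⟩ ⟨hx, hy⟩
    by_cases hxy : G.Adj x y
    · exact Or.inl (Or.inl ⟨hx, hy, hxy⟩)
    · by_cases he : y = x
      · subst he
        exact Or.inl (Or.inr ⟨y, hy, rfl⟩)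
      · have hm : y ∈ miss G S x := ⟨hy, he, hxy⟩
        rcases hx with rfl | rfl | rfl
        · exact Or.inr (Or.inl (Or.inl ⟨y, hm, rfl⟩))
        · exact Or.inr (Or.inl (Or.inr ⟨y, hm, rfl⟩))
        · exact Or.inr (Or.inr ⟨y, hm, rfl⟩)
  have h1 := Set.ncard_le_ncard h (Set.toFinite _)
  rw [Set.ncard_prod, hS] at h1
  have h2 := Set.ncard_union_le ({p : V × V | p.1 ∈ S ∧ p.2 ∈ S ∧ G.Adj p.1 p.2} ∪
    (fun x => (x, x)) '' S) ((fun x => (a, x)) '' miss G S a ∪ (fun x => (b, x)) '' miss G S b ∪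
        (fun x => (c, x)) '' miss G S c)
  have h3 := Set.ncard_union_le {p : V × V | p.1 ∈ S ∧ p.2 ∈ S ∧ G.Adj p.1 p.2}
    ((fun x => (x, x)) '' S)
  have h4 := Set.ncard_union_le ((fun x => (a, x)) '' miss G S a ∪ (fun x => (b, x)) '' miss G S b)
    ((fun x => (c, x)) '' miss G S c)
  have h5 := Set.ncard_union_le ((fun x => (a, x)) '' miss G S a) ((fun x => (b, x)) '' miss G S b)
  have h6 := Set.ncard_image_le (f := fun x => (x, x)) S.toFinite
  have h7 := Set.ncard_image_le (f := fun x => (a, x)) (miss G S a).toFinite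
  have h8 := Set.ncard_image_le (f := fun x => (b, x)) (miss G S b).toFinite
  have h9 := Set.ncard_image_le (f := fun x => (c, x)) (miss G S c).toFinite
  simp only [dIn]
  omega

theorem Tight.four_le_nb [Finite V] (hG : Tight t G) (hC : Conn G C)
    (hne : C ∪ nb G C ≠ Set.univ) : 4 ≤ (nb G C).ncard := by
  by_contra hlt
  push Not at hlt
  obtain ⟨C, hC', hmin⟩ := Set.exists_min_image {C | Conn G C ∧ C ∪ nb G C ≠ Set.univ}
    (fun C => (nb G C).ncard) (Set.toFinite _) ⟨C, hC, hne⟩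
  replace hlt := lt_of_le_of_lt (hmin _ ⟨hC, hne⟩) hlt
  clear hC hne
  obtain ⟨hC, hne⟩ := hC'
  obtain ⟨y, hy⟩ := (Set.ne_univ_iff_exists_notMem _).1 hne
  obtain ⟨D, hyD, hD⟩ := exists_isComp G (S := (C ∪ nb G C)ᶜ) hy
  have hDC : Disjoint D C := Set.disjoint_left.2 fun x hx hxC => hD.subset hx (Or.inl hxC)
  have hDS : Disjoint D (nb G C) := Set.disjoint_left.2 fun x hx hxC => hD.subset hx (Or.inr hxC)
  have hsub : nb G D ⊆ nb G C := by
    intro x hx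
    have := hD.nb_subset hx
    rw [compl_compl] at this
    rcases this with h | h
    · obtain ⟨u, hu, hux⟩ := hx.2
      exact absurd (show u ∈ nb G C from ⟨Set.disjoint_left.1 hDC hu, x, h, hux.symm⟩)
        (Set.disjoint_left.1 hDS hu)
    · exact h
  obtain ⟨z, hz⟩ := hC.nonempty
  have hzD : z ∉ D := fun h => Set.disjoint_left.1 hDC h hz
  have hnbD : nb G D = nb G C := by
    refine Set.eq_of_subset_of_ncard_le hsub (hmin D ⟨hD.conn, fun h => ?_⟩) (Set.toFinite _)
    rcases (h ▸ Set.mem_univ z : z ∈ D ∪ nb G D) with h | h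
    · exact hzD h
    · exact (hsub h).1 hz
  set S := nb G C with hS
  have hXY : Dᶜ ∩ (D ∪ S) = S := by
    ext x
    exact ⟨fun h => h.2.resolve_left h.1, fun h => ⟨fun h' => Set.disjoint_left.1 hDS h' h, Or.inr h⟩⟩
  have hSX : S ⊆ Dᶜ := fun x hx h => Set.disjoint_left.1 hDS h hx
  have hSY : S ⊆ D ∪ S := Set.subset_union_right
  have hYC : D ∪ S ⊆ Cᶜ := by
    rintro x (h | h) hx
    · exact Set.disjoint_left.1 hDC h hx
    · exact h.1 hx
  have hcover : ∀ u v, G.Adj u v → u ∈ Dᶜ ∧ v ∈ Dᶜ ∨ u ∈ D ∪ S ∧ v ∈ D ∪ S := by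
    have hc : ∀ u v, G.Adj u v → u ∈ D → v ∈ D ∪ S := fun u v huv hu => by
      by_cases hv : v ∈ D
      · exact Or.inl hv
      · exact Or.inr (hnbD ▸ ⟨hv, u, hu, huv⟩)
    intro u v huv
    by_cases hu : u ∈ D
    · exact Or.inr ⟨Or.inl hu, hc u v huv hu⟩
    · by_cases hv : v ∈ D
      · exact Or.inr ⟨hc v u huv.symm hv, Or.inl hv⟩
      · exact Or.inl ⟨hu, hv⟩
  have hsix : ∀ {E : Set V} {z : V}, z ∈ E → 6 ≤ (E ∪ nb G E).ncard := fun {E z} hz => by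
    have h1 := hG.five_le_degree z
    have h2 : insert z (G.neighborSet z) ⊆ E ∪ nb G E := by
      rintro x (rfl | hx)
      · exact Or.inl hz
      · by_cases hxE : x ∈ E
        · exact Or.inl hxE
        · exact Or.inr ⟨hxE, z, hz, hx⟩
    have h3 := Set.ncard_le_ncard h2 (Set.toFinite _)
    rw [Set.ncard_insert_of_notMem (show z ∉ G.neighborSet z from G.loopless.irrefl z)] at h3
    omega
  have hY6 := hsix hyD
  rw [hnbD] at hY6
  have hX6 := (hsix hz).trans (Set.ncard_le_ncard (show C ∪ nb G C ⊆ Dᶜ from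
    Set.union_subset (fun x hx h => Set.disjoint_left.1 hDC h hx) hSX) (Set.toFinite _))
  have hcard := Set.ncard_union_add_ncard_inter Dᶜ (D ∪ S)
  rw [hXY, show Dᶜ ∪ (D ∪ S) = Set.univ by rw [← Set.union_assoc, Set.compl_union_self, Set.univ_union],
    Set.ncard_univ] at hcard
  have hXn : (Dᶜ).ncard < Nat.card V := by
    rw [← Set.ncard_univ]
    exact Set.ncard_lt_ncard ((Set.ssubset_univ_iff).2 fun h => (h ▸ Set.mem_univ y : y ∈ Dᶜ) hyD)
      (Set.toFinite _)
  have hYn : (D ∪ S).ncard < Nat.card V := by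
    rw [← Set.ncard_univ]
    exact Set.ncard_lt_ncard ((Set.ssubset_univ_iff).2 fun h =>
      hYC (h ▸ Set.mem_univ z : z ∈ D ∪ S) hz) (Set.toFinite _)
  have hdc := dc_add_inter_le hcover
  rw [hXY] at hdc
  have hedges := hG.edges
  have ht := hG.t_cases
  by_cases h3 : S.ncard = 3
  · have hA : ∀ a ∈ S, dIn G Dᶜ + 2 * (miss G S a).ncard + 2 * t + 2 ≤ 8 * (Dᶜ).ncard := fun a ha => by
      have h1 := hG.proper _ (addStar_isMinor hD.conn (subset_refl Dᶜ) hnbD.ge (hnbD.ge ha))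
        (by rw [Nat.card_coe_set_eq]; omega) (by rw [Nat.card_coe_set_eq]; omega)
      have h2 := dc_addStar (G := G) hSX (hSX ha)
      rw [Nat.card_coe_set_eq] at h1
      omega
    have hB : ∀ a ∈ S, dIn G (D ∪ S) + 2 * (miss G S a).ncard + 2 * t + 2 ≤ 8 * (D ∪ S).ncard :=
      fun a ha => by
      have h1 := hG.proper _ (addStar_isMinor (S := S) hC hYC subset_rfl ha)
        (by rw [Nat.card_coe_set_eq]; omega) (by rw [Nat.card_coe_set_eq]; omega)
      have h2 := dc_addStar (G := G) hSY (hSY ha)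
      rw [Nat.card_coe_set_eq] at h1
      omega
    obtain ⟨a, b, c, -, -, -, habc⟩ := Set.ncard_eq_three.1 h3
    have h6 := six_le_dIn_add_miss (G := G) (habc ▸ h3)
    rw [← habc] at h6
    have ha : a ∈ S := habc ▸ Or.inl rfl
    have hb : b ∈ S := habc ▸ Or.inr (Or.inl rfl)
    have hc : c ∈ S := habc ▸ Or.inr (Or.inr rfl)
    have hAa := hA a ha
    have hAb := hA b hb
    have hAc := hA c hc
    have hBa := hB a ha
    have hBb := hB b hb
    have hBc := hB c hc
    rcases hG.octa_cases with ⟨rfl, -⟩ | ⟨rfl, hocta⟩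
    · omega
    · have hoct : ∀ X : Set V, 6 ≤ X.ncard → 8 * X.ncard ≤ dIn G X + 16 →
          ∃ μ, Model octa G μ ∧ ∀ p, μ p ⊆ X := fun X hX h => by
        obtain ⟨μ, hμ⟩ := isMinor_iff.1 (hocta (G.induce X) (isMinor_induce _ _)
          (by rw [Nat.card_coe_set_eq]; omega) (by rw [Nat.card_coe_set_eq, dc_induce]; exact h))
        refine ⟨_, hμ.image_val, fun p => ?_⟩
        rintro _ ⟨x, -, rfl⟩
        exact x.2
      have hfree : ∀ μ, Model octa G μ → ∃ p, Disjoint (μ p) S := fun μ hμ => by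
        by_contra hno
        push Not at hno
        have := card_le_of_disjoint_hit hμ.disj fun p => Set.not_disjoint_iff_nonempty_inter.1 (hno p)
        simp only [Fintype.card_fin] at this
        omega
      obtain ⟨μ, hμ, hμX⟩ := hoct Dᶜ (by omega) (by omega)
      obtain ⟨ν, hν, hνY⟩ := hoct (D ∪ S) (by omega) (by omega)
      obtain ⟨p, hp⟩ := hfree μ hμ
      obtain ⟨q, hq⟩ := hfree ν hν
      refine hG.inW.2 ⟨Dᶜ, D ∪ S, μ, ν, p, q, ⟨?_, ?_⟩, ?_, hμ, hν, ?_, ?_⟩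
      · rw [← Set.union_assoc, Set.compl_union_self, Set.univ_union]
      · rintro u v huv ⟨⟨h1, h2⟩, h3, h4⟩
        rcases hcover u v huv with h | h
        · exact h4 h.2
        · exact h2 h.1
      · rw [hXY]; omega
      · refine fun x hx => ⟨hμX p hx, fun h => ?_⟩
        exact h.elim (hμX p hx) (Set.disjoint_left.1 hp hx)
      · refine fun x hx => ⟨hνY q hx, fun h => ?_⟩
        exact (hνY q hx).elim h (Set.disjoint_left.1 hq hx)
  · have h1 := hG.proper (G.induce Dᶜ) (isMinor_induce _ _)
        (by rw [Nat.card_coe_set_eq]; omega) (by rw [Nat.card_coe_set_eq]; omega)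
    have h2 := hG.proper (G.induce (D ∪ S)) (isMinor_induce _ _)
        (by rw [Nat.card_coe_set_eq]; omega) (by rw [Nat.card_coe_set_eq]; omega)
    rw [Nat.card_coe_set_eq, dc_induce] at h1 h2
    omega

end Cut

section Local

variable {V : Type} {G : SimpleGraph V} {v : V} {d n : ℕ} {T m : ℕ → ℕ → Bool} {e : Bool} {g : ℕ → V}

/-- The sequence `g 0, …, g (d - 1)` enumerates the neighbours of `v`, and any nonadjacent
pair among them is listed in `T`. -/
structure NbhdEnum (G : SimpleGraph V) (v : V) (d : ℕ) (T : ℕ → ℕ → Bool) (g : ℕ → V) : Prop where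
  inj : ∀ i < d, ∀ j < d, g i = g j → i = j
  adj : ∀ i < d, G.Adj v (g i)
  surj : ∀ x, G.Adj v x → ∃ i < d, g i = x
  tab : ∀ i j, i < j → j < d → T i j = false → G.Adj (g i) (g j)

/-- The table of a neighbourhood with complement `T`, its center at index `d`, and further
connected sets seen according to the mask `m`. -/
def locAdj (d : ℕ) (T m : ℕ → ℕ → Bool) (e : Bool) (i j : ℕ) : Bool :=
  decide (i < j) && (if j < d then !T i j else if i < d then j == d || m j i else e && decide (d < i))

theorem NbhdEnum.bags (h : NbhdEnum G v d T g) {K : ℕ → Set V}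
    (hK : ∀ i, d < i → i < n → Conn G (K i) ∧ ∀ x ∈ K i, x ≠ v ∧ ¬ G.Adj v x)
    (hKd : ∀ i j, d < i → i < n → d < j → j < n → i ≠ j →
      Disjoint (K i) (K j) ∧ (e = true → Touch G (K i) (K j)))
    (hm : ∀ i, d < i → i < n → ∀ j < d, m i j = true → g j ∈ nb G (K i)) :
    Bags G n (locAdj d T m e) (fun i => if i < d then {g i} else if i = d then {v} else K i) := by
  refine ⟨fun i hi => ?_, ?_, fun i hi j hj hij ht => ?_⟩
  · split_ifs
    · exact conn_singleton _
    · exact conn_singleton _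
    · exact (hK i (by omega) hi).1
  · have key : ∀ i < n, ∀ j < n, i < j →
        Disjoint (if i < d then {g i} else if i = d then {v} else K i : Set V)
          (if j < d then {g j} else if j = d then {v} else K j) := by
      intro i hi j hj hij
      by_cases h1 : j < d
      · rw [if_pos h1, if_pos (by omega), Set.disjoint_singleton]
        exact fun he => hij.ne (h.inj i (by omega) j h1 he)
      rw [if_neg h1]
      by_cases h2 : j = d
      · rw [if_pos h2, if_pos (by omega), Set.disjoint_singleton]
        exact (h.adj i (by omega)).ne'
      rw [if_neg h2]
      have hj' := hK j (by omega) hj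
      by_cases h3 : i < d
      · rw [if_pos h3, Set.disjoint_singleton_left]
        exact fun hx => (hj'.2 _ hx).2 (h.adj i h3)
      rw [if_neg h3]
      by_cases h4 : i = d
      · rw [if_pos h4, Set.disjoint_singleton_left]
        exact fun hx => (hj'.2 _ hx).1 rfl
      · rw [if_neg h4]
        exact (hKd i j (by omega) hi (by omega) hj hij.ne).1
    intro i hi j hj hij
    rcases lt_or_gt_of_ne hij with h1 | h1
    · exact key i hi j hj h1
    · exact (key j hj i hi h1).symm
  · simp only [locAdj, Bool.and_eq_true, decide_eq_true_eq] at ht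
    obtain ⟨hlt, ht⟩ := ht
    by_cases h1 : j < d
    · rw [if_pos h1] at ht
      rw [if_pos h1, if_pos (by omega), touch_singleton]
      exact h.tab i j hlt h1 (by simpa using ht)
    rw [if_neg h1] at ht
    rw [if_neg h1]
    by_cases h3 : i < d
    · rw [if_pos h3] at ht
      rw [if_pos h3]
      by_cases h2 : j = d
      · rw [if_pos h2, touch_singleton]
        exact (h.adj i h3).symm
      · rw [if_neg h2]
        simp only [Bool.or_eq_true, beq_iff_eq, h2, false_or] at ht
        obtain ⟨-, u, hu, hug⟩ := hm j (by omega) hj i h3 ht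
        exact ⟨g i, rfl, u, hu, hug.symm⟩
    · rw [if_neg h3] at ht
      simp only [Bool.and_eq_true, decide_eq_true_eq] at ht
      rw [if_neg h3, if_neg (by omega), if_neg (by omega)]
      exact (hKd i j ht.2 hi (by omega) hj hij).2 ht.1

theorem NbhdEnum.exists_missing [Finite V] (h : NbhdEnum G v d T g) {C : Set V}
    (hC : nb G C ⊆ G.neighborSet v) {k : ℕ} (hk : d ≤ k + (nb G C).ncard) (hkd : k ≤ d) :
    ∃ s : Finset (Fin d), s.card = k ∧ ∀ i : Fin d, i ∉ s → g i ∈ nb G C := by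
  classical
  let s : Finset (Fin d) := Finset.univ.filter fun i => g i ∉ nb G C
  have h1 : nb G C ⊆ (fun i : Fin d => g i) '' (sᶜ : Finset (Fin d)) := by
    intro x hx
    obtain ⟨i, hi, rfl⟩ := h.surj x (hC hx)
    exact ⟨⟨i, hi⟩, by simpa [s] using hx, rfl⟩
  have h2 := (Set.ncard_le_ncard h1 (Set.toFinite _)).trans (Set.ncard_image_le (Set.toFinite _))
  rw [Set.ncard_coe_finset, Finset.card_compl, Fintype.card_fin] at h2
  have h3 := s.card_le_univ
  rw [Fintype.card_fin] at h3
  obtain ⟨t, hst, ht⟩ := Finset.exists_superset_card_eq (s := s) (n := k) (by omega) (by simpa using hkd)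
  refine ⟨t, ht, fun i hi => ?_⟩
  by_contra hn
  exact hi (hst (by simpa [s] using hn))

theorem exists_lt_of_card_two : ∀ s : Finset (Fin 6), s.card = 2 → ∃ p q, p < q ∧ s = {p, q} := by
  decide

theorem exists_lt_of_card_three : ∀ s : Finset (Fin 7), s.card = 3 →
    ∃ p q r, p < q ∧ q < r ∧ s = {p, q, r} := by
  decide +kernel

/-- The possible complements of a neighbourhood of size seven. -/
def compl7 : ℕ → List (ℕ × ℕ)
  | 0 => [(0, 1), (1, 2), (2, 3), (3, 4), (4, 5), (5, 6), (0, 6)]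
  | 1 => [(0, 1), (1, 2), (2, 3), (3, 4), (4, 5), (0, 5)]
  | 2 => [(0, 1), (1, 2), (2, 3), (3, 4), (0, 4), (5, 6)]
  | 3 => [(0, 1), (1, 2), (2, 3), (0, 3), (4, 5), (5, 6), (4, 6)]
  | _ => [(0, 1), (1, 2), (0, 2), (3, 4), (4, 5), (3, 5)]

def tab7 (t i j : ℕ) : Bool := (compl7 t).contains (i, j)

def ops7 : ℕ → List (List (ℕ × ℕ))
  | 0 => [[(5, 1), (6, 3)], [(5, 2), (4, 0)], [(3, 0), (1, 0)], [(5, 2), (3, 0)], [(5, 1), (3, 0)],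
      [(5, 1), (6, 1)]]
  | 1 => [[(5, 2), (4, 0)], [(4, 0), (5, 0)], [(2, 0), (2, 0)], [(5, 2), (4, 1)], [(3, 0), (4, 2)]]
  | 2 => [[(8, 1), (5, 0)], [(5, 0), (4, 0)], [(5, 4), (4, 1)], [(6, 4), (4, 3)], [(5, 3), (4, 3)]]
  | 3 => [[(6, 2), (5, 0)], [(4, 3), (5, 1)], [(4, 2), (6, 0)], [(5, 2), (4, 0)]]
  | _ => [[(3, 1), (5, 0)], [(5, 2), (4, 0)], [(4, 2), (3, 1)], [(4, 1), (3, 0)], [(5, 0), (4, 0)]]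

/-- The triples of a five-cycle inducing a path with two consecutive vertices. -/
def exc7 (p q r : Fin 7) : Prop :=
  (p, q, r) ∈ ([(0, 1, 3), (0, 2, 3), (0, 2, 4), (1, 2, 4), (1, 3, 4)] : List (Fin 7 × Fin 7 × Fin 7))

instance (p q r : Fin 7) : Decidable (exc7 p q r) := inferInstanceAs (Decidable (_ ∈ _))

theorem vee_table7 : ∀ t : Fin 5, ∀ p q r : Fin 7, p < q → q < r → (t = 2 ∧ exc7 p q r) ∨
    (ops7 t).any (veeOps 9 (locAdj 7 (tab7 t)
      (fun _ i => i != p && i != q && i != r) false)) = true := by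
  decide +kernel

theorem vee_table7_two : ∀ p q : Fin 7, p < q →
    (ops7 2).any (veeOps 9 (locAdj 7 (tab7 2) (fun _ i => i != p && i != q) false)) = true := by
  decide +kernel

theorem vee_table7_pair : ∀ p q r p' q' r' : Fin 7, exc7 p q r → exc7 p' q' r' →
    ([[(8, 6), (2, 0), (4, 1)], [(3, 1), (8, 5), (3, 0)]] : List (List (ℕ × ℕ))).any
      (veeOps 10 (locAdj 7 (tab7 2) (fun k i => if k = 8 then i != p && i != q && i != r
        else i != p' && i != q' && i != r') false)) = true := by
  intro p q r p' q' r' h hexc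
  have key : ∀ x ∈ ([(0, 1, 3), (0, 2, 3), (0, 2, 4), (1, 2, 4), (1, 3, 4)] : List (Fin 7 × Fin 7 × Fin 7)),
      ∀ y ∈ ([(0, 1, 3), (0, 2, 3), (0, 2, 4), (1, 2, 4), (1, 3, 4)] : List (Fin 7 × Fin 7 × Fin 7)),
      ([[(8, 6), (2, 0), (4, 1)], [(3, 1), (8, 5), (3, 0)]] : List (List (ℕ × ℕ))).any
      (veeOps 10 (locAdj 7 (tab7 2) (fun k i => if k = 8 then i != x.1 && i != x.2.1 && i != x.2.2
        else i != y.1 && i != y.2.1 && i != y.2.2) false)) = true := by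
    decide +kernel
  exact key (p, q, r) h (p', q', r') (by exact hexc)

/-- A perfect matching in the complement of a neighbourhood of size six, up to the `k`-th pair. -/
def tab6 (k i j : ℕ) : Bool := i + 1 == j && i % 2 == 0 && decide (i < 2 * k)

theorem vee_table6_one : veeOps 7 (locAdj 6 (tab6 1) (fun _ _ => false) false) [] = true := by
  decide +kernel

theorem vee_table6_two : ∀ p q : Fin 6, p < q → ([[(2, 0)], [(3, 1)], [(7, 1)]] : List (List (ℕ × ℕ))).any
    (veeOps 8 (locAdj 6 (tab6 2) (fun _ i => i != p && i != q) false)) = true := by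
  decide +kernel

theorem vee_table6_pair : ∀ p q p' q' : Fin 6, p < q → p' < q' →
    ([[(5, 1), (2, 1)], [(4, 2), (2, 1)], [(8, 5), (3, 0)], [(2, 1), (4, 1)], [(8, 0), (5, 3)],
      [(4, 0), (3, 0)], [(8, 5), (7, 1)], [(7, 0), (2, 0)], [(7, 4), (4, 0)]] : List (List (ℕ × ℕ))).any
    (veeOps 9 (locAdj 6 (tab6 3) (fun k i => if k = 7 then i != p && i != q
      else i != p' && i != q') false)) = true := by
  decide +kernel

theorem vee_table6_split : ∀ k : Fin 3, ∀ s : Finset (Fin 6), s.card = 3 →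
    ([[(7, 0), (4, 2)], [(4, 1), (7, 3)], [(2, 1), (7, 5)], [(5, 0), (7, 2)], [(5, 3), (7, 1)],
      [(7, 4), (3, 0)], [(3, 1), (7, 5)], [(7, 1), (5, 2)], [(4, 1), (7, 2)], [(4, 3), (7, 0)],
      [(5, 0), (7, 3)], [(7, 4), (3, 1)]] : List (List (ℕ × ℕ))).any
    (veeOps 9 (locAdj 6 (tab6 3) (fun c i => if c = 7 then decide (i / 2 = k) ||
      decide (∃ j ∈ s, j.val = i) else decide (∃ j : Fin 6, j ∉ s ∧ j.val = i)) true)) = true := by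
  decide +kernel

end Local

section Local6

variable {V : Type} {G : SimpleGraph V} {v : V} {d n t : ℕ} {T m : ℕ → ℕ → Bool} {e : Bool}
  {g : ℕ → V} {X Y C : Set V}

/-- The vertices outside the closed neighbourhood of `v`. -/
def outer (G : SimpleGraph V) (v : V) : Set V := {x | x ≠ v ∧ ¬ G.Adj v x}

theorem Tight.four_le_nb_outer [Finite V] (hG : Tight t G) (hX : Conn G X) (hXS : X ⊆ outer G v) :
    4 ≤ (nb G X).ncard := by
  refine hG.four_le_nb hX fun he => ?_
  have : v ∈ X ∪ nb G X := he ▸ Set.mem_univ v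
  rcases this with h | ⟨-, u, hu, huv⟩
  · exact (hXS h).1 rfl
  · exact (hXS hu).2 huv.symm

theorem nb_subset_of_isComp_outer (hC : IsComp G (outer G v) C) : nb G C ⊆ G.neighborSet v := by
  intro x hx
  have h1 := hC.nb_subset hx
  by_contra hn
  obtain ⟨-, u, hu, hux⟩ := hx
  refine h1 ⟨?_, hn⟩
  rintro rfl
  exact (hC.subset hu).2 hux.symm

theorem Bags.vee_of_any {adj : ℕ → ℕ → Bool} {f : ℕ → Set V} {L : List (List (ℕ × ℕ))}
    (h : Bags G n adj f) (hv : L.any (veeOps n adj) = true) : IsMinor K7vee G := by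
  obtain ⟨l, -, hl⟩ := List.any_eq_true.1 hv
  exact h.vee_of_ops hl

theorem NbhdEnum.bags_one (h : NbhdEnum G v d T g) (hX : Conn G X) (hXS : X ⊆ outer G v)
    (hm : ∀ j < d, m (d + 1) j = true → g j ∈ nb G X) :
    ∃ f, Bags G (d + 2) (locAdj d T m e) f := by
  refine ⟨_, h.bags (K := fun _ => X) (fun i _ _ => ⟨hX, hXS⟩) (fun i j _ _ _ _ _ => ?_) ?_⟩
  · omega
  · intro i hi hi' j hj hmj
    exact hm j hj ((by omega : i = d + 1) ▸ hmj)

theorem NbhdEnum.bags_two (h : NbhdEnum G v d T g) (hX : Conn G X) (hXS : X ⊆ outer G v)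
    (hY : Conn G Y) (hYS : Y ⊆ outer G v) (hd : Disjoint X Y) (he : e = true → Touch G X Y)
    (hmX : ∀ j < d, m (d + 1) j = true → g j ∈ nb G X)
    (hmY : ∀ j < d, m (d + 2) j = true → g j ∈ nb G Y) :
    ∃ f, Bags G (d + 3) (locAdj d T m e) f := by
  refine ⟨_, h.bags (K := fun i => if i = d + 1 then X else Y) (fun i _ _ => ?_)
    (fun i j _ _ _ _ _ => ?_) ?_⟩
  · split_ifs
    exacts [⟨hX, hXS⟩, ⟨hY, hYS⟩]
  · split_ifs
    · omega
    · exact ⟨hd, he⟩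
    · exact ⟨hd.symm, fun h => (he h).symm⟩
    · omega
  · intro i hi hi' j hj hmj
    split_ifs with h1
    · exact hmX j hj (h1 ▸ hmj)
    · exact hmY j hj ((by omega : i = d + 2) ▸ hmj)

open Classical in
/-- The indices of the enumerated vertices with a neighbour in `X`. -/
noncomputable def lab (G : SimpleGraph V) (d : ℕ) (g : ℕ → V) (X : Set V) : Finset (Fin d) :=
  Finset.univ.filter fun i => g i ∈ nb G X

theorem mem_lab {i : Fin d} : i ∈ lab G d g X ↔ g i ∈ nb G X := by simp [lab]

theorem NbhdEnum.card_le_lab (h : NbhdEnum G v d T g) (X : Set V) :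
    (nb G X ∩ G.neighborSet v).ncard ≤ (lab G d g X).card := by
  classical
  have h1 : nb G X ∩ G.neighborSet v ⊆ (fun i : Fin d => g i) '' (lab G d g X : Set (Fin d)) := by
    rintro x ⟨hx, hxv⟩
    obtain ⟨i, hi, rfl⟩ := h.surj x hxv
    exact ⟨⟨i, hi⟩, by simpa [lab] using hx, rfl⟩
  have h2 := (Set.ncard_le_ncard h1 (Set.toFinite _)).trans (Set.ncard_image_le (Set.toFinite _))
  rwa [Set.ncard_coe_finset] at h2

theorem exists_pair_of_four_le : ∀ s : Finset (Fin 6), 4 ≤ s.card →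
    ∃ k : Fin 3, ∀ i : Fin 6, i.val / 2 = k → i ∈ s := by
  decide +kernel

theorem NbhdEnum.vee_of_split (h : NbhdEnum G v 6 (tab6 3) g) (hX : Conn G X) (hXS : X ⊆ outer G v)
    (hY : Conn G Y) (hYS : Y ⊆ outer G v) (hd : Disjoint X Y) (ht : Touch G X Y)
    (hlX : 4 ≤ (lab G 6 g X).card) (hlY : 3 ≤ (lab G 6 g Y).card)
    (hcov : ∀ i : Fin 6, g i ∈ nb G X ∨ g i ∈ nb G Y) : IsMinor K7vee G := by
  classical
  obtain ⟨k, hk⟩ := exists_pair_of_four_le _ hlX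
  have hle : ((lab G 6 g X)ᶜ).card ≤ 3 := by
    rw [Finset.card_compl, Fintype.card_fin]; omega
  obtain ⟨A, hA1, hA2, hA3⟩ := Finset.exists_subsuperset_card_eq (s := (lab G 6 g X)ᶜ)
    (t := lab G 6 g Y) (n := 3) (fun i hi => by
      rw [Finset.mem_compl, mem_lab] at hi
      exact mem_lab.2 ((hcov i).resolve_left hi)) hle hlY
  have htab := vee_table6_split k Aᶜ (by rw [Finset.card_compl, Fintype.card_fin, hA3])
  obtain ⟨f, hf⟩ := h.bags_two (e := true) (m := fun c i => if c = 7 then decide (i / 2 = k) ||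
      decide (∃ j ∈ Aᶜ, j.val = i) else decide (∃ j : Fin 6, j ∉ Aᶜ ∧ j.val = i)) hX hXS hY hYS hd
    (fun _ => ht) (fun j hj hm => by
      simp only [if_true, Bool.or_eq_true, decide_eq_true_eq] at hm
      rcases hm with hm | ⟨i, hi, rfl⟩
      · exact mem_lab.1 (hk ⟨j, hj⟩ hm)
      · by_contra hcon
        exact Finset.mem_compl.1 hi (hA1 (by rwa [Finset.mem_compl, mem_lab])))
    (fun j hj hm => by
      simp only [Nat.reduceAdd, Nat.reduceEqDiff, if_false, decide_eq_true_eq] at hm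
      obtain ⟨i, hi, rfl⟩ := hm
      exact mem_lab.1 (hA2 (by simpa using hi)))
  exact hf.vee_of_any htab

/-- Every enumerated vertex has a neighbour in a connected outer set `C` off any given vertex. -/
theorem NbhdEnum.exists_second [Finite V] (hG : Tight t G) (h : NbhdEnum G v 6 (tab6 3) g)
    (hnon : ∀ i < 3, ¬ G.Adj (g (2 * i)) (g (2 * i + 1))) (hC : Conn G C)
    (hCS : C = outer G v) (hnb : ∀ i : Fin 6, g i ∈ nb G C) {c : V} (hc : c ∈ C) (hne : C ≠ {c})
    (i : Fin 6) : ∃ x ∈ C, x ≠ c ∧ G.Adj x (g i) := by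
  classical
  by_contra! hcon
  have hadj : ∀ j : Fin 6, j.val / 2 ≠ i.val / 2 → G.Adj c (g j) := by
    intro j hji
    have hij : G.Adj (g i) (g j) := by
      rcases lt_trichotomy i.val j.val with hlt | heq | hlt
      · exact h.tab i j hlt j.isLt (by simp [tab6]; omega)
      · exact absurd (congrArg (· / 2) heq).symm hji
      · exact (h.tab j i hlt i.isLt (by simp [tab6]; omega)).symm
    have hcom := hG.four_le_common hij
    have hnonadj : ∀ a b : Fin 6, a.val / 2 = b.val / 2 → ¬ G.Adj (g a) (g b) := by
      intro a b hab had
      rcases lt_trichotomy a.val b.val with hlt | heq | hlt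
      · have := hnon (a.val / 2) (by omega)
        rw [show 2 * (a.val / 2) = a.val by omega, show a.val + 1 = b.val by omega] at this
        exact this had
      · rw [heq] at had; exact G.loopless.irrefl _ had
      · have := hnon (a.val / 2) (by omega)
        rw [show 2 * (a.val / 2) = b.val by omega, show b.val + 1 = a.val by omega] at this
        exact this had.symm
    let s : Finset (Fin 6) := Finset.univ.filter fun a => a.val / 2 ≠ i.val / 2 ∧ a.val / 2 ≠ j.val / 2
    have hs : s.card ≤ 2 := by
      have : ∀ i j : Fin 6, j.val / 2 ≠ i.val / 2 →
        (Finset.univ.filter fun a : Fin 6 => a.val / 2 ≠ i.val / 2 ∧ a.val / 2 ≠ j.val / 2).card ≤ 2 := by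
        decide
      exact this i j hji
    by_contra hcj
    have hsub : {w | G.Adj (g i) w ∧ G.Adj (g j) w} ⊆
        insert v ((fun a : Fin 6 => g a) '' (s : Set (Fin 6))) := by
      rintro w ⟨hwi, hwj⟩
      by_cases hwv : w = v
      · exact Or.inl hwv
      by_cases hw : G.Adj v w
      · obtain ⟨a, ha, rfl⟩ := h.surj w hw
        refine Or.inr ⟨⟨a, ha⟩, ?_, rfl⟩
        simp only [s, Finset.coe_filter, Finset.mem_univ, true_and, Set.mem_ofPred_eq]
        exact ⟨fun he => hnonadj i ⟨a, ha⟩ he.symm hwi, fun he => hnonadj j ⟨a, ha⟩ he.symm hwj⟩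
      · have hwC : w ∈ C := hCS ▸ ⟨hwv, hw⟩
        by_cases hwc : w = c
        · exact absurd (hwc ▸ hwj.symm) hcj
        · exact absurd hwi.symm (hcon w hwC hwc)
    have h1 := Set.ncard_le_ncard hsub (Set.toFinite _)
    have h2 := Set.ncard_insert_le v ((fun a : Fin 6 => g a) '' (s : Set (Fin 6)))
    have h3 := Set.ncard_image_le (f := fun a : Fin 6 => g a) (Set.toFinite (s : Set (Fin 6)))
    rw [Set.ncard_coe_finset] at h3
    omega
  obtain ⟨y, hy⟩ : (C \ {c}).Nonempty := by
    by_contra hemp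
    rw [Set.not_nonempty_iff_eq_empty, Set.sdiff_eq_empty] at hemp
    exact hne (hemp.antisymm (Set.singleton_subset_iff.2 hc))
  obtain ⟨Y, hyY, hY⟩ := exists_isComp G hy
  have hYC : Y ⊆ C := hY.subset.trans Set.sdiff_subset
  have hX : Conn G (C \ Y) := hC.diff_comp (conn_singleton c) (Set.singleton_subset_iff.2 hc) hY
  have hcY : c ∉ Y := fun hcY => (hY.subset hcY).2 rfl
  obtain ⟨u, huY, huc⟩ := hC.adj_comp hc hY
  have hgC : ∀ j : Fin 6, g j ∉ C := fun j hj => (hnb j).1 hj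
  have hlX : 4 ≤ (lab G 6 g (C \ Y)).card := by
    have hcard : ∀ i : Fin 6, 4 ≤ (Finset.univ.filter fun j : Fin 6 => j.val / 2 ≠ i.val / 2).card := by
      decide
    refine (hcard i).trans (Finset.card_le_card fun j hj => ?_)
    rw [Finset.mem_filter] at hj
    exact mem_lab.2 ⟨fun hx => hgC j hx.1, c, ⟨hc, hcY⟩, hadj j hj.2⟩
  have hlY : 3 ≤ (lab G 6 g Y).card := by
    have h4 := hG.four_le_nb_outer hY.conn (hCS ▸ hYC)
    have hsub : nb G Y ⊆ insert c (nb G Y ∩ G.neighborSet v) := by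
      intro x hx
      have h1 := hY.nb_subset hx
      by_cases hxc : x = c
      · exact Or.inl hxc
      refine Or.inr ⟨hx, ?_⟩
      by_contra hxv
      have hxC : x ∉ C := fun hxC => h1 ⟨hxC, hxc⟩
      obtain ⟨-, w, hw, hwx⟩ := hx
      have hwS : w ∈ outer G v := hCS ▸ hYC hw
      refine hxC (hCS ▸ ⟨?_, hxv⟩)
      rintro rfl
      exact hwS.2 hwx.symm
    have h5 := (Set.ncard_le_ncard hsub (Set.toFinite _)).trans (Set.ncard_insert_le _ _)
    have h6 := h.card_le_lab Y
    omega
  refine hG.inW.1 (h.vee_of_split hX (hCS ▸ Set.sdiff_subset) hY.conn (hCS ▸ hYC) Set.disjoint_sdiff_left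
    ⟨c, ⟨hc, hcY⟩, u, huY, huc.symm⟩ hlX hlY fun j => ?_)
  obtain ⟨hj, w, hw, hwj⟩ := hnb j
  by_cases hwY : w ∈ Y
  · exact Or.inr ⟨fun hx => hj (hYC hx), w, hwY, hwj⟩
  · exact Or.inl ⟨fun hx => hj hx.1, w, ⟨hw, hwY⟩, hwj⟩

theorem NbhdEnum.vee_of_octahedron [Finite V] (hG : Tight t G) (h : NbhdEnum G v 6 (tab6 3) g)
    (hnon : ∀ i < 3, ¬ G.Adj (g (2 * i)) (g (2 * i + 1))) (hC : Conn G (outer G v))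
    (hnb : ∀ i : Fin 6, g i ∈ nb G (outer G v)) (hne : ∀ c, outer G v ≠ {c}) :
    IsMinor K7vee G := by
  classical
  set C := outer G v with hCS
  by_contra hvee
  have hgC : ∀ j : Fin 6, g j ∉ C := fun j hj => (hnb j).1 hj
  have hsnd : ∀ c ∈ C, ∀ i : Fin 6, ∃ x ∈ C, x ≠ c ∧ G.Adj x (g i) := fun c hc i =>
    h.exists_second hG hnon hC hCS hnb hc (hne c) i
  have hfull : ∀ c ∈ C, (lab G 6 g (C \ {c})).card = 6 := by
    intro c hc
    have : lab G 6 g (C \ {c}) = Finset.univ := by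
      refine Finset.eq_univ_iff_forall.2 fun i => mem_lab.2 ?_
      obtain ⟨x, hx, hxc, hxi⟩ := hsnd c hc i
      exact ⟨fun hi => hgC i hi.1, x, ⟨hx, hxc⟩, hxi⟩
    rw [this]; rfl
  obtain ⟨r, hr⟩ := hC.nonempty
  obtain ⟨x₀, hx₀, -, hx₀C⟩ := hC.exists_noncut hr (hne r)
  obtain ⟨X, ⟨hXC, hX, hY, hlX⟩, hmin⟩ := Set.exists_min_image
    {X | X ⊆ C ∧ Conn G X ∧ Conn G (C \ X) ∧ 3 ≤ (lab G 6 g X).card}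
    (fun X => X.ncard) (Set.toFinite _)
    ⟨C \ {x₀}, Set.sdiff_subset, hx₀C, by
      rw [Set.sdiff_sdiff_right_self, Set.inter_eq_right.2 (Set.singleton_subset_iff.2 hx₀)]
      exact conn_singleton x₀, by rw [hfull x₀ hx₀]; omega⟩
  set Y := C \ X with hYdef
  have hYC : Y ⊆ C := Set.sdiff_subset
  obtain ⟨x₁, hx₁, y₁, hy₁, hxy₁⟩ := hC.exists_adj hXC hX.nonempty (by
    intro he
    obtain ⟨y, hy⟩ := hY.nonempty
    exact hy.2 (he ▸ hy.1))
  have hcov : ∀ j : Fin 6, g j ∈ nb G Y ∨ g j ∈ nb G X := by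
    intro j
    obtain ⟨hj, w, hw, hwj⟩ := hnb j
    by_cases hwX : w ∈ X
    · exact Or.inr ⟨fun hx => hj (hXC hx), w, hwX, hwj⟩
    · exact Or.inl ⟨fun hx => hj hx.1, w, ⟨hw, hwX⟩, hwj⟩
  have hlY : (lab G 6 g Y).card < 4 := by
    by_contra hlt
    exact hvee (h.vee_of_split hY hYC hX hXC Set.disjoint_sdiff_left ⟨y₁, hy₁, x₁, hx₁, hxy₁.symm⟩
      (not_lt.1 hlt) hlX hcov)
  have hX1 : ∀ x, X ≠ {x} := by
    intro x hXx
    rw [hYdef, hXx, hfull x (hXC (hXx ▸ rfl))] at hlY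
    omega
  have hlD : ∀ x ∈ X, Touch G {x} Y → ∀ D, IsComp G (X \ {x}) D → (lab G 6 g D).card ≤ 2 := by
    intro x hx ⟨x', hx', y, hy, hxy⟩ D hD
    obtain rfl : x' = x := hx'
    by_contra hlt
    have hDX : D ⊆ X := hD.subset.trans Set.sdiff_subset
    have hxD : x' ∉ D := fun hxD => (hD.subset hxD).2 rfl
    have h1 := hmin D ⟨hDX.trans hXC, hD.conn, by
      have h2 := (hX.diff_comp (conn_singleton x') (Set.singleton_subset_iff.2 hx) hD).union hY
        ⟨x', ⟨hx, hxD⟩, y, hy, hxy⟩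
      have h3 : C \ D = X \ D ∪ Y := by
        ext z
        simp only [Set.mem_sdiff, Set.mem_union, hYdef]
        have := @hXC z; have := @hDX z
        tauto
      rwa [h3], by omega⟩
    have h4 : D ⊂ X := ⟨hDX, fun hXD => hxD (hXD hx)⟩
    exact absurd (Set.ncard_lt_ncard h4 (Set.toFinite _)) (not_lt.2 h1)
  have htouch : ∀ x ∈ X, Touch G {x} Y → ∀ D, IsComp G (X \ {x}) D → Touch G D Y := by
    intro x hx hxY D hD
    by_contra hDY
    have hDC : D ⊆ C := (hD.subset.trans Set.sdiff_subset).trans hXC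
    have h4 := hG.four_le_nb_outer hD.conn hDC
    have hsub : nb G D ⊆ insert x (nb G D ∩ G.neighborSet v) := by
      intro z hz
      have h1 := hD.nb_subset hz
      by_cases hzx : z = x
      · exact Or.inl hzx
      refine Or.inr ⟨hz, ?_⟩
      by_contra hzv
      obtain ⟨-, w, hw, hwz⟩ := hz
      have hzC : z ∈ C := by
        refine ⟨?_, hzv⟩
        rintro rfl
        exact (hDC hw).2 hwz.symm
      by_cases hzX : z ∈ X
      · exact h1 ⟨hzX, hzx⟩
      · exact hDY ⟨w, hw, z, ⟨hzC, hzX⟩, hwz⟩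
    have h5 := (Set.ncard_le_ncard hsub (Set.toFinite _)).trans (Set.ncard_insert_le _ _)
    have h6 := h.card_le_lab D
    have h7 := hlD x hx hxY D hD
    omega
  have hdiff : ∀ x ∈ X, (X \ {x}).Nonempty := by
    intro x hx
    by_contra hemp
    rw [Set.not_nonempty_iff_eq_empty, Set.sdiff_eq_empty] at hemp
    exact hX1 x (hemp.antisymm (Set.singleton_subset_iff.2 hx))
  obtain ⟨z₁, hz₁⟩ := hdiff x₁ hx₁
  obtain ⟨D₁, -, hD₁⟩ := exists_isComp G hz₁
  obtain ⟨⟨x, D⟩, ⟨hx, hxY, hD⟩, hmax⟩ := Set.exists_max_image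
    {p : V × Set V | p.1 ∈ X ∧ Touch G {p.1} Y ∧ IsComp G (X \ {p.1}) p.2} (fun p => p.2.ncard)
    (Set.toFinite _) ⟨(x₁, D₁), hx₁, ⟨x₁, rfl, y₁, hy₁, hxy₁⟩, hD₁⟩
  dsimp only at hx hxY hD
  have hxD : x ∉ D := fun hxD => (hD.subset hxD).2 rfl
  have hDX : D = X \ {x} := by
    refine hD.subset.antisymm fun z hz => ?_
    by_contra hzD
    obtain ⟨D', hzD', hD'⟩ := exists_isComp G hz
    have hdisj : ∀ w ∈ D, w ∉ D' := fun w hw hw' =>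
      hzD (hD.subset_of_conn hD'.conn hD'.subset ⟨w, hw', hw⟩ hzD')
    obtain ⟨x', hx', y, hy, hxy⟩ := htouch x hx hxY D' hD'
    obtain ⟨u, hu, hux⟩ := hX.adj_comp hx hD
    have hconn : Conn G (insert x D) := hD.conn.insert_adj hu hux
    have hsub : insert x D ⊆ X \ {x'} := by
      rintro w (rfl | hw)
      · exact ⟨hx, fun he => (hD'.subset hx').2 he.symm⟩
      · exact ⟨(hD.subset hw).1, fun he => hdisj w hw (he ▸ hx')⟩
    obtain ⟨D'', hxD'', hD''⟩ := exists_isComp G (hsub (Set.mem_insert x D))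
    have h1 := hD''.subset_of_conn hconn hsub ⟨x, Set.mem_insert x D, hxD''⟩
    have h2 := hmax (x', D'') ⟨(hD'.subset hx').1, ⟨x', rfl, y, hy, hxy⟩, hD''⟩
    have h3 := Set.ncard_le_ncard h1 (Set.toFinite _)
    rw [Set.ncard_insert_of_notMem hxD (Set.toFinite _)] at h3
    dsimp only at h2
    omega
  have h2 := hlD x hx hxY D hD
  have h4 : 4 ≤ (lab G 6 g Y).card := by
    have : (lab G 6 g D)ᶜ ⊆ lab G 6 g Y := by
      intro i hi
      rw [Finset.mem_compl, mem_lab] at hi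
      obtain ⟨c, hc, hcx, hci⟩ := hsnd x (hXC hx) i
      refine mem_lab.2 ⟨fun hz => hgC i (hYC hz), c, ⟨hc, fun hcX => hi ?_⟩, hci⟩
      exact ⟨fun hz => hgC i (hXC (hD.subset hz).1), c, hDX ▸ ⟨hcX, hcx⟩, hci⟩
    have := Finset.card_le_card this
    rw [Finset.card_compl, Fintype.card_fin] at this
    omega
  omega

end Local6

section Matching

variable {V : Type} {G : SimpleGraph V} {v : V} {d t : ℕ} {T : ℕ → ℕ → Bool} {g : ℕ → V}

theorem NbhdEnum.of_list [Finite V] {l : List V} (hnd : l.Nodup) (hadj : ∀ x ∈ l, G.Adj v x)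
    (hlen : l.length = d) (hd : (G.neighborSet v).ncard = d)
    (htab : ∀ i j, i < j → j < l.length → T i j = false → G.Adj (l.getD i v) (l.getD j v)) :
    NbhdEnum G v d T (fun i => l.getD i v) := by
  classical
  subst hlen
  have hset : {x | x ∈ l} = G.neighborSet v := by
    refine Set.eq_of_subset_of_ncard_le (fun x hx => hadj x hx) ?_ (Set.toFinite _)
    rw [hd, ← List.coe_toFinset, Set.ncard_coe_finset, List.toFinset_card_of_nodup hnd]
  refine ⟨fun i hi j hj hij => ?_, fun i hi => ?_, fun x hx => ?_, htab⟩
  · rw [List.getD_eq_getElem _ _ hi, List.getD_eq_getElem _ _ hj] at hij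
    exact (hnd.getElem_inj_iff).1 hij
  · rw [List.getD_eq_getElem _ _ hi]
    exact hadj _ (List.getElem_mem hi)
  · have hxl : x ∈ {x | x ∈ l} := hset ▸ hx
    obtain ⟨i, hi, rfl⟩ := List.getElem_of_mem hxl
    exact ⟨i, hi, List.getD_eq_getElem _ _ hi⟩

theorem NbhdEnum.mono {T' : ℕ → ℕ → Bool} (h : NbhdEnum G v d T g)
    (hT : ∀ i j, i < j → j < d → T' i j = false → T i j = false) : NbhdEnum G v d T' g :=
  ⟨h.inj, h.adj, h.surj, fun i j hij hj ht => h.tab i j hij hj (hT i j hij hj ht)⟩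

/-- A finite set in which every vertex has at most one non-neighbour can be listed with the
nonadjacent pairs first. -/
theorem exists_list_of_matching (s : Finset V) (hs : ∀ x ∈ s, ∀ y ∈ s, ∀ z ∈ s, x ≠ y → x ≠ z →
      ¬ G.Adj x y → ¬ G.Adj x z → y = z) : ∃ (l : List V) (k : ℕ), l.Nodup ∧ (∀ x, x ∈ l ↔ x ∈ s) ∧
      2 * k ≤ l.length ∧
      (∀ i j, i < j → j < l.length → tab6 k i j = false → G.Adj (l.getD i v) (l.getD j v)) ∧
      ∀ i < k, ¬ G.Adj (l.getD (2 * i) v) (l.getD (2 * i + 1) v) := by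
  classical
  induction s using Finset.strongInduction with
  | H s ih =>
    by_cases hcl : ∀ x ∈ s, ∀ y ∈ s, x ≠ y → G.Adj x y
    · refine ⟨s.toList, 0, s.nodup_toList, fun x => Finset.mem_toList, by omega,
        fun i j hij hj _ => ?_, fun i hi => by omega⟩
      rw [List.getD_eq_getElem _ _ hj, List.getD_eq_getElem _ _ (hij.trans hj)]
      exact hcl _ (Finset.mem_toList.1 (List.getElem_mem _)) _
        (Finset.mem_toList.1 (List.getElem_mem _)) fun he =>
          hij.ne ((s.nodup_toList.getElem_inj_iff).1 he)
    · push Not at hcl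
      obtain ⟨x, hx, y, hy, hxy, hn⟩ := hcl
      have hxz : ∀ z ∈ s, z ≠ x → z ≠ y → G.Adj x z := fun z hz h1 h2 => by
        by_contra hxz
        exact h2 (hs x hx y hy z hz hxy h1.symm hn hxz).symm
      have hyz : ∀ z ∈ s, z ≠ x → z ≠ y → G.Adj y z := fun z hz h1 h2 => by
        by_contra hyz
        exact h1 (hs y hy x hx z hz hxy.symm h2.symm (fun h => hn h.symm) hyz).symm
      obtain ⟨l, k, hl, hmem, hk, htab, hnon⟩ := ih ((s.erase x).erase y)
        ((Finset.erase_subset _ _).trans_ssubset (Finset.erase_ssubset hx)) (by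
          intro a ha b hb c hc
          simp only [Finset.mem_erase] at ha hb hc
          exact hs a ha.2.2 b hb.2.2 c hc.2.2)
      simp only [Finset.mem_erase] at hmem
      have hmem' : ∀ i < l.length, l.getD i v ≠ y ∧ l.getD i v ≠ x ∧ l.getD i v ∈ s := by
        intro i hi
        rw [List.getD_eq_getElem _ _ hi]
        exact (hmem _).1 (List.getElem_mem _)
      refine ⟨x :: y :: l, k + 1, ?_, fun z => ?_, by simp only [List.length_cons]; omega, ?_, ?_⟩
      · simp [hl, hmem, hxy]
      · simp only [List.mem_cons, hmem]
        by_cases h1 : z = x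
        · simp [h1, hx]
        · by_cases h2 : z = y
          · simp [h2, hy]
          · simp [h1, h2]
      · intro i j hij hj ht
        simp only [List.length_cons] at hj
        rcases j with _ | _ | j
        · omega
        · obtain rfl : i = 0 := by omega
          simp [tab6] at ht
        · have hj' := hmem' j (by omega)
          rcases i with _ | _ | i
          · simpa using hxz _ hj'.2.2 hj'.2.1 hj'.1
          · simpa using hyz _ hj'.2.2 hj'.2.1 hj'.1
          · simp only [List.getD_cons_succ]
            refine htab i j (by omega) (by omega) ?_
            simp only [tab6, Bool.and_eq_false_iff, beq_eq_false_iff_ne, decide_eq_false_iff_not] at ht ⊢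
            omega
      · rintro (_ | i) hi
        · simpa using hn
        · have := hnon i (by omega)
          rw [show 2 * (i + 1) = 2 * i + 2 by ring]
          simpa only [List.getD_cons_succ] using this

theorem exists_nbhdEnum_of_matching [Finite V] (hd : (G.neighborSet v).ncard = d)
    (hm : ∀ x y z, G.Adj v x → G.Adj v y → G.Adj v z → x ≠ y → x ≠ z →
      ¬ G.Adj x y → ¬ G.Adj x z → y = z) : ∃ (g : ℕ → V) (k : ℕ), NbhdEnum G v d (tab6 k) g ∧
      2 * k ≤ d ∧ ∀ i < k, ¬ G.Adj (g (2 * i)) (g (2 * i + 1)) := by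
  classical
  obtain ⟨l, k, hl, hmem, hk, htab, hnon⟩ := exists_list_of_matching (v := v)
    (Set.toFinite (G.neighborSet v)).toFinset (by
      simp only [Set.Finite.mem_toFinset, mem_neighborSet]
      exact fun x hx y hy z hz => hm x y z hx hy hz)
  simp only [Set.Finite.mem_toFinset, mem_neighborSet] at hmem
  have hlen : l.length = d := by
    rw [← hd, ← List.toFinset_card_of_nodup hl, ← Set.ncard_coe_finset]
    congr 1
    ext x
    simp [hmem]
  exact ⟨_, k, NbhdEnum.of_list hl (fun x => (hmem x).1) hlen hd htab, hlen ▸ hk, hnon⟩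

theorem Tight.nonadj_card [Finite V] (hG : Tight t G) {u : V} (h : G.Adj v u) :
    {w | G.Adj v w ∧ w ≠ u ∧ ¬ G.Adj u w}.ncard + 5 ≤ (G.neighborSet v).ncard := by
  have h4 := hG.four_le_common h
  have h1 : (insert u {w | G.Adj v w ∧ G.Adj u w}).ncard = _ :=
    Set.ncard_insert_of_notMem (fun hu => G.loopless.irrefl u hu.2) (Set.toFinite _)
  have h2 : Disjoint {w | G.Adj v w ∧ w ≠ u ∧ ¬ G.Adj u w} (insert u {w | G.Adj v w ∧ G.Adj u w}) := by
    rw [Set.disjoint_left]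
    rintro w ⟨-, hw1, hw2⟩ (hw | hw)
    · exact hw1 hw
    · exact hw2 hw.2
  have h3 : {w | G.Adj v w ∧ w ≠ u ∧ ¬ G.Adj u w} ∪ insert u {w | G.Adj v w ∧ G.Adj u w} ⊆
      G.neighborSet v := by
    rintro w (hw | rfl | hw)
    exacts [hw.1, h, hw.1]
  have h5 := Set.ncard_le_ncard h3 (Set.toFinite _)
  rw [Set.ncard_union_eq h2, h1] at h5
  omega

/-- A neighbour of a vertex `v` of minimum degree with a nonadjacent partner has a neighbour
outside the closed neighbourhood of `v`. -/
theorem exists_outer_adj [Finite V] {u w : V}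
    (hmin : (G.neighborSet v).ncard ≤ (G.neighborSet u).ncard) (hu : G.Adj v u) (hw : G.Adj v w)
    (hne : w ≠ u) (hn : ¬ G.Adj u w) : ∃ x ∈ outer G v, G.Adj x u := by
  by_contra! hcon
  have hsub : G.neighborSet u ⊆ insert v ((G.neighborSet v \ {w}) \ {u}) := by
    intro x hx
    by_cases hxv : x = v
    · exact Or.inl hxv
    refine Or.inr ⟨⟨?_, ?_⟩, ?_⟩
    · by_contra hvx
      exact hcon x ⟨hxv, hvx⟩ hx.symm
    · rintro rfl; exact hn hx
    · rintro rfl; exact G.loopless.irrefl _ hx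
  have h1 := (Set.ncard_le_ncard hsub (Set.toFinite _)).trans (Set.ncard_insert_le _ _)
  have h2 := Set.ncard_sdiff_singleton_add_one (s := G.neighborSet v) hw
  have h3 := Set.ncard_sdiff_singleton_add_one (s := G.neighborSet v \ {w}) (a := u) ⟨hu, hne.symm⟩
  omega

theorem Tight.five_lt_degree [Finite V] (hG : Tight t G) (v : V) : 5 < (G.neighborSet v).ncard := by
  by_contra hlt
  have hd : (G.neighborSet v).ncard = 5 := le_antisymm (not_lt.1 hlt) (hG.five_le_degree v)
  have hadj : ∀ x y, G.Adj v x → G.Adj v y → x ≠ y → G.Adj x y := by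
    intro x y hx hy hxy
    by_contra hn
    have h1 := hG.nonadj_card hx
    have h2 : {w | G.Adj v w ∧ w ≠ x ∧ ¬ G.Adj x w}.Nonempty := ⟨y, hy, hxy.symm, hn⟩
    have := (Set.ncard_pos (Set.toFinite _)).2 h2
    omega
  obtain ⟨g, k, hg, hk, hnon⟩ := exists_nbhdEnum_of_matching hd
    fun x y z hx hy hz hxy hxz h1 h2 => absurd (hadj x y hx hy hxy) h1
  have hk0 : k = 0 := by
    by_contra hk0
    refine hnon 0 (by omega) (hadj _ _ (hg.adj 0 (by omega)) (hg.adj 1 (by omega)) fun he => ?_)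
    exact absurd (hg.inj _ (by omega) _ (by omega) he) (by omega)
  subst hk0
  obtain ⟨x, hx⟩ : (outer G v).Nonempty := by
    by_contra hemp
    rw [Set.not_nonempty_iff_eq_empty] at hemp
    have h1 : (Set.univ : Set V) ⊆ insert v (G.neighborSet v) := by
      intro x _
      by_contra hx
      rw [Set.mem_insert_iff, not_or] at hx
      exact (hemp ▸ (show x ∈ outer G v from hx) : x ∈ (∅ : Set V))
    have h2 := (Set.ncard_le_ncard h1 (Set.toFinite _)).trans (Set.ncard_insert_le _ _)
    rw [Set.ncard_univ, hd] at h2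
    have h3 := hG.card_ge
    have h4 := hG.edges
    have h5 := dc_le_sq (G := G)
    have h6 := hG.t_cases
    rw [show Nat.card V = 6 by omega] at h4 h5
    omega
  obtain ⟨C, -, hC⟩ := exists_isComp G hx
  have h4 := hG.four_le_nb_outer hC.conn hC.subset
  obtain ⟨s, hs, hsC⟩ := hg.exists_missing (nb_subset_of_isComp_outer hC) (k := 1) (by omega) (by omega)
  obtain ⟨p, rfl⟩ := Finset.card_eq_one.1 hs
  have htab : ∀ p : Fin 5, veeOps 7 (locAdj 5 (tab6 0) (fun _ i => i != p) false) [] = true := by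
    decide +kernel
  obtain ⟨f, hf⟩ := hg.bags_one (m := fun _ i => i != p) (e := false) hC.conn hC.subset
    fun j hj hm => hsC ⟨j, hj⟩ (by simpa [Fin.ext_iff] using hm)
  exact hG.inW.1 (hf.vee_of_ops (htab p))

end Matching

section DegreeSix

variable {V : Type} {G : SimpleGraph V} {v : V} {t : ℕ} {g : ℕ → V}

theorem octa_of_locAdj : ∀ i j : Fin 8, octa.Adj i j →
    locAdj 6 (tab6 3) (fun _ _ => true) false i j = true ∨
      locAdj 6 (tab6 3) (fun _ _ => true) false j i = true := by
  decide +kernel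

theorem NbhdEnum.octa_isMinor {C : Set V} (h : NbhdEnum G v 6 (tab6 3) g) (hC : Conn G C)
    (hCS : C ⊆ outer G v) (hnb : ∀ i : Fin 6, g i ∈ nb G C) : IsMinor octa G := by
  obtain ⟨f, hf⟩ := h.bags_one (m := fun _ _ => true) (e := false) hC hCS
    fun j hj _ => hnb ⟨j, hj⟩
  refine isMinor_iff.2 ⟨fun i => f i, fun i => hf.conn i i.isLt, fun i j hij =>
    hf.disj i i.isLt j j.isLt (by rwa [ne_eq, Fin.val_inj]), fun i j hij => ?_⟩
  have hne : i.val ≠ j.val := by rw [ne_eq, Fin.val_inj]; exact hij.ne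
  rcases octa_of_locAdj i j hij with h1 | h1
  · exact hf.touch i i.isLt j j.isLt hne h1
  · exact (hf.touch j j.isLt i i.isLt hne.symm h1).symm

/-- A vertex of degree six with a single outer vertex forces too few edges. -/
theorem NbhdEnum.outer_ne_singleton [Finite V] (hG : Tight t G) (h : NbhdEnum G v 6 (tab6 3) g)
    (hd : (G.neighborSet v).ncard = 6) (hnon : ∀ i < 3, ¬ G.Adj (g (2 * i)) (g (2 * i + 1)))
    (ht : t = 7) (c : V) : outer G v ≠ {c} := by
  intro hc
  have := Fintype.ofFinite V
  have hcm : c ∈ outer G v := hc ▸ rfl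
  have hcov : ∀ x, x = v ∨ G.Adj v x ∨ x = c := by
    intro x
    by_contra! hx
    exact hx.2.2 (hc ▸ (show x ∈ outer G v from ⟨hx.1, hx.2.1⟩) : x ∈ ({c} : Set V))
  have hcard : Nat.card V = 8 := by
    have h1 : (insert c (insert v (G.neighborSet v))).ncard = 8 := by
      rw [Set.ncard_insert_of_notMem _ (Set.toFinite _), Set.ncard_insert_of_notMem _ (Set.toFinite _), hd]
      · exact fun h => G.loopless.irrefl _ h
      · rintro (h | h)
        exacts [hcm.1 h, hcm.2 h]
    rw [← h1, ← Set.ncard_univ]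
    congr 1
    ext x
    have := hcov x
    simp only [Set.mem_univ, Set.mem_insert_iff, mem_neighborSet, true_iff]
    tauto
  have hpart : ∀ x, ∃ y, y ≠ x ∧ ¬ G.Adj x y := by
    intro x
    rcases hcov x with rfl | hx | rfl
    · exact ⟨c, hcm⟩
    · obtain ⟨i, hi, rfl⟩ := h.surj x hx
      have hn := hnon (i / 2) (by omega)
      rcases Nat.even_or_odd' i with ⟨k, rfl | rfl⟩
      · rw [Nat.mul_div_cancel_left _ two_pos] at hn
        exact ⟨g (2 * k + 1), fun he => absurd (h.inj _ (by omega) _ hi he) (by omega), hn⟩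
      · rw [show (2 * k + 1) / 2 = k by omega] at hn
        exact ⟨g (2 * k), fun he => absurd (h.inj _ (by omega) _ hi he) (by omega), fun h => hn h.symm⟩
    · exact ⟨v, hcm.1.symm, fun h => hcm.2 h.symm⟩
  have hdeg : ∀ x, (G.neighborSet x).ncard ≤ 6 := by
    intro x
    obtain ⟨y, hyx, hn⟩ := hpart x
    have h1 : (insert x (insert y (G.neighborSet x))).ncard = _ :=
      Set.ncard_insert_of_notMem (by
        rintro (h | h)
        exacts [hyx h.symm, G.loopless.irrefl _ h]) (Set.toFinite _)
    rw [Set.ncard_insert_of_notMem (show y ∉ G.neighborSet x from hn) (Set.toFinite _)] at h1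
    have h2 := Set.ncard_le_ncard (Set.subset_univ (insert x (insert y (G.neighborSet x)))) (Set.toFinite _)
    rw [Set.ncard_univ] at h2
    omega
  have h1 := Finset.sum_le_card_nsmul Finset.univ (fun v => (G.neighborSet v).ncard) 6 fun v _ => hdeg v
  rw [← dc_eq_sum, Finset.card_univ, ← Nat.card_eq_fintype_card, smul_eq_mul] at h1
  have h2 := hG.edges
  omega

theorem Tight.degree_ne_six [Finite V] (hG : Tight t G)
    (hmin : ∀ u, (G.neighborSet v).ncard ≤ (G.neighborSet u).ncard) : (G.neighborSet v).ncard ≠ 6 := by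
  intro hd
  obtain ⟨g, k, hg, hk, hnon⟩ := exists_nbhdEnum_of_matching hd (by
    intro x y z hx hy hz hxy hxz hnxy hnxz
    have h1 := hG.nonadj_card hx
    rw [hd] at h1
    exact (Set.ncard_le_one (Set.toFinite _)).1 (by omega : {w | G.Adj v w ∧ w ≠ x ∧ ¬ G.Adj x w}.ncard ≤ 1)
      y ⟨hy, hxy.symm, hnxy⟩ z ⟨hz, hxz.symm, hnxz⟩)
  have houter : ∀ i < k, ∀ j, j = 2 * i ∨ j = 2 * i + 1 → ∃ x ∈ outer G v, G.Adj x (g j) := by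
    intro i hi j hj
    have h1 : G.Adj v (g (2 * i)) := hg.adj _ (by omega)
    have h2 : G.Adj v (g (2 * i + 1)) := hg.adj _ (by omega)
    have h3 : g (2 * i) ≠ g (2 * i + 1) := fun he => absurd (hg.inj _ (by omega) _ (by omega) he) (by omega)
    rcases hj with rfl | rfl
    · exact exists_outer_adj (hmin _) h1 h2 h3.symm (hnon i hi)
    · exact exists_outer_adj (hmin _) h2 h1 h3 fun h => hnon i hi h.symm
  by_cases hk1 : k ≤ 1
  · have hg1 : NbhdEnum G v 6 (tab6 1) g := hg.mono fun i j _ _ h => by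
      simp only [tab6, Bool.and_eq_false_iff, beq_eq_false_iff_ne, decide_eq_false_iff_not] at h ⊢
      omega
    exact hG.inW.1 ((hg1.bags (K := fun _ => ∅) (n := 7) (m := fun _ _ => false) (e := false)
      (fun i _ _ => by omega) (fun i j _ _ _ _ _ => by omega) (fun i _ _ => by omega)).vee_of_ops
        vee_table6_one)
  obtain ⟨x, hx, hx0⟩ := houter 0 (by omega) 0 (by omega)
  obtain ⟨C, hxC, hC⟩ := exists_isComp G hx
  have h4 := hG.four_le_nb_outer hC.conn hC.subset
  obtain ⟨s, hs, hsC⟩ := hg.exists_missing (nb_subset_of_isComp_outer hC) (k := 2) (by omega) (by omega)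
  obtain ⟨p, q, hpq, rfl⟩ := exists_lt_of_card_two s hs
  have hsC' : ∀ j < 6, (j != p.val && j != q.val) = true → g j ∈ nb G C := fun j hj hm =>
    hsC ⟨j, hj⟩ (by simpa [Fin.ext_iff] using hm)
  rcases Nat.lt_or_ge k 3 with hk3 | hk3
  · obtain rfl : k = 2 := by omega
    obtain ⟨f, hf⟩ := hg.bags_one (m := fun _ i => i != p.val && i != q.val) (e := false) hC.conn
      hC.subset hsC'
    exact hG.inW.1 (hf.vee_of_any (vee_table6_two p q hpq))
  obtain rfl : k = 3 := by omega
  by_cases hCo : C = outer G v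
  · subst hCo
    have hnb : ∀ i : Fin 6, g i ∈ nb G (outer G v) := by
      intro i
      obtain ⟨y, hy, hyi⟩ := houter (i.val / 2) (by omega) i (by omega)
      exact ⟨fun h => h.2 (hg.adj i i.isLt), y, hy, hyi⟩
    rcases hG.octa_cases with ⟨-, ho⟩ | ⟨ht, -⟩
    · exact ho (hg.octa_isMinor hC.conn subset_rfl hnb)
    · exact hG.inW.1 (hg.vee_of_octahedron hG hnon hC.conn hnb (hg.outer_ne_singleton hG hd hnon ht))
  · obtain ⟨y, hy, hyC⟩ := Set.exists_of_ssubset (hC.subset.ssubset_of_ne hCo)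
    obtain ⟨C', hyC', hC'⟩ := exists_isComp G hy
    have h4' := hG.four_le_nb_outer hC'.conn hC'.subset
    obtain ⟨s, hs, hsC''⟩ := hg.exists_missing (nb_subset_of_isComp_outer hC') (k := 2)
      (by omega) (by omega)
    obtain ⟨p', q', hpq', rfl⟩ := exists_lt_of_card_two s hs
    have hdisj : Disjoint C C' := by
      rw [Set.disjoint_left]
      exact fun z hz hz' => hyC (hC.subset_of_conn hC'.conn hC'.subset ⟨z, hz', hz⟩ hyC')
    obtain ⟨f, hf⟩ := hg.bags_two (m := fun k i => if k = 7 then i != p.val && i != q.val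
      else i != p'.val && i != q'.val) (e := false) hC.conn hC.subset hC'.conn hC'.subset hdisj
      (fun h => absurd h (by simp)) (fun j hj hm => hsC' j hj (by simpa using hm))
      (fun j hj hm => hsC'' ⟨j, hj⟩ (by simpa [Fin.ext_iff] using hm))
    exact hG.inW.1 (hf.vee_of_any (vee_table6_pair p q p' q' hpq hpq'))

end DegreeSix

section Chains

variable {V : Type} {G : SimpleGraph V} {v : V} {d k m t : ℕ} {T : ℕ → ℕ → Bool} {g p q : ℕ → V}

theorem NbhdEnum.of_inj [Finite V] (hd : (G.neighborSet v).ncard = d)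
    (hinj : ∀ i < d, ∀ j < d, g i = g j → i = j) (hadj : ∀ i < d, G.Adj v (g i))
    (htab : ∀ i j, i < j → j < d → T i j = false → G.Adj (g i) (g j)) : NbhdEnum G v d T g := by
  classical
  refine ⟨hinj, hadj, fun x hx => ?_, htab⟩
  have hset : ((Finset.range d).image g : Set V) = G.neighborSet v := by
    refine Set.eq_of_subset_of_ncard_le (fun x hx => ?_) ?_ (Set.toFinite _)
    · simp only [Finset.coe_image, Finset.coe_range, Set.mem_image, Set.mem_Iio] at hx
      obtain ⟨i, hi, rfl⟩ := hx
      exact hadj i hi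
    · rw [hd, Set.ncard_coe_finset, Finset.card_image_of_injOn, Finset.card_range]
      intro i hi j hj hij
      exact hinj i (by simpa using hi) j (by simpa using hj) hij
  have hx' : x ∈ ((Finset.range d).image g : Set V) := hset ▸ hx
  simpa using hx'

theorem NbhdEnum.glue [Finite V] (hd : (G.neighborSet v).ncard = k + m)
    (hp : ∀ i < k, ∀ j < k, p i = p j → i = j) (hpv : ∀ i < k, G.Adj v (p i))
    (hq : ∀ i < m, ∀ j < m, q i = q j → i = j) (hqv : ∀ i < m, G.Adj v (q i))
    (hpq : ∀ i < k, ∀ j < m, G.Adj (p i) (q j))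
    (hTp : ∀ i j, i < j → j < k → T i j = false → G.Adj (p i) (p j))
    (hTq : ∀ i j, i < j → j < m → T (k + i) (k + j) = false → G.Adj (q i) (q j)) :
    NbhdEnum G v (k + m) T (fun i => if i < k then p i else q (i - k)) := by
  refine NbhdEnum.of_inj hd (fun i hi j hj hij => ?_) (fun i hi => ?_) fun i j hij hj ht => ?_
  · split_ifs at hij with h1 h2 h2
    · exact hp i h1 j h2 hij
    · exact absurd hij (hpq i h1 _ (by omega)).ne
    · exact absurd hij (hpq j h2 _ (by omega)).ne'
    · have := hq _ (by omega) _ (by omega) hij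
      omega
  · split_ifs with h1
    exacts [hpv i h1, hqv _ (by omega)]
  · by_cases h2 : j < k
    · simp only [if_pos h2, if_pos (hij.trans h2)]
      exact hTp i j hij h2 ht
    by_cases h1 : i < k
    · simp only [if_neg h2, if_pos h1]
      exact hpq i h1 _ (by omega)
    · simp only [if_neg h2, if_neg h1]
      refine hTq _ _ (by omega) (by omega) ?_
      rwa [Nat.add_sub_cancel' (by omega), Nat.add_sub_cancel' (by omega)]

/-- The vertices `p 0, …, p (k - 1)` form a path in the complement of the neighbourhood of `v`. -/
structure Chain (G : SimpleGraph V) (v : V) (p : ℕ → V) (k : ℕ) : Prop where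
  inj : ∀ i < k, ∀ j < k, p i = p j → i = j
  mem : ∀ i < k, G.Adj v (p i)
  nonadj : ∀ i, i + 1 < k → ¬ G.Adj (p i) (p (i + 1))

/-- Every vertex of the neighbourhood of `v` has at most two non-neighbours in it. -/
def ThinNbhd (G : SimpleGraph V) (v : V) : Prop := ∀ x a b c, G.Adj v x → G.Adj v a → G.Adj v b →
  G.Adj v c → a ≠ x → b ≠ x → c ≠ x → a ≠ b → a ≠ c → b ≠ c → ¬ G.Adj x a → ¬ G.Adj x b → G.Adj x c

theorem Chain.adj_self (hN : ThinNbhd G v) (h : Chain G v p k) {i j : ℕ} (hij : i < j) (hj : j < k)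
    (h1 : j ≠ i + 1) (h2 : ¬ (i = 0 ∧ j + 1 = k)) : G.Adj (p i) (p j) := by
  have hne : ∀ a < k, ∀ b < k, a ≠ b → p a ≠ p b := fun a ha b hb hab he => hab (h.inj a ha b hb he)
  by_cases hi : i = 0
  · refine (hN (p j) (p (j - 1)) (p (j + 1)) (p i) (h.mem _ hj) (h.mem _ (by omega))
      (h.mem _ (by omega)) (h.mem _ (by omega)) (hne _ (by omega) _ hj (by omega))
      (hne _ (by omega) _ hj (by omega)) (hne _ (by omega) _ hj (by omega))
      (hne _ (by omega) _ (by omega) (by omega)) (hne _ (by omega) _ (by omega) (by omega))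
      (hne _ (by omega) _ (by omega) (by omega)) ?_ (h.nonadj j (by omega))).symm
    have := h.nonadj (j - 1) (by omega)
    rw [show j - 1 + 1 = j by omega] at this
    exact fun h => this h.symm
  · refine hN (p i) (p (i - 1)) (p (i + 1)) (p j) (h.mem _ (by omega)) (h.mem _ (by omega))
      (h.mem _ (by omega)) (h.mem _ (by omega)) (hne _ (by omega) _ (by omega) (by omega))
      (hne _ (by omega) _ (by omega) (by omega)) (hne _ (by omega) _ (by omega) (by omega))
      (hne _ (by omega) _ (by omega) (by omega)) (hne _ (by omega) _ (by omega) (by omega))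
      (hne _ (by omega) _ (by omega) (by omega)) ?_ (h.nonadj i (by omega))
    have := h.nonadj (i - 1) (by omega)
    rw [show i - 1 + 1 = i by omega] at this
    exact fun h => this h.symm

theorem Chain.cons (h : Chain G v p k) {y : V} (hy : G.Adj v y) (hyp : ∀ j < k, p j ≠ y)
    (hn : ¬ G.Adj (p 0) y) : Chain G v (fun i => if i = 0 then y else p (i - 1)) (k + 1) := by
  refine ⟨fun i hi j hj hij => ?_, fun i hi => ?_, fun i hi => ?_⟩
  · split_ifs at hij with h1 h2 h2
    · omega
    · exact absurd hij.symm (hyp _ (by omega))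
    · exact absurd hij (hyp _ (by omega))
    · have := h.inj _ (by omega) _ (by omega) hij
      omega
  · split_ifs
    exacts [hy, h.mem _ (by omega)]
  · by_cases hi0 : i = 0
    · subst hi0
      simpa using fun h => hn h.symm
    · simp only [if_neg hi0, Nat.add_eq_zero_iff, one_ne_zero, and_false, if_false]
      have := h.nonadj (i - 1) (by omega)
      rwa [show i - 1 + 1 = i + 1 - 1 by omega] at this

theorem Chain.reverse (h : Chain G v p k) : Chain G v (fun i => p (k - 1 - i)) k := by
  refine ⟨fun i hi j hj hij => ?_, fun i hi => h.mem _ (by omega), fun i hi => ?_⟩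
  · have := h.inj _ (by omega) _ (by omega) hij
    omega
  · have := h.nonadj (k - 1 - (i + 1)) (by omega)
    rw [show k - 1 - (i + 1) + 1 = k - 1 - i by omega] at this
    exact fun h => this h.symm

theorem Chain.adj_of_maximal (hN : ThinNbhd G v) (h : Chain G v p k)
    (hmax : ∀ p', ¬ Chain G v p' (k + 1)) {i : ℕ} (hi : i < k) {y : V} (hy : G.Adj v y)
    (hyp : ∀ j < k, p j ≠ y) : G.Adj (p i) y := by
  by_contra hn
  by_cases h0 : i = 0
  · subst h0
    exact hmax _ (h.cons hy hyp hn)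
  by_cases h1 : i + 1 = k
  · refine hmax _ (h.reverse.cons hy (fun j hj => hyp _ (by omega)) ?_)
    rwa [show k - 1 - 0 = i by omega]
  have hne : ∀ a < k, ∀ b < k, a ≠ b → p a ≠ p b := fun a ha b hb hab he => hab (h.inj a ha b hb he)
  refine hn (hN (p i) (p (i - 1)) (p (i + 1)) y (h.mem _ hi) (h.mem _ (by omega))
    (h.mem _ (by omega)) hy (hne _ (by omega) _ (by omega) (by omega))
    (hne _ (by omega) _ (by omega) (by omega)) (hyp i hi).symm
    (hne _ (by omega) _ (by omega) (by omega)) (hyp _ (by omega)) (hyp _ (by omega)) ?_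
    (h.nonadj i (by omega)))
  have := h.nonadj (i - 1) (by omega)
  rw [show i - 1 + 1 = i by omega] at this
  exact fun h => this h.symm

theorem Chain.exists_rest [Finite V] (h : Chain G v p k) (hd : (G.neighborSet v).ncard = k + m) :
    ∃ q : ℕ → V, (∀ i < m, ∀ j < m, q i = q j → i = j) ∧ (∀ i < m, G.Adj v (q i)) ∧
      ∀ i < m, ∀ j < k, p j ≠ q i := by
  classical
  let P : Finset V := (Finset.range k).image p
  let R : Finset V := (Set.toFinite (G.neighborSet v)).toFinset \ P
  have hP : P.card = k := by
    rw [Finset.card_image_of_injOn, Finset.card_range]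
    intro i hi j hj hij
    exact h.inj i (by simpa using hi) j (by simpa using hj) hij
  have hPN : P ⊆ (Set.toFinite (G.neighborSet v)).toFinset := by
    intro x hx
    simp only [P, Finset.mem_image, Finset.mem_range] at hx
    obtain ⟨i, hi, rfl⟩ := hx
    simpa using h.mem i hi
  have hR : R.toList.length = m := by
    rw [Finset.length_toList, Finset.card_sdiff_of_subset hPN, hP,
      ← Set.ncard_eq_toFinset_card (G.neighborSet v), hd]
    omega
  have hmem : ∀ i < m, R.toList.getD i v ∈ R := fun i hi => by
    rw [List.getD_eq_getElem _ _ (hR ▸ hi)]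
    exact Finset.mem_toList.1 (List.getElem_mem _)
  refine ⟨fun i => R.toList.getD i v, fun i hi j hj hij => ?_, fun i hi => ?_, fun i hi j hj he => ?_⟩
  · dsimp only at hij
    rw [List.getD_eq_getElem _ _ (hR ▸ hi), List.getD_eq_getElem _ _ (hR ▸ hj)] at hij
    exact (R.nodup_toList.getElem_inj_iff).1 hij
  · have := (Finset.mem_sdiff.1 (hmem i hi)).1
    simpa using this
  · have := (Finset.mem_sdiff.1 (hmem i hi)).2
    exact this (Finset.mem_image.2 ⟨j, Finset.mem_range.2 hj, he⟩)

theorem Chain.exists_nbhdEnum [Finite V] (hN : ThinNbhd G v) (h : Chain G v p k)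
    (hmax : ∀ p', ¬ Chain G v p' (k + 1)) (hd : (G.neighborSet v).ncard = k + m)
    (hTp : ∀ j < k, ∀ i < j, T i j = false → j ≠ i + 1 ∧ ¬ (i = 0 ∧ j + 1 = k))
    (hTq : ∀ j < m, ∀ i < j, T (k + i) (k + j) = true) : ∃ g, NbhdEnum G v (k + m) T g := by
  obtain ⟨q, hq, hqv, hqp⟩ := h.exists_rest hd
  refine ⟨_, NbhdEnum.glue hd h.inj h.mem hq hqv
    (fun i hi j hj => h.adj_of_maximal hN hmax hi (hqv j hj) (hqp j hj))
    (fun i j hij hj ht => ?_) fun i j hij hj ht => ?_⟩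
  · obtain ⟨h1, h2⟩ := hTp j hj i hij ht
    exact h.adj_self hN hij hj h1 h2
  · rw [hTq j hj i hij] at ht
    exact absurd ht (by simp)

theorem chain_three {x y z : V} (hx : G.Adj v x) (hy : G.Adj v y) (hz : G.Adj v z) (hxy : x ≠ y)
    (hxz : x ≠ z) (hyz : y ≠ z) (h1 : ¬ G.Adj x y) (h2 : ¬ G.Adj x z) :
    Chain G v (fun i => if i = 0 then y else if i = 1 then x else z) 3 := by
  refine ⟨fun i hi j hj hij => ?_, fun i hi => ?_, fun i hi => ?_⟩
  · interval_cases i <;> interval_cases j <;> simp_all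
  · interval_cases i <;> simpa
  · have : i = 0 ∨ i = 1 := by omega
    rcases this with rfl | rfl
    · simpa using fun h => h1 h.symm
    · simpa using h2

theorem Chain.exists_nbhdEnum_three [Finite V] (hN : ThinNbhd G v) (h : Chain G v p 3)
    (hmax : ∀ p', ¬ Chain G v p' 4) (hd : (G.neighborSet v).ncard = 7) :
    (∃ g, NbhdEnum G v 7 (tab7 3) g) ∨ ∃ g, NbhdEnum G v 7 (tab7 4) g := by
  classical
  by_cases hR : ∀ x y z, G.Adj v x → G.Adj v y → G.Adj v z → (∀ j < 3, p j ≠ x) → (∀ j < 3, p j ≠ y) →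
      (∀ j < 3, p j ≠ z) → x ≠ y → x ≠ z → ¬ G.Adj x y → ¬ G.Adj x z → y = z
  · left
    obtain ⟨q, hq, hqv, hqp⟩ := h.exists_rest (m := 4) hd
    have hs : ∀ x ∈ (Finset.range 4).image q, G.Adj v x ∧ ∀ j < 3, p j ≠ x := by
      intro x hx
      simp only [Finset.mem_image, Finset.mem_range] at hx
      obtain ⟨i, hi, rfl⟩ := hx
      exact ⟨hqv i hi, hqp i hi⟩
    obtain ⟨l, k, hl, hmem, hk, htab, -⟩ := exists_list_of_matching (G := G) (v := v)
      ((Finset.range 4).image q) (fun x hx y hy z hz => hR x y z (hs x hx).1 (hs y hy).1 (hs z hz).1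
        (hs x hx).2 (hs y hy).2 (hs z hz).2)
    have hlen : l.length = 4 := by
      rw [← List.toFinset_card_of_nodup hl, ← Finset.card_range 4]
      rw [← Finset.card_image_of_injOn (f := q) (s := Finset.range 4) (by
        intro i hi j hj hij
        exact hq i (by simpa using hi) j (by simpa using hj) hij)]
      congr 1
      ext x
      rw [List.mem_toFinset, hmem]
    have hmem' : ∀ i < 4, l.getD i v ∈ (Finset.range 4).image q := fun i hi => by
      rw [List.getD_eq_getElem _ _ (hlen ▸ hi), ← hmem]
      exact List.getElem_mem _
    refine ⟨_, NbhdEnum.glue (k := 4) (m := 3) (p := fun i => l.getD i v) hd (fun i hi j hj hij => ?_)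
      (fun i hi => (hs _ (hmem' i hi)).1) h.inj h.mem
      (fun i hi j hj => (h.adj_of_maximal hN hmax hj (hs _ (hmem' i hi)).1 (hs _ (hmem' i hi)).2).symm)
      (fun i j hij hj ht => htab i j hij (hlen ▸ hj) ?_) fun i j hij hj ht => ?_⟩
    · rw [List.getD_eq_getElem _ _ (hlen ▸ hi), List.getD_eq_getElem _ _ (hlen ▸ hj)] at hij
      exact (hl.getElem_inj_iff).1 hij
    · have : ∀ k ≤ 2, ∀ j < 4, ∀ i < j, tab7 3 i j = false → tab6 k i j = false := by decide
      exact this k (by omega) j hj i hij ht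
    · have : ∀ j < 3, ∀ i < j, tab7 3 (4 + i) (4 + j) = true := by decide
      rw [this j hj i hij] at ht
      exact absurd ht (by simp)
  · right
    push Not at hR
    obtain ⟨x, y, z, hx, hy, hz, hxp, hyp, hzp, hxy, hxz, h1, h2, hyz⟩ := hR
    have h' := chain_three hx hy hz hxy hxz hyz h1 h2
    set r : ℕ → V := fun i => if i = 0 then y else if i = 1 then x else z with hr
    have hrp : ∀ i < 3, ∀ j < 3, p j ≠ r i := by
      intro i hi j hj
      interval_cases i
      exacts [hyp j hj, hxp j hj, hzp j hj]
    obtain ⟨w, hw, hwp⟩ : ∃ w, G.Adj v w ∧ w ∉ (Finset.range 3).image p ∪ (Finset.range 3).image r := by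
      by_contra! hcon
      have hsub : G.neighborSet v ⊆ ((Finset.range 3).image p ∪ (Finset.range 3).image r : Finset V) :=
        fun w hw => hcon w hw
      have h3 := Set.ncard_le_ncard hsub (Set.toFinite _)
      rw [Set.ncard_coe_finset, hd] at h3
      have h4 := Finset.card_union_le ((Finset.range 3).image p) ((Finset.range 3).image r)
      have h5 := Finset.card_image_le (s := Finset.range 3) (f := p)
      have h6 := Finset.card_image_le (s := Finset.range 3) (f := r)
      rw [Finset.card_range] at h5 h6
      omega
    simp only [Finset.mem_union, Finset.mem_image, Finset.mem_range, not_or, not_exists, not_and] at hwp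
    refine ⟨_, NbhdEnum.glue (k := 3) (m := 4) (q := fun i => if i < 3 then r i else w) hd h.inj h.mem
      (fun i hi j hj hij => ?_) (fun i hi => ?_) (fun i hi j hj => ?_) (fun i j hij hj ht => ?_)
      fun i j hij hj ht => ?_⟩
    · split_ifs at hij with h3 h4 h4
      · exact h'.inj i h3 j h4 hij
      · exact absurd hij (hwp.2 i h3)
      · exact absurd hij.symm (hwp.2 j h4)
      · omega
    · split_ifs with h3
      exacts [h'.mem i h3, hw]
    · split_ifs with h3
      · exact h.adj_of_maximal hN hmax hi (h'.mem j h3) fun a ha => hrp j h3 a ha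
      · exact h.adj_of_maximal hN hmax hi hw hwp.1
    · have : ∀ j < 3, ∀ i < j, tab7 4 i j = true := by decide
      rw [this j hj i hij] at ht
      exact absurd ht (by simp)
    · by_cases h3 : j < 3
      · have : ∀ j < 3, ∀ i < j, tab7 4 (3 + i) (3 + j) = true := by decide
        rw [this j h3 i hij] at ht
        exact absurd ht (by simp)
      · simp only [if_neg h3, if_pos (by omega : i < 3)]
        exact h'.adj_of_maximal hN hmax (by omega) hw hwp.2

theorem ThinNbhd.exists_nbhdEnum [Finite V] (hN : ThinNbhd G v) (hd : (G.neighborSet v).ncard = 7) :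
    ∃ (t : Fin 5) (g : ℕ → V), NbhdEnum G v 7 (tab7 t) g := by
  classical
  have h8 : ∀ p, ¬ Chain G v p 8 := by
    intro p hp
    have hsub : ((Finset.range 8).image p : Set V) ⊆ G.neighborSet v := by
      intro x hx
      simp only [Finset.coe_image, Finset.coe_range, Set.mem_image, Set.mem_Iio] at hx
      obtain ⟨i, hi, rfl⟩ := hx
      exact hp.mem i hi
    have h1 := Set.ncard_le_ncard hsub (Set.toFinite _)
    rw [Set.ncard_coe_finset, Finset.card_image_of_injOn, Finset.card_range, hd] at h1
    · omega
    · intro i hi j hj hij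
      exact hp.inj i (by simpa using hi) j (by simpa using hj) hij
  by_cases h7 : ∃ p, Chain G v p 7
  · obtain ⟨p, hp⟩ := h7
    exact ⟨0, hp.exists_nbhdEnum (m := 0) hN h8 hd (by decide) (by decide)⟩
  by_cases h6 : ∃ p, Chain G v p 6
  · obtain ⟨p, hp⟩ := h6
    exact ⟨1, hp.exists_nbhdEnum (m := 1) hN (not_exists.1 h7) hd (by decide) (by decide)⟩
  by_cases h5 : ∃ p, Chain G v p 5
  · obtain ⟨p, hp⟩ := h5
    exact ⟨2, hp.exists_nbhdEnum (m := 2) hN (not_exists.1 h6) hd (by decide) (by decide)⟩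
  by_cases h4 : ∃ p, Chain G v p 4
  · obtain ⟨p, hp⟩ := h4
    exact ⟨3, hp.exists_nbhdEnum (m := 3) hN (not_exists.1 h5) hd (by decide) (by decide)⟩
  by_cases h3 : ∃ p, Chain G v p 3
  · obtain ⟨p, hp⟩ := h3
    rcases hp.exists_nbhdEnum_three hN (not_exists.1 h4) hd with h | h
    exacts [⟨3, h⟩, ⟨4, h⟩]
  obtain ⟨g, k, hg, hk, -⟩ := exists_nbhdEnum_of_matching hd (by
    intro x y z hx hy hz hxy hxz h1 h2
    by_contra hyz
    exact h3 ⟨_, chain_three hx hy hz hxy hxz hyz h1 h2⟩)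
  refine ⟨0, g, hg.mono fun i j hij hj ht => ?_⟩
  have : ∀ k ≤ 3, ∀ j < 7, ∀ i < j, tab7 0 i j = false → tab6 k i j = false := by decide
  exact this k (by omega) j hj i hij ht

end Chains

section DegreeSeven

variable {V : Type} {G : SimpleGraph V} {v : V} {t : ℕ} {g : ℕ → V}

theorem mul_card_le_dc [Finite V] {d : ℕ} (h : ∀ u, d ≤ (G.neighborSet u).ncard) :
    d * Nat.card V ≤ dc G := by
  have := Fintype.ofFinite V
  rw [dc_eq_sum, Nat.card_eq_fintype_card, ← Finset.card_univ, mul_comm, ← smul_eq_mul]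
  exact Finset.card_nsmul_le_sum _ _ _ fun u _ => h u

theorem Tight.thinNbhd [Finite V] (hG : Tight t G) (hd : (G.neighborSet v).ncard = 7) :
    ThinNbhd G v := by
  intro x a b c hx ha hb hc hax hbx hcx hab hac hbc hna hnb
  by_contra hnc
  have h1 := hG.nonadj_card hx
  have h2 : 2 < {w | G.Adj v w ∧ w ≠ x ∧ ¬ G.Adj x w}.ncard :=
    (Set.two_lt_ncard_iff (Set.toFinite _)).2
      ⟨a, b, c, ⟨ha, hax, hna⟩, ⟨hb, hbx, hnb⟩, ⟨hc, hcx, hnc⟩, hab, hac, hbc⟩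
  omega

theorem Tight.outer_nonempty [Finite V] (hG : Tight t G)
    (hmin : ∀ u, (G.neighborSet v).ncard ≤ (G.neighborSet u).ncard)
    (hd : (G.neighborSet v).ncard = 7) : (outer G v).Nonempty := by
  by_contra hemp
  rw [Set.not_nonempty_iff_eq_empty] at hemp
  have h1 : (Set.univ : Set V) ⊆ insert v (G.neighborSet v) := by
    intro x _
    by_contra hx
    rw [Set.mem_insert_iff, not_or] at hx
    exact (hemp ▸ (show x ∈ outer G v from hx) : x ∈ (∅ : Set V))
  have h2 := (Set.ncard_le_ncard h1 (Set.toFinite _)).trans (Set.ncard_insert_le _ _)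
  have h3 := Set.ncard_insert_of_notMem (s := G.neighborSet v) (a := v)
    (fun h => G.loopless.irrefl v h) (Set.toFinite _)
  have h4 := Set.ncard_le_ncard (Set.subset_univ (insert v (G.neighborSet v))) (Set.toFinite _)
  rw [Set.ncard_univ] at h2 h4
  have h5 := hG.edges
  have h6 := mul_card_le_dc hmin
  have h7 := hG.t_cases
  rw [show Nat.card V = 8 by omega] at h5 h6
  omega

theorem NbhdEnum.exceptional [Finite V] (hG : Tight t G) {k : Fin 5} (h : NbhdEnum G v 7 (tab7 k) g)
    {C : Set V} (hC : IsComp G (outer G v) C) : k = 2 ∧ ∃ p q r : Fin 7, p < q ∧ q < r ∧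
      exc7 p q r ∧ ∀ j < 7, (j != p.val && j != q.val && j != r.val) = true → g j ∈ nb G C := by
  have h4 := hG.four_le_nb_outer hC.conn hC.subset
  obtain ⟨s, hs, hsC⟩ := h.exists_missing (nb_subset_of_isComp_outer hC) (k := 3) (by omega) (by omega)
  obtain ⟨p, q, r, hpq, hqr, rfl⟩ := exists_lt_of_card_three s hs
  have hsC' : ∀ j < 7, (j != p.val && j != q.val && j != r.val) = true → g j ∈ nb G C :=
    fun j hj hm => hsC ⟨j, hj⟩ (by simpa [Fin.ext_iff, and_assoc] using hm)
  rcases vee_table7 k p q r hpq hqr with ⟨hk, he⟩ | hv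
  · exact ⟨hk, p, q, r, hpq, hqr, he, hsC'⟩
  · obtain ⟨f, hf⟩ := h.bags_one (m := fun _ i => i != p.val && i != q.val && i != r.val) (e := false)
      hC.conn hC.subset hsC'
    exact absurd (hf.vee_of_any hv) hG.inW.1

theorem NbhdEnum.vee_of_missing_two (h : NbhdEnum G v 7 (tab7 2) g) {C : Set V}
    (hC : IsComp G (outer G v) C) {p q : Fin 7} (hpq : p < q)
    (hm : ∀ j < 7, (j != p.val && j != q.val) = true → g j ∈ nb G C) : IsMinor K7vee G := by
  obtain ⟨f, hf⟩ := h.bags_one (m := fun _ i => i != p.val && i != q.val) (e := false)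
    hC.conn hC.subset hm
  exact hf.vee_of_any (vee_table7_two p q hpq)

theorem Tight.degree_ne_seven [Finite V] (hG : Tight t G)
    (hmin : ∀ u, (G.neighborSet v).ncard ≤ (G.neighborSet u).ncard) :
    (G.neighborSet v).ncard ≠ 7 := by
  intro hd
  obtain ⟨k, g, hg⟩ := (hG.thinNbhd hd).exists_nbhdEnum hd
  obtain ⟨x, hx⟩ := hG.outer_nonempty hmin hd
  obtain ⟨C, -, hC⟩ := exists_isComp G hx
  obtain ⟨rfl, p, q, r, hpq, hqr, hexc, hm⟩ := hg.exceptional hG hC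
  have hout : ∀ i : Fin 7, i = p ∨ i = q ∨ i = r → ∀ j < 7, j ≠ i.val → G.Adj (g i) (g j) := by
    intro i hi j hj hji
    by_contra hn
    have hvi := hg.adj i i.isLt
    obtain ⟨y, hy, hyi⟩ := exists_outer_adj (hmin _) hvi (hg.adj j hj)
      (fun he => hji (hg.inj _ hj _ i.isLt he)) hn
    obtain ⟨C', hyC', hC'⟩ := exists_isComp G hy
    have hiC' : g i ∈ nb G C' := ⟨fun h => (hC'.subset h).2 hvi, y, hyC', hyi⟩
    by_cases hCC : C' = C
    · subst hCC
      have hm' : ∀ a b : Fin 7, (∀ j : Fin 7, j ≠ a → j ≠ b → j = i ∨ (j ≠ p ∧ j ≠ q ∧ j ≠ r)) →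
          ∀ j < 7, (j != a.val && j != b.val) = true → g j ∈ nb G C' := by
        intro a b hab j hj hj'
        simp only [Bool.and_eq_true, bne_iff_ne] at hj'
        rcases hab ⟨j, hj⟩ (fun h => hj'.1 (congrArg Fin.val h)) (fun h => hj'.2 (congrArg Fin.val h))
          with h | ⟨h1, h2, h3⟩
        · rw [← show j = i.val from congrArg Fin.val h] at hiC'
          exact hiC'
        · refine hm j hj ?_
          simp only [Bool.and_eq_true, bne_iff_ne]
          exact ⟨⟨fun h => h1 (Fin.ext h), fun h => h2 (Fin.ext h)⟩, fun h => h3 (Fin.ext h)⟩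
      rcases hi with rfl | rfl | rfl
      · exact hG.inW.1 (hg.vee_of_missing_two hC hqr (hm' _ _ fun j _ _ => by tauto))
      · exact hG.inW.1 (hg.vee_of_missing_two hC (hpq.trans hqr) (hm' _ _ fun j _ _ => by tauto))
      · exact hG.inW.1 (hg.vee_of_missing_two hC hpq (hm' _ _ fun j _ _ => by tauto))
    · obtain ⟨-, p', q', r', -, -, hexc', hm'⟩ := hg.exceptional hG hC'
      have hdisj : Disjoint C C' := by
        rw [Set.disjoint_left]
        intro z hz hz'
        exact hCC ((hC.subset_of_conn hC'.conn hC'.subset ⟨z, hz', hz⟩).antisymm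
          (hC'.subset_of_conn hC.conn hC.subset ⟨z, hz, hz'⟩))
      obtain ⟨f, hf⟩ := hg.bags_two (m := fun k i => if k = 8 then i != p.val && i != q.val && i != r.val
        else i != p'.val && i != q'.val && i != r'.val) (e := false) hC.conn hC.subset hC'.conn
        hC'.subset hdisj (fun h => absurd h (by simp)) (fun j hj hmj => hm j hj (by simpa using hmj))
        (fun j hj hmj => hm' j hj (by simpa using hmj))
      exact hG.inW.1 (hf.vee_of_any (vee_table7_pair p q r p' q' r' hexc hexc'))
  have htab : ∀ p q r : Fin 7, exc7 p q r → ∀ i j : Fin 7, i < j →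
      (i.val == 5 && j.val == 6) = false → tab7 2 i j = false ∨ (i = p ∨ i = q ∨ i = r) ∨
        (j = p ∨ j = q ∨ j = r) := by
    decide +kernel
  have hg' : NbhdEnum G v 7 (fun i j => i == 5 && j == 6) g := by
    refine ⟨hg.inj, hg.adj, hg.surj, fun i j hij hj ht => ?_⟩
    rcases htab p q r hexc ⟨i, hij.trans hj⟩ ⟨j, hj⟩ hij ht with h | h | h
    · exact hg.tab i j hij hj h
    · exact hout _ h j hj hij.ne'
    · exact (hout _ h i (hij.trans hj) hij.ne).symm
  exact hG.inW.1 ((hg'.bags (K := fun _ => ∅) (n := 8) (m := fun _ _ => false) (e := false)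
    (fun i _ _ => by omega) (fun i j _ _ _ _ _ => by omega) (fun i _ _ => by omega)).vee_of_ops
      (show veeOps 8 _ [(5, 5)] = true by decide +kernel))

theorem Tight.false [Finite V] (hG : Tight t G) : False := by
  obtain ⟨u, hu⟩ := hG.exists_degree_le
  have : Nonempty V := ⟨u⟩
  obtain ⟨v, hv⟩ := Finite.exists_min fun u => (G.neighborSet u).ncard
  have h1 := hG.five_lt_degree v
  have h2 := hG.degree_ne_six hv
  have h3 := hG.degree_ne_seven hv
  have h4 := hv u
  omega

end DegreeSeven

section Extremal

variable {V : Type} {G : SimpleGraph V}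

theorem dc_eq_two_mul_ncard [Finite V] (G : SimpleGraph V) : dc G = 2 * G.edgeSet.ncard := by
  classical
  have := Fintype.ofFinite V
  rw [dc_eq_sum, Set.ncard_eq_toFinset_card', ← edgeFinset, ← G.sum_degrees_eq_twice_card_edges]
  refine Finset.sum_congr rfl fun v _ => ?_
  rw [Set.ncard_eq_toFinset_card', ← G.card_neighborFinset_eq_degree]
  rfl

theorem isMinor_refl (G : SimpleGraph V) : IsMinor G G :=
  Model.isMinor (bag := fun v => {v}) ⟨fun _ => conn_singleton _,
    fun _ _ h => Set.disjoint_singleton.2 h, fun _ _ h => touch_singleton.2 h⟩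

theorem exists_le_dc_eq [Finite V] {m : ℕ} (hm : 2 * m ≤ dc G) : ∃ G' ≤ G, dc G' = 2 * m := by
  rw [dc_eq_two_mul_ncard] at hm
  obtain ⟨s, hs, hsm⟩ := Set.exists_subset_card_eq (s := G.edgeSet) (n := m) (by omega)
  have hes : (fromEdgeSet s).edgeSet = s := by
    rw [edgeSet_fromEdgeSet, sdiff_eq_left, Set.disjoint_left]
    exact fun e he => G.not_isDiag_of_mem_edgeSet (hs he)
  refine ⟨fromEdgeSet s, ?_, ?_⟩
  · rw [← edgeSet_subset_edgeSet, hes]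
    exact hs
  · rw [dc_eq_two_mul_ncard, hes, hsm]

/-- Graphs without a `K7vee`-minor, distant octahedra, or an octahedron minor have at most
`4 n - 9` edges. -/
theorem dc_le_of_not_octa [Finite V] (hG : InW G) (ho : ¬ IsMinor octa G) (h3 : 3 ≤ Nat.card V) :
    dc G + 18 ≤ 8 * Nat.card V := by
  induction hn : Nat.card V using Nat.strong_induction_on generalizing V with
  | _ n ih =>
    by_contra hlt
    have heven := even_iff_two_dvd.1 (even_dc G)
    obtain ⟨G', hle, hdc⟩ := exists_le_dc_eq (G := G) (m := 4 * Nat.card V - 8) (by omega)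
    have hmin : IsMinor G' G := isMinor_mono hle (isMinor_refl G')
    have hT : Tight 8 G' := by
      refine ⟨hG.mono hle, h3, by omega, fun {U} _ K hK hU hUV => ?_,
        Or.inl ⟨rfl, fun h => ho (isMinor_trans h hmin)⟩⟩
      have hKG := isMinor_trans hK hmin
      have := ih _ (hn ▸ hUV) (hG.of_isMinor hKG) (fun h => ho (isMinor_trans h hKG)) hU rfl
      omega
    exact hT.false

/-- Graphs without a `K7vee`-minor or distant octahedra have at most `4 n - 8` edges. -/
theorem InW.dc_le [Finite V] (hG : InW G) (h3 : 3 ≤ Nat.card V) : dc G + 16 ≤ 8 * Nat.card V := by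
  induction hn : Nat.card V using Nat.strong_induction_on generalizing V with
  | _ n ih =>
    by_contra hlt
    have heven := even_iff_two_dvd.1 (even_dc G)
    obtain ⟨G', hle, hdc⟩ := exists_le_dc_eq (G := G) (m := 4 * Nat.card V - 7) (by omega)
    have hG' := hG.mono hle
    have hT : Tight 7 G' := by
      refine ⟨hG', h3, by omega, fun {U} _ K hK hU hUV => ?_,
        Or.inr ⟨rfl, fun {U} _ K hK hU hd => ?_⟩⟩
      · have := ih _ (hn ▸ hUV) (hG'.of_isMinor hK) hU rfl
        omega
      · by_contra ho
        have := dc_le_of_not_octa (hG'.of_isMinor hK) ho hU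
        omega
    exact hT.false

theorem MinCE.false [Finite V] (hG : MinCE G) : False := by
  have hd : ∀ v, 8 ≤ (G.neighborSet v).ncard := fun v =>
    lt_of_le_of_ne (hG.seven_le_degree v) (hG.degree_ne_seven v).symm
  have hle := mul_card_le_dc hd
  by_cases h3 : 3 ≤ Nat.card V
  · have := hG.inW.dc_le h3
    omega
  · have hsq := dc_le_sq (G := G)
    have hpos : Nonempty V := by
      by_contra hemp
      rw [not_nonempty_iff] at hemp
      exact hG.notCol ⟨fun v => (hemp.false v).elim, fun v => (hemp.false v).elim⟩
    obtain ⟨v⟩ := hpos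
    have h1 := Set.ncard_le_ncard (Set.subset_univ (G.neighborSet v)) (Set.toFinite _)
    rw [Set.ncard_univ] at h1
    have := hd v
    omega

theorem colorable_six_of_not_isMinor [Finite V] (h : ¬ IsMinor K7vee G) : G.Colorable 6 := by
  induction hn : Nat.card V using Nat.strong_induction_on generalizing V with
  | _ n ih =>
    by_contra hc
    exact (minCE_of_minimal h hc fun W _ H hlt hv => ih _ (hn ▸ hlt) hv rfl).false

end Extremal

/-- Every graph with no `K7vee`-minor is 6-colorable. -/
theorem statement_0 (V : Type) [Fintype V] (G : SimpleGraph V)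
    (h : ¬ IsMinor K7vee G) : G.Colorable 6 := by
  exact colorable_six_of_not_isMinor h
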